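/- Let G be a finite group with |G| = |L₃(79)| = 2⁶·3²·5·7²·13²·43·79³ and degree pattern D(G) = D(L₃(79)) = (4,2,2,1,4,1,2), i.e., deg_G(2)=4, deg_G(3)=2, deg_G(5)=2, deg_G(7)=1, deg_G(13)=4, deg_G(43)=1, deg_G(79)=2. Then G is isomorphic to L₃(79). -/

import Mathlib

open scoped MatrixGroups

/-- Two distinct primes `p` and `q` dividing `|G|` are adjacent in the prime graph `Γ(G)`
of a finite group `G` iff `G` has an element of order `p * q`. -/
def primeGraphAdj (G : Type*) [Group G] (p q : ℕ) : Prop :=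
  p ≠ q ∧ p.Prime ∧ q.Prime ∧ p ∣ Nat.card G ∧ q ∣ Nat.card G ∧ ∃ g : G, orderOf g = p * q

open scoped Classical in
/-- The degree of a vertex `p` in the prime graph of `G`: the number of primes dividing `|G|`
that are adjacent to `p`. -/
noncomputable def primeGraphDeg (G : Type*) [Group G] (p : ℕ) : ℕ :=
  ((Nat.card G).primeFactors.filter (fun r => primeGraphAdj G p r)).card

set_option linter.style.haveILetI false
set_option linter.unusedSectionVars false
set_option linter.unusedVariables false
set_option autoImplicit false

open Subgroup
open Nat (Coprime card card_coe_set_eq card_congr card_eq_fintype_card card_pos card_zpowers eq_of_mul_eq_mul_left le_of_dvd)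
open Finset (univ inter_subset_left inter_subset_right subset_univ smul_sum mem_image_of_mem eq_of_subset_of_card_le card_image_of_injective card_eq_sum_ones card_eq_sum_card_fiberwise add_sum_erase card_univ mem_erase mem_filter mem_image mem_insert mem_singleton mem_univ mul_sum prod_insert sum_add_distrib sum_comm sum_congr sum_const sum_eq_single sum_eq_zero sum_filter sum_insert sum_mul sum_sub_distrib)
open MulAut (conj)

notation "ordL" => 2 ^ 6 * 3 ^ 2 * 5 * 7 ^ 2 * 13 ^ 2 * 43 * 79 ^ 3

notation "N[" H "]" => normalizer (SetLike.coe H)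

lemma hp2 : Nat.Prime 2 := by norm_num

lemma hp3 : Nat.Prime 3 := by norm_num

lemma hp5 : Nat.Prime 5 := by norm_num

lemma hp7 : Nat.Prime 7 := by norm_num

lemma hp43 : Nat.Prime 43 := by norm_num

lemma hp79 : Nat.Prime 79 := by norm_num

lemma mem_cent {G : Type*} [Group G] {g h : G} : h ∈ centralizer {g} ↔ h * g = g * h :=
  mem_centralizer_singleton_iff

lemma card_zp {G : Type*} [Group G] {x : G} {n : ℕ} (h : orderOf x = n) :
    card (zpowers x) = n ^ 1 := by rw [card_zpowers, h, pow_one]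

section Toolkit
open Pointwise

variable {G : Type*} [Group G]

lemma mem_conj_smul {g x : G} {H : Subgroup G} : x ∈ conj g • H ↔ g⁻¹ * x * g ∈ H := by
  rw [mem_pointwise_smul_iff_inv_smul_mem]
  simp [MulAut.smul_def]

lemma conj_mem_conj_smul {g x : G} {H : Subgroup G} : g * x * g⁻¹ ∈ conj g • H ↔ x ∈ H := by
  rw [mem_conj_smul]; simp [mul_assoc]

lemma mem_normalizer_conj {g : G} {H : Subgroup G} :
    g ∈ N[H] ↔ conj g • H = H := by
  rw [mem_normalizer_iff_map_conj_eq]; rfl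

lemma conj_smul_eq_of_mem {g : G} {H : Subgroup G} (h : g ∈ N[H]) :
    conj g • H = H := mem_normalizer_conj.1 h

lemma card_conj_smul (g : G) (H : Subgroup G) :
    card (conj g • H : Subgroup G) = card H :=
  (card_congr (equivSMul (conj g) H).toEquiv).symm

lemma conj_smul_le_of_mem {g : G} {H K : Subgroup G} (hg : g ∈ K) (hH : H ≤ K) :
    conj g • H ≤ K := by
  intro x hx
  rw [mem_conj_smul] at hx
  have := K.mul_mem (K.mul_mem hg (hH hx)) (K.inv_mem hg)
  simpa [mul_assoc] using this

lemma conj_smul_normalizer (g : G) (H : Subgroup G) :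
    conj g • N[H] = N[(conj g • H : Subgroup G)] := by
  ext x
  rw [mem_conj_smul, mem_normalizer_conj, mem_normalizer_conj,
    map_mul, map_mul, mul_smul, mul_smul, map_inv, inv_smul_eq_iff]

lemma conj_smul_inf (g : G) (H K : Subgroup G) :
    conj g • (H ⊓ K) = conj g • H ⊓ conj g • K := smul_inf _ _ _

lemma conj_smul_centralizer (g x : G) :
    conj g • centralizer {x} = centralizer {g * x * g⁻¹} := by
  ext y
  rw [mem_conj_smul, mem_cent, mem_cent]
  constructor
  · intro h
    have := congrArg (fun z => g * z * g⁻¹) h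
    simpa [mul_assoc] using this
  · intro h
    have := congrArg (fun z => g⁻¹ * z * g) h
    simpa [mul_assoc] using this

lemma conj_smul_zpowers (g x : G) :
    conj g • zpowers x = zpowers (g * x * g⁻¹) := by
  change Subgroup.map (conj g).toMonoidHom _ = _
  rw [MonoidHom.map_zpowers]; rfl

lemma orderOf_conj' (g x : G) : orderOf (g * x * g⁻¹) = orderOf x :=
  orderOf_injective (conj g).toMonoidHom (conj g).injective x

/-- Conjugation action of `G` on its subgroups. -/
abbrev conjActSub : MulAction G (Subgroup G) := MulAction.compHom _ (conj (G := G))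

/-- the set of `H`-conjugates of `K` -/
def conjSet (H K : Subgroup G) : Set (Subgroup G) := {L | ∃ h ∈ H, L = conj h • K}

lemma card_conjSet [Finite G] (H K : Subgroup G) :
    card (conjSet H K) * card (H ⊓ N[K] : Subgroup G) = card H := by
  letI : MulAction G (Subgroup G) := conjActSub
  have h1 : conjSet H K = MulAction.orbit H K := by
    ext L
    constructor
    · rintro ⟨h, hh, rfl⟩
      exact ⟨⟨h, hh⟩, rfl⟩
    · rintro ⟨h, rfl⟩
      exact ⟨h, h.2, rfl⟩
  rw [h1, card_congr (MulAction.orbitEquivQuotientStabilizer H K),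
    card_eq_card_quotient_mul_card_subgroup (MulAction.stabilizer H K)]
  congr 1
  refine card_congr ?_
  refine ⟨fun x => ⟨⟨x.1, x.2.1⟩, ?_⟩, fun x => ⟨x.1.1, x.1.2, ?_⟩, ?_, ?_⟩
  · have := x.2.2
    exact conj_smul_eq_of_mem this
  · exact mem_normalizer_conj.2 x.2
  · intro x; rfl
  · intro x; rfl

lemma isPGroup_of_card {p n : ℕ} {P : Subgroup G} (h : card P = p ^ n) : IsPGroup p P :=
  IsPGroup.of_card h

/-- Inside `H`: a Sylow subgroup -/
lemma exists_sylow_of [Finite G] {p n : ℕ} (hp : p.Prime) {H P : Subgroup G} (hPH : P ≤ H)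
    (hP : card P = p ^ n) (hn : ¬ p ^ (n+1) ∣ card H) :
    ∃ S : Sylow p H, (S : Subgroup H) = P.subgroupOf H := by
  haveI := Fact.mk hp
  have hc : card (P.subgroupOf H) = p ^ (card H).factorization p := by
    rw [card_congr (subgroupOfEquivOfLe hPH).toEquiv, hP]
    congr 1
    have h1 : p ^ n ∣ card H := hP ▸ card_dvd_of_le hPH
    have h0 : card H ≠ 0 := card_pos.ne'
    have := (hp.pow_dvd_iff_le_factorization h0).1 h1
    have h2 := mt (hp.pow_dvd_iff_le_factorization h0).2 hn
    omega
  exact ⟨Sylow.ofCard _ hc, rfl⟩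

/-- Sylow conjugacy inside `H`. -/
lemma sylow_conj_in [Finite G] {p n : ℕ} (hp : p.Prime) {H P : Subgroup G} (hPH : P ≤ H)
    (hP : card P = p ^ n) (hn : ¬ p ^ (n+1) ∣ card H) {Q : Subgroup G} (hQH : Q ≤ H)
    (hQ : IsPGroup p Q) : ∃ h ∈ H, conj h • Q ≤ P := by
  haveI := Fact.mk hp
  obtain ⟨S, hS⟩ := exists_sylow_of hp hPH hP hn
  have hQ' : IsPGroup p (Q.subgroupOf H) := hQ.of_equiv (subgroupOfEquivOfLe hQH).symm
  obtain ⟨T, hT⟩ := hQ'.exists_le_sylow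
  obtain ⟨h, hh⟩ := MulAction.exists_smul_eq H T S
  refine ⟨h, h.2, ?_⟩
  intro x hx
  rw [mem_conj_smul] at hx
  have hxH : (h : G)⁻¹ * x * h ∈ H := hQH hx
  have h1 : (⟨(h : G)⁻¹ * x * h, hxH⟩ : H) ∈ (T : Subgroup H) := hT (by rwa [mem_subgroupOf])
  have h2 : conj h • (⟨(h : G)⁻¹ * x * h, hxH⟩ : H) ∈ ((h • T : Sylow p H) : Subgroup H) := by
    exact smul_mem_pointwise_smul _ _ _ h1
  rw [hh, hS, mem_subgroupOf] at h2
  simpa [mul_assoc] using h2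

lemma sylow_exists_in [Finite G] {p n : ℕ} (hp : p.Prime) {H : Subgroup G}
    (hn : p ^ n ∣ card H) : ∃ P ≤ H, card P = p ^ n := by
  haveI := Fact.mk hp
  obtain ⟨K, hK⟩ := Sylow.exists_subgroup_card_pow_prime p hn
  refine ⟨K.map H.subtype, map_subtype_le K, ?_⟩
  rw [← hK]
  exact card_congr (K.equivMapOfInjective _ H.subtype_injective).toEquiv.symm

lemma sylow_exists_ge [Finite G] {p n : ℕ} (hp : p.Prime) {H Q : Subgroup G} (hQH : Q ≤ H)
    (hQ : IsPGroup p Q)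
    (hn : p ^ n ∣ card H) (hn' : ¬ p ^ (n+1) ∣ card H) :
    ∃ P ≤ H, Q ≤ P ∧ card P = p ^ n := by
  obtain ⟨P, hPH, hP⟩ := sylow_exists_in hp hn
  obtain ⟨h, hh, hle⟩ := sylow_conj_in hp hPH hP hn' hQH hQ
  refine ⟨conj h⁻¹ • P, conj_smul_le_of_mem (H.inv_mem hh) hPH, ?_, by rw [card_conj_smul, hP]⟩
  intro x hx
  rw [mem_conj_smul]
  have := hle ((conj_mem_conj_smul (g := h)).2 hx)
  simpa using this

lemma conj_eq_of_le [Finite G] {P Q : Subgroup G} {g : G} (h : conj g • Q ≤ P)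
    (hc : card P ≤ card Q) : conj g • Q = P := by
  apply eq_of_le_of_card_ge h
  rwa [card_conj_smul]

/-- The counting form of Sylow's theorem inside a subgroup `H`. -/
lemma sylow_count [Finite G] {p n : ℕ} (hp : p.Prime) {H P : Subgroup G} (hPH : P ≤ H)
    (hP : card P = p ^ n) (hn : ¬ p ^ (n+1) ∣ card H) :
    card (conjSet H P) % p = 1 := by
  haveI := Fact.mk hp
  obtain ⟨S, hS⟩ := exists_sylow_of hp hPH hP hn
  have key : card (conjSet H P) = card (Sylow p H) := by
    symm
    refine card_congr (Equiv.ofBijective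
      (fun T => ⟨(T : Subgroup H).map H.subtype, ?_⟩) ⟨?_, ?_⟩)
    · obtain ⟨h, hh⟩ := MulAction.exists_smul_eq H S T
      refine ⟨h, h.2, ?_⟩
      ext x
      rw [mem_conj_smul]
      constructor
      · rintro ⟨y, hy, rfl⟩
        rw [← hh] at hy
        have hy' : y ∈ conj h • (S : Subgroup H) := hy
        rw [mem_conj_smul, hS, mem_subgroupOf] at hy'
        simpa using hy'
      · intro hx
        have hxH : x ∈ H := by
          have := H.mul_mem (H.mul_mem h.2 (hPH hx)) (H.inv_mem h.2)
          simpa [mul_assoc] using this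
        refine ⟨⟨x, hxH⟩, ?_, rfl⟩
        rw [← hh]
        change _ ∈ conj h • (S : Subgroup H)
        rw [mem_conj_smul, hS, mem_subgroupOf]
        simpa using hx
    · intro T1 T2 h
      have := congrArg Subtype.val h
      exact Sylow.ext (map_injective H.subtype_injective this)
    · rintro ⟨L, h, hh, rfl⟩
      refine ⟨(⟨h, hh⟩ : H) • S, ?_⟩
      ext x
      simp only
      rw [mem_conj_smul]
      constructor
      · rintro ⟨y, hy, rfl⟩
        have hy' : y ∈ conj (⟨h, hh⟩ : H) • (S : Subgroup H) := hy
        rw [mem_conj_smul, hS, mem_subgroupOf] at hy'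
        simpa using hy'
      · intro hx
        have hxH : x ∈ H := by
          have := H.mul_mem (H.mul_mem hh (hPH hx)) (H.inv_mem hh)
          simpa [mul_assoc] using this
        refine ⟨⟨x, hxH⟩, ?_, rfl⟩
        change _ ∈ conj (⟨h, hh⟩ : H) • (S : Subgroup H)
        rw [mem_conj_smul, hS, mem_subgroupOf]
        simpa using hx
  rw [key]
  have := card_sylow_modEq_one p H
  rw [Nat.ModEq, Nat.mod_eq_of_lt hp.one_lt] at this
  exact this

lemma sylow_k [Finite G] {p n : ℕ} (hp : p.Prime) {H P : Subgroup G} (hPH : P ≤ H)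
    (hP : card P = p ^ n) (hn : ¬ p ^ (n+1) ∣ card H) :
    ∃ k, k % p = 1 ∧ card H = k * card (H ⊓ N[P] : Subgroup G) :=
  ⟨_, sylow_count hp hPH hP hn, (card_conjSet H P).symm⟩

lemma exists_order_of_dvd [Finite G] {p : ℕ} (hp : p.Prime) {H : Subgroup G} (h : p ∣ card H) :
    ∃ x ∈ H, orderOf x = p := by
  haveI := Fact.mk hp
  obtain ⟨x, hx⟩ := exists_prime_orderOf_dvd_card' (G := H) p h
  exact ⟨x, x.2, by rw [← hx]; exact orderOf_coe x⟩

lemma orderOf_dvd_of_mem {H : Subgroup G} {x : G} (hx : x ∈ H) : orderOf x ∣ card H := by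
  have := orderOf_dvd_natCard (⟨x, hx⟩ : H)
  rwa [orderOf_mk] at this

/-- A `p`-group acting on a finite set: fixed points count. General function form:
an action given by a permutation-like hom. -/
lemma exists_fixed_of_order [Finite G] {p n : ℕ} (hp : p.Prime) {w : G} (hw : orderOf w = p ^ n)
    {α : Type*} [MulAction G α] (s : Set α) (hs : s.Finite) (hinv : ∀ a ∈ s, w • a ∈ s) :
    card s % p = card {a : s | w • (a : α) = a} % p := by
  haveI := Fact.mk hp
  haveI : Finite s := hs
  have hinv' : ∀ a, a ∈ s → ∀ (z : zpowers w), z • a ∈ s := by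
    intro a ha z
    have hz : (z : G) ∈ Submonoid.powers w := by
      rw [mem_powers_iff_mem_zpowers]; exact z.2
    obtain ⟨m, hm⟩ := hz
    change (z : G) • a ∈ s
    rw [← hm]
    change w ^ m • a ∈ s
    induction m generalizing z with
    | zero => simpa using ha
    | succ m ih =>
      rw [pow_succ', mul_smul]
      exact hinv _ (ih ⟨w ^ m, by exact npow_mem_zpowers w m⟩ rfl)
  letI : MulAction (zpowers w) s :=
    { smul := fun z a => ⟨z • (a : α), hinv' a a.2 z⟩
      one_smul := fun a => Subtype.ext (one_smul _ _)
      mul_smul := fun x y a => Subtype.ext (mul_smul x y (a : α)) }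
  have hpg : IsPGroup p (zpowers w) := IsPGroup.of_card (n := n) (by rw [card_zpowers, hw])
  have := hpg.card_modEq_card_fixedPoints s
  rw [Nat.ModEq] at this
  rw [this]
  have hset : MulAction.fixedPoints (zpowers w) s = {a : s | w • (a : α) = a} := ?_
  · rw [hset]
  ext a
  constructor
  · intro h
    have := h ⟨w, mem_zpowers w⟩
    exact congrArg Subtype.val this
  · intro h z
    obtain ⟨m, hm⟩ := z.2
    apply Subtype.ext
    change (z : G) • (a : α) = a
    rw [← hm]
    have h' : w ∈ MulAction.stabilizer G (a : α) := h
    exact (MulAction.stabilizer G (a : α)).zpow_mem h' m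

lemma conj_fixed_count [Finite G] {p n : ℕ} (hp : p.Prime) {w : G} (hw : orderOf w = p ^ n)
    (s : Set G) (hinv : ∀ a ∈ s, w * a * w⁻¹ ∈ s) :
    card s % p = card {a : s | w * (a : G) * w⁻¹ = a} % p :=
  @exists_fixed_of_order G _ _ p n hp w hw G (MulAction.compHom G (conj (G := G))) s
    (Set.toFinite s) hinv

lemma conj_fixed_exists [Finite G] {p n : ℕ} (hp : p.Prime) {w : G} (hw : orderOf w = p ^ n)
    (s : Set G) (hinv : ∀ a ∈ s, w * a * w⁻¹ ∈ s) (hs : ¬ p ∣ card s) :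
    ∃ a ∈ s, Commute w a := by
  have h := conj_fixed_count hp hw s hinv
  have hne : card {a : s | w * (a : G) * w⁻¹ = a} ≠ 0 := by
    intro h0
    rw [h0, Nat.zero_mod] at h
    exact hs (Nat.dvd_of_mod_eq_zero h)
  obtain ⟨⟨⟨a, ha⟩, h2⟩⟩ := (Nat.card_ne_zero.1 hne).1
  refine ⟨a, ha, ?_⟩
  have h3 : w * a * w⁻¹ = a := h2
  exact mul_inv_eq_iff_eq_mul.1 h3

/-- version for actions on subgroups by conjugation -/
lemma sub_fixed_count [Finite G] {p n : ℕ} (hp : p.Prime) {w : G} (hw : orderOf w = p ^ n)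
    (s : Set (Subgroup G)) (hinv : ∀ a ∈ s, conj w • a ∈ s) :
    card s % p = card {a : s | conj w • (a : Subgroup G) = a} % p :=
  @exists_fixed_of_order G _ _ p n hp w hw (Subgroup G) conjActSub s
    (Set.toFinite s) hinv

lemma sub_fixed_exists [Finite G] {p n : ℕ} (hp : p.Prime) {w : G} (hw : orderOf w = p ^ n)
    (s : Set (Subgroup G)) (hinv : ∀ a ∈ s, conj w • a ∈ s) (hs : ¬ p ∣ card s) :
    ∃ a ∈ s, w ∈ N[a] := by
  have h := sub_fixed_count hp hw s hinv
  have hne : card {a : s | conj w • (a : Subgroup G) = a} ≠ 0 := by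
    intro h0
    rw [h0, Nat.zero_mod] at h
    exact hs (Nat.dvd_of_mod_eq_zero h)
  obtain ⟨⟨⟨a, ha⟩, h2⟩⟩ := (Nat.card_ne_zero.1 hne).1
  exact ⟨a, ha, mem_normalizer_conj.2 h2⟩

/-- `N(⟨x⟩)/C(x)` for `x` of prime order. -/
lemma card_normalizer_zpowers [Finite G] {p : ℕ} (hp : p.Prime) {x : G} (hx : orderOf x = p) :
    ∃ e, e ∣ p - 1 ∧ card N[zpowers x] = e * card (centralizer {x}) := by
  have hC : centralizer ((zpowers x : Subgroup G) : Set G) = centralizer {x} := by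
    rw [zpowers_eq_closure, centralizer_closure]
  set φ := normalizerMonoidHom (zpowers x)
  have h1 := card_eq_card_quotient_mul_card_subgroup φ.ker
  have h2 : card (N[zpowers x] ⧸ φ.ker) = card φ.range :=
    card_congr (QuotientGroup.quotientKerEquivRange φ).toEquiv
  have h3 : card φ.range ∣ p - 1 := by
    have := card_subgroup_dvd_card φ.range
    rw [IsCyclic.card_mulAut, card_zpowers, hx, Nat.totient_prime hp] at this
    exact this
  refine ⟨_, h3, ?_⟩
  rw [← h2]
  convert h1 using 2
  rw [normalizerMonoidHom_ker]
  rw [hC]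
  refine (card_congr (subgroupOfEquivOfLe ?_).toEquiv).symm
  rw [← hC]
  exact centralizer_le_normalizer _

lemma mem_normalizer_zpowers [Finite G] {x n : G} (h : n ∈ N[zpowers x]) :
    ∃ a : ℕ, n * x * n⁻¹ = x ^ a := by
  have := (mem_normalizer_iff.1 h x).1 (mem_zpowers x)
  have h2 : n * x * n⁻¹ ∈ Submonoid.powers x := by rwa [mem_powers_iff_mem_zpowers]
  obtain ⟨a, ha⟩ := h2
  exact ⟨a, ha.symm⟩

lemma mem_normalizer_zpowers_of [Finite G] {x n : G} (h : n * x * n⁻¹ ∈ zpowers x) :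
    n ∈ N[zpowers x] := by
  rw [mem_normalizer_conj, conj_smul_zpowers]
  apply eq_of_le_of_card_ge
  · rwa [zpowers_le]
  · rw [card_zpowers, card_zpowers, orderOf_conj']

lemma cent_le_normalizer (x : G) :
    centralizer {x} ≤ N[zpowers x] := by
  intro g hg
  rw [mem_cent] at hg
  rw [mem_normalizer_conj, conj_smul_zpowers, hg, mul_inv_cancel_right]

/-- `N/C` is abelian -/
lemma commutator_mem_centralizer [Finite G] {x n m : G} (hn : n ∈ N[zpowers x])
    (hm : m ∈ N[zpowers x]) : m⁻¹ * n⁻¹ * m * n ∈ centralizer {x} := by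
  obtain ⟨a, ha⟩ := mem_normalizer_zpowers hn
  obtain ⟨b, hb⟩ := mem_normalizer_zpowers hm
  rw [mem_cent]
  have e1 : n * x = x ^ a * n := mul_inv_eq_iff_eq_mul.1 ha
  have e2 : m * x = x ^ b * m := mul_inv_eq_iff_eq_mul.1 hb
  have e3 : ∀ k : ℕ, n * x ^ k = x ^ (a * k) * n := by
    intro k
    have : n * x ^ k * n⁻¹ = (n * x * n⁻¹) ^ k := by rw [conj_pow]
    rw [ha, ← pow_mul] at this
    exact mul_inv_eq_iff_eq_mul.1 this
  have e4 : ∀ k : ℕ, m * x ^ k = x ^ (b * k) * m := by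
    intro k
    have : m * x ^ k * m⁻¹ = (m * x * m⁻¹) ^ k := by rw [conj_pow]
    rw [hb, ← pow_mul] at this
    exact mul_inv_eq_iff_eq_mul.1 this
  have e5 : (m * n) * x = x ^ (a * b) * (m * n) := by
    rw [mul_assoc, e1, ← mul_assoc, e4, mul_assoc, mul_comm a b]
  have e6 : (n * m) * x = x ^ (a * b) * (n * m) := by
    rw [mul_assoc, e2, ← mul_assoc, e3, mul_assoc]
  have e7 : m⁻¹ * n⁻¹ * m * n = (n * m)⁻¹ * (m * n) := by group
  rw [e7, mul_assoc, e5, ← mul_assoc]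
  have e8 : (n * m)⁻¹ * x ^ (a * b) = x * (n * m)⁻¹ := by
    rw [inv_mul_eq_iff_eq_mul, ← mul_assoc, e6, mul_inv_cancel_right]
  rw [e8, mul_assoc]

end Toolkit

section Graph
variable {G : Type*} [Group G]

open scoped Classical in
/-- adjacency as a `0/1` number -/
noncomputable def ad (G : Type*) [Group G] (p q : ℕ) : ℕ := if primeGraphAdj G p q then 1 else 0

lemma ad_comm (p q : ℕ) : ad G p q = ad G q p := by
  have : primeGraphAdj G p q ↔ primeGraphAdj G q p := by
    unfold primeGraphAdj
    constructor
    · rintro ⟨h1, h2, h3, h4, h5, g, h6⟩; exact ⟨h1.symm, h3, h2, h5, h4, g, by rw [h6, mul_comm]⟩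
    · rintro ⟨h1, h2, h3, h4, h5, g, h6⟩; exact ⟨h1.symm, h3, h2, h5, h4, g, by rw [h6, mul_comm]⟩
  classical
  unfold ad
  by_cases h : primeGraphAdj G p q
  · rw [if_pos h, if_pos (this.1 h)]
  · rw [if_neg h, if_neg (fun h' => h (this.2 h'))]

lemma ad_le (p q : ℕ) : ad G p q ≤ 1 := by unfold ad; split_ifs <;> simp

lemma ad_les : ad G 2 3 ≤ 1 ∧ ad G 2 5 ≤ 1 ∧ ad G 2 7 ≤ 1 ∧ ad G 2 13 ≤ 1 ∧ ad G 2 79 ≤ 1 ∧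
    ad G 3 13 ≤ 1 ∧ ad G 5 13 ≤ 1 ∧ ad G 7 13 ≤ 1 ∧ ad G 13 79 ≤ 1 := by simp [ad_le]

lemma ad_self (p : ℕ) : ad G p p = 0 := by simp [ad, primeGraphAdj]

/-- The order of the group together with the degree equations. -/
structure OD (G : Type*) [Group G] : Prop where
  card : card G = ordL
  d2 : ad G 2 3 + ad G 2 5 + ad G 2 7 + ad G 2 13 + ad G 2 43 + ad G 2 79 = 4
  d3 : ad G 2 3 + ad G 3 5 + ad G 3 7 + ad G 3 13 + ad G 3 43 + ad G 3 79 = 2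
  d5 : ad G 2 5 + ad G 3 5 + ad G 5 7 + ad G 5 13 + ad G 5 43 + ad G 5 79 = 2
  d7 : ad G 2 7 + ad G 3 7 + ad G 5 7 + ad G 7 13 + ad G 7 43 + ad G 7 79 = 1
  d13 : ad G 2 13 + ad G 3 13 + ad G 5 13 + ad G 7 13 + ad G 13 43 + ad G 13 79 = 4
  d43 : ad G 2 43 + ad G 3 43 + ad G 5 43 + ad G 7 43 + ad G 13 43 + ad G 43 79 = 1
  d79 : ad G 2 79 + ad G 3 79 + ad G 5 79 + ad G 7 79 + ad G 13 79 + ad G 43 79 = 2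

lemma primeFactors_card : (ordL : ℕ).primeFactors
    = {2, 3, 5, 7, 13, 43, 79} := by
  have h13 : Nat.Prime 13 := by norm_num
  rw [Nat.primeFactors_mul (by norm_num) (by norm_num), Nat.primeFactors_mul (by norm_num) (by norm_num),
    Nat.primeFactors_mul (by norm_num) (by norm_num), Nat.primeFactors_mul (by norm_num) (by norm_num),
    Nat.primeFactors_mul (by norm_num) (by norm_num), Nat.primeFactors_mul (by norm_num) (by norm_num),
    Nat.primeFactors_prime_pow (by norm_num) hp2, Nat.primeFactors_prime_pow (by norm_num) hp3,
    hp5.primeFactors, Nat.primeFactors_prime_pow (by norm_num) hp7,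
    Nat.primeFactors_prime_pow (by norm_num) h13, hp43.primeFactors,
    Nat.primeFactors_prime_pow (by norm_num) hp79]
  decide

lemma deg_eq (hcard : card G = ordL) (p : ℕ) :
    primeGraphDeg G p = ad G p 2 + ad G p 3 + ad G p 5 + ad G p 7 + ad G p 13 + ad G p 43
      + ad G p 79 := by
  classical
  unfold primeGraphDeg
  rw [hcard, primeFactors_card, Finset.card_filter]
  simp only [ad]
  rw [sum_insert (by decide), sum_insert (by decide), sum_insert (by decide),
    sum_insert (by decide), sum_insert (by decide), sum_insert (by decide),
    Finset.sum_singleton]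
  simp only [← add_assoc]

lemma OD.mk' (hcard : Nat.card G = ordL)
    (hdeg2 : primeGraphDeg G 2 = 4)
    (hdeg3 : primeGraphDeg G 3 = 2)
    (hdeg5 : primeGraphDeg G 5 = 2)
    (hdeg7 : primeGraphDeg G 7 = 1)
    (hdeg13 : primeGraphDeg G 13 = 4)
    (hdeg43 : primeGraphDeg G 43 = 1)
    (hdeg79 : primeGraphDeg G 79 = 2) : OD G := by
  rw [deg_eq hcard] at *
  simp only [ad_self, zero_add, add_zero] at *
  rw [ad_comm 3 2] at hdeg3
  rw [ad_comm 5 2, ad_comm 5 3] at hdeg5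
  rw [ad_comm 7 2, ad_comm 7 3, ad_comm 7 5] at hdeg7
  rw [ad_comm 13 2, ad_comm 13 3, ad_comm 13 5, ad_comm 13 7] at hdeg13
  rw [ad_comm 43 2, ad_comm 43 3, ad_comm 43 5, ad_comm 43 7, ad_comm 43 13] at hdeg43
  rw [ad_comm 79 2, ad_comm 79 3, ad_comm 79 5, ad_comm 79 7, ad_comm 79 13, ad_comm 79 43] at hdeg79
  exact ⟨hcard, hdeg2, hdeg3, hdeg5, hdeg7, hdeg13, hdeg43, hdeg79⟩

lemma ad_of_commute [Finite G] {p q : ℕ} (hp : p.Prime) (hq : q.Prime) (hpq : p ≠ q) {x y : G}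
    (hx : orderOf x = p) (hy : orderOf y = q) (h : Commute x y) : ad G p q = 1 := by
  have hadj : primeGraphAdj G p q := by
    refine ⟨hpq, hp, hq, hx ▸ orderOf_dvd_natCard x, hy ▸ orderOf_dvd_natCard y, x * y, ?_⟩
    rw [h.orderOf_mul_eq_mul_orderOf_of_coprime, hx, hy]
    rw [hx, hy]
    exact (Nat.coprime_primes hp hq).2 hpq
  simp [ad, hadj]

lemma ad_of_dvd_centralizer [Finite G] {p q : ℕ} (hp : p.Prime) (hq : q.Prime) (hpq : p ≠ q) {x : G}
    (hx : orderOf x = p) (h : q ∣ card (centralizer {x})) : ad G p q = 1 := by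
  obtain ⟨y, hy, hy2⟩ := exists_order_of_dvd hq h
  exact ad_of_commute hp hq hpq hx hy2 (mem_cent.1 hy).symm

/-- the same with elements of prime power order -/
lemma ad_of_commute_pow [Finite G] {p q : ℕ} (hp : p.Prime) (hq : q.Prime) (hpq : p ≠ q) {x y : G}
    (hx : p ∣ orderOf x) (hy : q ∣ orderOf y) (h : Commute x y) : ad G p q = 1 := by
  have h1 : orderOf (x ^ (orderOf x / p)) = p := orderOf_pow_orderOf_div (orderOf_pos x).ne' hx
  have h2 : orderOf (y ^ (orderOf y / q)) = q := orderOf_pow_orderOf_div (orderOf_pos y).ne' hy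
  exact ad_of_commute hp hq hpq h1 h2 (h.pow_pow _ _)

lemma exists_ad [Finite G] {p q : ℕ} (h : ad G p q = 1) :
    ∃ x y : G, orderOf x = p ∧ orderOf y = q ∧ Commute x y := by
  classical
  unfold ad at h
  split_ifs at h with h'
  · obtain ⟨_, hp, hq, _, _, g, hg⟩ := h'
    have hp0 := hp.pos
    have hq0 := hq.pos
    refine ⟨g ^ q, g ^ p, ?_, ?_, (Commute.refl g).pow_pow _ _⟩
    · rw [orderOf_pow_of_dvd hq0.ne' (by rw [hg]; exact dvd_mul_left _ _), hg, Nat.mul_div_cancel _ hq0]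
    · rw [orderOf_pow_of_dvd hp0.ne' (by rw [hg]; exact dvd_mul_right _ _), hg, Nat.mul_div_cancel_left _ hp0]

end Graph

section PhaseOne
open Pointwise
variable {G : Type*} [Group G] [Finite G]

lemma card_form {n : ℕ} (h : n ∣ ordL) :
    n = 2 ^ n.factorization 2 * 3 ^ n.factorization 3 * 5 ^ n.factorization 5 *
      7 ^ n.factorization 7 * 13 ^ n.factorization 13 * 43 ^ n.factorization 43 *
      79 ^ n.factorization 79 ∧ n.factorization 2 ≤ 6 ∧ n.factorization 3 ≤ 2 ∧
      n.factorization 5 ≤ 1 ∧ n.factorization 7 ≤ 2 ∧ n.factorization 13 ≤ 2 ∧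
      n.factorization 43 ≤ 1 ∧ n.factorization 79 ≤ 3 := by
  have hM : (ordL : ℕ) ≠ 0 := by norm_num
  have hn : n ≠ 0 := fun h0 => by rw [h0] at h; exact hM (zero_dvd_iff.1 h)
  have key : ∀ p k : ℕ, p.Prime → ¬ p ^ (k+1) ∣ ordL →
      n.factorization p ≤ k := by
    intro p k hp hk
    by_contra hc
    exact hk (((hp.pow_dvd_iff_le_factorization hn).2 (by omega)).trans h)
  refine ⟨?_, key 2 6 (by norm_num) (by norm_num), key 3 2 (by norm_num) (by norm_num),
    key 5 1 (by norm_num) (by norm_num), key 7 2 (by norm_num) (by norm_num),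
    key 13 2 (by norm_num) (by norm_num), key 43 1 (by norm_num) (by norm_num),
    key 79 3 (by norm_num) (by norm_num)⟩
  have h1 := Nat.prod_factorization_pow_eq_self hn
  rw [Finsupp.prod_of_support_subset (s := {2, 3, 5, 7, 13, 43, 79})] at h1
  · conv_lhs => rw [← h1]
    rw [prod_insert (by decide), prod_insert (by decide), prod_insert (by decide),
    prod_insert (by decide), prod_insert (by decide), prod_insert (by decide),
    Finset.prod_singleton]
    ring
  · rw [Nat.support_factorization, ← primeFactors_card]
    exact Nat.primeFactors_mono h hM
  · simp

lemma card_form' {n : ℕ} (h : n ∣ ordL) :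
    ∃ v : ℕ → ℕ, n = 2 ^ v 2 * 3 ^ v 3 * 5 ^ v 5 * 7 ^ v 7 * 13 ^ v 13 * 43 ^ v 43 * 79 ^ v 79 ∧
      v 2 ≤ 6 ∧ v 3 ≤ 2 ∧ v 5 ≤ 1 ∧ v 7 ≤ 2 ∧ v 13 ≤ 2 ∧ v 43 ≤ 1 ∧ v 79 ≤ 3 ∧
      (∀ p, ¬ p ∣ n → v p = 0) ∧ (∀ p i, p.Prime → (p ^ i ∣ n ↔ i ≤ v p)) := by
  have hM : (ordL : ℕ) ≠ 0 := by norm_num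
  have hn : n ≠ 0 := fun h0 => by rw [h0] at h; exact hM (zero_dvd_iff.1 h)
  obtain ⟨h1, h2, h3, h4, h5, h6, h7, h8⟩ := card_form h
  exact ⟨fun p => n.factorization p, h1, h2, h3, h4, h5, h6, h7, h8,
    fun p => Nat.factorization_eq_zero_of_not_dvd,
    fun p i hp => hp.pow_dvd_iff_le_factorization hn⟩

lemma fac_zero {n p : ℕ} (h : ¬ p ∣ n) : n.factorization p = 0 :=
  Nat.factorization_eq_zero_of_not_dvd h

lemma OD.dvd (h : OD G) (H : Subgroup G) :
    Nat.card H ∣ ordL :=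
  h.card ▸ card_subgroup_dvd_card H

lemma OD.not_dvd (h : OD G) (H : Subgroup G) {m : ℕ}
    (hm : ¬ m ∣ ordL) : ¬ m ∣ Nat.card H :=
  fun h' => hm (h'.trans (h.dvd H))

lemma div42 {e : ℕ} (he : e ∣ 42) : e = 1 ∨ e = 2 ∨ e = 3 ∨ e = 6 ∨ e = 7 ∨ e = 14 ∨ e = 21 ∨ e = 42 := by
  have : e ∈ Nat.divisors 42 := by simp [he]
  have h2 : Nat.divisors 42 = {1, 2, 3, 6, 7, 14, 21, 42} := by decide
  rw [h2] at this
  simpa using this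

lemma p1arith {k e c : ℕ} (hk : k % 43 = 1)
    (hk3 : k * (e * c) = 2 ^ 6 * 3 ^ 2 * 5 * 7 ^ 2 * 13 ^ 2 * 79 ^ 3)
    (he : e = 1 ∨ e = 2 ∨ e = 3 ∨ e = 6 ∨ e = 7 ∨ e = 14 ∨ e = 21 ∨ e = 42) :
    (c ∣ 2 ^ 6 → c = 32 ∧ e = 14 ∨ c = 64 ∧ e = 7) ∧ (c ∣ 3 ^ 2 → c = 3 ∧ e = 6 ∨ c = 9 ∧ e = 2) ∧
      (c ∣ 5 ^ 1 → False) ∧ (c ∣ 7 ^ 2 → c = 7 ∧ e = 21 ∨ c = 49 ∧ e = 3) ∧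
      (c ∣ 13 ^ 2 → False) ∧ (c ∣ 79 ^ 3 → c = 79 ^ 2 ∧ e = 3) := by
  refine ⟨?_, ?_, ?_, ?_, ?_, ?_⟩ <;> intro hc <;>
    obtain ⟨v, hv, rfl⟩ := (Nat.dvd_prime_pow (by norm_num)).1 hc <;> norm_num at hk3 <;>
    interval_cases v <;> rcases he with rfl | rfl | rfl | rfl | rfl | rfl | rfl | rfl <;> omega

lemma phase1_cases (h : OD G) {x : G} (hx : orderOf x = 43) :
    (ad G 2 43 = 1 ∧ card (centralizer {x}) = 43 * 32 ∧
      card N[zpowers x] = 43 * 32 * 14) ∨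
    (ad G 2 43 = 1 ∧ card (centralizer {x}) = 43 * 64 ∧
      card N[zpowers x] = 43 * 64 * 7) ∨
    (ad G 3 43 = 1 ∧ card (centralizer {x}) = 43 * 3 ∧
      card N[zpowers x] = 43 * 3 * 6) ∨
    (ad G 3 43 = 1 ∧ card (centralizer {x}) = 43 * 9 ∧
      card N[zpowers x] = 43 * 9 * 2) ∨
    (ad G 7 43 = 1 ∧ card (centralizer {x}) = 43 * 7 ∧
      card N[zpowers x] = 43 * 7 * 21) ∨
    (ad G 7 43 = 1 ∧ card (centralizer {x}) = 43 * 49 ∧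
      card N[zpowers x] = 43 * 49 * 3) ∨
    (ad G 43 79 = 1 ∧ card (centralizer {x}) = 43 * 79 ^ 2 ∧
      card N[zpowers x] = 43 * 79 ^ 2 * 3) := by
  obtain ⟨e, he, hN⟩ := card_normalizer_zpowers hp43 hx
  have hz : card (zpowers x) = 43 ^ 1 := card_zp hx
  obtain ⟨k, hk, hk2⟩ := sylow_k (H := (⊤ : Subgroup G)) hp43 le_top hz
    (h.not_dvd _ (by norm_num))
  rw [top_inf_eq, hN, card_top, h.card] at hk2
  have hxC : x ∈ centralizer {x} := by simp [mem_cent]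
  have h43 : 43 ∣ card (centralizer {x}) := hx ▸ orderOf_dvd_of_mem hxC
  have hd : ∀ q : ℕ, q.Prime → q ≠ 43 → ad G 43 q = 0 → (card (centralizer {x})).factorization q = 0 := by
    intro q hq hq' h0
    apply fac_zero
    intro hd
    have := ad_of_dvd_centralizer hp43 hq hq'.symm hx hd
    omega
  have d2 := hd 2 (by norm_num) (by norm_num)
  have d3 := hd 3 (by norm_num) (by norm_num)
  have d5 := hd 5 (by norm_num) (by norm_num)
  have d7 := hd 7 (by norm_num) (by norm_num)
  have d13 := hd 13 (by norm_num) (by norm_num)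
  have d79 := hd 79 (by norm_num) (by norm_num)
  obtain ⟨hC, b2, b3, b5, b7, b13, b43, b79⟩ := card_form (h.dvd (centralizer {x}))
  have b43' : 1 ≤ (card (centralizer {x})).factorization 43 :=
    (hp43.dvd_iff_one_le_factorization card_pos.ne').1 h43
  have b43 : (card (centralizer {x})).factorization 43 = 1 := by omega
  have l2 := ad_le (G := G) 2 43
  have l3 := ad_le (G := G) 3 43
  have l5 := ad_le (G := G) 5 43
  have l7 := ad_le (G := G) 7 43
  have l13 := ad_le (G := G) 13 43
  have l79 := ad_le (G := G) 43 79
  have := h.d43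
  rw [ad_comm] at d2 d3 d5 d7 d13
  rw [hN]
  have hc : card (centralizer {x}) ∣ 2 ^ 6 * 43 ∧ ad G 2 43 = 1 ∨ card (centralizer {x}) ∣ 3 ^ 2 * 43 ∧ ad G 3 43 = 1
      ∨ card (centralizer {x}) ∣ 5 ^ 1 * 43 ∨ card (centralizer {x}) ∣ 7 ^ 2 * 43 ∧ ad G 7 43 = 1 ∨
      card (centralizer {x}) ∣ 13 ^ 2 * 43 ∨ card (centralizer {x}) ∣ 79 ^ 3 * 43 ∧ ad G 43 79 = 1 := by
    have hcases : ad G 2 43 = 1 ∨ ad G 3 43 = 1 ∨ ad G 5 43 = 1 ∨ ad G 7 43 = 1 ∨ ad G 13 43 = 1 ∨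
      ad G 43 79 = 1 := by omega
    rw [b43] at hC
    rcases hcases with h1 | h1 | h1 | h1 | h1 | h1
    · left
      rw [d3 (by omega), d5 (by omega), d7 (by omega), d13 (by omega), d79 (by omega)] at hC
      refine ⟨?_, h1⟩
      exact dvd_trans (dvd_of_eq (hC.trans (by ring))) (mul_dvd_mul_right (pow_dvd_pow 2 b2) 43)
    · right; left
      rw [d2 (by omega), d5 (by omega), d7 (by omega), d13 (by omega), d79 (by omega)] at hC
      refine ⟨?_, h1⟩
      exact dvd_trans (dvd_of_eq (hC.trans (by ring))) (mul_dvd_mul_right (pow_dvd_pow 3 b3) 43)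
    · right; right; left
      rw [d2 (by omega), d3 (by omega), d7 (by omega), d13 (by omega), d79 (by omega)] at hC
      exact dvd_trans (dvd_of_eq (hC.trans (by ring))) (mul_dvd_mul_right (pow_dvd_pow 5 b5) 43)
    · right; right; right; left
      rw [d2 (by omega), d3 (by omega), d5 (by omega), d13 (by omega), d79 (by omega)] at hC
      refine ⟨?_, h1⟩
      exact dvd_trans (dvd_of_eq (hC.trans (by ring))) (mul_dvd_mul_right (pow_dvd_pow 7 b7) 43)
    · right; right; right; right; left
      rw [d2 (by omega), d3 (by omega), d5 (by omega), d7 (by omega), d79 (by omega)] at hC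
      exact dvd_trans (dvd_of_eq (hC.trans (by ring))) (mul_dvd_mul_right (pow_dvd_pow 13 b13) 43)
    · right; right; right; right; right
      rw [d2 (by omega), d3 (by omega), d5 (by omega), d7 (by omega), d13 (by omega)] at hC
      refine ⟨?_, h1⟩
      exact dvd_trans (dvd_of_eq (hC.trans (by ring))) (mul_dvd_mul_right (pow_dvd_pow 79 b79) 43)
  obtain ⟨c, hc43⟩ := h43
  have hk3 : k * (e * c) = 2 ^ 6 * 3 ^ 2 * 5 * 7 ^ 2 * 13 ^ 2 * 79 ^ 3 := by
    rw [hc43] at hk2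
    have : 43 * (k * (e * c)) = 43 * (2 ^ 6 * 3 ^ 2 * 5 * 7 ^ 2 * 13 ^ 2 * 79 ^ 3) := by
      rw [show 43 * (k * (e * c)) = k * (e * (43 * c)) by ring, ← hk2]; norm_num
    exact eq_of_mul_eq_mul_left (by norm_num) this
  obtain ⟨a2, a3, a5, a7, a13, a79⟩ := p1arith hk hk3 (div42 he)
  rw [hc43] at hc ⊢
  have h43' : ∀ m, 43 * c ∣ m * 43 → c ∣ m := fun m hm =>
    Nat.dvd_of_mul_dvd_mul_left (by norm_num : 0 < 43) (by rwa [mul_comm m] at hm)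
  rcases hc with ⟨hc, h1⟩ | ⟨hc, h1⟩ | hc | ⟨hc, h1⟩ | hc | ⟨hc, h1⟩
  · have := a2 (h43' _ hc)
    rcases this with ⟨rfl, rfl⟩ | ⟨rfl, rfl⟩ <;> simp [h1]
  · have := a3 (h43' _ hc)
    rcases this with ⟨rfl, rfl⟩ | ⟨rfl, rfl⟩ <;> simp [h1]
  · exact (a5 (h43' _ hc)).elim
  · have := a7 (h43' _ hc)
    rcases this with ⟨rfl, rfl⟩ | ⟨rfl, rfl⟩ <;> simp [h1]
  · exact (a13 (h43' _ hc)).elim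
  · have := a79 (h43' _ hc)
    rcases this with ⟨rfl, rfl⟩; simp [h1]

lemma card_dvd_of_orbits {R α : Type*} [Group R] [MulAction R α] [Finite α] {d : ℕ}
    (h : ∀ a : α, d ∣ card (MulAction.orbit R a)) : d ∣ card α := by
  classical
  rw [card_congr (MulAction.selfEquivSigmaOrbits R α)]
  haveI := Fintype.ofFinite (MulAction.orbitRel.Quotient R α)
  rw [Nat.card_sigma]
  exact Finset.dvd_sum fun i _ => h _

/-- orbit sizes under conjugation -/
lemma dvd_card_of_conjSet {R : Subgroup G} {s : Set (Subgroup G)} {d : ℕ}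
    (hinv : ∀ r ∈ R, ∀ L ∈ s, conj r • L ∈ s)
    (h : ∀ L ∈ s, d ∣ card (conjSet R L)) : d ∣ card s := by
  letI : MulAction R s :=
    { smul := fun r L => ⟨conj (r : G) • (L : Subgroup G), hinv r r.2 L L.2⟩
      one_smul := fun a => Subtype.ext (by
        change conj ((1 : R) : G) • (a : Subgroup G) = a
        simp)
      mul_smul := fun x y a => Subtype.ext (by
        change conj ((x * y : R) : G) • (a : Subgroup G) =
          conj (x : G) • conj (y : G) • (a : Subgroup G)
        rw [Subgroup.coe_mul, map_mul, mul_smul]) }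
  apply card_dvd_of_orbits (R := R)
  intro a
  have := h a a.2
  convert this using 1
  refine card_congr (Equiv.ofBijective (fun b => ⟨((b : s) : Subgroup G), ?_⟩) ⟨?_, ?_⟩)
  · obtain ⟨r, hr⟩ := b.2
    exact ⟨r, r.2, congrArg Subtype.val hr.symm⟩
  · intro b c hbc
    have h2 : ((b : s) : Subgroup G) = ((c : s) : Subgroup G) := congrArg (fun t : conjSet R (a : Subgroup G) => (t : Subgroup G)) hbc
    exact Subtype.ext (Subtype.ext h2)
  · rintro ⟨L, r, hr, rfl⟩
    exact ⟨⟨⟨_, hinv r hr a a.2⟩, ⟨r, hr⟩, rfl⟩, rfl⟩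

lemma frattini_card {p n : ℕ} (hp : p.Prime) {H M P : Subgroup G} (hPM : P ≤ M) (hMH : M ≤ H)
    (hnorm : H ≤ N[M]) (hP : card P = p ^ n) (hn : ¬ p ^ (n+1) ∣ card M) :
    card (conjSet M P) = card (conjSet H P) := by
  have : conjSet M P = conjSet H P := by
    ext L
    constructor
    · rintro ⟨m, hm, rfl⟩; exact ⟨m, hMH hm, rfl⟩
    · rintro ⟨h, hh, rfl⟩
      have hle : conj h • P ≤ M := by
        intro y hy
        rw [mem_conj_smul] at hy
        have := (mem_normalizer_iff.1 (hnorm hh) _).1 (hPM hy)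
        simpa [mul_assoc] using this
      obtain ⟨m, hm, hm2⟩ := sylow_conj_in hp hPM hP hn hle
        (IsPGroup.of_card (n := n) (by rw [card_conj_smul, hP]))
      have := conj_eq_of_le hm2 (by rw [card_conj_smul])
      refine ⟨m⁻¹, M.inv_mem hm, ?_⟩
      rw [map_inv, eq_inv_smul_iff, this]
  rw [this]

/-- unique Sylow subgroup by counting -/
lemma normal_of_sylow {p n m : ℕ} (hp : p.Prime) {H P : Subgroup G} (hPH : P ≤ H)
    (hP : card P = p ^ n) (hH : card H = p ^ n * m) (hn : ¬ p ∣ m)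
    (hm : ∀ k, k ∣ m → k % p = 1 → k = 1) : H ≤ N[P] := by
  have hn' : ¬ p ^ (n+1) ∣ card H := by
    rw [hH, pow_succ]
    intro h
    exact hn (Nat.dvd_of_mul_dvd_mul_left (pow_pos hp.pos n) h)
  obtain ⟨k, hk, hk2⟩ := sylow_k hp hPH hP hn'
  have hle : P ≤ H ⊓ N[P] := le_inf hPH le_normalizer
  obtain ⟨t, ht⟩ := card_dvd_of_le hle
  rw [hP] at ht
  rw [hH, ht] at hk2
  have : m = k * t := eq_of_mul_eq_mul_left (pow_pos hp.pos n) (by rw [hk2]; ring)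
  have hk1 := hm k ⟨t, this⟩ hk
  rw [hk1, one_mul] at hk2 this
  have : H ⊓ N[P] = H := by
    apply eq_of_le_of_card_ge inf_le_left
    rw [ht, hH, this]
  rw [← this]
  exact inf_le_right

/-- number of Sylow subgroups divides the index -/
lemma sylow_k' {p n m : ℕ} (hp : p.Prime) {H P : Subgroup G} (hPH : P ≤ H)
    (hP : card P = p ^ n) (hH : card H = p ^ n * m) (hn : ¬ p ∣ m) :
    card (conjSet H P) ∣ m ∧ card (conjSet H P) % p = 1 := by
  have hn' : ¬ p ^ (n+1) ∣ card H := by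
    rw [hH, pow_succ]
    intro h
    exact hn (Nat.dvd_of_mul_dvd_mul_left (pow_pos hp.pos n) h)
  refine ⟨?_, sylow_count hp hPH hP hn'⟩
  have hle : P ≤ H ⊓ N[P] := le_inf hPH le_normalizer
  obtain ⟨t, ht⟩ := card_dvd_of_le hle
  have h1 := card_conjSet H P
  rw [hH, ht, hP] at h1
  exact ⟨t, eq_of_mul_eq_mul_left (pow_pos hp.pos n) (by rw [← h1]; ring)⟩

/-- a `p`-subgroup normalizing a Sylow subgroup lies in it -/
lemma le_of_le_normalizer_sylow {p n : ℕ} (hp : p.Prime) {P Q : Subgroup G}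
    (hP : card P = p ^ n) (hn : ¬ p ^ (n+1) ∣ card G) (hQ : IsPGroup p Q)
    (hle : Q ≤ N[P]) : Q ≤ P := by
  have hn' : ¬ p ^ (n+1) ∣ card N[P] :=
    fun h => hn (h.trans (card_subgroup_dvd_card _))
  obtain ⟨h, hh, hle⟩ := sylow_conj_in hp (le_normalizer) hP hn' hle hQ
  intro q hq
  have := hle ((conj_mem_conj_smul (g := h)).2 hq)
  exact (mem_normalizer_iff.1 hh q).2 this

lemma isPGroup_zpowers {p n : ℕ} {x : G} (hx : orderOf x = p ^ n) : IsPGroup p (zpowers x) :=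
  IsPGroup.of_card (n := n) (by rw [card_zpowers, hx])

lemma mem_sylow_of_normalizer {p n i : ℕ} (hp : p.Prime) {P : Subgroup G} {x : G}
    (hP : card P = p ^ n) (hn : ¬ p ^ (n+1) ∣ card G) (hx : orderOf x = p ^ i)
    (hle : x ∈ N[P]) : x ∈ P :=
  le_of_le_normalizer_sylow hp hP hn (isPGroup_zpowers hx) (by rwa [zpowers_le]) (mem_zpowers x)

/-- a normal Sylow subgroup of `H` is its unique Sylow subgroup. -/
lemma le_of_normal_sylow {p n : ℕ} (hp : p.Prime) {H P Q : Subgroup G} (hPH : P ≤ H)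
    (hP : card P = p ^ n) (hn : ¬ p ^ (n+1) ∣ card H) (hQ : IsPGroup p Q) (hQH : Q ≤ H)
    (hle : H ≤ N[P]) : Q ≤ P := by
  obtain ⟨h, hh, hle'⟩ := sylow_conj_in hp hPH hP hn hQH hQ
  intro q hq
  have := hle' ((conj_mem_conj_smul (g := h)).2 hq)
  exact (mem_normalizer_iff.1 (hle hh) q).2 this

lemma conj_mem_centralizer {x n c : G} (hn : n ∈ N[zpowers x])
    (hc : c ∈ centralizer {x}) : n * c * n⁻¹ ∈ centralizer {x} := by
  obtain ⟨a, ha⟩ := mem_normalizer_zpowers (inv_mem hn)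
  rw [mem_cent] at *
  rw [inv_inv] at ha
  have h1 : x = n * x ^ a * n⁻¹ := by rw [← ha]; group
  have h2 : Commute c (x ^ a) := (show Commute c x from hc).pow_right a
  calc n * c * n⁻¹ * x = n * c * n⁻¹ * (n * x ^ a * n⁻¹) := by rw [← h1]
    _ = n * (c * x ^ a) * n⁻¹ := by group
    _ = n * (x ^ a * c) * n⁻¹ := by rw [h2.eq]
    _ = (n * x ^ a * n⁻¹) * (n * c * n⁻¹) := by group
    _ = x * (n * c * n⁻¹) := by rw [← h1]

lemma coset_fix {p n : ℕ} (hp : p.Prime) {x w s : G} {S : Subgroup G}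
    (hwx : w ∈ N[zpowers x]) (hwS : w ∈ N[S])
    (hSx : S ≤ N[zpowers x]) (hs : s ∈ S) (hw : orderOf w = p ^ n)
    (hpS : ¬ p ∣ card S) : ∃ a ∈ S, s⁻¹ * a ∈ centralizer {x} ∧ Commute w a := by
  let σ : Set G := {a | a ∈ S ∧ s⁻¹ * a ∈ centralizer {x}}
  have hcard : card σ = card (S ⊓ centralizer {x} : Subgroup G) := by
    refine card_congr ⟨fun a => ⟨s⁻¹ * a.1, S.mul_mem (S.inv_mem hs) a.2.1, a.2.2⟩,
      fun b => ⟨s * b.1, S.mul_mem hs b.2.1, by simpa using b.2.2⟩, ?_, ?_⟩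
    · intro a; simp
    · intro b; simp
  have hinv : ∀ a ∈ σ, w * a * w⁻¹ ∈ σ := by
    rintro a ⟨ha, ha2⟩
    refine ⟨(mem_normalizer_iff.1 hwS a).1 ha, ?_⟩
    have h1 := commutator_mem_centralizer (inv_mem hwx) (hSx hs)
    have h2 := conj_mem_centralizer hwx ha2
    have := mul_mem h1 h2
    convert this using 1
    group
  obtain ⟨a, ha, hc⟩ := conj_fixed_exists hp hw σ hinv (by
    rw [hcard]
    exact fun h => hpS (h.trans (card_dvd_of_le inf_le_left)))
  exact ⟨a, ha.1, ha.2, hc⟩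

/-- subgroups of prime order: disjoint union of their non-identity elements -/
lemma card_prime_subgroups {p : ℕ} (hp : p.Prime) (s : Set (Subgroup G))
    (hs : ∀ L ∈ s, card L = p) :
    card s * (p - 1) = card {y : G | ∃ L ∈ s, y ∈ L ∧ y ≠ 1} := by
  classical
  haveI := Fact.mk hp
  have huniq : ∀ L ∈ s, ∀ y ∈ L, y ≠ 1 → L = zpowers y := by
    intro L hL y hy hy1
    symm
    apply eq_of_le_of_card_ge (by rwa [zpowers_le])
    rw [hs L hL, card_zpowers]
    have := orderOf_dvd_of_mem hy
    rw [hs L hL] at this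
    rcases (Nat.dvd_prime hp).1 this with h | h
    · exact absurd (orderOf_eq_one_iff.1 h) hy1
    · exact h.ge
  have e : {y : G | ∃ L ∈ s, y ∈ L ∧ y ≠ 1} ≃ Σ L : s, {y : (L : Subgroup G) // y ≠ 1} :=
    { toFun := fun y => ⟨⟨zpowers y.1, by
          obtain ⟨L, hL, hy, hy1⟩ := y.2
          rw [← huniq L hL y.1 hy hy1]; exact hL⟩, ⟨⟨y.1, mem_zpowers _⟩, by
          obtain ⟨L, hL, hy, hy1⟩ := y.2
          intro h; exact hy1 (congrArg Subtype.val h)⟩⟩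
      invFun := fun t => ⟨t.2.1.1, t.1.1, t.1.2, t.2.1.2, fun h => t.2.2 (Subtype.ext h)⟩
      left_inv := fun y => rfl
      right_inv := by
        rintro ⟨⟨L, hL⟩, ⟨⟨y, hy⟩, hy1⟩⟩
        have := huniq L hL y hy (fun h => hy1 (Subtype.ext h))
        subst this
        rfl }
  rw [card_congr e]
  haveI := Fintype.ofFinite s
  rw [Nat.card_sigma]
  have : ∀ L : s, card {y : (L : Subgroup G) // y ≠ 1} = p - 1 := by
    intro L
    haveI := Fintype.ofFinite (L : Subgroup G)
    rw [card_eq_fintype_card, Fintype.card_subtype_compl, Fintype.card_subtype_eq,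
      ← card_eq_fintype_card, hs L L.2]
  rw [sum_congr rfl (fun L _ => this L)]
  simp

lemma index3 (h : OD G) (M : Subgroup G) [M.Normal] (hM : 3 ∣ M.index) (hM5 : 5 ∣ card M) :
    ad G 3 5 = 1 := by
  obtain ⟨f, hf, hf5⟩ := exists_order_of_dvd hp5 hM5
  have hz : card (zpowers f) = 5 ^ 1 := card_zp hf5
  have h1 := frattini_card hp5 (H := ⊤) (M := M) (P := zpowers f) (by rwa [zpowers_le]) le_top
    (by rw [normalizer_eq_top]) hz (h.not_dvd _ (by norm_num))
  have h2 := card_conjSet M (zpowers f)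
  have h3 := card_conjSet ⊤ (zpowers f)
  rw [top_inf_eq, card_top, ← h1, ← M.card_mul_index, ← h2] at h3
  obtain ⟨e, he, hN⟩ := card_normalizer_zpowers hp5 hf5
  have hpos : 0 < card (conjSet M (zpowers f)) := by
    rw [Nat.pos_iff_ne_zero]; intro h0; rw [h0] at h2
    have : 0 < card M := card_pos
    omega
  have h4 : card N[zpowers f] =
      card (M ⊓ N[zpowers f] : Subgroup G) * M.index := by
    apply eq_of_mul_eq_mul_left hpos
    rw [h3]; ring
  have h5 : 3 ∣ e * card (centralizer {f}) := by
    rw [← hN, h4]; exact Dvd.dvd.mul_left hM _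
  rw [ad_comm]
  apply ad_of_dvd_centralizer hp5 (by norm_num) (by norm_num) hf5
  rcases (Nat.Prime.dvd_mul (by norm_num)).1 h5 with h6 | h6
  · exfalso
    have : 3 ∣ 4 := h6.trans he
    omega
  · exact h6

lemma le_normalizer_of_card {p : ℕ} (hp : p.Prime) {n : ℕ} {P R : Subgroup G} (hRP : R ≤ P)
    (hR : card R = p ^ n) (hP : card P = p ^ (n+1)) : P ≤ N[R] := by
  have hidx : (R.subgroupOf P).index = p := by
    have := (R.subgroupOf P).card_mul_index
    rw [card_congr (subgroupOfEquivOfLe hRP).toEquiv, hR, hP, pow_succ] at this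
    exact eq_of_mul_eq_mul_left (pow_pos hp.pos n) this
  have : (R.subgroupOf P).Normal := by
    apply normal_of_index_eq_minFac_card
    rw [hidx, hP, hp.pow_minFac (by omega)]
  exact (normal_subgroupOf_iff_le_normalizer hRP).1 this

lemma caseD (h : OD G) {x : G} (hx : orderOf x = 43) (had : ad G 43 79 = 1)
    (hC : card (centralizer {x}) = 43 * 79 ^ 2)
    (hN : card N[zpowers x] = 43 * 79 ^ 2 * 3) : False := by
  have hz : card (zpowers x) = 43 ^ 1 := card_zp hx
  obtain ⟨R, hRC, hR⟩ := sylow_exists_in (n := 2) hp79 (H := centralizer {x}) (by rw [hC]; norm_num)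
  have hRN : R ≤ N[zpowers x] := hRC.trans (cent_le_normalizer x)
  have hNR : N[zpowers x] ≤ N[R] := by
    refine normal_of_sylow hp79 hRN hR (m := 129) (by rw [hN]; norm_num) (by norm_num) ?_
    intro k hk hk2
    have : k ∈ Nat.divisors 129 := by simp [hk]
    have h2 : Nat.divisors 129 = {1, 3, 43, 129} := by decide
    rw [h2] at this
    simp only [mem_insert, mem_singleton] at this
    omega
  obtain ⟨P, -, hRP, hP⟩ := sylow_exists_ge (H := ⊤) (n := 3) hp79 (le_top (a := R))
    (IsPGroup.of_card hR) (by rw [card_top, h.card]; norm_num) (h.not_dvd _ (by norm_num))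
  have hPM : P ≤ N[R] := le_normalizer_of_card hp79 hRP hR hP
  set M := N[R] with hM
  set D := centralizer (R : Set G) with hD
  have hxD : x ∈ D := by
    rw [hD, mem_centralizer_iff]
    intro r hr
    exact mem_cent.1 (hRC hr)
  have hDM : D ≤ M := centralizer_le_normalizer _
  have hMD : M ≤ N[D] := by
    intro g hg
    rw [mem_normalizer_iff]
    have key : ∀ g ∈ M, ∀ d ∈ D, g * d * g⁻¹ ∈ D := by
      intro g hg d hd
      rw [hD, mem_centralizer_iff] at hd ⊢
      intro r hr
      have h1 := hd (g⁻¹ * r * g) ((mem_normalizer_iff''.1 hg r).1 hr)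
      calc r * (g * d * g⁻¹) = g * ((g⁻¹ * r * g) * d) * g⁻¹ := by group
        _ = g * (d * (g⁻¹ * r * g)) * g⁻¹ := by rw [h1]
        _ = _ := by group
    intro d
    refine ⟨key g hg d, fun hd => ?_⟩
    have := key g⁻¹ (M.inv_mem hg) _ hd
    simpa [mul_assoc] using this
  have hfr := frattini_card hp43 (H := M) (M := D) (P := zpowers x) (by rwa [zpowers_le])
    hDM hMD hz (h.not_dvd _ (by norm_num))
  have h1 := card_conjSet D (zpowers x)
  have h2 := card_conjSet M (zpowers x)
  rw [inf_eq_right.2 hNR, hN] at h2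
  have hk := sylow_count hp43 (H := M) (P := zpowers x) (by
    rw [zpowers_le]; exact hDM hxD) hz (h.not_dvd _ (by norm_num))
  rw [hfr] at h1
  generalize card (conjSet M (zpowers x)) = k at *
  -- k divides the rest
  have hkG : k * (43 * 79 ^ 2 * 3) ∣ ordL := by
    rw [h2]; exact h.dvd M
  have hk79 : 79 ∣ k := by
    have : 79 ^ 3 ∣ k * (43 * 79 ^ 2 * 3) := by rw [h2, ← hP]; exact card_dvd_of_le hPM
    have h3 : 79 ^ 2 * 79 ∣ 79 ^ 2 * (k * 129) := by
      convert this using 1 <;> ring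
    have h4 := Nat.dvd_of_mul_dvd_mul_left (by norm_num) h3
    rcases hp79.dvd_mul.1 h4 with h | h
    · exact h
    · omega
  obtain ⟨r, hr, hr79⟩ := exists_order_of_dvd hp79 (H := R) (by rw [hR]; norm_num)
  have hDr : D ≤ centralizer {r} := centralizer_le (by simpa using hr)
  have hkD : k ∣ card (centralizer {r}) := (Dvd.intro _ h1).trans (card_dvd_of_le hDr)
  have hprime : ∀ q : ℕ, q.Prime → q ≠ 79 → ad G 79 q = 0 → ¬ q ∣ k := by
    intro q hq hq' h0 hd
    have := ad_of_dvd_centralizer hp79 hq hq'.symm hr79 (hd.trans hkD)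
    omega
  have hkG' : k ∣ ordL := (Dvd.intro _ rfl).trans hkG
  obtain ⟨v, hv, b2, b3, b5, b7, b13, b43, b79, hv0, hvd⟩ := card_form' hkG'
  have z43 : v 43 = 0 := by
    apply hv0
    intro hd
    have := (mul_dvd_mul_right hd (43 * 79 ^ 2 * 3)).trans hkG
    revert this; norm_num
  have v79 : v 79 = 1 := by
    have h3 : 1 ≤ v 79 := (hvd 79 1 hp79).1 (by simpa using hk79)
    have h4 : ¬ 2 ≤ v 79 := by
      intro h4
      have := (mul_dvd_mul_right ((hvd 79 2 hp79).2 h4) (43 * 79 ^ 2 * 3)).trans hkG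
      revert this; norm_num
    omega
  have d2 := hprime 2 (by norm_num) (by norm_num)
  have d3 := hprime 3 (by norm_num) (by norm_num)
  have d5 := hprime 5 (by norm_num) (by norm_num)
  have d7 := hprime 7 (by norm_num) (by norm_num)
  have d13 := hprime 13 (by norm_num) (by norm_num)
  rw [ad_comm] at d2 d3 d5 d7 d13
  have e2 := h.d2
  have e7 := h.d7
  have e43 := h.d43
  have e79 := h.d79
  have l := ad_les (G := G)
  have h7 : ad G 7 79 = 0 := by omega
  rw [z43, v79, hv0 7 (d7 h7)] at hv
  have hcases : ad G 2 79 = 0 ∧ ad G 3 79 = 0 ∧ ad G 5 79 = 0 ∨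
    ad G 2 79 = 0 ∧ ad G 3 79 = 0 ∧ ad G 13 79 = 0 ∨
    ad G 2 79 = 0 ∧ ad G 5 79 = 0 ∧ ad G 13 79 = 0 ∨
    ad G 3 79 = 0 ∧ ad G 5 79 = 0 ∧ ad G 13 79 = 0 := by omega
  rcases hcases with ⟨a1, a2, a3⟩ | ⟨a1, a2, a3⟩ | ⟨a1, a2, a3⟩ | ⟨a1, a2, a3⟩
  · rw [hv0 2 (d2 a1), hv0 3 (d3 a2), hv0 5 (d5 a3)] at hv
    generalize v 13 = u at *
    interval_cases u <;> omega
  · rw [hv0 2 (d2 a1), hv0 3 (d3 a2), hv0 13 (d13 a3)] at hv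
    generalize v 5 = u at *
    interval_cases u <;> omega
  · rw [hv0 2 (d2 a1), hv0 5 (d5 a2), hv0 13 (d13 a3)] at hv
    generalize v 3 = u at *
    interval_cases u <;> omega
  · rw [hv0 3 (d3 a1), hv0 5 (d5 a2), hv0 13 (d13 a3)] at hv
    generalize v 2 = u at *
    interval_cases u <;> omega

lemma caseC' (h : OD G) {x : G} (hx : orderOf x = 43) (had : ad G 7 43 = 1)
    (hC : card (centralizer {x}) = 43 * 7)
    (hN : card N[zpowers x] = 43 * 7 * 21) : False := by
  obtain ⟨S0, hS0, hS0c⟩ := sylow_exists_in (n := 2) hp7 (H := N[zpowers x])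
    (by rw [hN]; norm_num)
  obtain ⟨w, hw, hw3⟩ := exists_order_of_dvd hp3 (H := N[zpowers x])
    (by rw [hN]; norm_num)
  obtain ⟨k1, k2⟩ := sylow_k' hp7 hS0 hS0c (m := 129) (by rw [hN]; norm_num) (by norm_num)
  obtain ⟨S, ⟨g, hg, rfl⟩, hwS⟩ := sub_fixed_exists hp3 (n := 1) (w := w) (by simpa using hw3)
    (conjSet N[zpowers x] S0) (by
      rintro _ ⟨g, hg, rfl⟩
      exact ⟨w * g, mul_mem hw hg, by rw [map_mul, mul_smul]⟩) (by
      generalize card (conjSet N[zpowers x] S0) = k at *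
      have : k ∈ Nat.divisors 129 := by simp [k1]
      have h2 : Nat.divisors 129 = {1, 3, 43, 129} := by decide
      rw [h2] at this
      simp only [mem_insert, mem_singleton] at this
      omega)
  have hS : card (conj g • S0 : Subgroup G) = 7 ^ 2 := by rw [card_conj_smul, hS0c]
  have hSN : conj g • S0 ≤ N[zpowers x] := conj_smul_le_of_mem hg hS0
  generalize conj g • S0 = S at *
  have hnot : ¬ S ≤ centralizer {x} := by
    intro hle
    have := card_dvd_of_le hle
    rw [hS, hC] at this
    revert this; norm_num
  obtain ⟨s, hs, hsC⟩ := Set.not_subset.1 hnot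
  obtain ⟨a, haS, haC, hcomm⟩ := coset_fix hp3 (n := 1) hw hwS hSN hs (by simpa using hw3)
    (by rw [hS]; norm_num)
  have ha1 : a ≠ 1 := by
    rintro rfl
    apply hsC
    rw [mul_one] at haC
    simpa using inv_mem haC
  have ha7 : 7 ∣ orderOf a := by
    have := orderOf_dvd_of_mem haS
    rw [hS] at this
    obtain ⟨i, hi, hi2⟩ := (Nat.dvd_prime_pow hp7).1 this
    rcases Nat.eq_zero_or_pos i with h0 | h0
    · rw [h0, pow_zero, orderOf_eq_one_iff] at hi2
      exact absurd hi2 ha1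
    · rw [hi2]; exact dvd_pow_self 7 h0.ne'
  have := ad_of_commute_pow hp3 hp7 (by norm_num) (dvd_of_eq hw3.symm) ha7 hcomm
  have e7 := h.d7
  omega

lemma le_normalizer_of_mod {p : ℕ} (hp : p.Prime) {H : Subgroup G} {x : G} (hx : orderOf x = p)
    (hxH : x ∈ H) (hn : ¬ p ^ 2 ∣ card H)
    (hm : ∀ k, k ∣ card H → ¬ p ∣ k → k % p = 1 → k = 1) : H ≤ N[zpowers x] := by
  have hz : card (zpowers x) = p ^ 1 := card_zp hx
  have h1 : zpowers x ≤ H := by rwa [zpowers_le]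
  have hcd : p ∣ card H := by
    rw [← hx]; exact orderOf_dvd_of_mem hxH
  obtain ⟨m, hm'⟩ := hcd
  refine normal_of_sylow hp h1 hz (m := m) (by rw [hm', pow_one]) ?_ ?_
  · rintro ⟨d, rfl⟩
    exact hn ⟨d, by rw [hm']; ring⟩
  · intro k hk hk2
    refine hm k (hk.trans ⟨p, by rw [hm']; ring⟩) ?_ hk2
    intro hd
    exact hn (by rw [hm', pow_two]; exact mul_dvd_mul_left p (hd.trans hk))

lemma B_cent (h : OD G) {x t : G} (hx : orderOf x = 43) (had : ad G 3 43 = 1)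
    (ht : orderOf t = 3) (hc : Commute x t) : centralizer {t} ≤ N[zpowers x] := by
  refine le_normalizer_of_mod (by norm_num) hx (mem_cent.2 hc)
    (h.not_dvd _ (by norm_num)) ?_
  intro k hk hk43 hk1
  have hprime : ∀ q : ℕ, q.Prime → q ≠ 3 → ad G 3 q = 0 → ¬ q ∣ k := by
    intro q hq hq' h0 hd
    have := ad_of_dvd_centralizer (by norm_num) hq hq'.symm ht (hd.trans hk)
    omega
  obtain ⟨v, hv, b2, b3, b5, b7, b13, b43, b79, hv0, hvd⟩ := card_form' (hk.trans (h.dvd _))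
  have e2 := h.d2
  have e3 := h.d3
  have e7 := h.d7
  have e13 := h.d13
  have e43 := h.d43
  have l := ad_les (G := G)
  rw [hv0 5 (hprime 5 (by norm_num) (by norm_num) (by omega)),
    hv0 7 (hprime 7 (by norm_num) (by norm_num) (by omega)),
    hv0 79 (hprime 79 (by norm_num) (by norm_num) (by omega)), hv0 43 hk43] at hv
  have hcases : ad G 2 3 = 0 ∨ ad G 3 13 = 0 := by omega
  rcases hcases with a | a
  · rw [hv0 2 (hprime 2 (by norm_num) (by norm_num) (by rw [ad_comm, a]))] at hv
    generalize v 3 = u at *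
    generalize v 13 = w at *
    interval_cases u <;> interval_cases w <;> omega
  · rw [hv0 13 (hprime 13 (by norm_num) (by norm_num) a)] at hv
    generalize v 3 = u at *
    generalize v 2 = w at *
    interval_cases u <;> interval_cases w <;> omega

lemma comm_of_card_sq {p : ℕ} (hp : p.Prime) {R : Subgroup G} (hR : card R = p ^ 2) {a b : G}
    (ha : a ∈ R) (hb : b ∈ R) : a * b = b * a := by
  haveI := Fact.mk hp
  have := (IsPGroup.isMulCommutative_of_card_eq_prime_sq hR).is_comm.comm (⟨a, ha⟩ : R) ⟨b, hb⟩
  simpa using congrArg Subtype.val this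

lemma conj_centralizer_of_normalizer {R : Subgroup G} {g c : G} (hg : g ∈ N[R])
    (hc : c ∈ centralizer (R : Set G)) : g * c * g⁻¹ ∈ centralizer (R : Set G) := by
  rw [mem_centralizer_iff] at hc ⊢
  intro r hr
  have h1 := hc (g⁻¹ * r * g) ((mem_normalizer_iff''.1 hg r).1 hr)
  calc r * (g * c * g⁻¹) = g * ((g⁻¹ * r * g) * c) * g⁻¹ := by group
    _ = g * (c * (g⁻¹ * r * g)) * g⁻¹ := by rw [h1]
    _ = _ := by group

lemma exists_order_of_ne_bot {p n : ℕ} (hp : p.Prime) {H R : Subgroup G} (hR : card R = p ^ n)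
    (hHR : H ≤ R) (hH : H ≠ ⊥) : ∃ t ∈ H, orderOf t = p := by
  apply exists_order_of_dvd hp
  have := card_dvd_of_le hHR
  rw [hR] at this
  obtain ⟨i, hi, hi2⟩ := (Nat.dvd_prime_pow hp).1 this
  rcases Nat.eq_zero_or_pos i with h0 | h0
  · rw [h0, pow_zero, card_eq_one] at hi2
    exact absurd hi2 hH
  · rw [hi2]; exact dvd_pow_self p (by omega)

/-- A Sylow subgroup which intersects its conjugates trivially. -/
lemma ti_count {p n : ℕ} (hp : p.Prime) {R : Subgroup G}
    (hR : card R = p ^ n) (hn : ¬ p ^ (n+1) ∣ card G)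
    (hTI : ∀ L ∈ conjSet ⊤ R, L ≠ R → R ⊓ L = ⊥) :
    p ^ n ∣ card (conjSet ⊤ R) - 1 := by
  have h1 : card (conjSet ⊤ R) - 1 = card (conjSet ⊤ R \ {R} : Set (Subgroup G)) := by
    rw [card_coe_set_eq, card_coe_set_eq, Set.ncard_sdiff_singleton_of_mem]
    exact ⟨1, trivial, by simp⟩
  rw [h1]
  refine dvd_card_of_conjSet (R := R) ?_ ?_
  · rintro r hr L ⟨⟨g, -, rfl⟩, hne⟩
    refine ⟨⟨r * g, trivial, by rw [map_mul, mul_smul]⟩, ?_⟩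
    intro heq
    apply hne
    have h2 : conj r • R = R := conj_smul_eq_of_mem (le_normalizer hr)
    rw [Set.mem_singleton_iff] at heq ⊢
    nth_rewrite 2 [← h2] at heq
    exact smul_left_cancel _ heq
  · rintro L ⟨hL, hne⟩
    have h2 := card_conjSet R L
    have hLc : card L = p ^ n := by
      obtain ⟨g, -, rfl⟩ := hL; rw [card_conj_smul, hR]
    have h3 : R ⊓ N[L] = ⊥ := by
      rw [eq_bot_iff, ← hTI L hL hne]
      refine le_inf inf_le_left ?_
      exact le_of_le_normalizer_sylow hp hLc hn ((IsPGroup.of_card hR).to_le inf_le_left) inf_le_right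
    rw [h3, card_bot, mul_one, hR] at h2
    rw [h2]

lemma caseB2 (h : OD G) {x : G} (hx : orderOf x = 43) (had : ad G 3 43 = 1)
    (hC : card (centralizer {x}) = 43 * 9)
    (hN : card N[zpowers x] = 43 * 9 * 2) : False := by
  have hz : card (zpowers x) = 43 ^ 1 := card_zp hx
  obtain ⟨R, hRC, hR⟩ := sylow_exists_in (n := 2) hp3 (H := centralizer {x}) (by rw [hC]; norm_num)
  have hxR : x ∈ centralizer (R : Set G) := by
    rw [mem_centralizer_iff]
    intro r hr
    exact mem_cent.1 (hRC hr)
  have hCR : centralizer {x} ≤ N[R] := by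
    have h1 : R ≤ centralizer {x} ⊓ N[R] := le_inf hRC le_normalizer
    have h2 : x ∈ centralizer {x} ⊓ N[R] :=
      ⟨mem_cent.2 rfl, centralizer_le_normalizer _ hxR⟩
    have h3 := card_dvd_of_le h1
    have h4 := orderOf_dvd_of_mem h2
    rw [hR] at h3
    rw [hx] at h4
    have h5 : 3 ^ 2 * 43 ∣ card (centralizer {x} ⊓ N[R] : Subgroup G) :=
      Coprime.mul_dvd_of_dvd_of_dvd (by norm_num) h3 h4
    have h6 : centralizer {x} ⊓ N[R] = centralizer {x} := by
      apply eq_of_le_of_card_ge inf_le_left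
      rw [hC]
      exact le_of_dvd card_pos h5
    rw [← h6]; exact inf_le_right
  have hNR : N[zpowers x] ≤ N[R] := by
    intro g hg
    rw [mem_normalizer_conj]
    have h1 : conj g • R ≤ centralizer {x} := by
      intro y hy
      rw [mem_conj_smul] at hy
      have := conj_mem_centralizer hg (hRC hy)
      simpa [mul_assoc] using this
    have h2 := le_of_normal_sylow hp3 (Q := conj g • R) hRC hR (by rw [hC]; norm_num)
      (IsPGroup.of_card (n := 2) (by rw [card_conj_smul, hR])) h1 hCR
    exact conj_eq_of_le h2 le_rfl
  have h27 : ¬ 3 ^ (2 + 1) ∣ card G := by rw [h.card]; norm_num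
  have hRN : N[R] ≤ N[zpowers x] := by
    intro g hg
    obtain ⟨t, htR, ht⟩ := exists_order_of_dvd hp3 (H := R) (by rw [hR]; norm_num)
    have h1 := B_cent h hx had ht (mem_centralizer_iff.1 hxR t htR).symm
    have h2 := conj_centralizer_of_normalizer hg hxR
    have h3 : g * x * g⁻¹ ∈ N[zpowers x] :=
      h1 (centralizer_le (by simpa using htR) h2)
    apply mem_normalizer_zpowers_of
    exact mem_sylow_of_normalizer hp43 hz (by rw [h.card]; norm_num) (i := 1)
      (by rw [orderOf_conj', hx, pow_one]) h3
  have hti := ti_count hp3 hR h27 (by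
    rintro _ ⟨g, -, rfl⟩ hne
    by_contra hb
    obtain ⟨t, ht, ht3⟩ := exists_order_of_ne_bot hp3 hR inf_le_left hb
    have hL : card (conj g • R : Subgroup G) = 3 ^ 2 := by rw [card_conj_smul, hR]
    have h1 : conj g • R ≤ N[R] := by
      refine le_trans ?_ ((B_cent h hx had ht3 (mem_centralizer_iff.1 hxR t ht.1).symm).trans hNR)
      intro y hy
      rw [mem_cent]
      exact comm_of_card_sq hp3 hL hy ht.2
    have h2 := le_of_le_normalizer_sylow hp3 hR h27 (IsPGroup.of_card hL) h1
    exact hne (conj_eq_of_le h2 le_rfl))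
  have h1 := card_conjSet ⊤ R
  rw [top_inf_eq, le_antisymm hRN hNR, hN, card_top, h.card] at h1
  omega

lemma transfer_normal {p : ℕ} (hp : p.Prime) {P : Subgroup G} (hP : card P = p ^ 2)
    (hn : ¬ p ^ (2+1) ∣ card G) {a : G} (ha : a ∈ P) (ha1 : a ≠ 1)
    (hcen : ∀ g ∈ N[P], Commute g a) :
    ∃ M : Subgroup G, M.Normal ∧ p ∣ M.index ∧ M.index ∣ p ^ 2 := by
  haveI := Fact.mk hp
  have hPp : IsPGroup p P := IsPGroup.of_card hP
  have hidx : ¬ p ∣ P.index := by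
    rintro ⟨d, hd⟩
    have := P.card_mul_index
    rw [hP, hd] at this
    exact hn ⟨d, by rw [← this]; ring⟩
  let S : Sylow p G := hPp.toSylow hidx
  haveI hcomm : IsMulCommutative P := IsPGroup.isMulCommutative_of_card_eq_prime_sq hP
  haveI : IsMulCommutative S := hcomm
  letI : CommGroup P := { (inferInstance : Group P) with mul_comm := hcomm.is_comm.comm }
  let τ : G →* P := MonoidHom.transfer (MonoidHom.id P)
  have key : ∀ (k : ℕ) (g₀ : G), g₀⁻¹ * a ^ k * g₀ ∈ P → g₀⁻¹ * a ^ k * g₀ = a ^ k := by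
    intro k g hg
    obtain ⟨n, hn, h1⟩ := Sylow.conj_eq_normalizer_conj_of_mem S (a ^ k) g (P.pow_mem ha k) hg
    rw [h1]
    have h2 : Commute n (a ^ k) := (hcen n hn).pow_right k
    rw [mul_assoc, ← h2.eq, inv_mul_cancel_left]
  have hτ : (τ a : G) = a ^ P.index := by
    have := MonoidHom.transfer_eq_pow (MonoidHom.id P) a key
    exact congrArg Subtype.val this
  have hidx' : τ.ker.index = card τ.range := index_ker τ
  have hd : card τ.range ∣ p ^ 2 := hP ▸ card_subgroup_dvd_card τ.range
  refine ⟨τ.ker, inferInstance, ?_, by rw [hidx']; exact hd⟩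
  rw [hidx']
  obtain ⟨i, hi, hi2⟩ := (Nat.dvd_prime_pow hp).1 hd
  rcases Nat.eq_zero_or_pos i with h0 | h0
  · exfalso
    rw [h0, pow_zero, card_eq_one] at hi2
    have h1 : τ a ∈ τ.range := ⟨a, rfl⟩
    rw [hi2, mem_bot] at h1
    rw [h1] at hτ
    have h2 : orderOf a ∣ P.index := orderOf_dvd_of_pow_eq_one (by rw [← hτ]; rfl)
    have h3 := orderOf_dvd_of_mem ha
    rw [hP] at h3
    obtain ⟨j, hj, hj2⟩ := (Nat.dvd_prime_pow hp).1 h3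
    rcases Nat.eq_zero_or_pos j with h4 | h4
    · rw [h4, pow_zero, orderOf_eq_one_iff] at hj2
      exact ha1 hj2
    · exact hidx ((dvd_pow_self p h4.ne').trans (hj2 ▸ h2))
  · rw [hi2]; exact dvd_pow_self p h0.ne'

lemma card_fibers {α β : Type*} [Finite α] [Finite β] (f : α → β) {d : ℕ}
    (h : ∀ b, card {a // f a = b} = d) : card α = card β * d := by
  haveI := Fintype.ofFinite β
  rw [← card_congr (Equiv.sigmaFiberEquiv f), Nat.card_sigma]
  simp [h]

lemma B_graph (h : OD G) (had : ad G 3 43 = 1) : ad G 3 5 = 0 := by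
  have e2 := h.d2
  have e3 := h.d3
  have e7 := h.d7
  have e13 := h.d13
  have e43 := h.d43
  have l := ad_les (G := G)
  omega

lemma caseB1 (h : OD G) {x : G} (hx : orderOf x = 43) (had : ad G 3 43 = 1)
    (hC : card (centralizer {x}) = 43 * 3)
    (hN : card N[zpowers x] = 43 * 3 * 6) : False := by
  have hzx : card (zpowers x) = 43 ^ 1 := card_zp hx
  have h27 : ¬ 3 ^ (2 + 1) ∣ card G := by rw [h.card]; norm_num
  obtain ⟨z, hzC, hz⟩ := exists_order_of_dvd hp3 (H := centralizer {x}) (by rw [hC]; norm_num)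
  have hxz : Commute x z := (mem_cent.1 hzC).symm
  have hzz : card (zpowers z) = 3 ^ 1 := card_zp hz
  have hCz := B_cent h hx had hz hxz
  have hzle : zpowers z ≤ centralizer {x} := by rwa [zpowers_le]
  have hCnz : centralizer {x} ≤ N[zpowers z] := by
    have h2 : x ∈ centralizer {x} ⊓ N[zpowers z] :=
      ⟨mem_cent.2 rfl, cent_le_normalizer z
        (mem_cent.2 hxz)⟩
    have h1 : z ∈ centralizer {x} ⊓ N[zpowers z] :=
      ⟨hzC, le_normalizer (mem_zpowers z)⟩
    have h3 := orderOf_dvd_of_mem h1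
    have h4 := orderOf_dvd_of_mem h2
    rw [hz] at h3
    rw [hx] at h4
    have h5 : 3 * 43 ∣ card (centralizer {x} ⊓ N[zpowers z] : Subgroup G) :=
      Coprime.mul_dvd_of_dvd_of_dvd (by norm_num) h3 h4
    have h6 : centralizer {x} ⊓ N[zpowers z] = centralizer {x} := by
      apply eq_of_le_of_card_ge inf_le_left
      rw [hC]
      exact le_of_dvd card_pos h5
    rw [← h6]; exact inf_le_right
  have hNz : N[zpowers x] ≤ N[zpowers z] := by
    intro g hg
    apply mem_normalizer_zpowers_of
    have h2 := le_of_normal_sylow hp3 (Q := zpowers (g * z * g⁻¹)) hzle hzz (by rw [hC]; norm_num)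
      (isPGroup_zpowers (n := 1) (by rw [orderOf_conj', hz, pow_one])) (by
        rw [zpowers_le]; exact conj_mem_centralizer hg hzC) hCnz
    exact h2 (mem_zpowers _)
  have hzN : N[zpowers z] ≤ N[zpowers x] := by
    intro g hg
    apply mem_normalizer_zpowers_of
    exact mem_sylow_of_normalizer hp43 hzx (by rw [h.card]; norm_num) (i := 1)
      (by rw [orderOf_conj', hx, pow_one])
      (hCz (conj_mem_centralizer hg (mem_cent.2 hxz)))
  have hNeq : N[zpowers z] = N[zpowers x] := le_antisymm hzN hNz
  obtain ⟨T, hTN, hzT, hT⟩ := sylow_exists_ge (n := 2) hp3 (H := N[zpowers x])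
    (Q := zpowers z) (hzle.trans (cent_le_normalizer x)) (IsPGroup.of_card hzz)
    (by rw [hN]; norm_num) (by rw [hN]; norm_num)
  have hTC : ¬ T ≤ centralizer {x} := by
    intro hle
    have := card_dvd_of_le hle
    rw [hT, hC] at this
    revert this; norm_num
  -- number of Sylow 3-subgroups of N
  obtain ⟨k1, k2⟩ := sylow_k' hp3 hTN hT (m := 86) (by rw [hN]; norm_num) (by norm_num)
  have hk43 : card (conjSet N[zpowers x] T) = 43 := by
    have h1 := card_conjSet N[zpowers x] T
    have hne : card (conjSet N[zpowers x] T) ≠ 1 := by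
      intro h1'
      rw [h1', one_mul] at h1
      have h2 := eq_of_le_of_card_ge inf_le_left h1.ge
      have hxT : x ∈ N[T] := by
        have : x ∈ N[zpowers x] := le_normalizer (mem_zpowers x)
        rw [← h2] at this
        exact this.2
      apply hTC
      intro t ht
      have h3 : t * x * t⁻¹ * x⁻¹ ∈ zpowers x :=
        mul_mem ((mem_normalizer_iff.1 (hTN ht) x).1 (mem_zpowers x))
          (inv_mem (mem_zpowers x))
      have h4 : t * x * t⁻¹ * x⁻¹ ∈ T := by
        have := T.mul_mem ht ((mem_normalizer_iff.1 hxT t⁻¹).1 (T.inv_mem ht))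
        simpa [mul_assoc] using this
      have h5 := orderOf_dvd_of_mem h3
      have h6 := orderOf_dvd_of_mem h4
      rw [hzx] at h5
      rw [hT] at h6
      have h7 : orderOf (t * x * t⁻¹ * x⁻¹) = 1 := Nat.eq_one_of_dvd_coprimes (by norm_num) h5 h6
      rw [orderOf_eq_one_iff, mul_inv_eq_one, mul_inv_eq_iff_eq_mul] at h7
      rw [mem_cent]
      exact h7
    generalize card (conjSet N[zpowers x] T) = k at *
    have : k ∈ Nat.divisors 86 := by simp [k1]
    have h2 : Nat.divisors 86 = {1, 2, 43, 86} := by decide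
    rw [h2] at this
    simp only [mem_insert, mem_singleton] at this
    omega
  have h18 : card (N[zpowers x] ⊓ N[T] : Subgroup G) = 18 := by
    have h1 := card_conjSet N[zpowers x] T
    rw [hk43, hN] at h1
    omega
  have hm := card_conjSet N[T] (zpowers z)
  rw [hNeq, inf_comm, h18] at hm
  have hsT : ∀ L ∈ conjSet N[T] (zpowers z), L ≤ T := by
    rintro _ ⟨g, hg, rfl⟩
    rw [← conj_smul_eq_of_mem hg]
    exact pointwise_smul_le_pointwise_smul_iff.2 hzT
  have hs3 : ∀ L ∈ conjSet N[T] (zpowers z), card L = 3 := by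
    rintro _ ⟨g, hg, rfl⟩
    rw [card_conj_smul, hzz, pow_one]
  have hcnt := card_prime_subgroups hp3 _ hs3
  have hsub : {y : G | ∃ L ∈ conjSet N[T] (zpowers z), y ∈ L ∧ y ≠ 1} ⊆
      (T : Set G) \ {1} := by
    rintro y ⟨L, hL, hy, hy1⟩
    exact ⟨hsT L hL hy, hy1⟩
  have hT8 : ((T : Set G) \ {1}).ncard = 8 := by
    rw [Set.ncard_sdiff_singleton_of_mem T.one_mem, ← card_coe_set_eq]
    change card T - 1 = 8
    rw [hT]; norm_num
  have hle8 : card {y : G | ∃ L ∈ conjSet N[T] (zpowers z), y ∈ L ∧ y ≠ 1} ≤ 8 := by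
    rw [card_coe_set_eq, ← hT8]
    exact Set.ncard_le_ncard hsub (Set.toFinite _)
  have hn3 := card_conjSet ⊤ T
  rw [top_inf_eq, ← hm, card_top, h.card] at hn3
  have hn3' := sylow_count hp3 (H := ⊤) (le_top (a := T)) hT (h.not_dvd _ (by norm_num))
  have hsurj : card (conjSet N[T] (zpowers z)) = 4 →
      {y : G | ∃ L ∈ conjSet N[T] (zpowers z), y ∈ L ∧ y ≠ 1} = (T : Set G) \ {1} := by
    intro h4
    apply Set.eq_of_subset_of_ncard_le hsub _ (Set.toFinite _)
    rw [hT8, ← card_coe_set_eq, ← hcnt, h4]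
  have hm14 : card (conjSet N[T] (zpowers z)) = 1 ∨
      card (conjSet N[T] (zpowers z)) = 4 := by
    generalize card (conjSet ⊤ T) = n at *
    generalize card (conjSet N[T] (zpowers z)) = m at *
    have : m ≤ 4 := by omega
    interval_cases m <;> omega
  rcases hm14 with hm1 | hm4
  · rw [hm1, one_mul] at hm
    have hTle : N[T] ≤ N[zpowers x] := by
      have h2 := eq_of_le_of_card_ge
        (inf_le_right (a := N[zpowers x]) (b := N[T]))
        (by rw [h18, hm])
      rw [← h2]; exact inf_le_left
    obtain ⟨w, hw, hw2⟩ := exists_order_of_dvd Nat.prime_two (H := N[T])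
      (by rw [← hm]; norm_num)
    obtain ⟨s, hs, hsC⟩ := Set.not_subset.1 hTC
    obtain ⟨a, haT, haC, hcomm⟩ := coset_fix Nat.prime_two (n := 1) (hTle hw) hw hTN hs
      (by simpa using hw2) (by rw [hT]; norm_num)
    have ha1 : a ≠ 1 := by
      rintro rfl
      apply hsC
      rw [mul_one] at haC
      simpa using inv_mem haC
    have hcen : N[T] ≤ centralizer {a} := by
      have h1 : T ≤ N[T] ⊓ centralizer {a} := by
        refine le_inf le_normalizer ?_
        intro t ht
        exact mem_cent.2 (comm_of_card_sq hp3 hT ht haT)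
      have h3 := card_dvd_of_le h1
      have h4 := orderOf_dvd_of_mem (H := N[T] ⊓ centralizer {a}) (x := w)
        ⟨hw, mem_cent.2 hcomm⟩
      rw [hT] at h3
      rw [hw2] at h4
      have h5 : 3 ^ 2 * 2 ∣ card (N[T] ⊓ centralizer {a} : Subgroup G) :=
        Coprime.mul_dvd_of_dvd_of_dvd (by norm_num) h3 h4
      have h6 : N[T] ⊓ centralizer {a} = N[T] := by
        apply eq_of_le_of_card_ge inf_le_left
        rw [← hm]
        exact le_of_dvd card_pos h5
      rw [← h6]; exact inf_le_right
    obtain ⟨M, hM, hM1, hM2⟩ := transfer_normal hp3 hT h27 haT ha1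
      (fun g hg => mem_cent.1 (hcen hg))
    have h5 : 5 ∣ card M := by
      have h6 := M.card_mul_index
      have h7 : 5 ∣ card M * M.index := by rw [h6, h.card]; norm_num
      rcases (show Nat.Prime 5 by norm_num).dvd_mul.1 h7 with h8 | h8
      · exact h8
      · have := h8.trans hM2
        revert this; norm_num
    have := index3 h M hM1 h5
    have := B_graph h had
    omega
  · have hall := hsurj hm4
    -- fibres
    let Ω : Set (Subgroup G) := conjSet ⊤ T
    let α : Set (Subgroup G) := {L | L ∈ Ω ∧ L ≠ T ∧ T ⊓ L ≠ ⊥}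
    let β : Set (Subgroup G) := {L | L ∈ Ω ∧ L ≠ T ∧ T ⊓ L = ⊥}
    have hcardΩ : ∀ L ∈ Ω, card L = 3 ^ 2 := by
      rintro _ ⟨g, -, rfl⟩; rw [card_conj_smul, hT]
    have hinvΩ : ∀ r ∈ T, ∀ L, L ∈ Ω ∧ L ≠ T → (conj r • L ∈ Ω ∧ conj r • L ≠ T) := by
      rintro r hr L ⟨⟨g, -, rfl⟩, hne⟩
      refine ⟨⟨r * g, trivial, by rw [map_mul, mul_smul]⟩, ?_⟩
      intro heq
      apply hne
      have h2 : conj r • T = T := conj_smul_eq_of_mem (le_normalizer hr)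
      nth_rewrite 2 [← h2] at heq
      exact smul_left_cancel _ heq
    have hβ : 9 ∣ card β := by
      refine dvd_card_of_conjSet (R := T) ?_ ?_
      · rintro r hr L ⟨hL, hne, hbot⟩
        obtain ⟨i1, i2⟩ := hinvΩ r hr L ⟨hL, hne⟩
        refine ⟨i1, i2, ?_⟩
        have h2 : conj r • T = T := conj_smul_eq_of_mem (le_normalizer hr)
        nth_rewrite 1 [← h2]
        rw [← conj_smul_inf, hbot, smul_bot]
      · rintro L ⟨hL, hne, hbot⟩
        have h2 := card_conjSet T L
        have h3 : T ⊓ N[L] = ⊥ := by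
          rw [eq_bot_iff, ← hbot]
          refine le_inf inf_le_left ?_
          exact le_of_le_normalizer_sylow hp3 (hcardΩ L hL) h27
            ((IsPGroup.of_card hT).to_le inf_le_left) inf_le_right
        rw [h3, card_bot, mul_one, hT] at h2
        rw [h2]; norm_num
    -- each L in Ω containing z is an N-conjugate of T
    have hfibz : ∀ L ∈ Ω, zpowers z ≤ L → L ∈ conjSet N[zpowers x] T := by
      intro L hL hzL
      have hLN : L ≤ N[zpowers x] := by
        refine le_trans ?_ hCz
        intro y hy
        rw [mem_cent]
        exact comm_of_card_sq hp3 (hcardΩ L hL) hy (hzL (mem_zpowers z))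
      obtain ⟨g, hg, hle⟩ := sylow_conj_in hp3 hTN hT (by rw [hN]; norm_num) hLN
        (IsPGroup.of_card (hcardΩ L hL))
      have := conj_eq_of_le hle (by rw [hT, hcardΩ L hL])
      refine ⟨g⁻¹, inv_mem hg, ?_⟩
      rw [← this, smul_smul, ← map_mul, inv_mul_cancel, map_one, one_smul]
    have hfibz' : {L | L ∈ Ω ∧ zpowers z ≤ L} = conjSet N[zpowers x] T := by
      ext L
      refine ⟨fun hL => hfibz L hL.1 hL.2, ?_⟩
      rintro ⟨g, hg, rfl⟩
      refine ⟨⟨g, trivial, rfl⟩, ?_⟩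
      have h2 : conj g • zpowers z = zpowers z := conj_smul_eq_of_mem (hNz hg)
      rw [← h2]
      exact pointwise_smul_le_pointwise_smul_iff.2 hzT
    have hinter : ∀ L ∈ α, T ⊓ L ∈ conjSet N[T] (zpowers z) := by
      rintro L ⟨hL, hne, hbot⟩
      obtain ⟨t, ht, ht3⟩ := exists_order_of_ne_bot hp3 hT inf_le_left hbot
      have ht1 : t ∈ (T : Set G) \ {1} := ⟨ht.1, by rintro rfl; simp at ht3⟩
      rw [← hall] at ht1
      obtain ⟨U, hU, htU, ht1⟩ := ht1
      have hUz : zpowers t = U := by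
        apply eq_of_le_of_card_ge (by rwa [zpowers_le])
        rw [hs3 U hU, card_zpowers, ht3]
      have hUle : U ≤ T ⊓ L := by rw [← hUz, zpowers_le]; exact ht
      have : U = T ⊓ L := by
        apply eq_of_le_of_card_ge hUle
        have h1 : card (T ⊓ L : Subgroup G) ∣ 3 ^ 2 := hT ▸ card_dvd_of_le inf_le_left
        obtain ⟨i, hi, hi2⟩ := (Nat.dvd_prime_pow hp3).1 h1
        have h9 : i ≠ 2 := by
          rintro rfl
          have e1 := eq_of_le_of_card_ge (inf_le_left (a := T) (b := L)) (by rw [hi2, hT])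
          have e2 := eq_of_le_of_card_ge (inf_le_right (a := T) (b := L)) (by rw [hi2, hcardΩ L hL])
          exact hne (e2.symm.trans e1)
        rw [hs3 U hU, hi2]
        interval_cases i <;> omega
      rwa [← this]
    have hα : card α = 4 * 42 := by
      rw [← hm4]
      refine card_fibers (fun L : α => (⟨T ⊓ (L : Subgroup G), hinter L L.2⟩ :
        conjSet N[T] (zpowers z))) ?_
      rintro ⟨U, g, hg, rfl⟩
      have hgT : conj g • T = T := conj_smul_eq_of_mem hg
      have hgT' : conj g⁻¹ • T = T := conj_smul_eq_of_mem (inv_mem hg)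
      have e1 : card ({L | L ∈ Ω ∧ zpowers z ≤ L} \ {T} : Set (Subgroup G)) = 42 := by
        rw [card_coe_set_eq, Set.ncard_sdiff_singleton_of_mem, hfibz', ← card_coe_set_eq, hk43]
        exact ⟨⟨1, trivial, by simp⟩, hzT⟩
      rw [← e1]
      have hback : ∀ L : Subgroup G, conj g⁻¹ • conj g • L = L := by
        intro L; rw [smul_smul, ← map_mul, inv_mul_cancel, map_one, one_smul]
      have hback' : ∀ L : Subgroup G, conj g • conj g⁻¹ • L = L := by
        intro L; rw [smul_smul, ← map_mul, mul_inv_cancel, map_one, one_smul]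
      refine card_congr ⟨fun L => ⟨conj g⁻¹ • (L.1 : Subgroup G), ?_⟩,
        fun L => ⟨⟨conj g • (L.1 : Subgroup G), ?_⟩, ?_⟩, ?_, ?_⟩
      · obtain ⟨⟨L, ⟨g1, -, rfl⟩, hne, hbot⟩, hL⟩ := L
        have hL' := congrArg Subtype.val hL
        refine ⟨⟨⟨g⁻¹ * g1, trivial, by rw [map_mul, mul_smul]⟩, ?_⟩, ?_⟩
        · have : zpowers z = conj g⁻¹ • (T ⊓ conj g1 • T) := by
            simp only at hL'
            rw [hL', hback]
          exact this.le.trans (pointwise_smul_le_pointwise_smul_iff.2 inf_le_right)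
        · intro heq
          apply hne
          exact smul_left_cancel _ ((Set.mem_singleton_iff.1 heq).trans hgT'.symm)
      · obtain ⟨L, ⟨⟨g1, -, rfl⟩, hzL⟩, hne⟩ := L
        refine ⟨⟨g * g1, trivial, by rw [map_mul, mul_smul]⟩, ?_, ?_⟩
        · intro heq
          apply hne
          exact smul_left_cancel _ (heq.trans hgT.symm)
        · intro hb
          have hb : conj g • (T ⊓ conj g1 • T) = ⊥ := by
            rw [conj_smul_inf, hgT]; exact hb
          have : zpowers z ≤ T ⊓ conj g1 • T := le_inf hzT hzL
          have h2 := pointwise_smul_le_pointwise_smul_iff (a := conj g) |>.2 this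
          rw [hb] at h2
          have h3 := card_dvd_of_le h2
          rw [card_conj_smul, hzz, card_bot] at h3
          revert h3; norm_num
      · obtain ⟨L, ⟨⟨g1, -, rfl⟩, hzL⟩, hne⟩ := L
        apply Subtype.ext
        simp only
        apply le_antisymm
        swap
        · refine le_inf ?_ (pointwise_smul_le_pointwise_smul_iff.2 hzL)
          exact hsT _ ⟨g, hg, rfl⟩
        · apply le_of_eq
          symm
          apply eq_of_le_of_card_ge
          · refine le_inf ?_ (pointwise_smul_le_pointwise_smul_iff.2 hzL)
            exact hsT _ ⟨g, hg, rfl⟩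
          · have hb : conj g • (T ⊓ conj g1 • T) = T ⊓ conj g • conj g1 • T := by
              rw [conj_smul_inf, hgT]
            rw [← hb, card_conj_smul, card_conj_smul]
            have h1 : card (T ⊓ conj g1 • T : Subgroup G) ∣ 3 ^ 2 :=
              hT ▸ card_dvd_of_le inf_le_left
            obtain ⟨i, hi, hi2⟩ := (Nat.dvd_prime_pow hp3).1 h1
            have h9 : i ≠ 2 := by
              rintro rfl
              have e1 := eq_of_le_of_card_ge (inf_le_left (a := T) (b := conj g1 • T))
                (by rw [hi2, hT])
              have e2 := eq_of_le_of_card_ge (inf_le_right (a := T) (b := conj g1 • T))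
                (by rw [hi2, card_conj_smul, hT])
              exact hne (e2.symm.trans e1)
            rw [hi2, hzz]
            exact Nat.pow_le_pow_right (by norm_num) (by omega)
      · intro L
        apply Subtype.ext
        apply Subtype.ext
        exact hback' _
      · intro L
        apply Subtype.ext
        exact hback _
    have htot : card Ω = 1 + (card α + card β) := by
      have h1 : Ω = insert T (α ∪ β) := by
        ext L
        simp only [α, β, Set.mem_insert_iff, Set.mem_union, Set.mem_ofPred_eq]
        constructor
        · intro hL; tauto
        · rintro (rfl | hL | hL)
          · exact ⟨1, trivial, by simp⟩
          · exact hL.1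
          · exact hL.1
      have h2 : Disjoint α β := by
        rw [Set.disjoint_left]
        rintro L ⟨_, _, h1⟩ ⟨_, _, h2⟩
        exact h1 h2
      rw [card_coe_set_eq, card_coe_set_eq, card_coe_set_eq, h1, Set.ncard_insert_of_notMem,
        Set.ncard_union_eq h2, add_comm]
      rintro (h3 | h3)
      · exact h3.2.1 rfl
      · exact h3.2.1 rfl
    rw [hm4] at hn3
    obtain ⟨d, hd⟩ := hβ
    rw [hα, hd] at htot
    change card Ω * _ = _ at hn3
    rw [htot] at hn3
    omega

end PhaseOne

section CaseA
open Pointwise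

lemma fixed_card {H : Type*} [Group H] [Finite H] {p n : ℕ} (hp : p.Prime) {w : H} (hw : orderOf w = p ^ n)
    {Q : Subgroup H} (hwQ : w ∈ N[Q]) :
    card Q % p = card (Q ⊓ centralizer {w} : Subgroup H) % p := by
  have h4 := conj_fixed_count hp hw (Q : Set H)
    (fun a ha => (mem_normalizer_iff.1 hwQ a).1 ha)
  have h5 : card {a : (Q : Set H) | w * (a : H) * w⁻¹ = a} =
      card (Q ⊓ centralizer {w} : Subgroup H) := by
    refine card_congr ⟨fun a => ⟨a.1, a.1.2, mem_cent.2
      (mul_inv_eq_iff_eq_mul.1 a.2).symm⟩, fun a => ⟨⟨a.1, a.2.1⟩, ?_⟩, fun a => rfl, fun a => rfl⟩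
    have := mem_cent.1 a.2.2
    exact mul_inv_eq_iff_eq_mul.2 this.symm
  rw [← h5, ← h4]; rfl

lemma burn_top {H : Type*} [Group H] [Finite H] {p q i : ℕ} (hp : p.Prime) (hq : q.Prime) (hpq : p ≠ q)
    {x : H} (hx : orderOf x = p) (hp2 : ¬ p ^ 2 ∣ card H)
    (hNC : ∀ g : H, g ∈ N[zpowers x] → g * x = x * g)
    (hqi : q ^ i ∣ card H) (hqi' : ¬ q ^ (i+1) ∣ card H) (hmod : q ^ i % p ≠ 1) :
    ∃ a b : H, orderOf a = p ∧ orderOf b = q ∧ Commute a b := by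
  haveI := Fact.mk hp
  have hz : card (zpowers x) = p ^ 1 := card_zp hx
  have hidx : ¬ p ∣ (zpowers x).index := by
    rintro ⟨d, hd⟩
    have := (zpowers x).card_mul_index
    rw [hz, hd] at this
    exact hp2 ⟨d, by rw [← this]; ring⟩
  let S : Sylow p H := (IsPGroup.of_card hz).toSylow hidx
  have hle : N[S] ≤ centralizer (S : Set H) := by
    intro g hg
    rw [mem_centralizer_iff]
    intro y hy
    obtain ⟨n, rfl⟩ := hy
    have h1 : Commute g x := hNC g hg
    exact (h1.zpow_right n).eq.symm
  have hcompl := MonoidHom.ker_transferSylow_isComplement' S hle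
  set K := (MonoidHom.transferSylow S hle).ker with hK
  have hKc : card K * p = card H := by
    have := hcompl.card_mul_card
    rw [← this]
    congr 1
    change p = card (zpowers x)
    rw [hz, pow_one]
  have hcop : Coprime (q ^ i) p := Coprime.pow_left _ ((Nat.coprime_primes hq hp).2 hpq.symm)
  have hqK : q ^ i ∣ card K := hcop.dvd_of_dvd_mul_right (hKc ▸ hqi)
  obtain ⟨Q, hQK, hQ⟩ := sylow_exists_in hq hqK
  have hfr := frattini_card hq (H := ⊤) (M := K) (P := Q) hQK le_top
    (by rw [normalizer_eq_top]) hQ (fun hd => hqi' (hd.trans (card_subgroup_dvd_card _)))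
  have h1 := card_conjSet K Q
  have h2 := card_conjSet ⊤ Q
  rw [top_inf_eq, card_top, ← hfr, ← hKc, ← h1] at h2
  have h3 : p ∣ card N[Q] := by
    have h4 : card (conjSet K Q) ≠ 0 := by
      intro h0
      rw [h0, zero_mul] at h1
      exact card_pos.ne h1
    have h5 := eq_of_mul_eq_mul_left (Nat.pos_of_ne_zero h4) (h2.trans (mul_assoc _ _ _))
    rw [h5]; exact Dvd.intro_left _ rfl
  obtain ⟨y, hy, hyp⟩ := exists_order_of_dvd hp h3
  have h4 := fixed_card hp (n := 1) (w := y) (by simpa using hyp) (Q := Q) hy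
  let F : Subgroup H := Q ⊓ centralizer {y}
  have hne : F ≠ ⊥ := by
    intro hb
    change _ = card F % p at h4
    rw [hb, card_bot, Nat.mod_eq_of_lt hp.one_lt, hQ] at h4
    exact hmod h4
  obtain ⟨t, ht, htq⟩ := exists_order_of_ne_bot hq hQ inf_le_left hne
  exact ⟨y, t, hyp, htq, (mem_cent.1 ht.2).symm⟩

variable {G : Type*} [Group G] [Finite G]

lemma burn (H : Subgroup G) {p q i : ℕ} (hp : p.Prime) (hq : q.Prime) (hpq : p ≠ q)
    {x : G} (hx : orderOf x = p) (hxH : x ∈ H) (hp2 : ¬ p ^ 2 ∣ card H)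
    (hNC : ∀ g ∈ H, g ∈ N[zpowers x] → g * x = x * g)
    (hqi : q ^ i ∣ card H) (hqi' : ¬ q ^ (i+1) ∣ card H) (hmod : q ^ i % p ≠ 1) :
    ad G p q = 1 := by
  obtain ⟨a, b, ha, hb, hab⟩ := burn_top (H := H) hp hq hpq (x := ⟨x, hxH⟩)
    (by rw [orderOf_mk, hx]) hp2 (by
      rintro ⟨g, hg⟩ hgn
      apply Subtype.ext
      apply hNC g hg
      apply mem_normalizer_zpowers_of
      have := (mem_normalizer_iff.1 hgn ⟨x, hxH⟩).1 (mem_zpowers _)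
      obtain ⟨n, hn⟩ := this
      exact ⟨n, by simpa using congrArg Subtype.val hn⟩) hqi hqi' hmod
  refine ad_of_commute hp hq hpq (x := (a : G)) (y := (b : G)) ?_ ?_ ?_
  · rw [orderOf_coe, ha]
  · rw [orderOf_coe, hb]
  · exact congrArg Subtype.val hab

lemma pow_index_mem_centralizer {x : G} {e : ℕ}
    (hN : card N[zpowers x] = card (centralizer {x}) * e) {g : G}
    (hg : g ∈ N[zpowers x]) : g ^ e ∈ centralizer {x} := by
  have hle := cent_le_normalizer x
  haveI : ((centralizer {x}).subgroupOf N[zpowers x]).Normal := by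
    constructor
    rintro ⟨c, hc'⟩ hc ⟨n, hn⟩
    exact conj_mem_centralizer hn hc
  have hidx : ((centralizer {x}).subgroupOf N[zpowers x]).index = e := by
    have := ((centralizer {x}).subgroupOf N[zpowers x]).card_mul_index
    rw [card_congr (subgroupOfEquivOfLe hle).toEquiv, hN] at this
    exact eq_of_mul_eq_mul_left card_pos this
  have := pow_index_mem ((centralizer {x}).subgroupOf N[zpowers x]) ⟨g, hg⟩
  rw [hidx] at this
  exact this

lemma mem_centralizer_of_coprime {x : G} {e : ℕ}
    (hN : card N[zpowers x] = card (centralizer {x}) * e) {g : G}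
    (hg : g ∈ N[zpowers x]) (hco : (orderOf g).Coprime e) : g ∈ centralizer {x} := by
  have h1 := pow_index_mem_centralizer hN hg
  obtain ⟨m, hm⟩ := exists_pow_eq_self_of_coprime (x := g) hco.symm
  rw [← hm]
  exact pow_mem h1 m

end CaseA

section CaseA1
open Pointwise
variable {G : Type*} [Group G] [Finite G]

lemma not_dvd_of_pow_dvd {p i k n m : ℕ} (hp : p.Prime) (h : k * n = m) (hi : ∀ j, p ^ j ∣ m → p ^ j ∣ n)
    (hm : m ≠ 0) : ¬ p ∣ k := by
  intro hd
  have h1 := (hp.pow_dvd_iff_le_factorization (k := m.factorization p) hm).2 le_rfl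
  have h2 := hi _ h1
  have h3 : p ^ (m.factorization p + 1) ∣ m := by
    have := mul_dvd_mul hd h2
    rw [h] at this
    rwa [pow_succ, mul_comm]
  have h4 := (hp.pow_dvd_iff_le_factorization hm).1 h3
  omega

lemma A_graph (h : OD G) (had : ad G 2 43 = 1) : ad G 3 43 = 0 ∧ ad G 5 43 = 0 ∧ ad G 7 43 = 0 ∧
    ad G 13 43 = 0 ∧ ad G 43 79 = 0 := by
  have e43 := h.d43
  omega

lemma A_graph7 (h : OD G) (had : ad G 2 43 = 1) (h7 : ad G 2 7 = 1) :
    ad G 3 7 = 0 ∧ ad G 5 7 = 0 ∧ ad G 7 13 = 0 ∧ ad G 7 79 = 0 ∧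
    ad G 2 13 = 1 ∧ ad G 3 13 = 1 ∧ ad G 5 13 = 1 ∧ ad G 13 79 = 1 ∧
    ad G 2 3 + ad G 2 5 + ad G 2 79 = 1 := by
  have e2 := h.d2
  have e7 := h.d7
  have e13 := h.d13
  have e43 := h.d43
  have l := ad_les (G := G)
  omega

/-- An odd number `k ≡ 1` mod 43 dividing the centralizer of an involution. -/
lemma A_arith (h : OD G) (had : ad G 2 43 = 1) (h7 : ad G 2 7 = 1) {t : G} (ht : orderOf t = 2)
    {k : ℕ} (hk : k ∣ card (centralizer {t})) (hk2 : ¬ 2 ∣ k) (hk43 : ¬ 43 ∣ k) (hk1 : k % 43 = 1) :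
    k = 1 ∨ k = 79 ^ 3 ∨ k = 49 * 79 := by
  have hprime : ∀ q : ℕ, q.Prime → q ≠ 2 → ad G 2 q = 0 → ¬ q ∣ k := by
    intro q hq hq' h0 hd
    have := ad_of_dvd_centralizer (by norm_num) hq hq'.symm ht (hd.trans hk)
    omega
  obtain ⟨v, hv, b2, b3, b5, b7, b13, b43, b79, hv0, hvd⟩ := card_form' (hk.trans (h.dvd _))
  obtain ⟨-, -, -, -, -, -, -, -, g⟩ := A_graph7 h had h7
  have d3 := hprime 3 (by norm_num) (by norm_num)
  have d5 := hprime 5 (by norm_num) (by norm_num)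
  have d79 := hprime 79 (by norm_num) (by norm_num)
  rw [hv0 2 hk2, hv0 43 hk43] at hv
  have hcases : (ad G 2 5 = 0 ∧ ad G 2 79 = 0) ∨ (ad G 2 3 = 0 ∧ ad G 2 79 = 0) ∨
    (ad G 2 3 = 0 ∧ ad G 2 5 = 0) := by omega
  rcases hcases with ⟨a1, a2⟩ | ⟨a1, a2⟩ | ⟨a1, a2⟩
  · rw [hv0 5 (d5 a1), hv0 79 (d79 a2)] at hv
    generalize v 7 = a at *
    generalize v 13 = b at *
    generalize v 3 = c at *
    interval_cases a <;> interval_cases b <;> interval_cases c <;> omega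
  · rw [hv0 3 (d3 a1), hv0 79 (d79 a2)] at hv
    generalize v 7 = a at *
    generalize v 13 = b at *
    generalize v 5 = c at *
    interval_cases a <;> interval_cases b <;> interval_cases c <;> omega
  · rw [hv0 3 (d3 a1), hv0 5 (d5 a2)] at hv
    generalize v 7 = a at *
    generalize v 13 = b at *
    generalize v 79 = c at *
    interval_cases a <;> interval_cases b <;> interval_cases c <;> omega

lemma caseA1 (h : OD G) {x : G} (hx : orderOf x = 43) (had : ad G 2 43 = 1)
    (hC : card (centralizer {x}) = 43 * 64)
    (hN : card N[zpowers x] = 43 * 64 * 7) : False := by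
  have hzx : card (zpowers x) = 43 ^ 1 := card_zp hx
  obtain ⟨R, hRC, hR⟩ := sylow_exists_in (n := 6) hp2 (H := centralizer {x}) (by rw [hC]; norm_num)
  have hRx : ∀ r ∈ R, r * x = x * r := fun r hr => mem_cent.1 (hRC hr)
  -- conjugate into R
  have hconj : ∀ t : G, orderOf t = 2 → ∃ g : G, g * t * g⁻¹ ∈ R := by
    intro t ht
    obtain ⟨g, -, hg⟩ := sylow_conj_in hp2 (le_top (a := R)) hR (h.not_dvd _ (by norm_num))
      (le_top (a := zpowers t)) (isPGroup_zpowers (n := 1) (by rw [ht, pow_one]))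
    exact ⟨g, hg (conj_mem_conj_smul.2 (mem_zpowers t))⟩
  -- k is odd
  have hodd : ∀ t ∈ R, orderOf t = 2 → ¬ 2 ∣ card (conjSet (centralizer {t}) (zpowers x)) := by
    intro t htR ht
    have hxt : x ∈ centralizer {t} := mem_cent.2 (hRx t htR).symm
    refine not_dvd_of_pow_dvd (i := 0) hp2 (card_conjSet (centralizer {t}) (zpowers x)) ?_ card_pos.ne'
    intro j hj
    have hj' : ∃ j', j ≤ j' ∧ 2 ^ j' ∣ card (centralizer {t}) ∧ ¬ 2 ^ (j'+1) ∣ card (centralizer {t}) := by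
      have hne : card (centralizer {t}) ≠ 0 := card_pos.ne'
      refine ⟨(card (centralizer {t})).factorization 2, ?_, ?_, ?_⟩
      · exact (hp2.pow_dvd_iff_le_factorization hne).1 hj
      · exact (hp2.pow_dvd_iff_le_factorization hne).2 le_rfl
      · intro hh
        have := (hp2.pow_dvd_iff_le_factorization hne).1 hh
        omega
    obtain ⟨j', hjj, hj1, hj2⟩ := hj'
    have htt : t ∈ centralizer {t} := mem_cent.2 rfl
    obtain ⟨Q, hQC, htQ, hQ⟩ := sylow_exists_ge hp2 (H := centralizer {t}) (Q := zpowers t)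
      (by rwa [zpowers_le]) (isPGroup_zpowers (n := 1) (by rw [ht, pow_one])) hj1 hj2
    obtain ⟨g, -, hg⟩ := sylow_conj_in hp2 (le_top (a := R)) hR (h.not_dvd _ (by norm_num))
      (le_top (a := Q)) (IsPGroup.of_card hQ)
    -- x' = g⁻¹ x g
    have hx' : ∀ q ∈ Q, q * (g⁻¹ * x * g⁻¹⁻¹) = (g⁻¹ * x * g⁻¹⁻¹) * q := by
      intro q hq
      have h1 := hRx _ (hg (conj_mem_conj_smul.2 hq))
      have h2 : g * (q * (g⁻¹ * x * g⁻¹⁻¹)) * g⁻¹ = g * ((g⁻¹ * x * g⁻¹⁻¹) * q) * g⁻¹ := by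
        calc _ = g * q * g⁻¹ * x := by group
          _ = x * (g * q * g⁻¹) := h1
          _ = _ := by group
      exact mul_left_cancel (mul_right_cancel h2)
    set x' := g⁻¹ * x * g⁻¹⁻¹ with hx'def
    have hx'o : orderOf x' = 43 := by rw [hx'def, orderOf_conj', hx]
    have hx't : x' ∈ centralizer {t} := mem_cent.2
      (hx' t (htQ (mem_zpowers t))).symm
    obtain ⟨c, hc, hcle⟩ := sylow_conj_in hp43 (H := centralizer {t}) (P := zpowers x)
      (by rwa [zpowers_le]) hzx (h.not_dvd _ (by norm_num)) (Q := zpowers x')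
      (by rwa [zpowers_le]) (isPGroup_zpowers (n := 1) (by rw [hx'o, pow_one]))
    have hceq := conj_eq_of_le hcle (by rw [card_zpowers, card_zpowers, hx, hx'o])
    have hQle : conj c • Q ≤ centralizer {t} ⊓ N[zpowers x] := by
      refine le_inf (conj_smul_le_of_mem hc hQC) ?_
      rw [← hceq, ← conj_smul_normalizer]
      apply pointwise_smul_le_pointwise_smul_iff.2
      refine le_trans ?_ (cent_le_normalizer x')
      intro q hq
      exact mem_cent.2 (hx' q hq)
    have := card_dvd_of_le hQle
    rw [card_conj_smul, hQ] at this
    exact (pow_dvd_pow 2 hjj).trans this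
  obtain ⟨g3, g5, g7, g13, g79⟩ := A_graph h had
  have e2 := h.d2
  rcases Nat.lt_or_ge (ad G 2 7) 1 with h7 | h7
  · -- 7 not adjacent to 2
    have key : ∀ q, q.Prime → q ≠ 43 → (∀ i, q ^ (i+1) ∣ ordL →
        q ^ (i+1) % 43 ≠ 1) → ad G 2 q = 1 → ad G 43 q = 1 := by
      intro q hq hq43 hqi h2q
      obtain ⟨t0, y0, ht0, hy0, hcomm⟩ := exists_ad h2q
      obtain ⟨g, hg⟩ := hconj t0 ht0
      set t := g * t0 * g⁻¹ with htdef
      have ht : orderOf t = 2 := by rw [htdef, orderOf_conj', ht0]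
      have hxt : x ∈ centralizer {t} := mem_cent.2 (hRx t hg).symm
      have hqd : q ∣ card (centralizer {t}) := by
        rw [htdef, ← conj_smul_centralizer, card_conj_smul, ← hy0]
        exact orderOf_dvd_of_mem (mem_cent.2 hcomm.symm)
      have hne : card (centralizer {t}) ≠ 0 := card_pos.ne'
      have h1 : 1 ≤ (card (centralizer {t})).factorization q :=
        (hq.pow_dvd_iff_le_factorization hne).1 (by rwa [pow_one])
      have h2 := (hq.pow_dvd_iff_le_factorization hne).2 (le_refl ((card (centralizer {t})).factorization q))
      refine burn (centralizer {t}) (i := (card (centralizer {t})).factorization q) hp43 hq hq43.symm hx hxt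
        (h.not_dvd _ (by norm_num)) ?_ h2 ?_ ?_
      · intro g hg hgN
        refine mem_cent.1 (mem_centralizer_of_coprime (e := 7) (by rw [hN, hC]) hgN ?_)
        rw [Nat.coprime_comm, Nat.Prime.coprime_iff_not_dvd (by norm_num)]
        intro hd
        have := ad_of_dvd_centralizer hp2 hp7 (by norm_num) ht
          (hd.trans (orderOf_dvd_of_mem hg))
        omega
      · intro hh
        have := (hq.pow_dvd_iff_le_factorization hne).1 hh
        omega
      · obtain ⟨i, hi⟩ : ∃ i, (card (centralizer {t})).factorization q = i + 1 := ⟨_, (Nat.sub_add_cancel h1).symm⟩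
        rw [hi] at h2 ⊢
        exact hqi i (h2.trans (h.dvd _))
    have bound : ∀ q i : ℕ, 2 ≤ q → q ^ (i+1) ∣ ordL → ∀ e,
        ¬ q ^ (e+1) ∣ ordL → i < e := by
      intro q i hq hd e he
      by_contra hlt
      exact he ((pow_dvd_pow q (by omega)).trans hd)
    have k3 := key 3 (by norm_num) (by norm_num) (fun i hi => by
      have := bound 3 i (by norm_num) hi 2 (by norm_num)
      interval_cases i <;> norm_num)
    have k5 := key 5 (by norm_num) (by norm_num) (fun i hi => by
      have := bound 5 i (by norm_num) hi 1 (by norm_num)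
      interval_cases i; norm_num)
    have k13 := key 13 (by norm_num) (by norm_num) (fun i hi => by
      have := bound 13 i (by norm_num) hi 2 (by norm_num)
      interval_cases i <;> norm_num)
    rw [ad_comm 43] at k3 k5 k13
    have l := ad_les (G := G)
    omega
  · have h7' : ad G 2 7 = 1 := le_antisymm (ad_le _ _) h7
    obtain ⟨-, -, -, -, h213, -⟩ := A_graph7 h had h7'
    obtain ⟨t0, y0, ht0, hy0, hcomm⟩ := exists_ad h213
    obtain ⟨g, hg⟩ := hconj t0 ht0
    set t := g * t0 * g⁻¹ with htdef
    have ht : orderOf t = 2 := by rw [htdef, orderOf_conj', ht0]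
    have hxt : x ∈ centralizer {t} := mem_cent.2 (hRx t hg).symm
    have hqd : 13 ∣ card (centralizer {t}) := by
      rw [htdef, ← conj_smul_centralizer, card_conj_smul, ← hy0]
      exact orderOf_dvd_of_mem (mem_cent.2 hcomm.symm)
    have hk := card_conjSet (centralizer {t}) (zpowers x)
    have hk1 := sylow_count hp43 (H := centralizer {t}) (P := zpowers x) (by rwa [zpowers_le]) hzx
      (h.not_dvd _ (by norm_num))
    have hk2 := hodd t hg ht
    have harith := A_arith h had h7' ht (Dvd.intro _ hk) hk2 (by omega) hk1
    have h13N : ¬ 13 ∣ card (centralizer {t} ⊓ N[zpowers x] : Subgroup G) := by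
      intro hd
      have := hd.trans (card_dvd_of_le inf_le_right)
      rw [hN] at this
      revert this; norm_num
    rw [← hk] at hqd
    rcases (show Nat.Prime 13 by norm_num).dvd_mul.1 hqd with h1 | h1
    · rcases harith with h2 | h2 | h2 <;> rw [h2] at h1 <;> revert h1 <;> norm_num
    · exact h13N h1

lemma card_mul_le_of_disjoint {A B V : Subgroup G} (hA : A ≤ V) (hB : B ≤ V) (hd : A ⊓ B = ⊥) :
    card A * card B ≤ card V := by
  rw [← Nat.card_prod]
  refine Nat.card_le_card_of_injective (fun p : A × B => (⟨p.1 * p.2, V.mul_mem (hA p.1.2) (hB p.2.2)⟩ : V)) ?_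
  intro p q hpq
  exact mul_injective_of_disjoint (disjoint_iff.2 hd) (congrArg Subtype.val hpq)

/-- irreducibility -/
lemma irred79 {x : G} (hx : orderOf x = 43) {V W : Subgroup G} (hV : card V = 79 ^ 3)
    (hfix : ∀ v ∈ V, v * x = x * v → v = 1) (hWV : W ≤ V) (hxW : x ∈ N[W]) :
    W = ⊥ ∨ W = V := by
  have h1 := fixed_card (n := 1) hp43 (by simpa using hx) hxW
  have h2 : W ⊓ centralizer {x} = ⊥ := by
    rw [eq_bot_iff]
    rintro v ⟨hv, hv2⟩
    exact hfix v (hWV hv) (mem_cent.1 hv2)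
  rw [h2, card_bot] at h1
  have h3 := card_dvd_of_le hWV
  rw [hV] at h3
  obtain ⟨i, hi, hi2⟩ := (Nat.dvd_prime_pow (by norm_num)).1 h3
  rw [hi2] at h1
  interval_cases i
  · left; exact card_eq_one.1 (by simpa using hi2)
  · norm_num at h1
  · norm_num at h1
  · right; exact eq_of_le_of_card_ge hWV (by rw [hV, hi2])

lemma orbit_four {w : G} {m : ℕ} (hw : orderOf w = 2 ^ m) {V : Subgroup G} (hwV : w ∈ N[V])
    (hfix : ∀ v ∈ V, Commute (w ^ 2) v → v = 1) : 4 ∣ card V - 1 := by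
  classical
  haveI : Fintype G := Fintype.ofFinite G
  let s : Set G := (V : Set G) \ {1}
  have hs : card s = card V - 1 := by
    rw [card_coe_set_eq, Set.ncard_sdiff_singleton_of_mem V.one_mem, ← card_coe_set_eq]; rfl
  rw [← hs]
  have hn : ∀ z ∈ zpowers w, ∀ a ∈ s, z * a * z⁻¹ ∈ s := by
    rintro z hz a ⟨ha, ha1⟩
    have hzV : z ∈ N[V] := (zpowers_le.2 hwV) hz
    refine ⟨(mem_normalizer_iff.1 hzV a).1 ha, ?_⟩
    intro h1
    apply ha1
    simpa using h1
  letI : MulAction (zpowers w) s :=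
    { smul := fun z a => ⟨z * a * (z : G)⁻¹, hn z z.2 a a.2⟩
      one_smul := fun a => Subtype.ext (by change ((1 : zpowers w) : G) * a * ((1 : zpowers w) : G)⁻¹ = a; simp)
      mul_smul := fun x y a => Subtype.ext (by
        change ((x * y : zpowers w) : G) * a * ((x * y : zpowers w) : G)⁻¹ = x * (y * a * (y : G)⁻¹) * (x : G)⁻¹
        simp [mul_assoc]) }
  refine card_dvd_of_orbits (R := zpowers w) fun a => ?_
  have h1 := MulAction.card_orbit_mul_card_stabilizer_eq_card_group (zpowers w) a
  rw [← card_eq_fintype_card, ← card_eq_fintype_card, ← card_eq_fintype_card,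
    card_zpowers, hw] at h1
  obtain ⟨i, hi, hi2⟩ := (Nat.dvd_prime_pow Nat.prime_two).1 (Dvd.intro _ h1)
  rcases Nat.lt_or_ge i 2 with hlt | hge
  · exfalso
    have hidx : (MulAction.stabilizer (zpowers w) a).index ∣ 2 := by
      rw [Subgroup.index, card_congr (MulAction.orbitEquivQuotientStabilizer (zpowers w) a).symm, hi2]
      interval_cases i <;> norm_num
    haveI : (MulAction.stabilizer (zpowers w) a).Normal := by
      constructor
      intro b hb g
      have : g * b * g⁻¹ = b := by
        obtain ⟨_, i, rfl⟩ := g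
        obtain ⟨_, j, rfl⟩ := b
        apply Subtype.ext
        change w ^ i * w ^ j * (w ^ i)⁻¹ = w ^ j
        rw [← zpow_add, ← zpow_neg, ← zpow_add]; congr 1; ring
      rwa [this]
    have h2 := pow_index_mem (MulAction.stabilizer (zpowers w) a) ⟨w, mem_zpowers w⟩
    obtain ⟨d, hd⟩ := hidx
    have h3 : (⟨w, mem_zpowers w⟩ : zpowers w) ^ 2 ∈ MulAction.stabilizer (zpowers w) a := by
      rw [hd, pow_mul]; exact pow_mem h2 d
    have h4 : w ^ 2 * (a : G) * (w ^ 2)⁻¹ = a := congrArg Subtype.val (MulAction.mem_stabilizer_iff.1 h3)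
    exact a.2.2 (hfix a a.2.1 (mul_inv_eq_iff_eq_mul.1 h4))
  · rw [hi2]
    exact (pow_dvd_pow 2 hge)

end CaseA1

section AbelLemma

/-- A group of order `8` with a fixed-point-free automorphism of order `7` is abelian. -/
lemma fpf7_comm {A : Type*} [Group A] [Finite A] (hA : card A = 8) (s : MulAut A) (hs7 : s ^ 7 = 1)
    (hs : ∀ a, s a = a → a = 1) : ∀ a b : A, a * b = b * a := by
  classical
  have hfix : ∀ k : ℕ, Coprime k 7 → ∀ a, (s ^ k) a = a → a = 1 := by
    intro k hk a ha
    apply hs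
    obtain ⟨m, -, hm⟩ := Nat.exists_mul_mod_eq_one_of_coprime hk (by norm_num)
    have h1 : ∀ m : ℕ, ((s ^ k) ^ m) a = a := by
      intro m
      induction m with
      | zero => simp
      | succ m ih => rw [pow_succ, MulAut.mul_apply, ha, ih]
    have h2 : (s ^ k) ^ m = s := by
      rw [← pow_mul, ← Nat.mod_add_div (k * m) 7, hm, pow_add, pow_mul, hs7]; simp
    have := h1 m
    rwa [h2] at this
  haveI : Fact (Nat.Prime 2) := ⟨Nat.prime_two⟩
  have hp : IsPGroup 2 A := IsPGroup.of_card (n := 3) (by rw [hA]; norm_num)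
  haveI : Nontrivial A := (Finite.one_lt_card_iff_nontrivial).1 (by rw [hA]; norm_num)
  have hZ := hp.center_nontrivial
  obtain ⟨⟨a, ha⟩, ha1⟩ := exists_ne (1 : center A)
  have ha1 : a ≠ 1 := fun h => ha1 (Subtype.ext h)
  have hmem : ∀ k : ℕ, (s ^ k) a ∈ center A := by
    intro k
    rw [mem_center_iff]
    intro g
    have := (mem_center_iff.1 ha) ((s ^ k).symm g)
    have := congrArg (s ^ k) this
    simpa using this
  have hcard : 8 ≤ card (center A) := by
    let f : Option (Fin 7) → center A := fun o => match o with
      | none => 1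
      | some k => ⟨(s ^ (k : ℕ)) a, hmem k⟩
    have hf : Function.Injective f := by
      have key : ∀ i j : Fin 7, i < j → (s ^ (i:ℕ)) a ≠ (s ^ (j:ℕ)) a := by
        intro i j hij h
        have hij' : (j : ℕ) = i + (j - i) := by have : (i:ℕ) < j := hij; omega
        rw [hij', pow_add, MulAut.mul_apply] at h
        have h2 := (s ^ (i:ℕ)).injective h
        apply ha1
        apply hfix ((j:ℕ) - i) _ a h2.symm
        apply Coprime.symm
        rw [Nat.Prime.coprime_iff_not_dvd (by norm_num)]
        intro hd
        have := le_of_dvd (by have : (i:ℕ) < j := hij; omega) hd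
        omega
      intro o1 o2 h
      rcases o1 with _ | i <;> rcases o2 with _ | j
      · rfl
      · exfalso
        have h2 : (1 : A) = (s ^ (j:ℕ)) a := congrArg Subtype.val h
        exact ha1 ((s ^ (j:ℕ)).map_eq_one_iff.1 h2.symm)
      · exfalso
        have h2 : (s ^ (i:ℕ)) a = (1 : A) := congrArg Subtype.val h
        exact ha1 ((s ^ (i:ℕ)).map_eq_one_iff.1 h2)
      · have h2 : (s ^ (i:ℕ)) a = (s ^ (j:ℕ)) a := congrArg Subtype.val h
        rcases lt_trichotomy i j with hlt | heq | hgt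
        · exact absurd h2 (key i j hlt)
        · rw [heq]
        · exact absurd h2.symm (key j i hgt)
    have := Nat.card_le_card_of_injective f hf
    simpa using this
  have htop : center A = ⊤ := eq_top_of_le_card _ (by rw [hA]; exact hcard)
  intro a b
  have : b ∈ center A := by rw [htop]; trivial
  exact mem_center_iff.1 this a

/-- key commutativity lemma -/
lemma abel_lemma {C : Type*} [Group C] [Finite C] (Z : Subgroup C) (hZ : Z ≤ center C)
    (hcard : card C = 8 * card Z) (hZ7 : Coprime (card Z) 7)
    (τ : MulAut C) (hτ7 : τ ^ 7 = 1) (hfixZ : ∀ c, τ c = c ↔ c ∈ Z) : ∀ a b : C, a * b = b * a := by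
  classical
  haveI hn : Z.Normal := ⟨fun n hn g => by
    have := mem_center_iff.1 (hZ hn) g
    rw [this, mul_inv_cancel_right]; exact hn⟩
  have hmap : Z ≤ Z.comap τ.toMonoidHom := fun z hz => by
    change τ z ∈ Z
    rw [(hfixZ z).2 hz]; exact hz
  have hmapeq : Z.map τ.toMonoidHom = Z := by
    ext z
    constructor
    · rintro ⟨w, hw, rfl⟩; exact hmap hw
    · intro hz; exact ⟨z, hz, (hfixZ z).2 hz⟩
  let s : MulAut (C ⧸ Z) := QuotientGroup.congr Z Z τ hmapeq
  have hs : ∀ c : C, s (c : C ⧸ Z) = ((τ c : C) : C ⧸ Z) := fun c => rfl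
  have hsk : ∀ (k : ℕ) (c : C), (s ^ k) (c : C ⧸ Z) = (((τ ^ k) c : C) : C ⧸ Z) := by
    intro k
    induction k with
    | zero => intro c; rfl
    | succ k ih => intro c; rw [pow_succ, pow_succ, MulAut.mul_apply, MulAut.mul_apply, hs, ih]
  have hs7 : s ^ 7 = 1 := by
    ext x
    induction x using QuotientGroup.induction_on with
    | H c => rw [hsk, hτ7]; rfl
  have hA : card (C ⧸ Z) = 8 := by
    have h1 := card_eq_card_quotient_mul_card_subgroup Z
    rw [hcard] at h1
    exact (Nat.eq_of_mul_eq_mul_right card_pos h1).symm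
  have hsfix : ∀ x, s x = x → x = 1 := by
    intro x
    induction x using QuotientGroup.induction_on with
    | H c =>
      intro h
      rw [hs, eq_comm, QuotientGroup.eq] at h
      set z := c⁻¹ * τ c with hz
      have hc : τ c = c * z := by rw [hz]; group
      have hck : ∀ k : ℕ, (τ ^ k) c = c * z ^ k := by
        intro k
        induction k with
        | zero => simp
        | succ k ih =>
          rw [pow_succ', MulAut.mul_apply, ih, map_mul, map_pow, (hfixZ z).2 h, hc, mul_assoc, pow_succ']
      have h7 : z ^ 7 = 1 := by
        have := hck 7
        rw [hτ7] at this
        simpa using this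
      have hz1 : z = 1 := by
        have h8 : orderOf z ∣ 7 := orderOf_dvd_of_pow_eq_one h7
        have h9 : orderOf z ∣ card Z := by
          have := orderOf_dvd_natCard (⟨z, h⟩ : Z)
          rwa [orderOf_mk] at this
        have := Nat.dvd_gcd h9 h8
        rw [hZ7] at this
        exact orderOf_eq_one_iff.1 (Nat.dvd_one.1 this)
      rw [QuotientGroup.eq_one_iff, ← hfixZ, hc, hz1, mul_one]
  have hcomm := fpf7_comm hA s hs7 hsfix
  -- main
  intro c b
  by_cases hcZ : c ∈ Z
  · exact (mem_center_iff.1 (hZ hcZ) b).symm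
  have hx1 : (c : C ⧸ Z) ≠ 1 := by rwa [Ne, QuotientGroup.eq_one_iff]
  let K : Subgroup (C ⧸ Z) := (centralizer {c}).map (QuotientGroup.mk' Z)
  have hcomZ : ∀ a b : C, a⁻¹ * b⁻¹ * a * b ∈ Z := by
    intro a b
    rw [← QuotientGroup.eq_one_iff]
    have := hcomm a b
    simp only [QuotientGroup.mk_mul, QuotientGroup.mk_inv]
    rw [mul_assoc, this]; group
  have hd : ∀ k : ℕ, k ≤ 7 → Commute c ((τ ^ k) c * (τ ^ (7 - k)) c) := by
    intro k hk
    set a := (τ ^ k) c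
    set a' := (τ ^ (7 - k)) c
    have h1 : (τ ^ k) a' = c := by
      change (τ ^ k) ((τ ^ (7 - k)) c) = c
      rw [← MulAut.mul_apply, ← pow_add, show k + (7 - k) = 7 by omega, hτ7]; rfl
    have hfk : ∀ (k : ℕ) (z : C), z ∈ Z → (τ ^ k) z = z := by
      intro k z hz
      induction k with
      | zero => rfl
      | succ k ih => rw [pow_succ, MulAut.mul_apply, (hfixZ z).2 hz, ih]
    have h2 : (τ ^ k) (c⁻¹ * a'⁻¹ * c * a') = a⁻¹ * c⁻¹ * a * c := by
      rw [map_mul, map_mul, map_mul, map_inv, map_inv, h1]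
    rw [hfk k _ (hcomZ c a')] at h2
    -- c a' = a' c u where u = a⁻¹c⁻¹ac ; a c = c a u
    have hu : ∀ g, g * (a⁻¹ * c⁻¹ * a * c) = (a⁻¹ * c⁻¹ * a * c) * g :=
      fun g => mem_center_iff.1 (hZ (hcomZ a c)) g
    set u := a⁻¹ * c⁻¹ * a * c with hu_def
    have e1 : c * a' = a' * c * u := by rw [← h2]; group
    have e2 : a * c = c * a * u := by rw [hu_def]; group
    change c * (a * a') = a * a' * c
    have e3 : a * (c * a') = a * c * a' := by group
    rw [e1, e2] at e3
    have e4 : c * a * u * a' = c * (a * a') * u := by rw [mul_assoc (c * a), ← hu a']; group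
    rw [e4] at e3
    have e5 : a * (a' * c * u) = (a * a' * c) * u := by group
    rw [e5] at e3
    exact (mul_right_cancel e3).symm
  have hinK : ∀ a : C, Commute c a → (a : C ⧸ Z) ∈ K := by
    intro a ha
    exact ⟨a, mem_cent.2 ha.symm.eq, rfl⟩
  let x : C ⧸ Z := c
  have hfix : ∀ k : ℕ, Coprime k 7 → ∀ a, (s ^ k) a = a → a = 1 := by
    intro k hk a ha
    apply hsfix
    obtain ⟨m, -, hm⟩ := Nat.exists_mul_mod_eq_one_of_coprime hk (by norm_num)
    have h1 : ∀ m : ℕ, ((s ^ k) ^ m) a = a := by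
      intro m
      induction m with
      | zero => simp
      | succ m ih => rw [pow_succ, MulAut.mul_apply, ha, ih]
    have h2 : (s ^ k) ^ m = s := by
      rw [← pow_mul, ← Nat.mod_add_div (k * m) 7, hm, pow_add, pow_mul, hs7]; simp
    have := h1 m
    rwa [h2] at this
  letI : CommGroup (C ⧸ Z) := { (inferInstance : Group (C ⧸ Z)) with mul_comm := hcomm }
  have hshift : ∀ i j : ℕ, (s ^ i) ((s ^ j) x) = (s ^ (i + j)) x := by
    intro i j; rw [pow_add, MulAut.mul_apply]
  have hmod : ∀ i : ℕ, (s ^ (i + 7)) x = (s ^ i) x := by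
    intro i; rw [pow_add, hs7, mul_one]
  have hdK : ∀ k : ℕ, k ≤ 7 → (s ^ k) x * (s ^ (7 - k)) x ∈ K := by
    intro k hk
    have := hinK _ (hd k hk)
    rw [QuotientGroup.mk_mul, ← hsk, ← hsk] at this
    exact this
  let cc : ℕ → C ⧸ Z := fun k => (s ^ k) x
  have hcc : ∀ k, (s ^ k) x = cc k := fun k => rfl
  have hne : ∀ i j : ℕ, i < j → j - i < 7 → cc i ≠ cc j := by
    intro i j hij h7 h
    apply hx1
    apply hfix (j - i) (by
      apply Coprime.symm
      rw [Nat.Prime.coprime_iff_not_dvd (by norm_num)]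
      intro hd
      have := le_of_dvd (by omega) hd
      omega)
    apply (s ^ i).injective
    change (s ^ i) ((s ^ (j - i)) x) = cc i
    rw [hshift, Nat.add_sub_cancel' hij.le, h]
  -- generic: s^i (cc a / cc b) = cc (i+a) / cc (i+b)
  have hdiv : ∀ i a b : ℕ, (s ^ i) (cc a * (cc b)⁻¹) = cc (i + a) * (cc (i + b))⁻¹ := by
    intro i a b
    rw [map_mul, map_inv]
    change (s ^ i) ((s ^ a) x) * ((s ^ i) ((s ^ b) x))⁻¹ = _
    rw [hshift, hshift]
  have hgen : ∀ i a b : ℕ, Coprime i 7 → a < b → b - a < 7 →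
      cc a * (cc b)⁻¹ ≠ cc (i + a) * (cc (i + b))⁻¹ := by
    intro i a b hi hab h7 h
    rw [← hdiv] at h
    have := hfix i hi _ h.symm
    exact hne a b hab h7 (mul_inv_eq_one.1 this)
  have m7 : cc 7 = cc 0 := hmod 0
  have k1 := hdK 1 (by norm_num)
  have k2 := hdK 2 (by norm_num)
  have k3 := hdK 3 (by norm_num)
  simp only [hcc, Nat.reduceSub] at k1 k2 k3
  have k0 : cc 0 ∈ K := hinK c (Commute.refl c)
  have move : ∀ p q r t : C ⧸ Z, p * q = r * t → p * r⁻¹ = t * q⁻¹ := by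
    intro p q r t h
    rw [mul_inv_eq_iff_eq_mul, mul_comm t, mul_assoc, mul_comm t, ← h, mul_comm p, inv_mul_cancel_left]
  have n12 : cc 1 * cc 6 ≠ cc 2 * cc 5 := fun h => hgen 4 1 2 (by decide) (by norm_num) (by norm_num) (move _ _ _ _ h)
  have n13 : cc 1 * cc 6 ≠ cc 3 * cc 4 := fun h => hgen 3 1 3 (by decide) (by norm_num) (by norm_num) (move _ _ _ _ h)
  have n23 : cc 2 * cc 5 ≠ cc 3 * cc 4 := fun h => hgen 2 2 3 (by decide) (by norm_num) (by norm_num) (move _ _ _ _ h)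
  have hsc : ∀ i j : ℕ, (s ^ i) (cc j) = cc (i + j) := hshift
  have cop : ∀ k, 0 < k → k < 7 → Coprime k 7 := by
    intro k h0 h7
    apply Coprime.symm
    rw [Nat.Prime.coprime_iff_not_dvd (by norm_num)]
    intro hd
    have := le_of_dvd h0 hd
    omega
  have none1 : ∀ k l : ℕ, 0 < k → 0 < l → k + l = 7 → cc k * cc l ≠ 1 := by
    intro k l hk hl hkl h
    have h1 : (s ^ k) (cc k * cc l) = cc (k + k) * cc 0 := by
      rw [map_mul, hsc, hsc, hkl, m7]
    rw [h, map_one] at h1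
    have h2 : (s ^ (k + k)) (cc (k + k) * cc 0) = cc (k + k + (k + k)) * cc (k + k) := by
      rw [map_mul, hsc, hsc, add_zero]
    rw [← h1, map_one] at h2
    have h3 : cc (k + k + (k + k)) = cc 0 := by
      have : cc (k + k + (k + k)) * cc (k + k) = cc 0 * cc (k + k) := by rw [← h2, h1, mul_comm]
      exact mul_right_cancel this
    exact hx1 (hfix (k + k + (k + k)) (by
      rw [show k + k + (k + k) = 4 * k by ring, Nat.coprime_mul_iff_left]
      exact ⟨by decide, cop k hk (by omega)⟩) _ h3)
  have none0 : ∀ k l : ℕ, 0 < k → 0 < l → k + l = 7 → cc k * cc l ≠ cc 0 := by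
    intro k l hk hl hkl h
    have h1 : (s ^ k) (cc k * cc l) = cc (k + k) * cc 0 := by
      rw [map_mul, hsc, hsc, hkl, m7]
    rw [h, hsc, add_zero] at h1
    rw [h1] at h
    have h2 : cc (k + k) * cc l = 1 := by
      have : cc (k + k) * cc l * cc 0 = 1 * cc 0 := by rw [one_mul, mul_assoc, mul_comm (cc l), ← mul_assoc, h]
      exact mul_right_cancel this
    have h3 : (s ^ k) (cc (k + k) * cc l) = cc (k + (k + k)) * cc 0 := by
      rw [map_mul, hsc, hsc, hkl, m7]
    rw [h2, map_one] at h3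
    have h4 : (s ^ (k + (k + k))) (cc (k + (k + k)) * cc 0) =
        cc (k + (k + k) + (k + (k + k))) * cc (k + (k + k)) := by
      rw [map_mul, hsc, hsc, add_zero]
    rw [← h3, map_one] at h4
    have h5 : cc (k + (k + k) + (k + (k + k))) = cc 0 := by
      have : cc (k + (k + k) + (k + (k + k))) * cc (k + (k + k)) = cc 0 * cc (k + (k + k)) := by
        rw [← h4, h3, mul_comm]
      exact mul_right_cancel this
    exact hx1 (hfix (k + (k + k) + (k + (k + k))) (by
      rw [show k + (k + k) + (k + (k + k)) = 6 * k by ring, Nat.coprime_mul_iff_left]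
      exact ⟨by decide, cop k hk (by omega)⟩) _ h5)
  have hK5 : 5 ≤ card K := by
    let f : Fin 5 → K := ![1, ⟨cc 0, k0⟩, ⟨_, k1⟩, ⟨_, k2⟩, ⟨_, k3⟩]
    have hf : Function.Injective f := by
      have a1 : (1 : C ⧸ Z) ≠ cc 0 := fun h => hx1 h.symm
      have b1 := none1 1 6 (by norm_num) (by norm_num) rfl
      have b2 := none1 2 5 (by norm_num) (by norm_num) rfl
      have b3 := none1 3 4 (by norm_num) (by norm_num) rfl
      have c1 := none0 1 6 (by norm_num) (by norm_num) rfl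
      have c2 := none0 2 5 (by norm_num) (by norm_num) rfl
      have c3 := none0 3 4 (by norm_num) (by norm_num) rfl
      intro i j h
      have h := congrArg Subtype.val h
      fin_cases i <;> fin_cases j <;>
        first
        | rfl
        | exact absurd h (by assumption)
        | exact absurd h.symm (by assumption)
    have := Nat.card_le_card_of_injective f hf
    simpa using this
  have hKtop : K = ⊤ := by
    have h1 : card K ∣ 8 := by rw [← hA]; exact card_subgroup_dvd_card K
    apply eq_top_of_le_card
    rw [hA]
    obtain ⟨m, hm⟩ := h1
    have : m = 1 := by
      have hm0 : m ≠ 0 := by rintro rfl; simp at hm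
      have : m < 2 := by by_contra hh; push Not at hh; nlinarith
      omega
    subst this
    omega
  have hbK : (b : C ⧸ Z) ∈ K := by rw [hKtop]; trivial
  obtain ⟨b', hb', hbb⟩ := hbK
  have hb'c := mem_cent.1 hb'
  have hz : b'⁻¹ * b ∈ Z := QuotientGroup.eq.1 hbb
  have hzc := mem_center_iff.1 (hZ hz) c
  calc c * b = (c * b') * (b'⁻¹ * b) := by group
    _ = b' * (c * (b'⁻¹ * b)) := by rw [← hb'c]; group
    _ = b' * ((b'⁻¹ * b) * c) := by rw [hzc]
    _ = b * c := by group

end AbelLemma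

section CaseA2a
open Pointwise
variable {G : Type*} [Group G] [Finite G]

lemma commute_of_sq43 {x v : G} (hx : orderOf x = 43) (h : x ^ 2 * v = v * x ^ 2) : v * x = x * v := by
  have h1 : Commute (x ^ 2) v := h
  have h2 : (x ^ 2) ^ 22 = x := by
    rw [← pow_mul, show 2 * 22 = 43 + 1 by norm_num, pow_succ, ← hx, pow_orderOf_eq_one, one_mul]
  have h3 := h1.pow_left 22
  rw [h2] at h3
  exact h3.eq.symm

lemma V_contra {x w : G} {m : ℕ} (hx : orderOf x = 43) {V : Subgroup G} (hV : card V = 79 ^ 3)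
    (hfix : ∀ v ∈ V, v * x = x * v → v = 1) (hxV : x ∈ N[V])
    (hwV : w ∈ N[V]) (hw : orderOf w = 2 ^ m) (hwx : w * x * w⁻¹ = x⁻¹) : False := by
  haveI : Fact (Nat.Prime 79) := ⟨by norm_num⟩
  have hwx1 : w * x = x⁻¹ * w := mul_inv_eq_iff_eq_mul.1 hwx
  have hwx2 : w * x⁻¹ = x * w := by
    have := congrArg Inv.inv hwx
    simp only [mul_inv_rev, inv_inv] at this
    rw [← mul_assoc] at this
    exact mul_inv_eq_iff_eq_mul.1 this
  have hVx : ∀ v ∈ V, x * v * x⁻¹ ∈ V := fun v hv => (mem_normalizer_iff.1 hxV v).1 hv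
  have hVw : ∀ v ∈ V, w * v * w⁻¹ ∈ V := fun v hv => (mem_normalizer_iff.1 hwV v).1 hv
  -- V abelian
  have hab : ∀ a ∈ V, ∀ b ∈ V, a * b = b * a := by
    have h1 := irred79 hx hV hfix (inf_le_left : V ⊓ centralizer (V : Set G) ≤ V) (by
      rw [mem_normalizer_iff]
      intro h
      constructor
      · rintro ⟨h1, h2⟩
        exact ⟨hVx _ h1, conj_centralizer_of_normalizer hxV h2⟩
      · rintro ⟨h1, h2⟩
        refine ⟨(mem_normalizer_iff.1 hxV h).2 h1, ?_⟩
        have := conj_centralizer_of_normalizer (inv_mem hxV) h2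
        simpa [mul_assoc] using this)
    rcases h1 with h1 | h1
    · exfalso
      haveI : Nontrivial V := (Finite.one_lt_card_iff_nontrivial).1 (by rw [hV]; norm_num)
      have hnt := (IsPGroup.of_card hV).center_nontrivial
      obtain ⟨⟨z, hz⟩, hz1⟩ := exists_ne (1 : center V)
      apply hz1
      have : (z : G) ∈ V ⊓ centralizer (V : Set G) := by
        refine ⟨z.2, mem_centralizer_iff.2 fun g hg => ?_⟩
        exact congrArg Subtype.val (mem_center_iff.1 hz ⟨g, hg⟩)
      rw [h1, mem_bot] at this
      exact Subtype.ext (Subtype.ext this)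
    · intro a ha b hb
      rw [← h1] at hb
      exact mem_centralizer_iff.1 hb.2 a ha
  -- w² centralizes V
  have hw2x : w ^ 2 * x = x * w ^ 2 := by
    rw [sq, mul_assoc, hwx1, ← mul_assoc, hwx2, mul_assoc]
  have hww : ∀ v ∈ V, Commute (w ^ 2) v := by
    have h1 := irred79 hx hV hfix (inf_le_left : V ⊓ centralizer {w ^ 2} ≤ V) (by
      rw [mem_normalizer_conj, conj_smul_inf, conj_smul_eq_of_mem hxV, conj_smul_centralizer,
        ← hw2x, mul_inv_cancel_right])
    rcases h1 with h1 | h1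
    · exfalso
      have := orbit_four hw hwV (fun v hv hc => by
        have : v ∈ V ⊓ centralizer {w ^ 2} := ⟨hv, mem_cent.2 hc.symm.eq⟩
        rwa [h1, mem_bot] at this)
      rw [hV] at this
      revert this; norm_num
    · intro v hv
      rw [← h1] at hv
      exact (mem_cent.1 hv.2).symm
  have hpow : ∀ K : Subgroup G, K ≤ V → K ⊓ conj x • K = ⊥ → card K ≤ 79 := by
    intro K hK hd
    have h1 := card_mul_le_of_disjoint hK
      (B := conj x • K) (by
        intro v hv
        rw [mem_conj_smul] at hv
        have := hVx _ (hK hv)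
        simpa [mul_assoc] using this) hd
    rw [card_conj_smul, hV] at h1
    have h3 := card_dvd_of_le hK
    rw [hV] at h3
    obtain ⟨i, hi, hi2⟩ := (Nat.dvd_prime_pow (by norm_num)).1 h3
    rw [hi2] at h1 ⊢
    interval_cases i <;> omega
  have hfin : ∀ v ∈ V, x * v * x⁻¹ = x⁻¹ * v * x → v = 1 := by
    intro v hv h
    apply hfix v hv
    apply commute_of_sq43 hx
    calc x ^ 2 * v = x * (x * v * x⁻¹) * x := by rw [sq]; group
      _ = x * (x⁻¹ * v * x) * x := by rw [h]
      _ = v * x ^ 2 := by rw [sq]; group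
  let C1 : Subgroup G := V ⊓ centralizer {w}
  let I1 : Subgroup G :=
    { carrier := {v | v ∈ V ∧ w * v * w⁻¹ = v⁻¹}
      one_mem' := ⟨V.one_mem, by simp⟩
      mul_mem' := by
        rintro a b ⟨ha, ha'⟩ ⟨hb, hb'⟩
        refine ⟨V.mul_mem ha hb, ?_⟩
        have : w * (a * b) * w⁻¹ = (w * a * w⁻¹) * (w * b * w⁻¹) := by group
        rw [this, ha', hb', hab a ha b hb, mul_inv_rev]
      inv_mem' := by
        rintro a ⟨ha, ha'⟩
        refine ⟨V.inv_mem ha, ?_⟩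
        have : w * a⁻¹ * w⁻¹ = (w * a * w⁻¹)⁻¹ := by group
        rw [this, ha'] }
  have hC1 : card C1 ≤ 79 := by
    apply hpow C1 inf_le_left
    rw [eq_bot_iff]
    rintro v ⟨⟨hv, hv1⟩, hv2⟩
    have hv1 : v * w = w * v := mem_cent.1 hv1
    replace hv2 := mem_conj_smul.1 (SetLike.mem_coe.1 hv2)
    have hv2 : x⁻¹ * v * x * w = w * (x⁻¹ * v * x) := mem_cent.1 hv2.2
    rw [mem_bot]
    apply hfin v hv
    apply mul_right_cancel (b := w)
    rw [hv2]
    calc x * v * x⁻¹ * w = x * v * (x⁻¹ * w) := by group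
      _ = x * (v * w) * x := by rw [← hwx1]; group
      _ = (x * w) * v * x := by rw [hv1]; group
      _ = w * (x⁻¹ * v * x) := by rw [← hwx2]; group
  have hI1 : card I1 ≤ 79 := by
    apply hpow I1 (fun v hv => hv.1)
    rw [eq_bot_iff]
    rintro v ⟨⟨hv, hv1⟩, hv2⟩
    have hv1 : w * v = v⁻¹ * w := mul_inv_eq_iff_eq_mul.1 hv1
    replace hv2 := mem_conj_smul.1 (SetLike.mem_coe.1 hv2)
    have hv2 : w * (x⁻¹ * v * x) = (x⁻¹ * v * x)⁻¹ * w := mul_inv_eq_iff_eq_mul.1 hv2.2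
    rw [mem_bot]
    rw [← inv_eq_one]
    apply hfin v⁻¹ (V.inv_mem hv)
    apply mul_right_cancel (b := w)
    calc x * v⁻¹ * x⁻¹ * w = x * v⁻¹ * (x⁻¹ * w) := by group
      _ = x * (v⁻¹ * w) * x := by rw [← hwx1]; group
      _ = (x * w) * v * x := by rw [← hv1]; group
      _ = w * (x⁻¹ * v * x) := by rw [← hwx2]; group
      _ = (x⁻¹ * v * x)⁻¹ * w := hv2
      _ = x⁻¹ * v⁻¹ * x * w := by group
  have hle : card V ≤ card C1 * card I1 := by
    rw [← Nat.card_prod]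
    have hinv : ∀ v ∈ V, w * (w * v * w⁻¹) * w⁻¹ = v := by
      intro v hv
      have := (hww v hv).eq
      calc w * (w * v * w⁻¹) * w⁻¹ = w ^ 2 * v * (w ^ 2)⁻¹ := by rw [sq]; group
        _ = v := by rw [this, mul_inv_cancel_right]
    refine Nat.card_le_card_of_injective (fun v : V =>
      ((⟨v * (w * v * w⁻¹), V.mul_mem v.2 (hVw v v.2), ?_⟩ : C1),
       (⟨v * (w * v * w⁻¹)⁻¹, V.mul_mem v.2 (V.inv_mem (hVw v v.2)), ?_⟩ : I1))) ?_
    · apply mem_cent.2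
      apply mul_right_cancel (b := w⁻¹)
      rw [mul_inv_cancel_right]
      have : w * (v * (w * v * w⁻¹)) * w⁻¹ = (w * v * w⁻¹) * (w * (w * v * w⁻¹) * w⁻¹) := by group
      rw [this, hinv v v.2, hab _ v.2 _ (hVw v v.2)]
    · have : w * (v * (w * v * w⁻¹)⁻¹) * w⁻¹ = (w * v * w⁻¹) * (w * (w * v * w⁻¹) * w⁻¹)⁻¹ := by group
      rw [this, hinv v v.2, mul_inv_rev, inv_inv]
    · rintro ⟨a, ha⟩ ⟨b, hb⟩ h
      simp only [Prod.mk.injEq, Subtype.mk.injEq] at h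
      obtain ⟨h1, h2⟩ := h
      replace h1 : a * (w * a * w⁻¹) = b * (w * b * w⁻¹) := congrArg Subtype.val h1
      have sqe : ∀ v ∈ V, (v * (w * v * w⁻¹)) * (v * (w * v * w⁻¹)⁻¹) = v ^ 2 := by
        intro v hv
        rw [hab v hv _ (hVw v hv), mul_assoc, ← mul_assoc v v, ← sq,
          hab _ (V.pow_mem hv 2) _ (V.inv_mem (hVw v hv)), mul_inv_cancel_left]
      have h3 : a ^ 2 = b ^ 2 := by rw [← sqe a ha, ← sqe b hb, h1, h2]
      have h4 : (a * b⁻¹) ^ 2 = 1 := by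
        rw [(show Commute a b⁻¹ from hab a ha _ (V.inv_mem hb)).mul_pow, h3, inv_pow, mul_inv_cancel]
      have h5 := orderOf_dvd_of_pow_eq_one h4
      have h6 := orderOf_dvd_of_mem (V.mul_mem ha (V.inv_mem hb))
      rw [hV] at h6
      have h7 := Nat.dvd_gcd h5 h6
      have h8 := orderOf_eq_one_iff.1 (Nat.dvd_one.1 (by simpa using h7))
      exact Subtype.ext (mul_inv_eq_one.1 h8)
  rw [hV] at hle
  have := Nat.mul_le_mul hC1 hI1
  omega

lemma A2_a (h : OD G) {x e w : G} (hx : orderOf x = 43) (had : ad G 2 43 = 1) (h7 : ad G 2 7 = 1)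
    (hN : card N[zpowers x] = 43 * 32 * 14) {Q : Subgroup G}
    (hQN : Q ≤ N[zpowers x]) (hQ : card Q = 64) (he : orderOf e = 2)
    (hex : e * x = x * e) (heQ : ∀ q ∈ Q, e * q = q * e) (hwQ : w ∈ Q) (hwx : w * x * w⁻¹ = x⁻¹) :
    centralizer {e} ≤ N[zpowers x] := by
  have hzx : card (zpowers x) = 43 ^ 1 := card_zp hx
  have hxH : x ∈ centralizer {e} := mem_cent.2 hex.symm
  have hQH : Q ≤ centralizer {e} := fun q hq => mem_cent.2 (heQ q hq).symm
  have hk := card_conjSet (centralizer {e}) (zpowers x)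
  have hk1 := sylow_count hp43 (H := centralizer {e}) (P := zpowers x) (by rwa [zpowers_le]) hzx
    (h.not_dvd _ (by norm_num))
  have h64 : 64 ∣ card (centralizer {e} ⊓ N[zpowers x] : Subgroup G) := by
    rw [← hQ]; exact card_dvd_of_le (le_inf hQH hQN)
  have h43 : 43 ∣ card (centralizer {e} ⊓ N[zpowers x] : Subgroup G) := by
    rw [← hx]; exact orderOf_dvd_of_mem ⟨hxH, le_normalizer (mem_zpowers x)⟩
  have hdN := card_dvd_of_le (inf_le_right : centralizer {e} ⊓ N[zpowers x] ≤ _)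
  have hdH := h.dvd (centralizer {e})
  have hadG := (A_graph h had).2.2.2.2
  rw [hN] at hdN
  rw [← hk] at hdH
  set k := card (conjSet (centralizer {e}) (zpowers x)) with hkdef
  set l := card (centralizer {e} ⊓ N[zpowers x] : Subgroup G) with hl
  have hl2 : l = 43 * 64 ∨ l = 43 * 64 * 7 := by
    have h1 : 43 * 64 ∣ l := Coprime.mul_dvd_of_dvd_of_dvd (by norm_num) h43 h64
    obtain ⟨m, hm⟩ := h1
    rw [hm, show 43 * 32 * 14 = 43 * 64 * 7 by norm_num] at hdN
    have := Nat.dvd_of_mul_dvd_mul_left (by norm_num) hdN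
    rcases (Nat.dvd_prime (by norm_num)).1 this with h2 | h2
    · left; rw [hm, h2]
    · right; rw [hm, h2]
  have hk2 : ¬ 2 ∣ k := by
    intro h2
    have := (mul_dvd_mul h2 h64).trans hdH
    revert this; norm_num
  have harith := A_arith h had h7 he (Dvd.intro _ hk) hk2 (by omega) hk1
  rcases harith with h1 | h1
  · rw [h1, one_mul] at hk
    have := eq_of_le_of_card_ge (inf_le_left : centralizer {e} ⊓ N[zpowers x] ≤ _)
      hk.ge
    rw [← this]; exact inf_le_right
  exfalso
  have hH : ∃ n m, (n = 1 ∨ n = 3) ∧ card (centralizer {e}) = 79 ^ n * m ∧ m ∣ 43 * 64 * 49 := by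
    rw [← hk]
    rcases h1 with h1 | h1 <;> rcases hl2 with h2 | h2
    · exact ⟨3, 43 * 64, Or.inr rfl, by rw [h1, h2], by norm_num⟩
    · exact ⟨3, 43 * 64 * 7, Or.inr rfl, by rw [h1, h2], by norm_num⟩
    · exact ⟨1, 43 * 64 * 49, Or.inl rfl, by rw [h1, h2]; norm_num, by norm_num⟩
    · exfalso
      rw [h1, h2] at hdH
      revert hdH; norm_num
  obtain ⟨n, m, hn, hHc, hm⟩ := hH
  have hm79 : ¬ 79 ∣ m := fun hh => by
    have := hh.trans hm
    revert this; norm_num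
  obtain ⟨V, hVH, hV⟩ := sylow_exists_in (n := n) hp79 (H := centralizer {e}) (by rw [hHc]; exact Dvd.intro _ rfl)
  have hVn := normal_of_sylow hp79 hVH hV hHc hm79 (by
    intro k hkm hk1
    have hkd := hkm.trans hm
    obtain ⟨v, hv, b2, b3, b5, b7, b13, b43, b79, hv0, hvd⟩ := card_form' (hkd.trans (by norm_num))
    rw [hv0 3 (fun hh => by have := hh.trans hkd; revert this; norm_num),
      hv0 5 (fun hh => by have := hh.trans hkd; revert this; norm_num),
      hv0 13 (fun hh => by have := hh.trans hkd; revert this; norm_num),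
      hv0 79 (fun hh => by have := hh.trans hkd; revert this; norm_num)] at hv
    generalize v 2 = a at *
    generalize v 7 = b at *
    generalize v 43 = c at *
    interval_cases a <;> interval_cases b <;> interval_cases c <;> omega)
  have hfix : ∀ v ∈ V, v * x = x * v → v = 1 := by
    intro v hv hc
    by_contra hv1
    have h2 := orderOf_dvd_of_mem hv
    rw [hV] at h2
    obtain ⟨i, hi, hi2⟩ := (Nat.dvd_prime_pow hp79).1 h2
    have : ad G 43 79 = 1 := ad_of_commute_pow hp43 hp79 (by norm_num) (by rw [hx]) (by
      rw [hi2]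
      apply dvd_pow_self
      rintro rfl
      exact hv1 (orderOf_eq_one_iff.1 (by simpa using hi2))) (x := x) (y := v) hc.symm
    omega
  rcases hn with rfl | rfl
  · have h3 := fixed_card (n := 1) hp43 (by simpa using hx) (hVn hxH)
    have h2 : V ⊓ centralizer {x} = ⊥ := by
      rw [eq_bot_iff]
      rintro v ⟨hv, hv2⟩
      exact hfix v hv (mem_cent.1 hv2)
    rw [h2, hV, card_bot] at h3
    norm_num at h3
  · have hwo := orderOf_dvd_of_mem hwQ
    rw [hQ, show 64 = 2 ^ 6 by norm_num] at hwo
    obtain ⟨i, hi, hi2⟩ := (Nat.dvd_prime_pow Nat.prime_two).1 hwo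
    exact V_contra hx hV hfix (hVn hxH) (hVn (hQH hwQ)) hi2 hwx

/-- the configuration in case A2 -/
structure CfgA2 (x y w : G) (Q : Subgroup G) : Prop where
  hQN : Q ≤ N[zpowers x]
  hQ : card Q = 64
  hR : card (Q ⊓ centralizer {x} : Subgroup G) = 32
  hy : orderOf y = 7
  hyN : y ∈ N[zpowers x]
  hyQ : y ∈ N[Q]
  hyR : y ∈ N[(Q ⊓ centralizer {x} : Subgroup G)]
  hwQ : w ∈ Q
  hwx : w * x * w⁻¹ = x⁻¹

lemma normalizer_centralizer_zpowers {x n : G} (hn : n ∈ N[zpowers x]) :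
    n ∈ N[centralizer {x}] := by
  rw [mem_normalizer_conj]
  apply eq_of_le_of_card_ge
  · intro c hc
    rw [mem_conj_smul] at hc
    have := conj_mem_centralizer hn hc
    simpa [mul_assoc] using this
  · rw [card_conj_smul]

lemma mem_normalizer_inf {n : G} {A B : Subgroup G} (hA : n ∈ N[A])
    (hB : n ∈ N[B]) : n ∈ N[(A ⊓ B : Subgroup G)] := by
  rw [mem_normalizer_conj, conj_smul_inf, conj_smul_eq_of_mem hA, conj_smul_eq_of_mem hB]

/-- 2-elements of the normalizer square into the centralizer -/
lemma sq_mem_centralizer {x q : G} {i : ℕ}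
    (hN : card N[zpowers x] = card (centralizer {x}) * 14)
    (hq : q ∈ N[zpowers x]) (hqo : orderOf q = 2 ^ i) : q ^ 2 ∈ centralizer {x} := by
  have h1 := pow_index_mem_centralizer hN hq
  have h2 : (orderOf (q ^ 2)).Coprime 7 := by
    have : orderOf (q ^ 2) ∣ 2 ^ i := hqo ▸ orderOf_pow_dvd 2
    exact Coprime.coprime_dvd_left this (Coprime.pow_left _ (by norm_num))
  obtain ⟨m, hm⟩ := exists_pow_eq_self_of_coprime (x := q ^ 2) h2.symm
  rw [← hm]
  apply pow_mem
  rw [← pow_mul]; exact h1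

lemma A2_setup (h : OD G) {x : G} (hx : orderOf x = 43) (had : ad G 2 43 = 1)
    (hC : card (centralizer {x}) = 43 * 32)
    (hN : card N[zpowers x] = 43 * 32 * 14) :
    ad G 2 7 = 1 ∧ ∃ y w Q, CfgA2 (G := G) x y w Q := by
  have hNC : card N[zpowers x] = card (centralizer {x}) * 14 := by rw [hN, hC]
  have hCN := cent_le_normalizer x
  obtain ⟨R0, hR0C, hR0⟩ := sylow_exists_in (n := 5) hp2 (H := centralizer {x}) (by rw [hC]; norm_num)
  obtain ⟨Q', hQ'N, hRQ', hQ'⟩ := sylow_exists_ge (n := 6) hp2 (H := N[zpowers x]) (Q := R0)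
    (hR0C.trans hCN) (IsPGroup.of_card hR0) (by rw [hN]; norm_num) (by rw [hN]; norm_num)
  let D2 : Subgroup G :=
    { carrier := {g | g ∈ N[zpowers x] ∧ g ^ 2 ∈ centralizer {x}}
      one_mem' := ⟨Subgroup.one_mem _, by simp⟩
      mul_mem' := by
        rintro a b ⟨ha, ha'⟩ ⟨hb, hb'⟩
        refine ⟨mul_mem ha hb, ?_⟩
        have h1 := commutator_mem_centralizer (inv_mem hb) ha
        have h2 : (a * b) ^ 2 = a ^ 2 * (a⁻¹ * b⁻¹⁻¹ * a * b⁻¹) * b ^ 2 := by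
          simp only [sq]; group
        rw [h2]
        exact mul_mem (mul_mem ha' h1) hb'
      inv_mem' := by
        rintro a ⟨ha, ha'⟩
        exact ⟨inv_mem ha, by rw [inv_pow]; exact inv_mem ha'⟩ }
  have hD2N : D2 ≤ N[zpowers x] := fun g hg => hg.1
  have hQ'o : ∀ q ∈ Q', ∃ i, orderOf q = 2 ^ i := by
    intro q hq
    have := orderOf_dvd_of_mem hq
    rw [hQ'] at this
    obtain ⟨i, -, hi⟩ := (Nat.dvd_prime_pow hp2).1 this
    exact ⟨i, hi⟩
  have hQ'D : Q' ≤ D2 := by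
    intro q hq
    obtain ⟨i, hi⟩ := hQ'o q hq
    exact ⟨hQ'N hq, sq_mem_centralizer hNC (hQ'N hq) hi⟩
  have h7D : ¬ 7 ∣ card D2 := by
    intro hd
    obtain ⟨g, ⟨hg, hg2⟩, hgo⟩ := exists_order_of_dvd hp7 hd
    have hg2 : g ^ 2 ∈ centralizer {x} := hg2
    obtain ⟨m, hm⟩ := exists_pow_eq_self_of_coprime (x := g) (n := 2) (by rw [hgo]; norm_num)
    have : g ∈ centralizer {x} := by rw [← hm]; exact pow_mem hg2 m
    have := orderOf_dvd_of_mem this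
    rw [hgo, hC] at this
    revert this; norm_num
  have hD2c : card D2 ∣ 43 * 64 := by
    have h1 := card_dvd_of_le hD2N
    rw [hN, show 43 * 32 * 14 = 7 * (43 * 64) by norm_num] at h1
    exact (Coprime.dvd_of_dvd_mul_left (Coprime.symm ((Nat.Prime.coprime_iff_not_dvd hp7).2 h7D)) h1)
  have hcard : card (conjSet N[zpowers x] Q') ∣ 43 := by
    rw [← frattini_card hp2 hQ'D hD2N ?_ hQ' (h.not_dvd _ (by norm_num))]
    · have h1 := card_conjSet D2 Q'
      have h2 : 64 ∣ card (D2 ⊓ N[Q'] : Subgroup G) := by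
        have := card_dvd_of_le (le_inf hQ'D (le_normalizer (H := Q')))
        rwa [hQ'] at this
      have h3 : card (conjSet D2 Q') * 64 ∣ 43 * 64 := (mul_dvd_mul_left _ h2).trans (h1 ▸ hD2c)
      exact Nat.dvd_of_mul_dvd_mul_right (by norm_num) h3
    · intro g hg
      rw [mem_normalizer_conj]
      apply eq_of_le_of_card_ge
      · intro d hd
        rw [mem_conj_smul] at hd
        have hd1 := hd.1
        have hd2 : (g⁻¹ * d * g) ^ 2 ∈ centralizer {x} := hd.2
        have e1 : d = g * (g⁻¹ * d * g) * g⁻¹ := by group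
        refine ⟨?_, ?_⟩
        · rw [e1]; exact mul_mem (mul_mem hg hd1) (inv_mem hg)
        · have := conj_mem_centralizer hg hd2
          have e2 : d ^ 2 = g * (g⁻¹ * d * g) ^ 2 * g⁻¹ := by simp only [sq]; group
          rw [e2]; exact this
      · rw [card_conj_smul]
  obtain ⟨y, hyN, hy⟩ := exists_order_of_dvd hp7 (H := N[zpowers x]) (by rw [hN]; norm_num)
  obtain ⟨Q, ⟨n, hn, hQn⟩, hyQ⟩ := sub_fixed_exists (n := 1) hp7 (w := y) (by rw [hy, pow_one])
    (conjSet N[zpowers x] Q') (by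
      rintro L ⟨n, hn, rfl⟩
      exact ⟨y * n, mul_mem hyN hn, by rw [map_mul, mul_smul]⟩) (by
      intro hd
      have := hd.trans hcard
      revert this; norm_num)
  have hQ : card Q = 64 := by rw [hQn, card_conj_smul, hQ']; norm_num
  have hQN : Q ≤ N[zpowers x] := by
    rw [hQn]; exact conj_smul_le_of_mem hn hQ'N
  have hR : card (Q ⊓ centralizer {x} : Subgroup G) = 32 := by
    have h1 : conj n • R0 ≤ Q ⊓ centralizer {x} := by
      refine le_inf ?_ ?_
      · rw [hQn]; exact pointwise_smul_le_pointwise_smul_iff.2 hRQ'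
      · have := conj_smul_eq_of_mem (normalizer_centralizer_zpowers hn)
        rw [← this]
        exact pointwise_smul_le_pointwise_smul_iff.2 hR0C
    have h2 := card_dvd_of_le h1
    rw [card_conj_smul, hR0] at h2
    have h3 := card_dvd_of_le (inf_le_left : Q ⊓ centralizer {x} ≤ Q)
    have h4 := card_dvd_of_le (inf_le_right : Q ⊓ centralizer {x} ≤ centralizer {x})
    rw [hQ] at h3
    rw [hC] at h4
    have h5 := Nat.dvd_gcd h3 h4
    exact Nat.dvd_antisymm (h5.trans (by norm_num)) (by simpa using h2)
  have hyR := mem_normalizer_inf hyQ (normalizer_centralizer_zpowers hyN)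
  have had7 : ad G 2 7 = 1 := by
    have h1 := fixed_card (n := 1) hp7 (by rw [hy, pow_one]) hyR
    rw [hR] at h1
    obtain ⟨t, ht, hto⟩ := exists_order_of_ne_bot (n := 5) hp2 (R := Q ⊓ centralizer {x})
      (H := (Q ⊓ centralizer {x}) ⊓ centralizer {y}) (by rw [hR]; norm_num) inf_le_left (by
        intro h0
        rw [h0, card_bot] at h1
        norm_num at h1)
    exact ad_of_commute hp2 hp7 (by norm_num) hto hy (mem_cent.1 ht.2)
  have hw : ∃ w ∈ Q, w ∉ centralizer {x} := by
    by_contra hcon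
    push Not at hcon
    have : Q ⊓ centralizer {x} = Q := inf_eq_left.2 hcon
    rw [this, hQ] at hR
    norm_num at hR
  obtain ⟨w, hwQ, hwC⟩ := hw
  refine ⟨had7, y, w, Q, hQN, hQ, hR, hy, hyN, hyQ, hyR, hwQ, ?_⟩
  have hwo : ∃ i, orderOf w = 2 ^ i := by
    have := orderOf_dvd_of_mem hwQ
    rw [hQ, show 64 = 2 ^ 6 by norm_num] at this
    obtain ⟨i, -, hi⟩ := (Nat.dvd_prime_pow hp2).1 this
    exact ⟨i, hi⟩
  obtain ⟨i, hi⟩ := hwo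
  have hw2 := sq_mem_centralizer hNC (hQN hwQ) hi
  obtain ⟨a, ha⟩ := mem_normalizer_zpowers (hQN hwQ)
  have hw2' : x ^ (a * a) = x := by
    have h1 : w ^ 2 * x * (w ^ 2)⁻¹ = x := by
      rw [mul_inv_eq_iff_eq_mul]
      exact mem_cent.1 hw2
    have h2 : w ^ 2 * x * (w ^ 2)⁻¹ = w * (w * x * w⁻¹) * w⁻¹ := by rw [sq]; group
    rw [h2, ha, ← conj_pow, ha, ← pow_mul] at h1
    exact h1
  have h3 : (x : G) ^ (a * a) = x ^ 1 := by rw [hw2', pow_one]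
  rw [pow_eq_pow_iff_modEq, hx] at h3
  have h4 : (43 : ℤ) ∣ ((a : ℤ) - 1) * (a + 1) := by
    have := (Nat.modEq_iff_dvd.1 h3.symm)
    push_cast at this
    have e : ((a : ℤ) - 1) * (a + 1) = a * a - 1 := by ring
    rw [e]; exact this
  rcases (Int.prime_iff_natAbs_prime.2 (by norm_num : Nat.Prime (43:ℤ).natAbs)).dvd_or_dvd h4 with h5 | h5
  · exfalso
    apply hwC
    have : a ≡ 1 [MOD 43] := (Nat.modEq_iff_dvd.2 (by push_cast; exact h5)).symm
    have h6 : x ^ a = x ^ 1 := by rw [pow_eq_pow_iff_modEq, hx]; exact this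
    rw [h6, pow_one] at ha
    exact mem_cent.2 (mul_inv_eq_iff_eq_mul.1 ha)
  · have h5' : 43 ∣ a + 1 := by exact_mod_cast h5
    rw [ha, eq_inv_iff_mul_eq_one, ← pow_succ]
    obtain ⟨b, hb⟩ := h5'
    rw [hb, pow_mul, ← hx, pow_orderOf_eq_one, one_pow]

lemma center_meets {p n : ℕ} (hp : p.Prime) {K Q : Subgroup G} (hQ : card Q = p ^ n) (hKQ : K ≤ Q)
    (hnorm : Q ≤ N[K]) (hK : K ≠ ⊥) :
    ∃ e ∈ K, orderOf e = p ∧ ∀ q ∈ Q, e * q = q * e := by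
  haveI : Fact p.Prime := ⟨hp⟩
  haveI : (K.subgroupOf Q).Normal := by
    rw [normal_subgroupOf_iff_le_normalizer hKQ]; exact hnorm
  have hpQ : IsPGroup p (ConjAct Q) := by
    have := IsPGroup.of_card hQ
    exact this.of_equiv ConjAct.toConjAct
  have h1 := hpQ.card_modEq_card_fixedPoints (K.subgroupOf Q)
  have hKp : p ∣ card (K.subgroupOf Q) := by
    rw [card_congr (subgroupOfEquivOfLe hKQ).toEquiv]
    obtain ⟨t, ht, hto⟩ := exists_order_of_ne_bot hp hQ hKQ hK
    rw [← hto]; exact orderOf_dvd_of_mem ht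
  have h2 : p ∣ card (MulAction.fixedPoints (ConjAct Q) (K.subgroupOf Q)) :=
    (Nat.modEq_zero_iff_dvd.1 (h1.symm.trans (Nat.modEq_zero_iff_dvd.2 hKp)))
  have hone : (1 : K.subgroupOf Q) ∈ MulAction.fixedPoints (ConjAct Q) (K.subgroupOf Q) := by
    intro g; exact smul_one g
  have h3 : 1 < card (MulAction.fixedPoints (ConjAct Q) (K.subgroupOf Q)) := by
    haveI : Nonempty (MulAction.fixedPoints (ConjAct Q) (K.subgroupOf Q)) := ⟨⟨1, hone⟩⟩
    have := card_pos (α := MulAction.fixedPoints (ConjAct Q) (K.subgroupOf Q))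
    exact lt_of_lt_of_le hp.one_lt (le_of_dvd this h2)
  haveI : Nontrivial (MulAction.fixedPoints (ConjAct Q) (K.subgroupOf Q)) := Finite.one_lt_card_iff_nontrivial.1 h3
  obtain ⟨⟨k, hk⟩, hk1⟩ := exists_ne (⟨1, hone⟩ : MulAction.fixedPoints (ConjAct Q) (K.subgroupOf Q))
  have hk2 : ∀ q ∈ Q, ((k : Q) : G) * q = q * ((k : Q) : G) := by
    intro q hq
    have := hk (ConjAct.toConjAct ⟨q, hq⟩)
    have h4 := congrArg (fun z : K.subgroupOf Q => ((z : Q) : G)) this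
    simp only [ConjAct.Subgroup.val_conj_smul, ConjAct.smul_def, ConjAct.ofConjAct_toConjAct, Subgroup.coe_mul, Subgroup.coe_inv] at h4
    rw [mul_inv_eq_iff_eq_mul] at h4
    exact h4.symm
  have hkK : ((k : Q) : G) ∈ K := mem_subgroupOf.1 k.2
  have hkne : ((k : Q) : G) ≠ 1 := by
    intro h0; apply hk1
    apply Subtype.ext; apply Subtype.ext; apply Subtype.ext; exact h0
  obtain ⟨t, ht, hto⟩ := exists_order_of_ne_bot hp hQ (H := zpowers ((k : Q) : G)) (by
    rw [zpowers_le]; exact hKQ hkK) (by rwa [Ne, zpowers_eq_bot])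
  refine ⟨t, (zpowers_le.2 hkK) ht, hto, ?_⟩
  intro q hq
  obtain ⟨i, rfl⟩ := mem_zpowers_iff.1 ht
  exact (Commute.zpow_left (hk2 q hq : Commute _ _) i)

lemma inv_or_eq {a q : G} {i : ℕ} (ha : orderOf a = 43)
    (hN : card N[zpowers a] = card (centralizer {a}) * 14)
    (hq : q ∈ N[zpowers a]) (hqo : orderOf q = 2 ^ i) :
    q * a * q⁻¹ = a ∨ q * a * q⁻¹ = a⁻¹ := by
  have hw2 := sq_mem_centralizer hN hq hqo
  obtain ⟨b, hb⟩ := mem_normalizer_zpowers hq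
  have hw2' : a ^ (b * b) = a := by
    have h1 : q ^ 2 * a * (q ^ 2)⁻¹ = a := by
      rw [mul_inv_eq_iff_eq_mul]
      exact mem_cent.1 hw2
    have h2 : q ^ 2 * a * (q ^ 2)⁻¹ = q * (q * a * q⁻¹) * q⁻¹ := by rw [sq]; group
    rw [h2, hb, ← conj_pow, hb, ← pow_mul] at h1
    exact h1
  have h3 : (a : G) ^ (b * b) = a ^ 1 := by rw [hw2', pow_one]
  rw [pow_eq_pow_iff_modEq, ha] at h3
  have h4 : (43 : ℤ) ∣ ((b : ℤ) - 1) * (b + 1) := by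
    have := (Nat.modEq_iff_dvd.1 h3.symm)
    push_cast at this
    have e : ((b : ℤ) - 1) * (b + 1) = b * b - 1 := by ring
    rw [e]; exact this
  rcases (Int.prime_iff_natAbs_prime.2 (by norm_num : Nat.Prime (43:ℤ).natAbs)).dvd_or_dvd h4 with h5 | h5
  · left
    have : b ≡ 1 [MOD 43] := (Nat.modEq_iff_dvd.2 (by push_cast; exact h5)).symm
    have h6 : a ^ b = a ^ 1 := by rw [pow_eq_pow_iff_modEq, ha]; exact this
    rw [hb, h6, pow_one]
  · right
    have h5' : 43 ∣ b + 1 := by exact_mod_cast h5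
    rw [hb, eq_inv_iff_mul_eq_one, ← pow_succ]
    obtain ⟨c, hc⟩ := h5'
    rw [hc, pow_mul, ← ha, pow_orderOf_eq_one, one_pow]

lemma card_le_two_mul {a : G} {T : Subgroup G} (hT : ∀ t ∈ T, t * a * t⁻¹ = a ∨ t * a * t⁻¹ = a⁻¹) :
    card T ≤ 2 * card (T ⊓ centralizer {a} : Subgroup G) := by
  by_cases hc : T ≤ centralizer {a}
  · rw [inf_eq_left.2 hc]; omega
  obtain ⟨t0, ht0, ht0c⟩ := SetLike.not_le_iff_exists.1 hc
  have h0 : t0 * a * t0⁻¹ = a⁻¹ := (hT t0 ht0).resolve_left (fun h => ht0c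
    (mem_cent.2 (mul_inv_eq_iff_eq_mul.1 h)))
  have hsub : (T : Set G) ⊆ ((T ⊓ centralizer {a} : Subgroup G) : Set G) ∪
      (fun g => t0 * g) '' ((T ⊓ centralizer {a} : Subgroup G) : Set G) := by
    intro t ht
    rcases hT t ht with h1 | h1
    · left; exact ⟨ht, mem_cent.2 (mul_inv_eq_iff_eq_mul.1 h1)⟩
    · right
      refine ⟨t0⁻¹ * t, ⟨T.mul_mem (T.inv_mem ht0) ht, ?_⟩, by simp⟩
      apply mem_cent.2
      rw [mul_inv_eq_iff_eq_mul] at h0 h1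
      have h2 : a * t0⁻¹ = t0⁻¹ * a⁻¹ := by
        rw [eq_inv_mul_iff_mul_eq, ← mul_assoc, h0]; group
      rw [mul_assoc, h1, ← mul_assoc, ← mul_assoc, h2]
  have h1 := (Set.ncard_le_ncard hsub (Set.toFinite _)).trans (Set.ncard_union_le _ _)
  have h2 := Set.ncard_image_le (f := fun g => t0 * g) (Set.toFinite ((T ⊓ centralizer {a} : Subgroup G) : Set G))
  have e1 : (T : Set G).ncard = card T := rfl
  have e2 : ((T ⊓ centralizer {a} : Subgroup G) : Set G).ncard = card (T ⊓ centralizer {a} : Subgroup G) := rfl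
  omega

/-- key consequence of `A2_a` -/
lemma A2_key (h : OD G) {x y w : G} {Q : Subgroup G} (hx : orderOf x = 43) (had : ad G 2 43 = 1)
    (h7 : ad G 2 7 = 1) (hN : card N[zpowers x] = 43 * 32 * 14)
    (cf : CfgA2 x y w Q) {K : Subgroup G} (hK : K ≤ Q ⊓ centralizer {x}) (hKne : K ≠ ⊥)
    (hnorm : Q ≤ N[K]) {a : G} (ha : orderOf a = 43) (haK : ∀ k ∈ K, k * a = a * k) :
    a ∈ zpowers x := by
  obtain ⟨e, heK, heo, heQ⟩ := center_meets (n := 6) hp2 (by rw [cf.hQ]; norm_num)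
    (hK.trans inf_le_left) hnorm hKne
  have h1 := A2_a h hx had h7 hN cf.hQN cf.hQ heo (mem_cent.1 (hK heK).2) heQ cf.hwQ cf.hwx
  exact mem_sylow_of_normalizer (n := 1) (i := 1) hp43 (card_zp hx)
    (by rw [h.card]; norm_num) (by rw [ha, pow_one]) (h1 (mem_cent.2 (haK e heK).symm))

lemma conj_cards {x j : G} {m k : ℕ} (hC : card (centralizer {x}) = m)
    (hN : card N[zpowers x] = k) :
    card (centralizer {j * x * j⁻¹}) = m ∧ card N[zpowers (j * x * j⁻¹)] = k := by
  rw [← conj_smul_centralizer, card_conj_smul, ← conj_smul_zpowers, ← conj_smul_normalizer, card_conj_smul]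
  exact ⟨hC, hN⟩

lemma relIndex_card {H K : Subgroup G} (h : H ≤ K) : H.relIndex K * card H = card K := by
  have := (H.subgroupOf K).card_mul_index
  rw [card_congr (subgroupOfEquivOfLe h).toEquiv, mul_comm] at this
  exact this

lemma card_dvd_of_ad7 (h : OD G) (h7 : ad G 2 7 = 1) {y : G} (hy : orderOf y = 7) :
    card (centralizer {y}) ∣ 64 * 49 := by
  have hd := h.d7
  have hno : ∀ p, p.Prime → p ≠ 7 → ad G 7 p ≠ 1 → ¬ p ∣ card (centralizer {y}) :=
    fun p hp hp7' hne hdvd => hne (ad_of_dvd_centralizer hp7 hp hp7'.symm hy hdvd)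
  obtain ⟨v, hv, h2, h3, h5, h7v, h13, h43, h79, hz, -⟩ := card_form' (h.dvd (centralizer {y}))
  rw [hz 3 (hno 3 (by norm_num) (by norm_num) (by rw [ad_comm]; omega)),
    hz 5 (hno 5 (by norm_num) (by norm_num) (by rw [ad_comm]; omega)),
    hz 13 (hno 13 (by norm_num) (by norm_num) (by omega)),
    hz 43 (hno 43 (by norm_num) (by norm_num) (by omega)),
    hz 79 (hno 79 (by norm_num) (by norm_num) (by omega))] at hv
  rw [hv]
  have e1 := pow_dvd_pow 2 h2
  have e2 := pow_dvd_pow 7 h7v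
  have := mul_dvd_mul e1 e2
  simpa using this

lemma A2_b1 (h : OD G) {x y w : G} {Q : Subgroup G} (hx : orderOf x = 43) (had : ad G 2 43 = 1)
    (h7 : ad G 2 7 = 1) (hC : card (centralizer {x}) = 43 * 32)
    (hN : card N[zpowers x] = 43 * 32 * 14)
    (cf : CfgA2 x y w Q) (hQy : Q ≤ centralizer {y}) : False := by
  have hJ : card (centralizer {y}) = 64 * 49 := by
    apply Nat.dvd_antisymm (card_dvd_of_ad7 h h7 cf.hy)
    apply Coprime.mul_dvd_of_dvd_of_dvd (by norm_num)
    · rw [← cf.hQ]; exact card_dvd_of_le hQy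
    · obtain ⟨S, -, hyS, hS⟩ := sylow_exists_ge (n := 2) hp7 (H := ⊤) (Q := zpowers y) le_top
        (isPGroup_zpowers (n := 1) (by rw [cf.hy, pow_one])) (by rw [card_top, h.card]; norm_num)
        (by rw [card_top, h.card]; norm_num)
      have : S ≤ centralizer {y} := fun s hs => mem_cent.2
        (comm_of_card_sq hp7 hS hs (hyS (mem_zpowers y)))
      have := card_dvd_of_le this
      rwa [hS] at this
  have hJN : card (centralizer {y} ⊓ N[zpowers x] : Subgroup G) = 448 := by
    apply Nat.dvd_antisymm
    · have h1 := card_dvd_of_le (inf_le_left : centralizer {y} ⊓ N[zpowers x] ≤ _)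
      have h2 := card_dvd_of_le (inf_le_right : centralizer {y} ⊓ N[zpowers x] ≤ _)
      rw [hJ] at h1; rw [hN] at h2
      exact (Nat.dvd_gcd h1 h2).trans (by norm_num)
    · rw [show 448 = 64 * 7 by norm_num]
      apply Coprime.mul_dvd_of_dvd_of_dvd (by norm_num)
      · rw [← cf.hQ]; exact card_dvd_of_le (le_inf hQy cf.hQN)
      · rw [← cf.hy]; exact orderOf_dvd_of_mem ⟨mem_cent.2 rfl, cf.hyN⟩
  have hset := card_conjSet (centralizer {y}) (zpowers x)
  rw [hJN, hJ] at hset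
  have hset7 : card (conjSet (centralizer {y}) (zpowers x)) = 7 := by omega
  have hmem : zpowers x ∈ conjSet (centralizer {y}) (zpowers x) := ⟨1, Subgroup.one_mem _, by simp⟩
  have h6 : card (conjSet (centralizer {y}) (zpowers x) \ {zpowers x} : Set (Subgroup G)) = 6 := by
    have := Set.ncard_sdiff_singleton_of_mem hmem
    rw [← card_coe_set_eq, ← card_coe_set_eq, hset7] at this
    exact this
  have hex : ∃ L ∈ (conjSet (centralizer {y}) (zpowers x) \ {zpowers x} : Set (Subgroup G)), ¬ 4 ∣ card (conjSet Q L) := by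
    by_contra hcon
    push Not at hcon
    have := dvd_card_of_conjSet (R := Q) (s := conjSet (centralizer {y}) (zpowers x) \ {zpowers x}) (d := 4) (by
      rintro r hr L ⟨⟨j, hj, rfl⟩, hL2⟩
      refine ⟨⟨r * j, mul_mem (hQy hr) hj, by rw [map_mul, mul_smul]⟩, ?_⟩
      intro hr2
      apply hL2
      rw [Set.mem_singleton_iff] at hr2 ⊢
      have h3 := conj_smul_eq_of_mem (cf.hQN hr)
      exact smul_left_cancel _ (hr2.trans h3.symm)) hcon
    rw [h6] at this
    revert this; norm_num
  obtain ⟨L, ⟨⟨j, hj, hL⟩, hLne⟩, hL4⟩ := hex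
  rw [conj_smul_zpowers] at hL
  set a := j * x * j⁻¹ with ha
  subst hL
  have hao : orderOf a = 43 := by rw [ha, orderOf_conj', hx]
  obtain ⟨haC, haN⟩ := conj_cards (j := j) hC hN
  rw [← ha] at haC haN
  have hNC : card N[zpowers a] = card (centralizer {a}) * 14 := by rw [haN, haC]
  have hQo : ∀ q ∈ Q, ∃ i, orderOf q = 2 ^ i := by
    intro q hq
    have := orderOf_dvd_of_mem hq
    rw [cf.hQ, show 64 = 2 ^ 6 by norm_num] at this
    obtain ⟨i, -, hi⟩ := (Nat.dvd_prime_pow hp2).1 this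
    exact ⟨i, hi⟩
  set T : Subgroup G := Q ⊓ N[zpowers a] with hT
  have hTi : ∀ t ∈ T, t * a * t⁻¹ = a ∨ t * a * t⁻¹ = a⁻¹ := by
    intro t ht
    obtain ⟨i, hi⟩ := hQo t ht.1
    exact inv_or_eq hao hNC ht.2 hi
  have hTc : card T = 64 ∨ card T = 32 := by
    have h1 := card_conjSet Q (zpowers a)
    rw [cf.hQ] at h1
    have h2 : card T ∣ 2 ^ 6 := by rw [← show 64 = 2 ^ 6 by norm_num, ← h1]; exact dvd_mul_left _ _
    obtain ⟨i, hi, hi2⟩ := (Nat.dvd_prime_pow hp2).1 h2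
    rw [← hT, hi2] at h1
    rw [hi2]
    revert hL4 h1
    generalize card (conjSet Q (zpowers a)) = z
    intro hL4 h1
    interval_cases i
    iterate 5
      exfalso; apply hL4; omega
    · right; norm_num
    · left; norm_num
  have hTQ : T ≤ Q := inf_le_left
  have hTn : Q ≤ N[T] := by
    rcases hTc with h1 | h1
    · have : T = Q := eq_of_le_of_card_ge hTQ (by rw [h1, cf.hQ])
      rw [this]; exact le_normalizer
    · exact le_normalizer_of_card (n := 5) hp2 hTQ (by rw [h1]; norm_num) (by rw [cf.hQ]; norm_num)
  obtain ⟨q0, hq0Q, hq0⟩ : ∃ q0 ∈ Q, ∀ q ∈ Q, q ∈ T ∨ q0⁻¹ * q ∈ T := by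
    by_cases hc : Q ≤ T
    · exact ⟨1, Subgroup.one_mem _, fun q hq => Or.inl (hc hq)⟩
    · obtain ⟨q0, hq0, hq0T⟩ := SetLike.not_le_iff_exists.1 hc
      refine ⟨q0, hq0, fun q hq => ?_⟩
      by_contra hcon
      push Not at hcon
      have hT32 : card T = 32 := hTc.resolve_left (fun h1 => hc (eq_of_le_of_card_ge hTQ (by rw [h1, cf.hQ])).ge)
      have hidx : (T.subgroupOf Q).index = 2 := by
        have := relIndex_card hTQ
        rw [hT32, cf.hQ] at this
        change T.relIndex Q = 2
        omega
      have h3 := (mul_mem_iff_of_index_two hidx (a := (⟨q0⁻¹, Q.inv_mem hq0⟩ : Q)) (b := ⟨q, hq⟩))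
      simp only [mem_subgroupOf, MulMemClass.mk_mul_mk] at h3
      exact hcon.2 (h3.2 ⟨fun h4 => absurd (T.inv_mem_iff.1 h4) hq0T, fun h4 => absurd h4 hcon.1⟩)
  have hq0sq : q0 * q0 ∈ T := by
    rcases hq0 (q0 * q0) (Q.mul_mem hq0Q hq0Q) with h1 | h1
    · exact h1
    · rw [inv_mul_cancel_left] at h1
      exact T.mul_mem h1 h1
  set A : Subgroup G := T ⊓ centralizer {a} with hA
  have hAc : 32 ≤ 2 * card A := by
    have := card_le_two_mul hTi
    rw [← hA] at this
    rcases hTc with h1 | h1 <;> omega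
  have hTA : ∀ t ∈ T, conj t • A = A := by
    intro t ht
    rw [hA, conj_smul_inf, conj_smul_eq_of_mem (le_normalizer ht), conj_smul_centralizer]
    rcases hTi t ht with h1 | h1
    · rw [h1]
    · rw [h1]; congr 1; ext g
      simp only [mem_cent]
      constructor
      · intro h2; have := (show Commute g a⁻¹ from h2).inv_right; rwa [inv_inv] at this
      · intro h2; exact (show Commute g a from h2).inv_right
  set B : Subgroup G := conj q0 • A with hB
  have hAQ : A ≤ Q := inf_le_left.trans hTQ
  have hBQ : B ≤ Q := conj_smul_le_of_mem hq0Q hAQ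
  have hTB : ∀ t ∈ T, conj t • B = B := by
    intro t ht
    have h1 : q0⁻¹ * t * q0 ∈ T := by
      have := (mem_normalizer_iff.1 (hTn (Q.inv_mem hq0Q)) t).1 ht
      simpa using this
    have h2 : conj t • B = conj q0 • (conj (q0⁻¹ * t * q0) • A) := by
      rw [hB, smul_smul, smul_smul, ← map_mul, ← map_mul]; congr 2; group
    rw [h2, hTA _ h1]
  have hq0B : conj q0 • B = A := by
    rw [hB, smul_smul, ← map_mul, hTA _ hq0sq]
  have hABn : Q ≤ N[(A ⊓ B : Subgroup G)] := by
    intro q hq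
    rw [mem_normalizer_conj, conj_smul_inf]
    rcases hq0 q hq with h1 | h1
    · rw [hTA q h1, hTB q h1]
    · have e : q = q0 * (q0⁻¹ * q) := by group
      rw [e, map_mul, mul_smul, mul_smul, hTA _ h1, hTB _ h1, hq0B, ← hB, inf_comm]
  have hRn : Q ≤ N[(Q ⊓ centralizer {x} : Subgroup G)] := fun q hq =>
    mem_normalizer_inf (le_normalizer hq) (normalizer_centralizer_zpowers (cf.hQN hq))
  have hKne : (A ⊓ B) ⊓ (Q ⊓ centralizer {x}) ≠ ⊥ := by
    intro h0
    have i1 := relIndex_card (inf_le_left : Q ⊓ centralizer {x} ≤ Q)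
    have i2 := relIndex_card hAQ
    have i3 := relIndex_card hBQ
    have i4 := relIndex_card ((inf_le_right.trans inf_le_left) : (A ⊓ B) ⊓ (Q ⊓ centralizer {x}) ≤ Q)
    rw [h0, card_bot, cf.hQ] at i4
    have hBc : card B = card A := card_conj_smul _ _
    rw [cf.hR, cf.hQ] at i1
    rw [cf.hQ] at i2; rw [cf.hQ, hBc] at i3
    have j1 := relIndex_inf_le (H := A ⊓ B) (K := Q ⊓ centralizer {x}) (L := Q)
    have j2 := relIndex_inf_le (H := A) (K := B) (L := Q)
    rw [h0] at j1
    have k1 : (Q ⊓ centralizer {x}).relIndex Q = 2 := by omega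
    have k2 : A.relIndex Q ≤ 4 := by nlinarith
    have k3 : B.relIndex Q ≤ 4 := by nlinarith
    have k4 := Nat.mul_le_mul k2 k3
    rw [k1] at j1
    omega
  have := A2_key h hx had h7 hN cf (K := (A ⊓ B) ⊓ (Q ⊓ centralizer {x})) inf_le_right hKne
    (fun q hq => mem_normalizer_inf (hABn hq) (hRn hq)) hao
    (fun k hk => mem_cent.1 hk.1.1.2)
  apply hLne
  rw [Set.mem_singleton_iff]
  exact eq_of_le_of_card_ge (zpowers_le.2 this) (by rw [card_zpowers, card_zpowers, hao, hx])

/-- elements of `Q` normalizing `⟨y⟩` centralize `y` -/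
lemma b2_norm {y : G} {Q : Subgroup G} (hy : orderOf y = 7) (hQ : card Q = 64)
    (hyQ : y ∈ N[Q]) {q : G} (hq : q ∈ Q)
    (hqN : q ∈ N[zpowers y]) : q * y = y * q := by
  have h1 : q * y * q⁻¹ ∈ zpowers y := (mem_normalizer_iff.1 hqN y).1 (mem_zpowers y)
  have h2 : q * y * q⁻¹ * y⁻¹ ∈ zpowers y := mul_mem h1 (inv_mem (mem_zpowers y))
  have h3 : q * y * q⁻¹ * y⁻¹ ∈ Q := by
    have := Q.mul_mem hq ((mem_normalizer_iff.1 hyQ q⁻¹).1 (Q.inv_mem hq))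
    simpa [mul_assoc] using this
  have h4 : Coprime (card (zpowers y)) (card Q) := by
    rw [card_zpowers, hy, hQ]; norm_num
  have h5 : q * y * q⁻¹ * y⁻¹ = 1 := by
    have := disjoint_of_coprime_natCard h4
    exact disjoint_def.1 this h2 h3
  rw [mul_inv_eq_one, mul_inv_eq_iff_eq_mul] at h5
  exact h5

lemma b2_normal {y : G} {Q : Subgroup G} (hy : orderOf y = 7) (hQ : card Q = 64)
    (hyQ : y ∈ N[Q]) (hF : card (Q ⊓ centralizer {y} : Subgroup G) = 8) :
    Q ≤ N[(Q ⊓ centralizer {y} : Subgroup G)] := by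
  have hFN : Q ⊓ N[zpowers y] = Q ⊓ centralizer {y} := by
    apply le_antisymm
    · intro q hq
      exact ⟨hq.1, mem_cent.2 (b2_norm hy hQ hyQ hq.1 hq.2)⟩
    · exact inf_le_inf_left _ (cent_le_normalizer y)
  have hΩ : card (conjSet Q (zpowers y)) = 8 := by
    have := card_conjSet Q (zpowers y)
    rw [hFN, hF, hQ] at this
    omega
  have key : ∀ f ∈ Q ⊓ centralizer {y}, ∀ q ∈ Q, q⁻¹ * f * q ∈ Q ⊓ centralizer {y} := by
    intro f hf q hq
    have hfo : ∃ i, orderOf f = 2 ^ i := by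
      have := orderOf_dvd_of_mem hf
      rw [hF, show 8 = 2 ^ 3 by norm_num] at this
      obtain ⟨i, -, hi⟩ := (Nat.dvd_prime_pow hp2).1 this
      exact ⟨i, hi⟩
    obtain ⟨i, hi⟩ := hfo
    have hfy := mem_cent.1 hf.2
    have h1 := sub_fixed_count hp2 hi (conjSet Q (zpowers y)) (by
      rintro L ⟨n, hn, rfl⟩
      exact ⟨f * n, mul_mem hf.1 hn, by rw [map_mul, mul_smul]⟩)
    set s : Set (Subgroup G) := {L | L ∈ conjSet Q (zpowers y) ∧ conj f • L = L} with hs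
    have hsc : card {a : conjSet Q (zpowers y) | conj f • (a : Subgroup G) = a} = card s := by
      refine card_congr ⟨fun a => ⟨a.1.1, a.1.2, a.2⟩, fun a => ⟨⟨a.1, a.2.1⟩, a.2.2⟩, fun _ => rfl, fun _ => rfl⟩
    rw [hsc, hΩ] at h1
    have hyinv : ∀ L ∈ conjSet Q (zpowers y), conj y • L ∈ conjSet Q (zpowers y) := by
      rintro L ⟨n, hn, rfl⟩
      refine ⟨y * n * y⁻¹, (mem_normalizer_iff.1 hyQ n).1 hn, ?_⟩
      have e : conj y⁻¹ • zpowers y = zpowers y := conj_smul_eq_of_mem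
        (inv_mem (le_normalizer (mem_zpowers y)))
      rw [map_mul, mul_smul, e, map_mul, mul_smul]
    have h2 := sub_fixed_count (n := 1) hp7 (w := y) (by rw [hy, pow_one]) s (by
      rintro L ⟨hL, hL2⟩
      refine ⟨hyinv L hL, ?_⟩
      rw [smul_smul, ← map_mul, hfy, map_mul, mul_smul, hL2])
    have h3 : card {a : s | conj y • (a : Subgroup G) = a} = 1 := by
      rw [Nat.card_eq_one_iff_unique]
      have hmem : zpowers y ∈ s := ⟨⟨1, Q.one_mem, by simp⟩, conj_smul_eq_of_mem (cent_le_normalizer y hf.2)⟩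
      refine ⟨⟨?_⟩, ⟨⟨⟨zpowers y, hmem⟩, conj_smul_eq_of_mem (le_normalizer (mem_zpowers y))⟩⟩⟩
      have hall : ∀ L ∈ s, conj y • L = L → L = zpowers y := by
        rintro L ⟨⟨n, hn, rfl⟩, -⟩ hL
        rw [← mem_normalizer_conj, ← conj_smul_normalizer, mem_conj_smul] at hL
        set g := n⁻¹ * (y * n * y⁻¹) with hg
        have hgQ : g ∈ Q := Q.mul_mem (Q.inv_mem hn) ((mem_normalizer_iff.1 hyQ n).1 hn)
        have e : n⁻¹ * y * n = g * y := by rw [hg]; group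
        rw [e] at hL
        have hgN : g ∈ N[zpowers y] := by
          have := mul_mem hL (inv_mem (le_normalizer (mem_zpowers y)))
          rwa [mul_inv_cancel_right] at this
        have hgc : Commute g y := b2_norm hy hQ hyQ hgQ hgN
        have hpow : (g * y) ^ 7 = 1 := by
          have e2 : g * y = n⁻¹ * y * n⁻¹⁻¹ := by rw [← e, inv_inv]
          rw [e2, conj_pow, ← hy, pow_orderOf_eq_one]; group
        rw [hgc.mul_pow, ← hy, pow_orderOf_eq_one, mul_one] at hpow
        have hg1 : g = 1 := by
          have d1 := orderOf_dvd_of_pow_eq_one hpow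
          have d2 := orderOf_dvd_of_mem hgQ
          rw [hQ] at d2; rw [hy] at d1
          have := Nat.dvd_gcd d1 d2
          rw [show Nat.gcd 7 64 = 1 by norm_num, Nat.dvd_one, orderOf_eq_one_iff] at this
          exact this
        have hny : n * y = y * n := by
          rw [hg1, one_mul] at e
          rw [mul_assoc, inv_mul_eq_iff_eq_mul] at e
          exact e.symm
        exact conj_smul_eq_of_mem (cent_le_normalizer y (mem_cent.2 hny))
      rintro ⟨⟨a, ha⟩, ha2⟩ ⟨⟨b, hb⟩, hb2⟩
      apply Subtype.ext; apply Subtype.ext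
      exact (hall a ha ha2).trans (hall b hb hb2).symm
    rw [h3] at h2
    have h4 : card s ≤ 8 := by
      rw [← hΩ]; exact Nat.card_mono (Set.toFinite _) (fun L hL => hL.1)
    have h5 : card s = 8 := by omega
    have h6 : s = conjSet Q (zpowers y) := by
      apply Set.eq_of_subset_of_ncard_le (fun L hL => hL.1)
      · rw [← card_coe_set_eq, ← card_coe_set_eq, h5, hΩ]
    have h7 : conj q • zpowers y ∈ s := by rw [h6]; exact ⟨q, hq, rfl⟩
    have h8 := h7.2
    rw [← mem_normalizer_conj, ← conj_smul_normalizer, mem_conj_smul] at h8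
    rw [← hFN]
    exact ⟨Q.mul_mem (Q.mul_mem (Q.inv_mem hq) hf.1) hq, h8⟩
  intro q hq
  rw [mem_normalizer_conj]
  apply eq_of_le_of_card_ge
  · intro f hf
    rw [mem_conj_smul] at hf
    have := key _ hf q⁻¹ (Q.inv_mem hq)
    simpa [mul_assoc] using this
  · rw [card_conj_smul]

lemma b2_struct {y : G} {Q F C : Subgroup G} (hy : orderOf y = 7) (hQ : card Q = 64)
    (hyQ : y ∈ N[Q]) (hF : F = Q ⊓ centralizer {y}) (hF8 : card F = 8)
    (hC : C = Q ⊓ centralizer (F : Set G)) :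
    card C = 8 * card (F ⊓ C : Subgroup G) ∧ (∀ c ∈ C, ∀ q ∈ Q, c * q = q * c) ∧ y ∈ N[C] := by
  have hFn := b2_normal hy hQ hyQ (hF ▸ hF8)
  rw [← hF] at hFn
  have hyF : y ∈ N[F] := by
    rw [hF]; exact mem_normalizer_inf hyQ (normalizer_centralizer_zpowers (le_normalizer (mem_zpowers y)))
  have hyf : ∀ f ∈ F, f * y = y * f := fun f hf => mem_cent.1 ((hF ▸ hf : f ∈ Q ⊓ centralizer {y}).2)
  have hyC : y ∈ N[C] := by
    rw [mem_normalizer_conj]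
    apply eq_of_le_of_card_ge
    · intro c hc
      rw [mem_conj_smul, hC] at hc
      rw [hC]
      have e : c = y * (y⁻¹ * c * y) * y⁻¹ := by group
      rw [e]
      exact ⟨(mem_normalizer_iff.1 hyQ _).1 hc.1, conj_centralizer_of_normalizer hyF hc.2⟩
    · rw [card_conj_smul]
  have hFQ : F ≤ Q := hF ▸ inf_le_left
  have hCQ : C ≤ Q := hC ▸ inf_le_left
  have hcf : ∀ c ∈ C, ∀ f ∈ F, f * c = c * f := fun c hc f hf => mem_centralizer_iff.1 ((hC ▸ hc : c ∈ Q ⊓ centralizer (F : Set G)).2) f hf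
  -- q⁻¹ * (y q y⁻¹) ∈ C
  have hcq : ∀ q ∈ Q, q⁻¹ * (y * q * y⁻¹) ∈ C := by
    intro q hq
    rw [hC]
    refine ⟨Q.mul_mem (Q.inv_mem hq) ((mem_normalizer_iff.1 hyQ q).1 hq), ?_⟩
    refine mem_centralizer_iff.2 ?_
    intro f hf
    have h1 : q * f * q⁻¹ ∈ F := (mem_normalizer_iff.1 (hFn hq) f).1 hf
    have h2 := hyf _ h1
    have h3 := hyf f hf
    -- y q f q⁻¹ y⁻¹ = q f q⁻¹ ; y⁻¹ f y = f
    have h4 : y⁻¹ * f = f * y⁻¹ := by rw [inv_mul_eq_iff_eq_mul, ← mul_assoc, ← h3]; group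
    calc f * (q⁻¹ * (y * q * y⁻¹)) = q⁻¹ * ((q * f * q⁻¹) * y) * q * y⁻¹ := by group
      _ = q⁻¹ * (y * (q * f * q⁻¹)) * q * y⁻¹ := by rw [h2]
      _ = q⁻¹ * y * q * (f * y⁻¹) := by group
      _ = q⁻¹ * y * q * (y⁻¹ * f) := by rw [h4]
      _ = q⁻¹ * (y * q * y⁻¹) * f := by group
  have hFC : ∀ q ∈ Q, ∃ f ∈ F, f⁻¹ * q ∈ C := by
    intro q hq
    have hcard : card ((fun c => q * c) '' (C : Set G)) = card C :=
      Nat.card_image_of_injective (mul_right_injective q) _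
    obtain ⟨a, ⟨c, hc, rfl⟩, hcomm⟩ := conj_fixed_exists (n := 1) hp7 (w := y) (by rw [hy, pow_one])
      ((fun c => q * c) '' (C : Set G)) (by
        rintro a ⟨c, hc, rfl⟩
        refine ⟨q⁻¹ * (y * q * y⁻¹) * (y * c * y⁻¹), C.mul_mem (hcq q hq) ((mem_normalizer_iff.1 hyC c).1 hc), ?_⟩
        simp only []; group) (by
        rw [hcard]
        intro h7
        have := h7.trans (card_dvd_of_le hCQ)
        rw [hQ] at this
        revert this; norm_num)
    refine ⟨q * c, ?_, ?_⟩
    · rw [hF]; exact ⟨Q.mul_mem hq (hCQ hc), mem_cent.2 hcomm.symm⟩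
    · have e : (q * c)⁻¹ * q = c⁻¹ := by group
      rw [e]; exact C.inv_mem hc
  have hcard : card C = 8 * card (F ⊓ C : Subgroup G) := by
    have hCn : Q ≤ N[C] := by
      intro q hq
      rw [mem_normalizer_conj]
      apply eq_of_le_of_card_ge
      · intro c hc
        rw [mem_conj_smul, hC] at hc
        rw [hC]
        have e : c = q * (q⁻¹ * c * q) * q⁻¹ := by group
        rw [e]
        exact ⟨Q.mul_mem (Q.mul_mem hq hc.1) (Q.inv_mem hq), conj_centralizer_of_normalizer (hFn hq) hc.2⟩
      · rw [card_conj_smul]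
    haveI : (C.subgroupOf Q).Normal := by
      rw [normal_subgroupOf_iff_le_normalizer hCQ]; exact hCn
    have hsup : F.subgroupOf Q ⊔ C.subgroupOf Q = ⊤ := by
      rw [eq_top_iff]
      rintro ⟨q, hq⟩ -
      obtain ⟨f, hf, hfc⟩ := hFC q hq
      have e : (⟨q, hq⟩ : Q) = ⟨f, hFQ hf⟩ * ⟨f⁻¹ * q, hCQ hfc⟩ := by
        apply Subtype.ext; simp
      rw [e]
      exact mul_mem_sup hf hfc
    have h1 := relIndex_sup_right (F.subgroupOf Q) (C.subgroupOf Q)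
    rw [hsup, relIndex_top_right] at h1
    have h2 : (C.subgroupOf Q).relIndex (F.subgroupOf Q) = C.relIndex F := relIndex_subgroupOf hFQ
    rw [h2] at h1
    have h3 := relIndex_card hCQ
    have h4 := relIndex_card (inf_le_left : F ⊓ C ≤ F)
    rw [inf_relIndex_left, hF8] at h4
    change C.relIndex Q = _ at h1
    rw [h1, hQ] at h3
    have hpos : 0 < C.relIndex F := by
      rcases Nat.eq_zero_or_pos (C.relIndex F) with h0 | h0
      · rw [h0] at h4; omega
      · exact h0
    apply eq_of_mul_eq_mul_left hpos
    rw [h3]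
    calc 64 = 8 * (C.relIndex F * card (F ⊓ C : Subgroup G)) := by rw [h4]
      _ = _ := by ring
  have hab : ∀ c ∈ C, ∀ d ∈ C, c * d = d * c := by
    have := abel_lemma (C := C) ((F ⊓ C).subgroupOf C) (by
        rintro ⟨z, hzC⟩ hz
        rw [mem_subgroupOf] at hz
        rw [mem_center_iff]
        rintro ⟨c, hc⟩
        apply Subtype.ext
        exact (hcf c hc z hz.1).symm) (by
        rw [card_congr (subgroupOfEquivOfLe (inf_le_right : F ⊓ C ≤ C)).toEquiv, hcard]) (by
        rw [card_congr (subgroupOfEquivOfLe (inf_le_right : F ⊓ C ≤ C)).toEquiv]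
        have := card_dvd_of_le (inf_le_left : F ⊓ C ≤ F)
        rw [hF8] at this
        exact Coprime.coprime_dvd_left this (by norm_num))
      (normalizerMonoidHom C ⟨y, hyC⟩) (by
        rw [← map_pow]
        have : (⟨y, hyC⟩ : N[C]) ^ 7 = 1 := by
          apply Subtype.ext
          rw [SubmonoidClass.coe_pow, ← hy]; exact pow_orderOf_eq_one y
        rw [this, map_one]) (by
        rintro ⟨c, hc⟩
        rw [mem_subgroupOf, Subtype.ext_iff]
        change y * c * y⁻¹ = c ↔ _
        rw [mul_inv_eq_iff_eq_mul, mem_inf, hF, mem_inf, mem_cent]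
        exact ⟨fun h => ⟨⟨hCQ hc, h.symm⟩, hc⟩, fun h => h.1.2.symm⟩)
    intro c hc d hd
    exact congrArg Subtype.val (this ⟨c, hc⟩ ⟨d, hd⟩)
  refine ⟨hcard, ?_, hyC⟩
  intro c hc q hq
  obtain ⟨f, hf, hfc⟩ := hFC q hq
  have e : q = f * (f⁻¹ * q) := by group
  have h1 : Commute c f := (hcf c hc f hf).symm
  have h2 : Commute c (f⁻¹ * q) := hab c hc _ hfc
  have := h1.mul_right h2
  rw [← e] at this
  exact this

lemma caseA2 (h : OD G) {x : G} (hx : orderOf x = 43) (had : ad G 2 43 = 1)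
    (hC : card (centralizer {x}) = 43 * 32)
    (hN : card N[zpowers x] = 43 * 32 * 14) : False := by
  obtain ⟨h7, y, w, Q, cf⟩ := A2_setup h hx had hC hN
  obtain ⟨F, hF⟩ : ∃ F, F = Q ⊓ centralizer {y} := ⟨_, rfl⟩
  have hFQ : F ≤ Q := hF ▸ inf_le_left
  have hf1 := fixed_card (n := 1) hp7 (by rw [cf.hy, pow_one]) cf.hyQ
  have hf2 := fixed_card (n := 1) hp7 (by rw [cf.hy, pow_one]) cf.hyR
  rw [cf.hQ, ← hF] at hf1
  rw [cf.hR] at hf2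
  have hF8 : card F = 8 := by
    have h1 := card_dvd_of_le hFQ
    have h2 := card_dvd_of_le (show (Q ⊓ centralizer {x}) ⊓ centralizer {y} ≤ F by
      rw [hF]; exact inf_le_inf_right _ inf_le_left)
    rw [cf.hQ, show 64 = 2 ^ 6 by norm_num] at h1
    obtain ⟨i, hi, hi2⟩ := (Nat.dvd_prime_pow hp2).1 h1
    rw [hi2] at hf1 h2 ⊢
    interval_cases i
    · rw [pow_zero, Nat.dvd_one] at h2; rw [h2] at hf2; omega
    · omega
    · omega
    · norm_num
    · omega
    · omega
    · exfalso
      have hFe : F = Q := eq_of_le_of_card_ge hFQ (by rw [hi2, cf.hQ]; norm_num)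
      exact A2_b1 h hx had h7 hC hN cf (by rw [← hFe, hF]; exact inf_le_right)
  obtain ⟨C, hCd⟩ : ∃ C, C = Q ⊓ centralizer (F : Set G) := ⟨_, rfl⟩
  have hCQ : C ≤ Q := hCd ▸ inf_le_left
  obtain ⟨hcard, hcen, hyC⟩ := b2_struct cf.hy cf.hQ cf.hyQ hF hF8 hCd
  set R : Subgroup G := Q ⊓ centralizer {x} with hR
  have hRQ : R ≤ Q := inf_le_left
  have hRn : Q ≤ N[R] := fun q hq =>
    mem_normalizer_inf (le_normalizer hq) (normalizer_centralizer_zpowers (cf.hQN hq))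
  have hRidx : R.relIndex Q = 2 := by
    have := relIndex_card hRQ
    rw [cf.hR, cf.hQ] at this
    omega
  have hidx : ∀ H : Subgroup G, H ≤ Q → card H ≤ 2 * card (H ⊓ R : Subgroup G) := by
    intro H hH
    have h1 := relIndex_inf_le (H := H) (K := R) (L := Q)
    have h2 := relIndex_card (show H ⊓ R ≤ Q from inf_le_left.trans hH)
    have h3 := relIndex_card hH
    rw [hRidx] at h1
    rw [← h2] at h3
    have hpos : 0 < H.relIndex Q := Nat.pos_of_ne_zero (by
      intro h0; rw [h0] at h1
      have h0' : (H ⊓ R).relIndex Q = 0 := by omega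
      rw [h0', cf.hQ] at h2; omega)
    apply Nat.le_of_mul_le_mul_left _ hpos
    rw [h3]
    calc _ ≤ (H.relIndex Q * 2) * card (H ⊓ R : Subgroup G) := Nat.mul_le_mul_right _ h1
      _ = _ := by ring
  -- a central involution of F in R
  obtain ⟨e, heK, heo, heF⟩ := center_meets (n := 3) (K := F ⊓ R) (Q := F) hp2 (by rw [hF8]; norm_num) inf_le_left
    (fun f hf => mem_normalizer_inf (le_normalizer hf) (hRn (hFQ hf))) (by
      intro h0
      have := hidx F hFQ
      rw [h0, card_bot, hF8] at this
      omega)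
  have heC : e ∈ C := by
    rw [hCd]; exact ⟨hFQ heK.1, mem_centralizer_iff.2 (fun f hf => (heF f hf).symm)⟩
  have hfix : (C ⊓ R) ⊓ centralizer {y} = F ⊓ C ⊓ R := by
    ext g
    simp only [mem_inf, hF]
    constructor
    · rintro ⟨⟨a, b⟩, c⟩; exact ⟨⟨⟨hCQ a, c⟩, a⟩, b⟩
    · rintro ⟨⟨⟨a, b⟩, c⟩, d⟩; exact ⟨⟨c, d⟩, b⟩
  have hW16 : 16 ≤ card (C ⊓ R : Subgroup G) := by
    have h1 := hidx C hCQ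
    have hz1 := card_dvd_of_le (inf_le_left : F ⊓ C ≤ F)
    have hz2 := orderOf_dvd_of_mem (show e ∈ F ⊓ C from ⟨heK.1, heC⟩)
    rw [heo] at hz2
    rw [hF8] at hz1
    have hz8 := le_of_dvd (by norm_num) hz1
    have hpos := card_pos (α := (F ⊓ C : Subgroup G))
    rcases (show card (F ⊓ C : Subgroup G) = 2 ∨ 4 ≤ card (F ⊓ C : Subgroup G) by omega) with hz | hz
    · have hfx := fixed_card (n := 1) hp7 (by rw [cf.hy, pow_one]) (mem_normalizer_inf hyC cf.hyR)
      rw [← hR, hfix] at hfx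
      have hz3 := orderOf_dvd_of_mem (show e ∈ F ⊓ C ⊓ R from ⟨⟨heK.1, heC⟩, heK.2⟩)
      rw [heo] at hz3
      have hz4 := card_dvd_of_le (inf_le_left : F ⊓ C ⊓ R ≤ F ⊓ C)
      rw [hz] at hz4
      have hz5 := Nat.dvd_antisymm hz4 hz3
      rw [hz5] at hfx
      have := card_dvd_of_le (inf_le_left : C ⊓ R ≤ C)
      rw [hcard, hz] at this
      rcases Nat.lt_or_ge (card (C ⊓ R : Subgroup G)) 16 with hlt | hge
      · have h9 : card (C ⊓ R : Subgroup G) = 9 := by omega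
        rw [h9] at this; revert this; norm_num
      · exact hge
    · omega
  have hWcen : ∀ g ∈ C ⊓ R, ∀ q ∈ Q, g * q = q * g := fun g hg => hcen g hg.1
  have hWc : 16 ∣ card (C ⊓ R : Subgroup G) := by
    have h1 := card_dvd_of_le (inf_le_left.trans hCQ : C ⊓ R ≤ Q)
    rw [cf.hQ, show 64 = 2 ^ 6 by norm_num] at h1
    obtain ⟨i, hi, hi2⟩ := (Nat.dvd_prime_pow hp2).1 h1
    rw [hi2] at hW16 ⊢
    have : 4 ≤ i := by
      by_contra hcon
      have : i ≤ 3 := by omega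
      have := Nat.pow_le_pow_right (n := 2) (by norm_num) this
      omega
    exact pow_dvd_pow 2 this
  have hn := card_conjSet (⊤ : Subgroup G) (zpowers x)
  rw [top_inf_eq, hN, card_top, h.card] at hn
  have hmem : zpowers x ∈ conjSet (⊤ : Subgroup G) (zpowers x) := ⟨1, Subgroup.one_mem _, by simp⟩
  have h6 := Set.ncard_sdiff_singleton_of_mem hmem
  rw [← card_coe_set_eq, ← card_coe_set_eq] at h6
  have h8 := dvd_card_of_conjSet (R := C ⊓ R) (s := conjSet ⊤ (zpowers x) \ {zpowers x}) (d := 8) (by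
      rintro r hr L ⟨⟨j, hj, rfl⟩, hL2⟩
      refine ⟨⟨r * j, mem_top _, by rw [map_mul, mul_smul]⟩, ?_⟩
      intro hr2
      apply hL2
      rw [Set.mem_singleton_iff] at hr2 ⊢
      have h3 := conj_smul_eq_of_mem (cf.hQN (hRQ hr.2))
      exact smul_left_cancel _ (hr2.trans h3.symm)) (by
      rintro L ⟨⟨j, hj, hL⟩, hLne⟩
      rw [conj_smul_zpowers] at hL
      set a := j * x * j⁻¹ with ha
      subst hL
      have hao : orderOf a = 43 := by rw [ha, orderOf_conj', hx]
      obtain ⟨haC, haN⟩ := conj_cards (j := j) hC hN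
      rw [← ha] at haC haN
      have hNC : card N[zpowers a] = card (centralizer {a}) * 14 := by rw [haN, haC]
      have hT := card_le_two_mul (a := a) (T := (C ⊓ R) ⊓ N[zpowers a]) (by
        intro t ht
        have := orderOf_dvd_of_mem (hRQ ht.1.2)
        rw [cf.hQ, show 64 = 2 ^ 6 by norm_num] at this
        obtain ⟨i, -, hi⟩ := (Nat.dvd_prime_pow hp2).1 this
        exact inv_or_eq hao hNC ht.2 hi)
      have hbot : ((C ⊓ R) ⊓ N[zpowers a]) ⊓ centralizer {a} = ⊥ := by
        by_contra hne
        have := A2_key h hx had h7 hN cf (K := ((C ⊓ R) ⊓ N[zpowers a]) ⊓ centralizer {a})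
          (inf_le_left.trans (inf_le_left.trans inf_le_right)) hne (by
            intro q hq
            refine centralizer_le_normalizer _ (mem_centralizer_iff.2 ?_)
            intro g hg
            exact hWcen g hg.1.1 q hq) hao (fun k hk => mem_cent.1 hk.2)
        apply hLne
        rw [Set.mem_singleton_iff]
        exact eq_of_le_of_card_ge (zpowers_le.2 this) (by rw [card_zpowers, card_zpowers, hao, hx])
      rw [hbot, card_bot, mul_one] at hT
      have hcs := card_conjSet (C ⊓ R) (zpowers a)
      have hpos := card_pos (α := ((C ⊓ R) ⊓ N[zpowers a] : Subgroup G))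
      rcases (show card ((C ⊓ R) ⊓ N[zpowers a] : Subgroup G) = 1 ∨
        card ((C ⊓ R) ⊓ N[zpowers a] : Subgroup G) = 2 by omega) with h1 | h1
      · rw [h1] at hcs; omega
      · rw [h1] at hcs; omega)
  rw [h6] at h8
  have : card (conjSet (⊤ : Subgroup G) (zpowers x)) = 9 * 5 * 7 * 169 * 79 ^ 3 := by
    apply Nat.eq_of_mul_eq_mul_right (m := 43 * 32 * 14) (by norm_num)
    rw [hn]; norm_num
  rw [this] at h8
  revert h8; norm_num

/-- outcome of phase 1 -/
lemma phase1 (h : OD G) {x : G} (hx : orderOf x = 43) : ad G 7 43 = 1 ∧ card (centralizer {x}) = 43 * 49 ∧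
      card N[zpowers x] = 43 * 49 * 3 := by
  rcases phase1_cases h hx with h1 | h1 | h1 | h1 | h1 | h1 | h1
  · exact (caseA2 h hx h1.1 h1.2.1 h1.2.2).elim
  · exact (caseA1 h hx h1.1 h1.2.1 h1.2.2).elim
  · exact (caseB1 h hx h1.1 h1.2.1 h1.2.2).elim
  · exact (caseB2 h hx h1.1 h1.2.1 h1.2.2).elim
  · exact (caseC' h hx h1.1 h1.2.1 h1.2.2).elim
  · exact h1
  · exact (caseD h hx h1.1 h1.2.1 h1.2.2).elim

end CaseA2a

section CharTheory
variable {k : Type*} [Field k] {G : Type*} [Group G]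
  {n : ℕ} {d : Fin n → ℕ}

lemma trace_sandwich (A B : (i : Fin n) → Matrix (Fin (d i)) (Fin (d i)) k) :
    LinearMap.trace k _ (LinearMap.mulLeft k A ∘ₗ LinearMap.mulRight k B)
      = ∑ i, (A i).trace * (B i).trace := by
  classical
  rw [LinearMap.trace_eq_matrix_trace k (Pi.basis fun i => Matrix.stdBasis k (Fin (d i)) (Fin (d i))),
    Matrix.trace]
  rw [Fintype.sum_sigma]
  refine sum_congr rfl fun i _ => ?_
  rw [Fintype.sum_prod_type, Matrix.trace, Matrix.trace, Finset.sum_mul_sum]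
  refine sum_congr rfl fun p _ => sum_congr rfl fun q _ => ?_
  rw [Matrix.diag_apply, LinearMap.toMatrix_apply, Pi.basis_apply, Pi.basis_repr,
    Matrix.stdBasis_eq_single]
  simp only [LinearMap.comp_apply, LinearMap.mulLeft_apply, LinearMap.mulRight_apply, Pi.mul_apply,
    Pi.single_eq_same]
  have : ∀ M : Matrix (Fin (d i)) (Fin (d i)) k,
    ((Matrix.stdBasis k (Fin (d i)) (Fin (d i))).repr M) (p, q) = M p q := by
    intro M
    simp [Matrix.stdBasis]
  rw [this]
  simp [Matrix.mul_apply, Matrix.single, Matrix.of_apply, Finset.sum_ite_eq, ite_and]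

/-- the matrix representation attached to a block -/
noncomputable def rep (φ : MonoidAlgebra k G ≃ₐ[k] ((i : Fin n) → Matrix (Fin (d i)) (Fin (d i)) k))
    (i : Fin n) : G →* Matrix (Fin (d i)) (Fin (d i)) k where
  toFun g := φ (MonoidAlgebra.of k G g) i
  map_one' := by rw [map_one, map_one]; rfl
  map_mul' a b := by rw [map_mul, map_mul]; rfl

noncomputable def chi (φ : MonoidAlgebra k G ≃ₐ[k] ((i : Fin n) → Matrix (Fin (d i)) (Fin (d i)) k))
    (i : Fin n) (g : G) : k := (rep φ i g).trace

variable (φ : MonoidAlgebra k G ≃ₐ[k] ((i : Fin n) → Matrix (Fin (d i)) (Fin (d i)) k))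

lemma chi_one (i : Fin n) : chi φ i 1 = d i := by simp [chi]

lemma sum_sandwich [Fintype G] (a b : MonoidAlgebra k G) :
    ∑ x : G, (a * MonoidAlgebra.of k G x * b).coeff x = ∑ i, (φ a i).trace * (φ b i).trace := by
  classical
  have h1 := trace_sandwich (φ a) (φ b)
  rw [← h1]
  have h2 : (LinearMap.mulLeft k (φ a) ∘ₗ LinearMap.mulRight k (φ b)) =
      φ.toLinearEquiv.conj (LinearMap.mulLeft k a ∘ₗ LinearMap.mulRight k b) := by
    refine LinearMap.ext fun M => ?_
    simp [LinearEquiv.conj_apply]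
  rw [h2, LinearMap.trace_conj', LinearMap.trace_eq_matrix_trace k (MonoidAlgebra.basis G k), Matrix.trace]
  refine sum_congr rfl fun x _ => ?_
  rw [Matrix.diag_apply, LinearMap.toMatrix_apply]
  simp [MonoidAlgebra.basis, mul_assoc]

/-- second orthogonality relation -/
lemma chi_orth [Fintype G] [DecidableEq G] (a g : G) :
    ∑ i, chi φ i g * chi φ i a⁻¹ = (univ.filter fun x : G => x * a * x⁻¹ = g).card := by
  have h := sum_sandwich φ (MonoidAlgebra.of k G g) (MonoidAlgebra.of k G a⁻¹)
  rw [show ∑ i, chi φ i g * chi φ i a⁻¹ = ∑ i, (φ (MonoidAlgebra.of k G g) i).trace *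
    (φ (MonoidAlgebra.of k G a⁻¹) i).trace from rfl, ← h, Finset.card_filter, Nat.cast_sum]
  refine sum_congr rfl fun x _ => ?_
  rw [← map_mul, ← map_mul, MonoidAlgebra.of_apply, MonoidAlgebra.coeff_single, Finsupp.single_apply]
  have : g * x * a⁻¹ = x ↔ x * a * x⁻¹ = g := by
    rw [mul_inv_eq_iff_eq_mul, mul_inv_eq_iff_eq_mul, eq_comm]
  simp [this]

/-- the regular trace -/
lemma reg_trace [Fintype G] (a : MonoidAlgebra k G) :
    (Fintype.card G : k) * a.coeff 1 = ∑ i, (d i : k) * (φ a i).trace := by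
  have h := sum_sandwich φ a 1
  have h2 : ∀ x : G, (a * MonoidAlgebra.of k G x * 1).coeff x = a.coeff 1 := by
    intro x
    rw [mul_one, MonoidAlgebra.of_apply]
    simp
  rw [sum_congr rfl fun x _ => h2 x] at h
  rw [sum_const, nsmul_eq_mul, card_univ] at h
  rw [h]
  refine sum_congr rfl fun i _ => ?_
  simp [mul_comm]

end CharTheory

section CharTheory2
variable {k : Type*} [Field k] [CharZero k] {G : Type*} [Group G]
  {n : ℕ} {d : Fin n → ℕ}

lemma idem_trace {m : ℕ} {E : Matrix (Fin m) (Fin m) k} (hE : E * E = E) : ∃ r : ℕ, E.trace = r := by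
  have h1 : IsIdempotentElem (Matrix.toLin' E) := by
    unfold IsIdempotentElem
    rw [Module.End.mul_eq_comp, ← Matrix.toLin'_mul, hE]
  have h2 := (LinearMap.IsIdempotentElem.isProj_range _ h1).trace
  rw [Matrix.trace_toLin'_eq] at h2
  exact ⟨_, h2⟩

variable (φ : MonoidAlgebra k G ≃ₐ[k] ((i : Fin n) → Matrix (Fin (d i)) (Fin (d i)) k))

lemma phi_sum [Fintype G] (a : MonoidAlgebra k G) (i : Fin n) :
    φ a i = ∑ g : G, a.coeff g • rep φ i g := by
  have h : a = ∑ g : G, a.coeff g • MonoidAlgebra.of k G g := by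
    ext x
    rw [MonoidAlgebra.coeff_sum, Finsupp.finsetSum_apply]
    classical
    simp [MonoidAlgebra.coeff_smul_apply, Finsupp.single_apply]
  conv_lhs => rw [h]
  rw [map_sum, Finset.sum_apply]
  refine sum_congr rfl fun g _ => ?_
  rw [map_smul]; rfl

lemma scalar_of_comm [Fintype G] {i : Fin n} {M : Matrix (Fin (d i)) (Fin (d i)) k}
    (h : ∀ g, M * rep φ i g = rep φ i g * M) : ∃ c : k, M = c • (1 : Matrix (Fin (d i)) (Fin (d i)) k) := by
  classical
  have h2 : ∀ N : Matrix (Fin (d i)) (Fin (d i)) k, M * N = N * M := by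
    intro N
    have : N = φ (φ.symm (Pi.single i N)) i := by simp
    rw [this, phi_sum, mul_sum, sum_mul]
    refine sum_congr rfl fun g _ => ?_
    rw [Matrix.mul_smul, Matrix.smul_mul, h]
  have h3 : M ∈ Set.range (Matrix.scalar (Fin (d i))) := by
    rw [Matrix.mem_range_scalar_iff_commute_single']
    intro a b
    exact (h2 _).symm
  obtain ⟨c, hc⟩ := h3
  exact ⟨c, by rw [← hc, Matrix.scalar_apply, Matrix.smul_one_eq_diagonal]⟩

lemma chi_conj (i : Fin n) (g x : G) : chi φ i (x * g * x⁻¹) = chi φ i g := by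
  unfold chi
  rw [map_mul, Matrix.trace_mul_comm, ← map_mul]
  group

/-- central idempotents -/
noncomputable def eps (i : Fin n) : MonoidAlgebra k G := φ.symm (Pi.single i 1)

lemma eps_coeff [Fintype G] (i : Fin n) (g : G) :
    (Fintype.card G : k) * (eps φ i).coeff g = d i * chi φ i g⁻¹ := by
  have h := reg_trace φ (eps φ i * MonoidAlgebra.of k G g⁻¹)
  have h2 : (eps φ i * MonoidAlgebra.of k G g⁻¹).coeff 1 = (eps φ i).coeff g := by simp
  rw [h2] at h
  rw [h, sum_eq_single i]
  · rw [map_mul, Pi.mul_apply]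
    simp [eps, chi, rep]
  · intro j _ hj
    rw [map_mul, Pi.mul_apply]
    simp [eps, hj]
  · simp

lemma first_orth [Fintype G] (i : Fin n) :
    ∑ g : G, chi φ i g⁻¹ • rep φ i g * (d i : Matrix (Fin (d i)) (Fin (d i)) k) = Fintype.card G := by
  have h := phi_sum φ (eps φ i) i
  have h2 : φ (eps φ i) i = 1 := by simp [eps]
  rw [h2] at h
  have h3 := congrArg (fun M => (Fintype.card G : k) • M) h
  simp only [smul_sum, smul_smul, eps_coeff] at h3
  rw [Nat.cast_smul_eq_nsmul, nsmul_one] at h3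
  rw [h3]
  refine sum_congr rfl fun g _ => ?_
  rw [← nsmul_eq_mul', ← Nat.cast_smul_eq_nsmul k, smul_smul]

end CharTheory2

section CharTheory3
variable {k : Type*} [Field k] [CharZero k] [IsAlgClosed k]

section dual
variable {B : Type*} [CommGroup B] [Fintype B] [Fintype (B →* kˣ)]

lemma dual_sum_group {l : B →* kˣ} (hl : l ≠ 1) : ∑ b, (l b : k) = 0 := by
  obtain ⟨c, hc⟩ : ∃ c, l c ≠ 1 := by
    by_contra h
    push Not at h
    exact hl (MonoidHom.ext h)
  have h1 : ∑ b, (l b : k) = (l c : k) * ∑ b, (l b : k) := by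
    rw [mul_sum, ← Equiv.sum_comp (Equiv.mulLeft c)]
    refine sum_congr rfl fun b _ => ?_
    simp
  have h2 : ((l c : k) - 1) * ∑ b, (l b : k) = 0 := by rw [sub_mul, ← h1]; ring
  rcases mul_eq_zero.1 h2 with h | h
  · exact (hc (Units.ext (by simpa using sub_eq_zero.1 h))).elim
  · exact h

lemma dual_sum_dual {b : B} (hb : b ≠ 1) : ∑ l : B →* kˣ, (l b : k) = 0 := by
  haveI : NeZero (Monoid.exponent B) := ⟨Monoid.exponent_ne_zero_of_finite⟩
  haveI : NeZero ((Monoid.exponent B : ℕ) : k) := ⟨by exact_mod_cast Monoid.exponent_ne_zero_of_finite⟩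
  obtain ⟨c, hc⟩ := CommGroup.exists_apply_ne_one_of_hasEnoughRootsOfUnity B k hb
  have h1 : ∑ l : B →* kˣ, (l b : k) = (c b : k) * ∑ l : B →* kˣ, (l b : k) := by
    rw [mul_sum, ← Equiv.sum_comp (Equiv.mulLeft c)]
    refine sum_congr rfl fun b _ => ?_
    simp
  have h2 : ((c b : k) - 1) * ∑ l : B →* kˣ, (l b : k) = 0 := by rw [sub_mul, ← h1]; ring
  rcases mul_eq_zero.1 h2 with h | h
  · exact (hc (Units.ext (by simpa using sub_eq_zero.1 h))).elim
  · exact h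

lemma dual_card : Fintype.card (B →* kˣ) = Fintype.card B := by
  haveI : NeZero (Monoid.exponent B) := ⟨Monoid.exponent_ne_zero_of_finite⟩
  haveI : NeZero ((Monoid.exponent B : ℕ) : k) := ⟨by exact_mod_cast Monoid.exponent_ne_zero_of_finite⟩
  rw [← card_eq_fintype_card, ← card_eq_fintype_card]
  exact CommGroup.card_monoidHom_of_hasEnoughRootsOfUnity B k

lemma dual_orth [DecidableEq (B →* kˣ)] (l m : B →* kˣ) :
    ∑ b, (l b : k) * (m b⁻¹ : k) = if l = m then (Fintype.card B : k) else 0 := by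
  have h1 : ∀ b, (l b : k) * (m b⁻¹ : k) = ((l * m⁻¹) b : k) := by
    intro b; simp
  simp only [h1]
  split_ifs with h
  · subst h; simp
  · refine dual_sum_group fun h2 => h (mul_inv_eq_one.1 h2)

lemma abel_decomp {r : ℕ} (ρ : B →* Matrix (Fin r) (Fin r) k) :
    ∃ m : (B →* kˣ) → ℕ, (∀ b, (ρ b).trace = ∑ l, (m l : k) * (l b : k)) ∧
      ∀ l, (m l : k) * Fintype.card B = ∑ b, (l b⁻¹ : k) * (ρ b).trace := by
  classical
  have hB : (Fintype.card B : k) ≠ 0 := by exact_mod_cast Fintype.card_ne_zero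
  set E : (B →* kˣ) → Matrix (Fin r) (Fin r) k := fun l =>
    (Fintype.card B : k)⁻¹ • ∑ b, (l b⁻¹ : k) • ρ b with hE
  have h1 : ∀ l b, ρ b * E l = (l b : k) • E l := by
    intro l b
    simp only [hE]
    rw [Matrix.mul_smul, smul_comm, mul_sum, smul_sum (r := (l b : k))]
    congr 1
    rw [← Equiv.sum_comp (Equiv.mulLeft b) (fun c => (l b : k) • (l c⁻¹ : k) • ρ c)]
    refine sum_congr rfl fun c _ => ?_
    simp only [Equiv.coe_mulLeft, mul_inv, map_mul, Units.val_mul, map_inv, smul_smul, Matrix.mul_smul]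
    congr 1
    rw [← mul_assoc, Units.mul_inv, one_mul]
  have h2 : ∀ l, E l * E l = E l := by
    intro l
    have : E l * E l = (Fintype.card B : k)⁻¹ • ∑ b, (l b⁻¹ : k) • (ρ b * E l) := by
      conv_lhs => rw [hE]
      simp only [Matrix.smul_mul, sum_mul]
      rfl
    rw [this]
    simp only [h1, smul_smul, ← Units.val_mul, ← map_mul, inv_mul_cancel, map_one, Units.val_one, one_smul]
    rw [sum_const, card_univ, ← Nat.cast_smul_eq_nsmul k, smul_smul, inv_mul_cancel₀ hB, one_smul]
  have h3 : ∑ l, E l = 1 := by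
    simp only [hE]
    rw [← smul_sum, sum_comm, sum_eq_single 1]
    · simp only [inv_one, map_one, Units.val_one, one_smul]
      rw [sum_const, card_univ, dual_card, ← Nat.cast_smul_eq_nsmul k, smul_smul, inv_mul_cancel₀ hB, one_smul]
    · intro b _ hb
      rw [← Finset.sum_smul, dual_sum_dual (by simpa using hb), zero_smul]
    · simp
  choose m hm using fun l => idem_trace (h2 l)
  refine ⟨m, fun b => ?_, fun l => ?_⟩
  · rw [← mul_one (ρ b), ← h3, mul_sum, Matrix.trace_sum]
    refine sum_congr rfl fun l _ => ?_
    rw [h1, Matrix.trace_smul, hm, smul_eq_mul, mul_comm]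
  · rw [← hm]
    simp only [hE]
    rw [Matrix.trace_smul, smul_eq_mul, mul_comm, mul_inv_cancel_left₀ hB, Matrix.trace_sum]
    simp [Matrix.trace_smul]

end dual

lemma sub_fix {B : Type*} [Group B] [Fintype B] {r : ℕ} (ρ : B →* Matrix (Fin r) (Fin r) k) :
    ∃ m : ℕ, ∑ b, (ρ b).trace = m * Fintype.card B := by
  have hB : (Fintype.card B : k) ≠ 0 := by exact_mod_cast Fintype.card_ne_zero
  set E : Matrix (Fin r) (Fin r) k := (Fintype.card B : k)⁻¹ • ∑ b, ρ b with hE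
  have h1 : ∀ b, ρ b * E = E := by
    intro b
    rw [hE, Matrix.mul_smul, mul_sum]
    congr 1
    rw [← Equiv.sum_comp (Equiv.mulLeft b) (fun c => ρ c)]
    simp
  have h2 : E * E = E := by
    conv_lhs => enter [1]; rw [hE]
    rw [Matrix.smul_mul, sum_mul]
    simp only [h1]
    rw [sum_const, card_univ, ← Nat.cast_smul_eq_nsmul k, smul_smul, inv_mul_cancel₀ hB, one_smul]
  obtain ⟨m, hm⟩ := idem_trace h2
  refine ⟨m, ?_⟩
  rw [← hm, hE, Matrix.trace_smul, smul_eq_mul, Matrix.trace_sum, mul_comm, mul_inv_cancel_left₀ hB]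

end CharTheory3

section CharTheory4
variable {k : Type*} [Field k] [CharZero k] [IsAlgClosed k]

section dual'
variable {B : Type*} [Group B] [Fintype B] [Fintype (B →* kˣ)]

lemma dual_card' (hc : ∀ a b : B, a * b = b * a) : Fintype.card (B →* kˣ) = Fintype.card B := by
  letI : CommGroup B := { (inferInstance : Group B) with mul_comm := hc }
  exact dual_card

lemma dual_orth' [DecidableEq (B →* kˣ)] (hc : ∀ a b : B, a * b = b * a) (l m : B →* kˣ) :
    ∑ b, (l b : k) * (m b⁻¹ : k) = if l = m then (Fintype.card B : k) else 0 := by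
  letI : CommGroup B := { (inferInstance : Group B) with mul_comm := hc }
  exact dual_orth l m

lemma dual_sum' (hc : ∀ a b : B, a * b = b * a) {l : B →* kˣ} (hl : l ≠ 1) : ∑ b, (l b : k) = 0 := by
  letI : CommGroup B := { (inferInstance : Group B) with mul_comm := hc }
  exact dual_sum_group hl

lemma abel_decomp' (hc : ∀ a b : B, a * b = b * a) {r : ℕ} (ρ : B →* Matrix (Fin r) (Fin r) k) :
    ∃ m : (B →* kˣ) → ℕ, (∀ b, (ρ b).trace = ∑ l, (m l : k) * (l b : k)) ∧
      ∀ l, (m l : k) * Fintype.card B = ∑ b, (l b⁻¹ : k) * (ρ b).trace := by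
  letI : CommGroup B := { (inferInstance : Group B) with mul_comm := hc }
  exact abel_decomp ρ
end dual'

variable {G : Type*} [Group G] [Fintype G]
  {n : ℕ} {d : Fin n → ℕ}
variable (φ : MonoidAlgebra k G ≃ₐ[k] ((i : Fin n) → Matrix (Fin (d i)) (Fin (d i)) k))

lemma chi_zpowers (i : Fin n) (g : G) : ∃ (s : Finset (zpowers g →* kˣ)) (m : (zpowers g →* kˣ) → ℕ),
    ∀ b : zpowers g, chi φ i b = ∑ l ∈ s, (m l : k) * (l b : k) := by
  classical
  haveI := Fintype.ofFinite (zpowers g)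
  haveI := Fintype.ofFinite (zpowers g →* kˣ)
  obtain ⟨m, hm, -⟩ := abel_decomp' (k := k) (B := zpowers g) (fun a b => mul_comm' a b)
    ((rep φ i).comp (zpowers g).subtype)
  exact ⟨univ, m, hm⟩

lemma hom_pow_card {B : Type*} [Group B] [Finite B] (l : B →* kˣ) (b : B) : (l b : k) ^ card B = 1 := by
  rw [← Units.val_pow_eq_pow_val, ← map_pow, pow_card_eq_one', map_one, Units.val_one]

lemma hom_integral {B : Type*} [Group B] [Finite B] (l : B →* kˣ) (b : B) : IsIntegral ℤ (l b : k) := by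
  refine IsIntegral.of_pow (card_pos (α := B)) ?_
  rw [hom_pow_card]
  exact isIntegral_one

lemma chi_integral (i : Fin n) (g : G) : IsIntegral ℤ (chi φ i g) := by
  obtain ⟨s, m, h⟩ := chi_zpowers φ i g
  have := h ⟨g, mem_zpowers g⟩
  rw [show chi φ i g = _ from this]
  refine IsIntegral.sum _ fun l _ => ?_
  exact (isIntegral_natCast _).mul (hom_integral _ _)

lemma nat_of_integral {q : ℚ} (h : IsIntegral ℤ (algebraMap ℚ k q)) : ∃ z : ℤ, q = z := by
  have h2 : IsIntegral ℤ q := (isIntegral_algebraMap_iff (algebraMap ℚ k).injective).1 h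
  obtain ⟨z, hz⟩ := IsIntegrallyClosed.isIntegral_iff.1 h2
  exact ⟨z, by rw [← hz]; simp⟩

/-- a divisibility criterion -/
lemma dvd_of_integral {a b : ℤ} (ha : a ≠ 0) (h : IsIntegral ℤ ((b : k) / (a : k))) : a ∣ b := by
  obtain ⟨z, hz⟩ := nat_of_integral (k := k) (q := (b : ℚ) / a) (by simpa using h)
  refine ⟨z, ?_⟩
  have : (a : ℚ) ≠ 0 := by exact_mod_cast ha
  field_simp at hz
  exact_mod_cast hz

lemma smul_one_integral {r : ℕ} (hr : r ≠ 0) {R : Type*} [CommRing R] [Algebra R k] {c : k}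
    (h : IsIntegral R (c • (1 : Matrix (Fin r) (Fin r) k))) : IsIntegral R c := by
  haveI : NeZero r := ⟨hr⟩
  rw [← Algebra.algebraMap_eq_smul_one] at h
  exact (isIntegral_algebraMap_iff (FaithfulSMul.algebraMap_injective _ _)).1 h

lemma conj_fiber_card [DecidableEq G] {g h : G} (hh : IsConj g h) :
    (univ.filter fun x : G => x * g * x⁻¹ = h).card = card (centralizer {g}) := by
  obtain ⟨y, hy⟩ := isConj_iff.1 hh
  rw [← Fintype.card_subtype, ← card_eq_fintype_card]
  refine card_congr ⟨fun x => ⟨y⁻¹ * x, ?_⟩, fun c => ⟨y * c, ?_⟩, ?_, ?_⟩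
  · rw [mem_cent]
    have := x.2.trans hy.symm
    rw [mul_inv_eq_iff_eq_mul] at this
    rw [mul_assoc, this]; group
  · have := mem_cent.1 c.2
    rw [← hy, mul_inv_eq_iff_eq_mul, mul_assoc, this]; group
  · intro x; simp
  · intro x; simp

/-- central characters are integral -/
lemma omega_integral (i : Fin n) (hd : d i ≠ 0) (g : G) :
    IsIntegral ℤ ((card G : k) * chi φ i g / (card (centralizer {g}) * d i)) := by
  classical
  set S : Finset G := univ.filter fun h => IsConj g h with hS
  have hcard : card (centralizer {g}) * S.card = card G := by
    have h0 := card_eq_sum_card_fiberwise (s := (univ : Finset G)) (t := S)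
      (f := fun x => x * g * x⁻¹) (by
        intro x _
        rw [hS, Finset.mem_coe, mem_filter]
        exact ⟨mem_univ _, isConj_iff.2 ⟨x, rfl⟩⟩)
    rw [Finset.sum_const_nat (m := card (centralizer {g})) fun h hh => conj_fiber_card
      (mem_filter.1 (hS ▸ hh)).2, card_univ] at h0
    rw [card_eq_fintype_card (α := G), h0, mul_comm]
  let f : MonoidAlgebra ℤ G →ₐ[ℤ] Matrix (Fin (d i)) (Fin (d i)) k :=
    MonoidAlgebra.lift ℤ _ G (rep φ i)
  set w : MonoidAlgebra ℤ G := ∑ h ∈ S, MonoidAlgebra.of ℤ G h with hw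
  have h1 : IsIntegral ℤ w := Algebra.IsIntegral.isIntegral (R := ℤ) w
  have h2 := h1.map f
  have h3 : f w = ∑ h ∈ S, rep φ i h := by
    rw [hw, map_sum]
    refine sum_congr rfl fun h _ => ?_
    simp [f]
  obtain ⟨c, hc⟩ := scalar_of_comm φ (i := i) (M := f w) (by
    intro x
    rw [h3, sum_mul, mul_sum]
    refine Finset.sum_bij' (fun h _ => x⁻¹ * h * x) (fun h _ => x * h * x⁻¹) ?_ ?_ ?_ ?_ ?_
    · intro h hh
      rw [hS, mem_filter] at hh ⊢
      refine ⟨mem_univ _, hh.2.trans ?_⟩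
      exact isConj_iff.2 ⟨x⁻¹, by simp⟩
    · intro h hh
      rw [hS, mem_filter] at hh ⊢
      refine ⟨mem_univ _, hh.2.trans ?_⟩
      exact isConj_iff.2 ⟨x, by simp⟩
    · intro h _; group
    · intro h _; group
    · intro h _; rw [← map_mul, ← map_mul]; congr 1; group)
  have h4 := congrArg Matrix.trace hc
  rw [h3, Matrix.trace_sum, Matrix.trace_smul, Matrix.trace_one, Fintype.card_fin, smul_eq_mul] at h4
  have h5 : ∑ h ∈ S, (rep φ i h).trace = S.card * chi φ i g := by
    rw [← nsmul_eq_mul]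
    refine Finset.sum_eq_card_nsmul fun h hh => ?_
    obtain ⟨x, hx⟩ := isConj_iff.1 (mem_filter.1 hh).2
    rw [← chi_conj φ i g x, hx]; rfl
  rw [h5] at h4
  rw [hc] at h2
  have h6 := smul_one_integral hd h2
  have hne : (card (centralizer {g}) : k) ≠ 0 := by exact_mod_cast card_pos.ne'
  have hd' : (d i : k) ≠ 0 := by exact_mod_cast hd
  convert h6 using 1
  rw [← hcard, Nat.cast_mul, div_eq_iff (mul_ne_zero hne hd'), mul_assoc, h4]; ring

/-- degrees divide the group order -/
lemma deg_dvd (φ : MonoidAlgebra k G ≃ₐ[k] ((i : Fin n) → Matrix (Fin (d i)) (Fin (d i)) k)) (i : Fin n) (hd : d i ≠ 0) : d i ∣ card G := by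
  set O := integralClosure ℤ k
  have hd' : (d i : k) ≠ 0 := by exact_mod_cast hd
  let f : MonoidAlgebra O G →ₐ[O] Matrix (Fin (d i)) (Fin (d i)) k :=
    MonoidAlgebra.lift O _ G (rep φ i)
  set w : MonoidAlgebra O G := ∑ g : G, (⟨chi φ i g⁻¹, chi_integral φ i g⁻¹⟩ : O) • MonoidAlgebra.of O G g with hw
  have h1 : IsIntegral O w := Algebra.IsIntegral.isIntegral (R := O) w
  have h2 := h1.map f
  have h3 : f w = ∑ g : G, chi φ i g⁻¹ • rep φ i g := by
    rw [hw, map_sum]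
    refine sum_congr rfl fun h _ => ?_
    rw [map_smul]
    simp only [f, MonoidAlgebra.lift_of]
    rfl
  have h4 : f w = ((Fintype.card G : k) / d i) • 1 := by
    have := first_orth φ i
    rw [← sum_mul, ← h3, ← nsmul_eq_mul', ← Nat.cast_smul_eq_nsmul k] at this
    rw [div_eq_inv_mul, ← smul_smul, Nat.cast_smul_eq_nsmul k, nsmul_one, ← this, smul_smul, inv_mul_cancel₀ hd', one_smul]
  rw [h4] at h2
  have h5 := smul_one_integral hd h2
  have h6 : IsIntegral ℤ ((Fintype.card G : k) / d i) := isIntegral_trans (A := O) _ h5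
  have := dvd_of_integral (k := k) (a := d i) (b := Fintype.card G) (by exact_mod_cast hd) (by simpa using h6)
  rw [card_eq_fintype_card]
  exact_mod_cast this

lemma central_idem {z : MonoidAlgebra k G} (hz : ∀ a, z * a = a * z) (hz2 : z * z = z) (j : Fin n)
    (hd : d j ≠ 0) : φ z j = 0 ∨ φ z j = 1 := by
  obtain ⟨c, hc⟩ := scalar_of_comm φ (i := j) (M := φ z j) (by
    intro g
    have := congrArg (fun a => φ a j) (hz (MonoidAlgebra.of k G g))
    simp only [map_mul, Pi.mul_apply] at this
    exact this)
  have h1 := congrArg (fun a => φ a j) hz2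
  simp only [map_mul, Pi.mul_apply] at h1
  rw [hc, smul_mul_smul_comm, one_mul] at h1
  haveI : NeZero (d j) := ⟨hd⟩
  have h2 : c * c = c := smul_left_injective k (one_ne_zero (α := Matrix (Fin (d j)) (Fin (d j)) k)) h1
  rcases IsIdempotentElem.iff_eq_zero_or_one.1 h2 with h | h
  · left; rw [hc, h, zero_smul]
  · right; rw [hc, h, one_smul]

lemma chi_galois (hd : ∀ i, d i ≠ 0) (σ : k ≃+* k) (i : Fin n) : ∃ j, ∀ g, chi φ j g = σ (chi φ i g) := by
  classical
  set S := MonoidAlgebra.mapRingEquiv G σ with hS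
  have hee : ∀ l j, φ (eps φ l) j = if j = l then 1 else 0 := by
    intro l j
    unfold eps
    rw [AlgEquiv.apply_symm_apply]
    split_ifs with h
    · subst h; simp
    · simp [h]
  have hec : ∀ l a, eps φ l * a = a * eps φ l := by
    intro l a
    apply φ.injective
    rw [map_mul, map_mul]
    funext j
    rw [Pi.mul_apply, Pi.mul_apply, hee]
    split_ifs <;> simp
  have hei : ∀ l, eps φ l * eps φ l = eps φ l := by
    intro l
    apply φ.injective
    rw [map_mul]
    funext j
    rw [Pi.mul_apply, hee]
    split_ifs <;> simp
  have hne : ∀ l, eps φ l ≠ 0 := by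
    intro l h
    have h1 := hee l l
    haveI : NeZero (d l) := ⟨hd l⟩
    rw [h, map_zero] at h1
    simp at h1
  have hgen : ∀ (T : MonoidAlgebra k G ≃+* MonoidAlgebra k G) l, (∀ a, T (eps φ l) * a = a * T (eps φ l)) ∧
      T (eps φ l) * T (eps φ l) = T (eps φ l) ∧ T (eps φ l) ≠ 0 := by
    intro T l
    refine ⟨fun a => ?_, by rw [← map_mul, hei], by simpa using hne l⟩
    have := congrArg T (hec l (T.symm a))
    simpa using this
  obtain ⟨j, hj⟩ : ∃ j, φ (S (eps φ i)) j = 1 := by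
    by_contra hcon
    push Not at hcon
    apply (hgen S i).2.2
    apply φ.injective
    rw [map_zero]
    funext j
    exact (central_idem φ (hgen S i).1 (hgen S i).2.1 j (hd j)).resolve_right (hcon j)
  have h1 : S (eps φ i) * eps φ j = eps φ j := by
    apply φ.injective
    rw [map_mul]
    funext l
    rw [Pi.mul_apply, hee]
    split_ifs with h
    · subst h; rw [hj, mul_one]
    · simp
  have h2 : eps φ i * S.symm (eps φ j) = S.symm (eps φ j) := by
    have := congrArg S.symm h1
    simpa using this
  have h3 : S.symm (eps φ j) = eps φ i := by
    have h4 : ∀ l, l ≠ i → φ (S.symm (eps φ j)) l = 0 := by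
      intro l hl
      rw [← h2, map_mul, Pi.mul_apply, hee, if_neg hl, zero_mul]
    apply φ.injective
    funext l
    rw [hee]
    split_ifs with h
    · subst h
      refine (central_idem φ (hgen S.symm j).1 (hgen S.symm j).2.1 l (hd l)).resolve_left fun h0 => ?_
      apply (hgen S.symm j).2.2
      apply φ.injective
      rw [map_zero]
      funext r
      by_cases hr : r = l
      · subst hr; exact h0
      · exact h4 r hr
    · exact h4 l h
  have h5 : eps φ j = S (eps φ i) := by rw [← h3]; simp
  have h6 : ∀ g, (d j : k) * chi φ j g = d i * σ (chi φ i g) := by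
    intro g
    have h7 := eps_coeff φ j g⁻¹
    have h8 := congrArg σ (eps_coeff φ i g⁻¹)
    have h9 : (S (eps φ i)).coeff g⁻¹ = σ ((eps φ i).coeff g⁻¹) := by simp [hS]
    rw [inv_inv] at h7 h8
    rw [h5, h9] at h7
    simp only [map_mul, map_natCast] at h8
    rw [← h7, h8]
  have h7 := h6 1
  rw [chi_one, chi_one, map_natCast] at h7
  have h8 : d j = d i := by
    have : d j * d j = d i * d i := by exact_mod_cast h7
    nlinarith
  refine ⟨j, fun g => ?_⟩
  have := h6 g
  rw [h8] at this
  exact mul_left_cancel₀ (by exact_mod_cast hd i) this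

end CharTheory4

/-- character table data -/
structure CTab (G : Type*) [Group G] [Fintype G] where
  n : ℕ
  d : Fin n → ℕ
  hd : ∀ i, d i ≠ 0
  φ : MonoidAlgebra (AlgebraicClosure ℚ) G ≃ₐ[AlgebraicClosure ℚ]
    ((i : Fin n) → Matrix (Fin (d i)) (Fin (d i)) (AlgebraicClosure ℚ))

lemma exists_ctab (G : Type*) [Group G] [Fintype G] : Nonempty (CTab G) := by
  obtain ⟨n, d, h, ⟨φ⟩⟩ := IsSemisimpleRing.exists_algEquiv_pi_matrix_of_isAlgClosed (AlgebraicClosure ℚ)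
    (MonoidAlgebra (AlgebraicClosure ℚ) G)
  exact ⟨⟨n, d, fun i => (h i).out, φ⟩⟩

section CharTheory6
/-- the field of character values -/
abbrev KK := AlgebraicClosure ℚ

variable {G : Type*} [Group G] [Fintype G]

/-- the irreducible characters -/
noncomputable def CTab.ch (T : CTab G) (i : Fin T.n) (g : G) : KK := chi T.φ i g

namespace CTab
variable (T : CTab G)

lemma ch_one (i : Fin T.n) : T.ch i 1 = T.d i := chi_one _ _

lemma ch_conj (i : Fin T.n) (g x : G) : T.ch i (x * g * x⁻¹) = T.ch i g := chi_conj _ _ _ _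

lemma orth [DecidableEq G] (a g : G) :
    ∑ i, T.ch i g * T.ch i a⁻¹ = (univ.filter fun x : G => x * a * x⁻¹ = g).card := chi_orth _ _ _

lemma abel (B : Subgroup G) [Fintype B] [Fintype (B →* KKˣ)] (hc : ∀ a b : B, a * b = b * a) (i : Fin T.n) :
    ∃ m : (B →* KKˣ) → ℕ, (∀ b : B, T.ch i b = ∑ l, (m l : KK) * (l b : KK)) ∧
      ∀ l, (m l : KK) * Fintype.card B = ∑ b : B, (l b⁻¹ : KK) * T.ch i b :=
  abel_decomp' hc ((rep T.φ i).comp B.subtype)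

lemma sub_sum (B : Subgroup G) [Fintype B] (i : Fin T.n) :
    ∃ m : ℕ, ∑ b : B, T.ch i b = m * Fintype.card B := sub_fix ((rep T.φ i).comp B.subtype)

lemma deg_dvd (i : Fin T.n) : T.d i ∣ card G := _root_.deg_dvd T.φ i (T.hd i)

lemma integral (i : Fin T.n) (g : G) : IsIntegral ℤ (T.ch i g) := chi_integral _ _ _

lemma omega (i : Fin T.n) (g : G) (z : ℤ) (hz : T.ch i g = z) :
    ((card (centralizer {g}) * T.d i : ℕ) : ℤ) ∣ (card G : ℤ) * z := by
  have h := omega_integral T.φ i (T.hd i) g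
  rw [show chi T.φ i g = z from hz] at h
  refine dvd_of_integral (k := KK) ?_ ?_
  · exact_mod_cast mul_ne_zero card_pos.ne' (T.hd i)
  · push_cast; exact h

lemma galois (σ : KK ≃+* KK) (i : Fin T.n) : ∃ j, ∀ g, T.ch j g = σ (T.ch i g) := chi_galois T.φ T.hd σ i

lemma ch_mul {i : Fin T.n} (hi : T.d i = 1) (a b : G) : T.ch i (a * b) = T.ch i a * T.ch i b := by
  unfold ch chi
  rw [map_mul]
  generalize rep T.φ i a = A
  generalize rep T.φ i b = B
  revert A B
  rw [hi]
  intro A B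
  simp [Matrix.trace, Matrix.mul_apply]

lemma exists_triv : ∃ i, ∀ g, T.ch i g = 1 := by
  classical
  choose m hm using fun i => T.sub_sum (⊤ : Subgroup G) i
  have h1 : ∀ g, ∑ i, (m i : KK) * T.ch i g = 1 := by
    intro g
    have hG : (Fintype.card G : KK) ≠ 0 := by exact_mod_cast Fintype.card_ne_zero
    have h2 : ∑ a : G, ∑ i, T.ch i g * T.ch i a⁻¹ = Fintype.card G := by
      simp only [orth]
      rw [← Nat.cast_sum]
      congr 1
      rw [← card_univ, card_eq_sum_card_fiberwise (f := fun x => x⁻¹ * g * x) (t := univ) (by simp)]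
      refine sum_congr rfl fun a _ => ?_
      congr 1
      ext x
      simp only [mem_filter, mem_univ, true_and]
      constructor
      · intro h; rw [← h]; group
      · intro h; rw [← h]; group
    rw [sum_comm] at h2
    have h3 : ∀ i, ∑ a : G, T.ch i g * T.ch i a⁻¹ = (m i : KK) * T.ch i g * Fintype.card G := by
      intro i
      rw [← mul_sum, show ∑ a : G, T.ch i a⁻¹ = ∑ a, T.ch i a from
        Equiv.sum_comp (Equiv.inv G) (fun a => T.ch i a), mul_comm (m i : KK), mul_assoc]
      congr 1
      have := hm i
      rw [Fintype.card_congr Subgroup.topEquiv.toEquiv] at this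
      rw [← this]
      exact (Equiv.sum_comp (Subgroup.topEquiv (G := G)).toEquiv (fun a => T.ch i a)).symm
    rw [sum_congr rfl fun i _ => h3 i, ← sum_mul] at h2
    exact mul_right_cancel₀ hG (by rw [h2, one_mul])
  have h2 : ∑ i, m i * T.d i = 1 := by
    have := h1 1
    simp only [ch_one] at this
    exact_mod_cast this
  obtain ⟨i, hi⟩ : ∃ i, m i * T.d i ≠ 0 := by
    by_contra h
    push Not at h
    rw [sum_eq_zero fun i _ => h i] at h2
    omega
  have h3 : ∀ j, j ≠ i → m j = 0 := by
    intro j hj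
    have h4 := Finset.add_le_sum (f := fun i => m i * T.d i) (fun _ _ => Nat.zero_le _) (mem_univ j) (mem_univ i) hj
    rw [h2] at h4
    have : m j * T.d j = 0 := by omega
    exact (mul_eq_zero.1 this).resolve_right (T.hd j)
  have h4 : m i = 1 := by
    have := Finset.single_le_sum (f := fun i => m i * T.d i) (fun _ _ => Nat.zero_le _) (mem_univ i)
    rw [h2] at this
    have h5 : m i * T.d i = 1 := by
      have : m i * T.d i ≤ 1 := this
      omega
    exact (mul_eq_one.1 h5).1
  refine ⟨i, fun g => ?_⟩
  have := h1 g
  rw [sum_eq_single i (fun j _ hj => by rw [h3 j hj]; simp) (by simp), h4] at this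
  simpa using this

lemma star_ch (τ : KK →+* ℂ) (i : Fin T.n) (g : G) : τ (T.ch i g⁻¹) = star (τ (T.ch i g)) := by
  obtain ⟨s, m, h⟩ := chi_zpowers T.φ i g
  have h1 : T.ch i g = _ := h ⟨g, mem_zpowers g⟩
  have h2 : T.ch i g⁻¹ = _ := h ⟨g, mem_zpowers g⟩⁻¹
  rw [h1, h2, map_sum, map_sum, star_sum]
  refine sum_congr rfl fun l _ => ?_
  rw [map_mul, map_mul, star_mul', map_natCast, star_natCast]
  congr 1
  have h3 := congrArg τ (hom_pow_card l ⟨g, mem_zpowers g⟩)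
  rw [map_pow, map_one] at h3
  have h4 := Complex.norm_eq_one_of_pow_eq_one h3 card_pos.ne'
  rw [map_inv, Units.val_inv_eq_inv_val, map_inv₀]
  exact Complex.inv_eq_conj h4

lemma int_of_fixed {x : KK} (hx : IsIntegral ℤ x) (h : ∀ σ : KK ≃+* KK, σ x = x) : ∃ z : ℤ, x = z := by
  haveI : Algebra.IsAlgebraic ℚ KK := by
    have h0 : (DivisionRing.toRatAlgebra : Algebra ℚ KK) = AlgebraicClosure.instAlgebra ℚ :=
      Subsingleton.elim _ _
    rw [h0]
    exact AlgebraicClosure.isAlgebraic ℚ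
  haveI : IsAlgClosure ℚ KK := ⟨inferInstance, this⟩
  haveI : _root_.Normal ℚ KK := IsAlgClosure.normal ℚ KK
  haveI : IsGalois ℚ KK := isGalois_iff.2 ⟨inferInstance, inferInstance⟩
  have h1 : x ∈ (⊥ : IntermediateField ℚ KK) := by
    rw [InfiniteGalois.mem_bot_iff_fixed]
    intro f
    exact h f.toRingEquiv
  obtain ⟨q, rfl⟩ := IntermediateField.mem_bot.1 h1
  obtain ⟨z, hz⟩ := nat_of_integral (k := KK) hx
  exact ⟨z, by rw [hz]; simp⟩

lemma congr_p {p e : ℕ} (hp : p.Prime) (i : Fin T.n) {u : G} (hu : orderOf u = p ^ e) {z : ℤ}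
    (hz : T.ch i u = z) (hd : p ∣ T.d i) : (p : ℤ) ∣ z := by
  haveI : Fact p.Prime := ⟨hp⟩
  obtain ⟨s, m, h⟩ := chi_zpowers T.φ i u
  have h1 : T.ch i u = _ := h ⟨u, mem_zpowers u⟩
  have h2 : T.ch i 1 = _ := h 1
  set O := integralClosure ℤ KK
  set I : Ideal O := Ideal.span {(p : O)} with hI
  have hmem : ∀ y : ℤ, ((y : O) ∈ I) → (p : ℤ) ∣ y := by
    intro y hy
    obtain ⟨w, hw⟩ := Ideal.mem_span_singleton.1 hy
    refine dvd_of_integral (k := KK) (by exact_mod_cast hp.ne_zero) ?_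
    have hw2 := congrArg (algebraMap O KK) hw
    rw [map_mul, map_natCast, map_intCast] at hw2
    rw [hw2]
    have : ((p : ℤ) : KK) ≠ 0 := by exact_mod_cast hp.ne_zero
    rw [Int.cast_natCast] at this ⊢
    rw [mul_div_cancel_left₀ _ this]
    exact w.2
  let L : (zpowers u →* KKˣ) → O := fun l => ⟨(l ⟨u, mem_zpowers u⟩ : KK), hom_integral _ _⟩
  have h3 : (z : O) = ∑ l ∈ s, (m l : O) * L l := by
    apply Subtype.ext
    have := hz.symm.trans h1
    push_cast
    exact this
  have h4 : ∀ l, L l ^ p ^ e = 1 := by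
    intro l
    apply Subtype.ext
    have := hom_pow_card l ⟨u, mem_zpowers u⟩
    rw [card_zpowers, hu] at this
    exact this
  have h5 : ∑ l ∈ s, m l = T.d i := by
    rw [ch_one] at h2
    simp only [map_one, Units.val_one, mul_one] at h2
    exact_mod_cast h2.symm
  by_contra hcon
  have hne : I ≠ ⊤ := by
    intro h
    have := hmem 1 (by rw [h]; trivial)
    exact hp.one_lt.ne' (by exact_mod_cast Int.eq_one_of_dvd_one (by positivity) this)
  haveI : Nontrivial (O ⧸ I) := Ideal.Quotient.nontrivial_iff.2 hne
  have hp0 : ((p : ℕ) : O ⧸ I) = 0 := by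
    have : Ideal.Quotient.mk I (p : O) = 0 := Ideal.Quotient.eq_zero_iff_mem.2 (Ideal.mem_span_singleton_self _)
    simpa using this
  haveI : CharP (O ⧸ I) p := (CharP.charP_iff_prime_eq_zero hp).2 hp0
  have h6 : (Ideal.Quotient.mk I (z : O)) ^ p ^ e = 0 := by
    rw [h3, map_sum, sum_pow_char_pow p e]
    simp only [map_mul, mul_pow, ← map_pow, h4, map_one, mul_one]
    have : ∀ l, (Ideal.Quotient.mk I) ((m l : O) ^ p ^ e) = ((m l : ℕ) : O ⧸ I) := by
      intro l
      rw [map_pow, map_natCast]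
      exact map_natCast (iterateFrobenius (O ⧸ I) p e) (m l)
    simp only [this]
    rw [← Nat.cast_sum, h5]
    exact (CharP.cast_eq_zero_iff (O ⧸ I) p _).2 hd
  rw [← map_pow, Ideal.Quotient.eq_zero_iff_mem, ← Int.cast_pow] at h6
  exact hcon ((Nat.prime_iff_prime_int.1 hp).dvd_of_dvd_pow (hmem _ h6))

end CTab
end CharTheory6

section StructA
open Pointwise
variable {G : Type*} [Group G] [Finite G]

/-- the prime graph after phase 1 -/
structure GR (G : Type*) [Group G] : Prop where
  a23 : ad G 2 3 = 1
  a25 : ad G 2 5 = 1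
  a213 : ad G 2 13 = 1
  a279 : ad G 2 79 = 1
  a1379 : ad G 13 79 = 1
  a35 : ad G 3 5 = 0
  a379 : ad G 3 79 = 0
  a579 : ad G 5 79 = 0
  a779 : ad G 7 79 = 0
  a4379 : ad G 43 79 = 0
  a27 : ad G 2 7 = 0
  a37 : ad G 3 7 = 0
  a57 : ad G 5 7 = 0
  a713 : ad G 7 13 = 0
  a243 : ad G 2 43 = 0
  a343 : ad G 3 43 = 0
  a543 : ad G 5 43 = 0
  a1343 : ad G 13 43 = 0

lemma OD.gr (h : OD G) : GR G := by
  obtain ⟨x, -, hx⟩ := exists_order_of_dvd (G := G) (p := 43) (H := ⊤) (by norm_num) (by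
    rw [card_top, h.card]; norm_num)
  have h1 := (phase1 h hx).1
  have e7 := h.d7
  have e43 := h.d43
  rw [h1] at e7 e43
  have z27 : ad G 2 7 = 0 := by omega
  have z37 : ad G 3 7 = 0 := by omega
  have z57 : ad G 5 7 = 0 := by omega
  have z713 : ad G 7 13 = 0 := by omega
  have z779 : ad G 7 79 = 0 := by omega
  have z243 : ad G 2 43 = 0 := by omega
  have z343 : ad G 3 43 = 0 := by omega
  have z543 : ad G 5 43 = 0 := by omega
  have z1343 : ad G 13 43 = 0 := by omega
  have z4379 : ad G 43 79 = 0 := by omega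
  have f2 := h.d2
  have f3 := h.d3
  have f5 := h.d5
  have f13 := h.d13
  have f79 := h.d79
  rw [z27, z243] at f2
  rw [z37, z343] at f3
  rw [z57, z543] at f5
  rw [z713, z1343] at f13
  rw [z779, z4379] at f79
  clear e7 e43
  have b := ad_le (G := G)
  have b1 := b 2 3
  have b2 := b 2 5
  have b3 := b 2 13
  have b4 := b 2 79
  have b5 := b 3 13
  have b6 := b 5 13
  have b7 := b 13 79
  have o1 : ad G 2 3 = 1 := by clear f3 f5 f13 f79 b5 b6 b7; omega
  have o2 : ad G 2 5 = 1 := by clear f3 f5 f13 f79 b5 b6 b7; omega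
  have o3 : ad G 2 13 = 1 := by clear f3 f5 f13 f79 b5 b6 b7; omega
  have o4 : ad G 2 79 = 1 := by clear f3 f5 f13 f79 b5 b6 b7; omega
  have o5 : ad G 3 13 = 1 := by clear f2 f3 f5 f79 b1 b2 b4; omega
  have o6 : ad G 5 13 = 1 := by clear f2 f3 f5 f79 b1 b2 b4; omega
  have o7 : ad G 13 79 = 1 := by clear f2 f3 f5 f79 b1 b2 b4; omega
  rw [o1, o5] at f3
  rw [o4, o7] at f79
  have o8 : ad G 3 5 = 0 := by clear f2 f5 f13 f79; omega
  have o9 : ad G 3 79 = 0 := by clear f2 f5 f13 f79; omega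
  have o10 : ad G 5 79 = 0 := by clear f2 f5 f13 f3; omega
  exact ⟨o1, o2, o3, o4, o7, o8, o9, o10, z779, z4379, z27, z37, z57, z713, z243, z343, z543, z1343⟩

/-- the exceptional subgroup -/
structure FA (G : Type*) [Group G] (A : Subgroup G) : Prop where
  cardA : card A = 2107
  cardN : card N[A] = 6321
  cent : ∀ a ∈ A, a ≠ 1 → centralizer {a} = A

lemma OD.fa (h : OD G) : ∃ A : Subgroup G, FA G A := by
  obtain ⟨x, -, hx⟩ := exists_order_of_dvd (G := G) (p := 43) (H := ⊤) hp43 (by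
    rw [card_top, h.card]; norm_num)
  obtain ⟨h1, hC, hN⟩ := phase1 h hx
  have hg := h.gr
  obtain ⟨A, hA⟩ : ∃ A, A = centralizer {x} := ⟨_, rfl⟩
  rw [← hA] at hC
  have hxA : x ∈ A := by rw [hA, mem_cent]
  have hxz : Nat.card (zpowers x) = 43 ^ 1 := card_zp hx
  have hcx : ∀ a ∈ A, a * x = x * a := fun a ha => by
    rw [hA] at ha; exact mem_cent.1 ha
  obtain ⟨S, hSA, hS⟩ := sylow_exists_in (H := A) (n := 2) hp7 (by rw [hC]; norm_num)
  have full : ∀ H : Subgroup G, S ≤ H → x ∈ H → H ≤ A → H = A := by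
    intro H hSH hxH hHA
    refine eq_of_le_of_card_ge hHA ?_
    rw [hC]
    refine le_of_dvd card_pos ?_
    refine Coprime.mul_dvd_of_dvd_of_dvd (by norm_num) ?_ ?_
    · have := orderOf_dvd_of_mem hxH; rwa [hx] at this
    · have := card_dvd_of_le hSH; rw [hS] at this; exact this
  have hcomm : ∀ a ∈ A, ∀ b ∈ A, a * b = b * a := by
    have hS2 : ∀ s ∈ S, ∀ b ∈ A, s * b = b * s := by
      intro s hs b hb
      have := full (A ⊓ centralizer {s}) (le_inf hSA fun t ht => mem_cent.2
        (comm_of_card_sq hp7 hS ht hs)) ⟨hxA, mem_cent.2 (hcx s (hSA hs)).symm⟩ inf_le_left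
      rw [← this] at hb
      exact (mem_cent.1 hb.2).symm
    intro a ha b hb
    have := full (A ⊓ centralizer {b}) (le_inf hSA fun t ht => mem_cent.2
        (hS2 t ht b hb)) ⟨hxA, mem_cent.2 (hcx b hb).symm⟩ inf_le_left
    rw [← this] at ha
    exact mem_cent.1 ha.2
  have hmem : ∀ t ∈ A, orderOf t = 43 → t ∈ zpowers x := by
    intro t ht ho
    exact mem_sylow_of_normalizer (i := 1) hp43 hxz (by rw [h.card]; norm_num) (by rw [ho, pow_one])
      (cent_le_normalizer x (hA ▸ ht))
  refine ⟨A, by rw [hC], ?_, ?_⟩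
  · have : N[A] = N[zpowers x] := by
      apply le_antisymm
      · intro g hg'
        apply mem_normalizer_zpowers_of
        refine hmem _ ((mem_normalizer_iff.1 hg' x).1 hxA) ?_
        rw [orderOf_conj', hx]
      · intro g hg'
        rw [hA]; exact normalizer_centralizer_zpowers hg'
    rw [this, hN]
  · intro a ha hne
    have hAle : A ≤ centralizer {a} := fun b hb => mem_cent.2 (hcomm b hb a ha)
    refine le_antisymm ?_ hAle
    have hao := orderOf_dvd_of_mem ha
    obtain ⟨p, hp, hpa⟩ := Nat.exists_prime_and_dvd (mt orderOf_eq_one_iff.1 hne)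
    have ht : orderOf (a ^ (orderOf a / p)) = p := orderOf_pow_orderOf_div (orderOf_pos a).ne' hpa
    set t := a ^ (orderOf a / p) with htd
    have htA : t ∈ A := A.pow_mem ha _
    have hle : centralizer {a} ≤ centralizer {t} := by
      intro c hc
      rw [mem_cent] at hc ⊢
      exact (Commute.pow_right (show Commute c a from hc) _)
    refine hle.trans ?_
    have hpd : p ∣ 43 * 7 ^ 2 := by rw [hC] at hao; exact hpa.trans hao
    rcases (Nat.Prime.dvd_mul hp).1 hpd with h2 | h2
    · have : p = 43 := (Nat.prime_dvd_prime_iff_eq hp hp43).1 h2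
      rw [this] at ht
      have htx := hmem t htA ht
      have : zpowers t = zpowers x := eq_of_le_of_card_ge (by rwa [zpowers_le])
        (by rw [card_zpowers, card_zpowers, ht, hx])
      intro c hc
      rw [mem_cent] at hc
      rw [hA, mem_cent]
      have hxt : x ∈ zpowers t := this ▸ mem_zpowers x
      obtain ⟨j, hj⟩ := mem_zpowers_iff.1 hxt
      rw [← hj]
      exact Commute.zpow_right (show Commute c t from hc) _
    · have : p = 7 := (Nat.prime_dvd_prime_iff_eq hp hp7).1 (hp.dvd_of_dvd_pow h2)
      rw [this] at ht
      have hno : ∀ p, p.Prime → p ≠ 7 → ad G 7 p ≠ 1 → ¬ p ∣ Nat.card (centralizer {t}) :=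
        fun p hp hp7' hne hdvd => hne (ad_of_dvd_centralizer hp7 hp hp7'.symm ht hdvd)
      have hAt : A ≤ centralizer {t} := fun b hb => mem_cent.2 (hcomm b hb t htA)
      refine le_of_eq (eq_of_le_of_card_ge hAt ?_).symm
      obtain ⟨v, hv, h2, h3, h5, h7v, h13, h43, h79, hz, -⟩ := card_form' (h.dvd (centralizer {t}))
      have e2 := hz 2 (hno 2 (by norm_num) (by norm_num) (by rw [ad_comm, hg.a27]; norm_num))
      have e3 := hz 3 (hno 3 (by norm_num) (by norm_num) (by rw [ad_comm, hg.a37]; norm_num))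
      have e5 := hz 5 (hno 5 (by norm_num) (by norm_num) (by rw [ad_comm, hg.a57]; norm_num))
      have e13 := hz 13 (hno 13 (by norm_num) (by norm_num) (by rw [hg.a713]; norm_num))
      have e79 := hz 79 (hno 79 (by norm_num) (by norm_num) (by rw [hg.a779]; norm_num))
      rw [e2, e3, e5, e13, e79] at hv
      rw [hv, hC]
      have q1 : 7 ^ v 7 ≤ 7 ^ 2 := Nat.pow_le_pow_right (by norm_num) h7v
      have q2 : 43 ^ v 43 ≤ 43 ^ 1 := Nat.pow_le_pow_right (by norm_num) h43
      have := Nat.mul_le_mul q1 q2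
      simp only [pow_zero, one_mul, mul_one]
      omega

lemma FA.comm {A : Subgroup G} (f : FA G A) {a b : G} (ha : a ∈ A) (hb : b ∈ A) : a * b = b * a := by
  by_cases h : b = 1
  · rw [h]; simp
  · rw [← f.cent b hb h] at ha
    exact mem_cent.1 ha

lemma FA.ti {A : Subgroup G} (f : FA G A) {a g : G} (ha : a ∈ A) (h1 : a ≠ 1) (hg : g * a * g⁻¹ ∈ A) :
    g ∈ N[A] := by
  rw [mem_normalizer_conj]
  conv_lhs => rw [← f.cent a ha h1]
  rw [conj_smul_centralizer, f.cent _ hg (by simpa using h1)]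

lemma FA.fpf {A : Subgroup G} (f : FA G A) {a x : G} (ha : a ∈ A) (h1 : a ≠ 1) (hx : x * a * x⁻¹ = a) :
    x ∈ A := by
  rw [← f.cent a ha h1, mem_cent]
  exact mul_inv_eq_iff_eq_mul.1 hx

end StructA

section Combi

lemma sunflower {α : Type*} [DecidableEq α] (V : Finset (Finset α)) (h3 : ∀ t ∈ V, t.card = 3)
    (h2 : ∀ s ∈ V, ∀ t ∈ V, s ≠ t → (s ∩ t).card = 2) (hV : 5 ≤ V.card) :
    ∃ C : Finset α, C.card = 2 ∧ ∀ t ∈ V, C ⊆ t := by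
  obtain ⟨t1, ht1, t2, ht2, hne⟩ := Finset.one_lt_card.1 (show 1 < V.card by omega)
  refine ⟨t1 ∩ t2, h2 _ ht1 _ ht2 hne, ?_⟩
  by_contra hcon
  push Not at hcon
  obtain ⟨t3, ht3, hn3⟩ := hcon
  have hC := h2 _ ht1 _ ht2 hne
  have hU : (t1 ∪ t2).card = 4 := by
    have := Finset.card_union_add_card_inter t1 t2
    rw [h3 _ ht1, h3 _ ht2, hC] at this; omega
  have key : ∀ t ∈ V, ¬ (t1 ∩ t2 ⊆ t) → t ⊆ t1 ∪ t2 := by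
    intro t ht hn
    have n1 : t ≠ t1 := by rintro rfl; exact hn inter_subset_left
    have n2 : t ≠ t2 := by rintro rfl; exact hn inter_subset_right
    have a1 := h2 _ ht _ ht1 n1
    have a2 := h2 _ ht _ ht2 n2
    have a3 : (t ∩ (t1 ∩ t2)).card < 2 := by
      rw [← hC]
      refine Finset.card_lt_card ⟨inter_subset_right, fun hs => hn (hs.trans inter_subset_left)⟩
    have a4 := Finset.card_union_add_card_inter (t ∩ t1) (t ∩ t2)
    rw [← Finset.inter_union_distrib_left, ← Finset.inter_inter_distrib_left, a1, a2] at a4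
    have : t ∩ (t1 ∪ t2) = t := eq_of_subset_of_card_le inter_subset_left (by
      rw [h3 _ ht]; omega)
    exact Finset.inter_eq_left.1 this
  have all : ∀ t ∈ V, t ⊆ t1 ∪ t2 := by
    intro t ht
    by_cases hCt : t1 ∩ t2 ⊆ t
    · have n3 : t ≠ t3 := by rintro rfl; exact hn3 hCt
      have a1 := h2 _ ht _ ht3 n3
      have hs : ¬ (t ∩ t3 ⊆ t1 ∩ t2) := by
        intro hs
        have := eq_of_subset_of_card_le hs (by rw [a1, hC])
        exact hn3 (this ▸ inter_subset_right)
      obtain ⟨x, hx, hxn⟩ := Finset.not_subset.1 hs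
      rw [Finset.mem_inter] at hx
      have hins : insert x (t1 ∩ t2) ⊆ t := Finset.insert_subset hx.1 hCt
      have := eq_of_subset_of_card_le hins (by
        rw [Finset.card_insert_of_notMem hxn, hC, h3 _ ht])
      rw [← this]
      exact Finset.insert_subset (key _ ht3 hn3 hx.2)
        (inter_subset_left.trans Finset.subset_union_left)
    · exact key t ht hCt
  have : V ⊆ (t1 ∪ t2).powersetCard 3 := fun t ht => Finset.mem_powersetCard.2 ⟨all t ht, h3 t ht⟩
  have := Finset.card_le_card this
  rw [Finset.card_powersetCard, hU] at this
  norm_num [Nat.choose] at this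
  omega

lemma vec_core {ι : Type*} [Fintype ι] [DecidableEq ι] (i0 : ι) (V : Finset (ι → ℤ)) (h0 : ∀ v ∈ V, v i0 = 1)
    (hn : ∀ v ∈ V, ∑ i, v i * v i = 4) (hip : ∀ v ∈ V, ∀ w ∈ V, v ≠ w → ∑ i, v i * w i = 3) (hV : 5 ≤ V.card) :
    ∃ X Y : ι, ∃ δ ε : ℤ, X ≠ i0 ∧ Y ≠ i0 ∧ X ≠ Y ∧ (δ = 1 ∨ δ = -1) ∧ (ε = 1 ∨ ε = -1) ∧
      ∃ c : (ι → ℤ) → ι, Set.InjOn c V ∧ ∀ v ∈ V, v X = δ ∧ v Y = ε ∧ c v ≠ i0 ∧ c v ≠ X ∧ c v ≠ Y ∧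
        (v (c v) = 1 ∨ v (c v) = -1) ∧ ∀ i, i ≠ i0 → i ≠ X → i ≠ Y → i ≠ c v → v i = 0 := by
  classical
  set E := univ.erase i0 with hE
  have hn' : ∀ v ∈ V, ∑ i ∈ E, v i * v i = 3 := by
    intro v hv
    have := add_sum_erase univ (fun i => v i * v i) (mem_univ i0)
    rw [hn v hv, h0 v hv] at this
    rw [hE]; linarith
  have hip' : ∀ v ∈ V, ∀ w ∈ V, v ≠ w → ∑ i ∈ E, v i * w i = 2 := by
    intro v hv w hw hne
    have := add_sum_erase univ (fun i => v i * w i) (mem_univ i0)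
    rw [hip v hv w hw hne, h0 v hv, h0 w hw] at this
    rw [hE]; linarith
  have hval : ∀ v ∈ V, ∀ i ∈ E, v i = 0 ∨ v i = 1 ∨ v i = -1 := by
    intro v hv i hi
    have := Finset.single_le_sum (f := fun i => v i * v i) (fun j _ => mul_self_nonneg (v j)) hi
    rw [hn' v hv] at this
    have h1 : v i ≤ 1 := by nlinarith
    have h2 : -1 ≤ v i := by nlinarith
    omega
  set S : (ι → ℤ) → Finset ι := fun v => E.filter fun i => v i ≠ 0 with hS
  set Tt : (ι → ℤ) → Finset (ι × ℤ) := fun v => (S v).image fun i => (i, v i) with hT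
  have memT : ∀ v (p : ι × ℤ), p ∈ Tt v ↔ p.1 ∈ E ∧ v p.1 ≠ 0 ∧ p.2 = v p.1 := by
    intro v p
    rw [hT]
    simp only [mem_image, hS, mem_filter]
    constructor
    · rintro ⟨i, ⟨hi, hi2⟩, rfl⟩; exact ⟨hi, hi2, rfl⟩
    · rintro ⟨a, b, c⟩; exact ⟨p.1, ⟨a, b⟩, Prod.ext rfl c.symm⟩
  have cardT : ∀ v ∈ V, (Tt v).card = 3 := by
    intro v hv
    rw [hT]
    simp only []
    rw [card_image_of_injective _ (fun a b h => (Prod.ext_iff.1 h).1)]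
    have : (((S v).card : ℕ) : ℤ) = 3 := by
      rw [← hn' v hv, card_eq_sum_ones, hS, sum_filter]
      push_cast
      refine sum_congr rfl fun i hi => ?_
      rcases hval v hv i hi with h | h | h <;> simp [h]
    exact_mod_cast this
  have agree : ∀ v ∈ V, ∀ w ∈ V, v ≠ w → (Tt v ∩ Tt w).card = 2 ∧
      ∀ i ∈ E, v i ≠ 0 → w i ≠ 0 → v i = w i := by
    intro v hv w hw hne
    set P := E.filter fun i => v i ≠ 0 ∧ w i = v i with hP
    set Q := E.filter fun i => v i ≠ 0 ∧ w i ≠ 0 ∧ w i ≠ v i with hQ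
    have e1 : Tt v ∩ Tt w = P.image fun i => (i, v i) := by
      ext p
      rw [Finset.mem_inter, memT, memT]
      simp only [mem_image, hP, mem_filter]
      constructor
      · rintro ⟨⟨a, b, c⟩, d, e, g⟩; exact ⟨p.1, ⟨a, b, by rw [← g, ← c]⟩, Prod.ext rfl c.symm⟩
      · rintro ⟨i, ⟨a, b, c⟩, rfl⟩; exact ⟨⟨a, b, rfl⟩, a, by rw [c]; exact b, c.symm⟩
    have e2 : (P.card : ℤ) - Q.card = 2 := by
      rw [← hip' v hv w hw hne, card_eq_sum_ones, card_eq_sum_ones, hP, hQ,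
        sum_filter, sum_filter]
      push_cast
      rw [← sum_sub_distrib]
      refine sum_congr rfl fun i hi => ?_
      rcases hval v hv i hi with h | h | h <;> rcases hval w hw i hi with h' | h' | h' <;> simp [h, h']
    have e3 : P.card + Q.card ≤ 3 := by
      rw [← cardT v hv, hT]
      simp only []
      rw [card_image_of_injective _ (fun a b h => (Prod.ext_iff.1 h).1), ← Finset.card_union_of_disjoint]
      · refine Finset.card_le_card fun i hi => ?_
        rw [hS, mem_filter]
        rcases Finset.mem_union.1 hi with h | h
        · rw [hP, mem_filter] at h; exact ⟨h.1, h.2.1⟩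
        · rw [hQ, mem_filter] at h; exact ⟨h.1, h.2.1⟩
      · rw [Finset.disjoint_left]
        intro i h1 h2
        rw [hP, mem_filter] at h1
        rw [hQ, mem_filter] at h2
        exact h2.2.2.2 h1.2.2
    have e4 : Q.card = 0 := by omega
    refine ⟨?_, ?_⟩
    · rw [e1, card_image_of_injective _ (fun a b h => (Prod.ext_iff.1 h).1)]; omega
    · intro i hi h1 h2
      by_contra h3
      have : i ∈ Q := by rw [hQ, mem_filter]; exact ⟨hi, h1, h2, fun h => h3 h.symm⟩
      rw [Finset.card_eq_zero.1 e4] at this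
      exact absurd this (Finset.notMem_empty _)
  have injT : Set.InjOn Tt V := by
    intro v hv w hw h
    by_contra hne
    have := (agree v hv w hw hne).1
    rw [h, Finset.inter_self, cardT w hw] at this
    omega
  obtain ⟨C, hC2, hC⟩ := sunflower (V.image Tt) (by
      intro t ht
      obtain ⟨v, hv, rfl⟩ := mem_image.1 ht
      exact cardT v hv) (by
      intro s hs t ht hne
      obtain ⟨v, hv, rfl⟩ := mem_image.1 hs
      obtain ⟨w, hw, rfl⟩ := mem_image.1 ht
      exact (agree v hv w hw (fun h => hne (by rw [h]))).1) (by
      rw [Finset.card_image_of_injOn injT]; exact hV)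
  have hC' : ∀ v ∈ V, C ⊆ Tt v := fun v hv => hC _ (mem_image_of_mem _ hv)
  obtain ⟨⟨X, δ⟩, ⟨Y, ε⟩, hne, rfl⟩ := Finset.card_eq_two.1 hC2
  obtain ⟨v0, hv0⟩ : V.Nonempty := Finset.card_pos.1 (by omega)
  have mX : ∀ v ∈ V, X ∈ E ∧ v X ≠ 0 ∧ δ = v X := fun v hv =>
    (memT v (X, δ)).1 (hC' v hv (by simp))
  have mY : ∀ v ∈ V, Y ∈ E ∧ v Y ≠ 0 ∧ ε = v Y := fun v hv =>
    (memT v (Y, ε)).1 (hC' v hv (by simp))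
  have hXY : X ≠ Y := by
    rintro rfl
    exact hne (by rw [(mX v0 hv0).2.2, (mY v0 hv0).2.2])
  have third : ∀ v ∈ V, ∃ c, Tt v \ {(X, δ), (Y, ε)} = {(c, v c)} ∧ c ∈ E ∧ v c ≠ 0 := by
    intro v hv
    have h1 : (Tt v \ {(X, δ), (Y, ε)}).card = 1 := by
      rw [Finset.card_sdiff_of_subset (hC' v hv), cardT v hv, hC2]
    obtain ⟨⟨c, e⟩, hce⟩ := Finset.card_eq_one.1 h1
    have : (c, e) ∈ Tt v \ {(X, δ), (Y, ε)} := by rw [hce]; simp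
    obtain ⟨h2, h3, h4⟩ := (memT v _).1 (Finset.mem_sdiff.1 this).1
    simp only [] at h2 h3 h4
    exact ⟨c, by rw [hce, h4], h2, h3⟩
  haveI : Nonempty ι := ⟨i0⟩
  choose! c hc hcE hc0 using third
  have hcm : ∀ v ∈ V, (c v, v (c v)) ∈ Tt v \ {(X, δ), (Y, ε)} := fun v hv => by rw [hc v hv]; simp
  refine ⟨X, Y, δ, ε, ?_, ?_, hXY, ?_, ?_, c, ?_, ?_⟩
  · exact (mem_erase.1 (mX v0 hv0).1).1
  · exact (mem_erase.1 (mY v0 hv0).1).1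
  · obtain ⟨a, b, e⟩ := mX v0 hv0
    rcases hval v0 hv0 X a with h | h | h
    · exact absurd h b
    · left; rw [e, h]
    · right; rw [e, h]
  · obtain ⟨a, b, e⟩ := mY v0 hv0
    rcases hval v0 hv0 Y a with h | h | h
    · exact absurd h b
    · left; rw [e, h]
    · right; rw [e, h]
  · intro v hv w hw h
    by_contra hne'
    have h1 := (agree v hv w hw hne').2 (c v) (hcE v hv) (hc0 v hv) (by rw [h]; exact hc0 w hw)
    have h2 : Tt v = Tt w := by
      rw [← Finset.sdiff_union_of_subset (hC' v hv), ← Finset.sdiff_union_of_subset (hC' w hw), hc v hv, hc w hw,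
        h1, h]
    exact hne' (injT hv hw h2)
  · intro v hv
    refine ⟨(mX v hv).2.2.symm, (mY v hv).2.2.symm, (mem_erase.1 (hcE v hv)).1, ?_, ?_, ?_, ?_⟩
    · intro h
      have := hcm v hv
      rw [h, ← (mX v hv).2.2] at this
      simp at this
    · intro h
      have := hcm v hv
      rw [h, ← (mY v hv).2.2] at this
      simp at this
    · rcases hval v hv _ (hcE v hv) with h | h | h
      · exact absurd h (hc0 v hv)
      · left; exact h
      · right; exact h
    · intro i h1 h2 h3 h4
      by_contra h5
      have : (i, v i) ∈ Tt v \ {(X, δ), (Y, ε)} := by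
        rw [Finset.mem_sdiff, memT]
        refine ⟨⟨mem_erase.2 ⟨h1, mem_univ _⟩, h5, rfl⟩, ?_⟩
        simp [h2, h3]
      rw [hc v hv] at this
      simp at this
      exact h4 this.1

end Combi

section ExcChar
variable {G : Type*} [Group G] [Fintype G] (T : CTab G) {A : Subgroup G}

/-- `a i l` is the multiplicity of `χ_i` in the exceptional generalized character -/
def IsA (A : Subgroup G) [Fintype A] (a : Fin T.n → (A →* KKˣ) → ℤ) : Prop :=
  ∀ i l, (a i l : KK) * 2107 = ∑ b : A, (1 - (l b⁻¹ : KK)) * T.ch i b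

variable {T}
variable [Fintype A] [Fintype (A →* KKˣ)]

lemma FA.fc (f : FA G A) : Fintype.card A = 2107 := by
  rw [← card_eq_fintype_card, f.cardA]

lemma FA.hc (f : FA G A) : ∀ a b : A, a * b = b * a := fun a b => Subtype.ext (f.comm a.2 b.2)

lemma exists_a (T : CTab G) (f : FA G A) : ∃ a : Fin T.n → (A →* KKˣ) → ℤ, IsA T A a ∧
    ∀ i (δ : ℤ), (∀ l, l ≠ 1 → a i l = δ) → ∃ m : ℕ, (T.d i : ℤ) = 2107 * m - 2106 * δ ∧
      (δ = 1 → T.d i = 1 → ∀ g ∈ A, T.ch i g = 1) := by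
  classical
  choose m hm hm2 using fun i => T.abel A f.hc i
  rw [f.fc] at hm2
  refine ⟨fun i l => m i 1 - m i l, ?_, ?_⟩
  · intro i l
    have h1 := hm2 i 1
    have h2 := hm2 i l
    push_cast at h1 h2 ⊢
    rw [sub_mul, h1, h2, ← sum_sub_distrib]
    refine sum_congr rfl fun b _ => ?_
    simp; ring
  · intro i δ hδ
    have hml : ∀ l, l ≠ 1 → (m i l : ℤ) = m i 1 - δ := fun l hl => by
      have := hδ l hl; simp only [] at this; omega
    have hd : (T.d i : ℤ) = 2107 * m i 1 - 2106 * δ := by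
      have h1 := hm i 1
      rw [Subgroup.coe_one, T.ch_one] at h1
      simp only [map_one, Units.val_one, mul_one] at h1
      have h2 : T.d i = ∑ l, m i l := by exact_mod_cast h1
      rw [h2]
      push_cast
      rw [← add_sum_erase _ _ (mem_univ (1 : A →* KKˣ)),
        sum_congr rfl (fun l hl => hml l (mem_erase.1 hl).1), sum_const,
        Finset.card_erase_of_mem (mem_univ _), card_univ, dual_card' f.hc, f.fc]
      simp; ring
    refine ⟨m i 1, hd, ?_⟩
    intro h1 h2 g hg
    rw [h1, h2] at hd
    have hm1 : m i 1 = 1 := by omega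
    have := hm i ⟨g, hg⟩
    rw [show T.ch i g = T.ch i ((⟨g, hg⟩ : A) : G) from rfl, this,
      ← add_sum_erase _ _ (mem_univ (1 : A →* KKˣ)), hm1, sum_eq_zero]
    · simp
    · intro l hl
      have := hml l (mem_erase.1 hl).1
      have : m i l = 0 := by rw [h1, hm1] at this; omega
      rw [this]; simp

variable {a : Fin T.n → (A →* KKˣ) → ℤ}

lemma a_triv (f : FA G A) (ha : IsA T A a) {i : Fin T.n} (hi : ∀ g, T.ch i g = 1) {l : A →* KKˣ} (hl : l ≠ 1) :
    a i l = 1 := by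
  have h := ha i l
  simp only [hi, mul_one] at h
  rw [sum_sub_distrib] at h
  have h2 : ∑ b : A, (l b⁻¹ : KK) = 0 := by
    rw [← dual_sum' f.hc hl]
    exact Equiv.sum_comp (Equiv.inv A) (fun b => (l b : KK))
  rw [h2] at h
  simp only [sum_const, card_univ, f.fc, sub_zero] at h
  have : (a i l : KK) * 2107 = ((1 : ℤ) : KK) * 2107 := by rw [h]; simp
  exact_mod_cast mul_right_cancel₀ (by norm_num) this

lemma a_vanish (ha : IsA T A a) (l : A →* KKˣ) {g : G} (hg : ∀ x, ∀ b ∈ A, b ≠ 1 → x * g⁻¹ * x⁻¹ ≠ b) :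
    ∑ i, (a i l : KK) * T.ch i g = 0 := by
  classical
  have h : ∑ i, (a i l : KK) * T.ch i g * 2107 = 0 := by
    have : ∀ i, (a i l : KK) * T.ch i g * 2107 = ∑ b : A, (1 - (l b⁻¹ : KK)) * (T.ch i b * T.ch i (g⁻¹)⁻¹) := by
      intro i
      rw [mul_right_comm, ha i l, sum_mul, inv_inv]
      exact sum_congr rfl fun b _ => by ring
    simp only [this]
    rw [sum_comm]
    refine sum_eq_zero fun b _ => ?_
    rw [← mul_sum, T.orth]
    by_cases hb : b = 1
    · rw [hb]; simp
    · rw [Finset.card_eq_zero.2, Nat.cast_zero, mul_zero]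
      refine Finset.filter_eq_empty_iff.2 fun x _ => ?_
      exact hg x b b.2 (fun h => hb (Subtype.ext h))
  rw [← sum_mul] at h
  exact (mul_eq_zero.1 h).resolve_right (by norm_num)

lemma a_galois (f : FA G A) (ha : IsA T A a) {σ : KK ≃+* KK} {i j : Fin T.n} (h : ∀ g, T.ch j g = σ (T.ch i g)) {δ : ℤ}
    (hi : ∀ l, l ≠ 1 → a i l = δ) : ∀ l, l ≠ 1 → a j l = δ := by
  intro l hl
  set l' : A →* KKˣ := (Units.map (σ.symm : KK →* KK)).comp l with hl'
  have hv : ∀ b, (l' b : KK) = σ.symm (l b) := fun b => rfl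
  have hne : l' ≠ 1 := by
    intro h1
    apply hl
    ext b
    have := hv b
    rw [h1] at this
    simp only [MonoidHom.one_apply, Units.val_one] at this ⊢
    exact (map_eq_one_iff σ.symm σ.symm.injective).1 this.symm
  have h1 := ha i l'
  rw [hi l' hne] at h1
  have h2 := congrArg σ h1
  rw [map_mul, map_intCast, map_ofNat, map_sum] at h2
  have h3 : (δ : KK) * 2107 = (a j l : KK) * 2107 := by
    rw [h2, ha j l]
    refine sum_congr rfl fun b _ => ?_
    rw [map_mul, map_sub, map_one, hv, RingEquiv.apply_symm_apply, h]
  exact_mod_cast (mul_right_cancel₀ (by norm_num) h3).symm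

end ExcChar

section ExcChar2
variable {G : Type*} [Group G] [Fintype G] {T : CTab G} {A : Subgroup G}
variable [Fintype A] [Fintype (A →* KKˣ)]
variable {a : Fin T.n → (A →* KKˣ) → ℤ}

/-- twisting a linear character by an element of the normalizer -/
noncomputable def tw (x : N[A]) (l : A →* KKˣ) : A →* KKˣ :=
  l.comp (A.normalizerMonoidHom x : A →* A)

lemma tw_coe (x : N[A]) (c : A) :
    ((A.normalizerMonoidHom x c : A) : G) = x * c * (x : G)⁻¹ := by
  rfl

lemma tw_ne {x : N[A]} {l : A →* KKˣ} (hl : l ≠ 1) : tw x l ≠ 1 := by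
  intro h
  apply hl
  ext b
  have := DFunLike.congr_fun h ((A.normalizerMonoidHom x).symm b)
  simp only [tw, MonoidHom.comp_apply, MonoidHom.coe_coe, MulEquiv.apply_symm_apply, MonoidHom.one_apply] at this
  rw [this]; rfl

lemma a_ip [Fintype N[A]] [DecidableEq (A →* KKˣ)] (f : FA G A) (ha : IsA T A a) {l m : A →* KKˣ} (hl : l ≠ 1) (hm : m ≠ 1) :
    (∑ i, a i l * a i m) * 2107 = 6321 + (univ.filter fun x : N[A] => tw x l = m).card := by
  classical
  have ha2 : ∀ i, (a i m : KK) * 2107 = ∑ c : A, (1 - (m c : KK)) * T.ch i ((c : G)⁻¹) := by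
    intro i
    rw [ha i m, ← Equiv.sum_comp (Equiv.inv A)]
    refine sum_congr rfl fun b _ => ?_
    simp
  have h1 : ((∑ i, a i l * a i m : ℤ) : KK) * 2107 * 2107 =
      ∑ c : A, ∑ b : A, (1 - (l b⁻¹ : KK)) * (1 - (m c : KK)) *
        ((univ.filter fun x : G => x * c * x⁻¹ = b).card : KK) := by
    push_cast
    rw [sum_mul, sum_mul]
    have : ∀ i, (a i l : KK) * (a i m) * 2107 * 2107 = ∑ c : A, ∑ b : A, (1 - (l b⁻¹ : KK)) * (1 - (m c : KK)) *
        (T.ch i b * T.ch i ((c : G)⁻¹)) := by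
      intro i
      rw [show (a i l : KK) * (a i m) * 2107 * 2107 = ((a i m : KK) * 2107) * ((a i l : KK) * 2107) by ring,
        ha i l, ha2 i, Finset.sum_mul_sum]
      refine sum_congr rfl fun c _ => sum_congr rfl fun b _ => ?_
      ring
    simp only [this]
    rw [sum_comm]
    refine sum_congr rfl fun c _ => ?_
    rw [sum_comm]
    refine sum_congr rfl fun b _ => ?_
    rw [← mul_sum, T.orth]
  have h2 : ∀ c : A, ∑ b : A, (1 - (l b⁻¹ : KK)) * (1 - (m c : KK)) *
        ((univ.filter fun x : G => x * c * x⁻¹ = b).card : KK) =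
      ∑ x : N[A], (1 - (tw x l c⁻¹ : KK)) * (1 - (m c : KK)) := by
    intro c
    by_cases hc : c = 1
    · rw [hc]; simp
    · have h3 : ∀ b : A, ((univ.filter fun x : G => x * c * x⁻¹ = b).card : KK) =
          ∑ x : N[A], if A.normalizerMonoidHom x c = b then (1 : KK) else 0 := by
        intro b
        rw [Finset.sum_boole]
        congr 1
        rw [← Finset.card_map (Function.Embedding.subtype _)]
        congr 1
        ext x
        simp only [mem_filter, mem_univ, true_and, Finset.mem_map, Function.Embedding.coe_subtype,
          Subtype.ext_iff, tw_coe]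
        constructor
        · intro h
          exact ⟨⟨x, f.ti c.2 (fun h => hc (Subtype.ext h)) (h ▸ b.2)⟩, h, rfl⟩
        · rintro ⟨y, h, rfl⟩; exact h
      simp only [h3, mul_sum]
      rw [sum_comm]
      refine sum_congr rfl fun x _ => ?_
      simp only [mul_ite, mul_one, mul_zero]
      rw [Finset.sum_ite_eq]
      simp [tw]
  have h4 : ∀ x : N[A], ∑ c : A, (1 - (tw x l c⁻¹ : KK)) * (1 - (m c : KK)) =
      2107 + if tw x l = m then 2107 else 0 := by
    intro x
    have e1 : ∑ b : A, (tw x l b⁻¹ : KK) = 0 := by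
      rw [← dual_sum' f.hc (tw_ne (x := x) hl)]
      exact Equiv.sum_comp (Equiv.inv A) (fun b => (tw x l b : KK))
    have e2 := dual_sum' (k := KK) f.hc hm
    have e3 := dual_orth' (k := KK) f.hc m (tw x l)
    rw [f.fc] at e3
    have : ∀ c : A, (1 - (tw x l c⁻¹ : KK)) * (1 - (m c : KK)) = 1 - (tw x l c⁻¹ : KK) - (m c : KK) +
      (m c : KK) * (tw x l c⁻¹ : KK) := fun c => by ring
    simp only [this]
    rw [sum_add_distrib, sum_sub_distrib, sum_sub_distrib, e1, e2, e3]
    simp [f.fc, eq_comm]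
  simp only [h2] at h1
  rw [sum_comm] at h1
  simp only [h4] at h1
  rw [sum_add_distrib, sum_const, card_univ, ← card_eq_fintype_card, f.cardN,
    ← sum_filter, sum_const] at h1
  have h5 : (((∑ i, a i l * a i m) * 2107 : ℤ) : KK) * 2107 = ((6321 +
      (univ.filter fun x : N[A] => tw x l = m).card : ℤ) : KK) * 2107 := by
    push_cast at h1 ⊢
    rw [h1]; simp; ring
  exact_mod_cast mul_right_cancel₀ (by norm_num) h5

/-- only elements of `A` stabilize a nontrivial character -/
lemma tw_fix (f : FA G A) {l : A →* KKˣ} (hl : l ≠ 1) (x : N[A]) : tw x l = l ↔ (x : G) ∈ A := by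
  constructor
  · intro h
    by_contra hx
    have hinj : Function.Injective fun b : A => A.normalizerMonoidHom x b * b⁻¹ := by
      intro b c hbc
      simp only [] at hbc
      by_contra hne
      have h1 : (b⁻¹ * c : A) ≠ 1 := fun h => hne (inv_mul_eq_one.1 h)
      apply hx
      refine f.fpf (a := ((b⁻¹ * c : A) : G)) (b⁻¹ * c : A).2 (fun h => h1 (Subtype.ext h)) ?_
      have h2 : A.normalizerMonoidHom x (b⁻¹ * c) = b⁻¹ * c := by
        rw [map_mul, map_inv, inv_mul_eq_iff_eq_mul]
        rw [mul_inv_eq_iff_eq_mul] at hbc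
        rw [hbc]
        group
      rw [← tw_coe, h2]
    have hsurj := Finite.surjective_of_injective hinj
    apply hl
    ext b
    obtain ⟨c, rfl⟩ := hsurj b
    have := DFunLike.congr_fun h c
    simp only [tw, MonoidHom.comp_apply, MonoidHom.coe_coe] at this
    simp [this]
  · intro hx
    ext b
    have : A.normalizerMonoidHom x b = b := Subtype.ext (by rw [tw_coe, f.comm hx b.2]; group)
    simp [tw, this]

end ExcChar2

section ExcChar3
variable {G : Type*} [Group G] [Fintype G]

/-- the exceptional generalized characters -/
structure EV (T : CTab G) (A : Subgroup G) (i0 : Fin T.n) (V : Finset (Fin T.n → ℤ)) : Prop where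
  triv : ∀ g, T.ch i0 g = 1
  card : V.card = 702
  v0 : ∀ v ∈ V, v i0 = 1
  norm : ∀ v ∈ V, ∑ i, v i * v i = 4
  ip : ∀ v ∈ V, ∀ w ∈ V, v ≠ w → ∑ i, v i * w i = 3
  vanish : ∀ v ∈ V, ∀ g, (∀ x, ∀ b ∈ A, b ≠ 1 → x * g⁻¹ * x⁻¹ ≠ b) → ∑ i, (v i : KK) * T.ch i g = 0
  deg : ∀ i (δ : ℤ), (∀ v ∈ V, v i = δ) → ∃ m : ℕ, (T.d i : ℤ) = 2107 * m - 2106 * δ ∧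
      (δ = 1 → T.d i = 1 → ∀ g ∈ A, T.ch i g = 1)
  gal : ∀ i (δ : ℤ) (σ : KK ≃+* KK) j, (∀ v ∈ V, v i = δ) → (∀ g, T.ch j g = σ (T.ch i g)) → ∀ v ∈ V, v j = δ

lemma exists_EV (T : CTab G) {A : Subgroup G} (f : FA G A) : ∃ i0 V, EV T A i0 V := by
  classical
  haveI := Fintype.ofFinite A
  haveI := Fintype.ofFinite N[A]
  haveI := Fintype.ofFinite (A →* KKˣ)
  obtain ⟨a, ha, hdeg⟩ := exists_a T f
  obtain ⟨i0, hi0⟩ := T.exists_triv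
  set L : Finset (A →* KKˣ) := univ.erase 1 with hL
  have memL : ∀ l, l ∈ L ↔ l ≠ 1 := fun l => by rw [hL]; simp
  set vec : (A →* KKˣ) → (Fin T.n → ℤ) := fun l i => a i l with hvec
  set N := N[A]
  set k : (A →* KKˣ) → (A →* KKˣ) → ℕ := fun l m => (univ.filter fun x : N => tw x l = m).card with hk
  have ip : ∀ l ∈ L, ∀ m ∈ L, (∑ i, vec l i * vec m i) * 2107 = 6321 + k l m := fun l hl m hm =>
    a_ip f ha ((memL l).1 hl) ((memL m).1 hm)
  have hkk : ∀ l ∈ L, k l l = 2107 := by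
    intro l hl
    simp only [hk]
    rw [← f.fc, ← Fintype.card_coe]
    refine Fintype.card_congr ⟨fun x => ⟨x.1.1, (tw_fix f ((memL l).1 hl) x.1).1 (mem_filter.1 x.2).2⟩,
      fun y => ⟨⟨y.1, le_normalizer y.2⟩, mem_filter.2 ⟨mem_univ _,
        (tw_fix f ((memL l).1 hl) _).2 y.2⟩⟩, fun x => rfl, fun y => rfl⟩
  have norm : ∀ l ∈ L, ∑ i, vec l i * vec l i = 4 := by
    intro l hl
    have := ip l hl l hl
    rw [hkk l hl] at this
    omega
  have cs : ∀ l ∈ L, ∀ m ∈ L, ∑ i, (vec l i - vec m i) * (vec l i - vec m i) = 8 - 2 * ∑ i, vec l i * vec m i := by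
    intro l hl m hm
    have : ∀ i, (vec l i - vec m i) * (vec l i - vec m i) = vec l i * vec l i + vec m i * vec m i
      - 2 * (vec l i * vec m i) := fun i => by ring
    simp only [this]
    rw [sum_sub_distrib, sum_add_distrib, norm l hl, norm m hm, ← mul_sum]
    ring
  have dich : ∀ l ∈ L, ∀ m ∈ L, (vec m = vec l → k l m = 2107) ∧ (vec m ≠ vec l → k l m = 0) := by
    intro l hl m hm
    have h1 := ip l hl m hm
    have h2 := cs l hl m hm
    constructor
    · intro h
      rw [h, norm l hl] at h1
      omega
    · intro h
      have h3 : 0 < ∑ i, (vec l i - vec m i) * (vec l i - vec m i) := by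
        obtain ⟨i, hi⟩ := Function.ne_iff.1 h
        refine Finset.sum_pos' (fun j _ => mul_self_nonneg _) ⟨i, mem_univ _, ?_⟩
        exact mul_self_pos.2 (sub_ne_zero.2 (Ne.symm hi))
      rw [h2] at h3
      generalize ∑ i, vec l i * vec m i = s at *
      omega
  have fib : ∀ l ∈ L, (L.filter fun m => vec m = vec l).card = 3 := by
    intro l hl
    have h1 : ∑ m ∈ L, k l m = 6321 := by
      have := card_eq_sum_card_fiberwise (f := fun x : N => tw x l) (s := univ) (t := L)
        (fun x _ => (memL _).2 (tw_ne ((memL l).1 hl)))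
      rw [card_univ, ← card_eq_fintype_card, f.cardN] at this
      exact this.symm
    have h2 : ∑ m ∈ L, k l m = ∑ m ∈ L, if vec m = vec l then 2107 else 0 := by
      refine sum_congr rfl fun m hm => ?_
      split_ifs with h
      · exact (dich l hl m hm).1 h
      · exact (dich l hl m hm).2 h
    rw [← sum_filter, sum_const, h1, smul_eq_mul] at h2
    omega
  refine ⟨i0, L.image vec, hi0, ?_, ?_, ?_, ?_, ?_, ?_, ?_⟩
  · have h1 := Finset.card_eq_sum_card_image vec L
    have h2 : L.card = 2106 := by
      rw [hL, Finset.card_erase_of_mem (mem_univ _), card_univ, dual_card' f.hc, f.fc]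
    rw [sum_congr rfl (g := fun _ => 3), sum_const, h2, smul_eq_mul] at h1
    · omega
    · intro v hv
      obtain ⟨l, hl, rfl⟩ := mem_image.1 hv
      exact fib l hl
  · intro v hv
    obtain ⟨l, hl, rfl⟩ := mem_image.1 hv
    exact a_triv f ha hi0 ((memL l).1 hl)
  · intro v hv
    obtain ⟨l, hl, rfl⟩ := mem_image.1 hv
    exact norm l hl
  · intro v hv w hw hne
    obtain ⟨l, hl, rfl⟩ := mem_image.1 hv
    obtain ⟨m, hm, rfl⟩ := mem_image.1 hw
    have h1 := ip l hl m hm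
    rw [(dich l hl m hm).2 (Ne.symm hne)] at h1
    generalize ∑ i, vec l i * vec m i = s at *
    omega
  · intro v hv g hg
    obtain ⟨l, hl, rfl⟩ := mem_image.1 hv
    exact a_vanish ha l hg
  · intro i δ h
    exact hdeg i δ fun l hl => h _ (mem_image_of_mem vec ((memL l).2 hl))
  · intro i δ σ j h hg v hv
    obtain ⟨l, hl, rfl⟩ := mem_image.1 hv
    exact a_galois f ha hg (fun l hl => h _ (mem_image_of_mem vec ((memL l).2 hl))) l ((memL l).1 hl)

end ExcChar3

section Degrees
open Pointwise
variable {G : Type*} [Group G] [Fintype G]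

lemma deg_cands : ∀ a : Fin 7, ∀ b : Fin 3, ∀ c : Fin 2, ∀ d : Fin 3, ∀ e : Fin 4,
    (2 ^ a.val * 3 ^ b.val * 5 ^ c.val * 13 ^ d.val * 79 ^ e.val % 2107 = 1 →
      2 ^ a.val * 3 ^ b.val * 5 ^ c.val * 13 ^ d.val * 79 ^ e.val ∈ [1, 162240, 493039, 79990647360]) ∧
    (2 ^ a.val * 3 ^ b.val * 5 ^ c.val * 13 ^ d.val * 79 ^ e.val % 2107 = 2106 →
      2 ^ a.val * 3 ^ b.val * 5 ^ c.val * 13 ^ d.val * 79 ^ e.val ∈ [6320, 12656748]) := by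
  decide +kernel

lemma deg_cands' {n : ℕ} (h : n ∣ ordL) :
    (n % 2107 = 1 → n ∈ [1, 162240, 493039, 79990647360]) ∧ (n % 2107 = 2106 → n ∈ [6320, 12656748]) := by
  obtain ⟨v, hv, h2, h3, h5, h7, h13, h43, h79, hz, -⟩ := card_form' h
  have key := deg_cands ⟨v 2, by omega⟩ ⟨v 3, by omega⟩ ⟨v 5, by omega⟩ ⟨v 13, by omega⟩ ⟨v 79, by omega⟩
  simp only [] at key
  constructor
  · intro hn
    rw [hz 7 (by omega), hz 43 (by omega)] at hv
    simp only [pow_zero, mul_one] at hv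
    rw [← hv] at key
    exact key.1 hn
  · intro hn
    rw [hz 7 (by omega), hz 43 (by omega)] at hv
    simp only [pow_zero, mul_one] at hv
    rw [← hv] at key
    exact key.2 hn

lemma deg_pairs {x y z : ℕ} {δ ε η m m' : ℤ} (hx : x ∣ ordL)
    (hy : y ∣ ordL) (hz : z ∣ ordL)
    (hδ : δ = 1 ∨ δ = -1) (hε : ε = 1 ∨ ε = -1) (hη : η = 1 ∨ η = -1)
    (h1 : (x : ℤ) = 2107 * m - 2106 * δ) (h2 : (y : ℤ) = 2107 * m' - 2106 * ε)
    (h3 : 1 + δ * x + ε * y + η * z = 0) :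
    (δ = 1 ∧ x = 1) ∨ (δ = -1 ∧ ε = 1 ∧ x = 6320 ∧ y = 493039 ∧ z = 486720) ∨
      (δ = 1 ∧ ε = -1 ∧ y = 6320 ∧ x = 493039 ∧ z = 486720) := by
  have hx' := deg_cands' hx
  have hy' := deg_cands' hy
  have cx : δ * x ∈ [(1 : ℤ), -6320, 162240, 493039, -12656748, 79990647360] := by
    rcases hδ with rfl | rfl
    · have := hx'.1 (by omega)
      simp at this ⊢; omega
    · have := hx'.2 (by omega)
      simp at this ⊢; omega
  have cy : ε * y ∈ [(1 : ℤ), -6320, 162240, 493039, -12656748, 79990647360] := by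
    rcases hε with rfl | rfl
    · have := hy'.1 (by omega)
      simp at this ⊢; omega
    · have := hy'.2 (by omega)
      simp at this ⊢; omega
  have hz' : 1 + δ * x + ε * y ≠ 0 ∧ (1 + δ * x + ε * y) ∣ ordL := by
    have e : 1 + δ * x + ε * y = - (η * z) := by linarith
    have z0 : z ≠ 0 := by rintro rfl; norm_num at hz
    have hz2 : (z : ℤ) ∣ ordL := by exact_mod_cast hz
    rw [e]
    rcases hη with rfl | rfl
    · refine ⟨by omega, ?_⟩
      rw [one_mul, neg_dvd]; exact hz2
    · refine ⟨by omega, ?_⟩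
      rw [neg_one_mul, neg_neg]; exact hz2
  have hab : ∀ s ∈ [(1 : ℤ), -6320, 162240, 493039, -12656748, 79990647360],
      ∀ t ∈ [(1 : ℤ), -6320, 162240, 493039, -12656748, 79990647360], 1 + s + t ≠ 0 →
      (1 + s + t) ∣ ordL →
      s = 1 ∨ (s = -6320 ∧ t = 493039) ∨ (t = -6320 ∧ s = 493039) := by decide +kernel
  have := hab _ cx _ cy hz'.1 hz'.2
  rcases hδ with rfl | rfl <;> rcases hε with rfl | rfl <;> rcases hη with rfl | rfl <;> omega

/-- a linear character trivial on `A` is trivial -/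
lemma no_linear (h : OD G) {A : Subgroup G} (f : FA G A) (T : CTab G) {X : Fin T.n} (hd : T.d X = 1)
    (hA : ∀ g ∈ A, T.ch X g = 1) (g : G) : T.ch X g = 1 := by
  set M : Subgroup G :=
    { carrier := {g | T.ch X g = 1}
      mul_mem' := fun {a b} ha hb => by
        simp only [Set.mem_setOf_eq] at ha hb ⊢
        rw [T.ch_mul hd, ha, hb, one_mul]
      one_mem' := by simp only [Set.mem_setOf_eq]; rw [T.ch_one, hd]; simp
      inv_mem' := fun {a} ha => by
        simp only [Set.mem_setOf_eq] at ha ⊢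
        have := T.ch_mul hd a⁻¹ a
        rw [ha, inv_mul_cancel, T.ch_one, hd] at this
        simpa using this.symm } with hM
  have memM : ∀ g, g ∈ M ↔ T.ch X g = 1 := fun g => Iff.rfl
  haveI : M.Normal := ⟨fun n hn g => by rw [memM] at hn ⊢; rw [T.ch_conj, hn]⟩
  obtain ⟨x, hxA, hx⟩ := exists_order_of_dvd (G := G) (p := 43) (H := A) hp43 (by rw [f.cardA]; norm_num)
  have hAM : A ≤ M := fun g hg => (memM g).2 (hA g hg)
  have hN := (phase1 h hx).2.2
  have hfr := frattini_card (p := 43) (n := 1) (H := ⊤) (M := M) (P := zpowers x) hp43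
    (by rw [zpowers_le]; exact hAM hxA) le_top (by rw [normalizer_eq_top])
    (card_zp hx) (by
      intro hd
      have := hd.trans (h.dvd M)
      revert this; norm_num)
  have c1 := card_conjSet M (zpowers x)
  have c2 := card_conjSet ⊤ (zpowers x)
  rw [← hfr, top_inf_eq, hN, card_top] at c2
  have hle : A ≤ M ⊓ N[zpowers x] := by
    refine le_inf hAM fun y hy => cent_le_normalizer x ?_
    rw [mem_cent]
    exact f.comm hy hxA
  have d1 := card_dvd_of_le hle
  have d2 := card_dvd_of_le (inf_le_right : M ⊓ N[zpowers x] ≤ _)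
  rw [f.cardA] at d1
  rw [hN] at d2
  obtain ⟨j, hj⟩ := d1
  have hj3 : j ∣ 3 := by
    rw [hj] at d2
    exact Nat.dvd_of_mul_dvd_mul_left (by norm_num : 0 < 2107) (by simpa using d2)
  have hidx : M.index * card M = card G := index_mul_card M
  set k := card (conjSet M (zpowers x))
  rw [hj] at c1
  have hk : 0 < k := by
    rcases Nat.eq_zero_or_pos k with h0 | h0
    · rw [h0, zero_mul] at c2; exact absurd c2.symm card_pos.ne'
    · exact h0
  rw [← c1, ← c2] at hidx
  have hij : M.index * j = 3 := by
    have : k * 2107 * (M.index * j) = k * 2107 * 3 := by linarith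
    exact eq_of_mul_eq_mul_left (by positivity) this
  rcases (Nat.dvd_prime hp3).1 hj3 with h1 | h1
  · exfalso
    rw [h1] at hij
    have h5 : 5 ∣ card M := by
      have e1 : 3 * card M = card G := by rw [← index_mul_card M]; congr 1; omega
      have : 5 ∣ 3 * card M := by rw [e1, h.card]; norm_num
      exact (Coprime.dvd_mul_left (by norm_num)).1 this
    have := index3 h M ⟨1, by omega⟩ h5
    rw [h.gr.a35] at this
    omega
  · rw [h1] at hij
    have : M = ⊤ := index_eq_one.1 (by omega)
    exact (memM g).1 (this ▸ mem_top g)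

end Degrees

section ExcChar4
variable {G : Type*} [Group G] [Fintype G]

lemma triv_unique (T : CTab G) {i j : Fin T.n} (hi : ∀ g, T.ch i g = 1) (hj : ∀ g, T.ch j g = 1) : i = j := by
  classical
  by_contra hne
  choose m hm using fun i => T.sub_sum (⊤ : Subgroup G) i
  have hm' : ∀ i, ∑ a : G, T.ch i a⁻¹ = (m i : KK) * Fintype.card G := by
    intro i
    have h1 := hm i
    rw [Fintype.card_congr (Subgroup.topEquiv (G := G)).toEquiv,
      ← Equiv.sum_comp (Subgroup.topEquiv (G := G)).symm.toEquiv] at h1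
    rw [← h1, ← Equiv.sum_comp (Equiv.inv G)]
    exact sum_congr rfl fun a _ => by simp
  have hG : (Fintype.card G : KK) ≠ 0 := by exact_mod_cast Fintype.card_ne_zero
  have h2 : ∑ a : G, ∑ i, T.ch i 1 * T.ch i a⁻¹ = Fintype.card G := by
    simp only [T.orth]
    rw [sum_eq_single 1]
    · simp
    · intro b _ hb
      rw [Finset.card_eq_zero.2, Nat.cast_zero]
      refine Finset.filter_eq_empty_iff.2 fun x _ h => hb ?_
      rw [mul_inv_eq_one] at h
      exact mul_eq_left.1 h
    · simp
  rw [sum_comm] at h2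
  simp only [← mul_sum, hm', T.ch_one] at h2
  have h3 : (((∑ i, T.d i * m i : ℕ)) : KK) = 1 := by
    have : (((∑ i, T.d i * m i : ℕ)) : KK) * Fintype.card G = 1 * Fintype.card G := by
      rw [one_mul]
      conv_rhs => rw [← h2]
      push_cast
      rw [sum_mul]
      exact sum_congr rfl fun i _ => by ring
    exact mul_right_cancel₀ hG this
  have h4 : ∑ i, T.d i * m i = 1 := by exact_mod_cast h3
  have one : ∀ k, (∀ g, T.ch k g = 1) → T.d k * m k = 1 := by
    intro k hk
    have e1 : T.d k = 1 := by
      have := T.ch_one k; rw [hk] at this; exact_mod_cast this.symm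
    have e2 := hm' k
    simp only [hk] at e2
    rw [sum_const, card_univ, nsmul_eq_mul] at e2
    have : (1 : KK) = m k := mul_right_cancel₀ hG (by rw [← e2]; ring)
    have : m k = 1 := by exact_mod_cast this.symm
    rw [e1, this]
  have h5 : ∑ k ∈ ({i, j} : Finset (Fin T.n)), T.d k * m k ≤ ∑ k, T.d k * m k :=
    Finset.sum_le_sum_of_subset (subset_univ _)
  rw [Finset.sum_pair hne, one i hi, one j hj, h4] at h5
  omega

/-- the common constituents -/
structure XYs (T : CTab G) (A : Subgroup G) (i0 X Y : Fin T.n) (V : Finset (Fin T.n → ℤ))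
    (c : (Fin T.n → ℤ) → Fin T.n) : Prop where
  ev : EV T A i0 V
  X0 : X ≠ i0
  Y0 : Y ≠ i0
  XY : X ≠ Y
  dX : T.d X = 6320
  dY : T.d Y = 493039
  vX : ∀ v ∈ V, v X = -1
  vY : ∀ v ∈ V, v Y = 1
  cinj : Set.InjOn c V
  c0 : ∀ v ∈ V, c v ≠ i0
  cX : ∀ v ∈ V, c v ≠ X
  cY : ∀ v ∈ V, c v ≠ Y
  vc : ∀ v ∈ V, v (c v) = 1 ∨ v (c v) = -1
  vz : ∀ v ∈ V, ∀ i, i ≠ i0 → i ≠ X → i ≠ Y → i ≠ c v → v i = 0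
  dc : ∀ v ∈ V, T.d (c v) = 486720

lemma sum_four {n : ℕ} {R : Type*} [AddCommMonoid R] (F : Fin n → R) {i j k l : Fin n} (hij : i ≠ j) (hik : i ≠ k) (hil : i ≠ l)
    (hjk : j ≠ k) (hjl : j ≠ l) (hkl : k ≠ l) (h : ∀ x, x ≠ i → x ≠ j → x ≠ k → x ≠ l → F x = 0) :
    ∑ x, F x = F i + (F j + (F k + F l)) := by
  rw [← Finset.sum_subset (subset_univ ({i, j, k, l} : Finset (Fin n)))]
  · rw [sum_insert, sum_insert, Finset.sum_pair hkl] <;> simp [*]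
  · intro x _ hx
    simp only [mem_insert, mem_singleton, not_or] at hx
    exact h x hx.1 hx.2.1 hx.2.2.1 hx.2.2.2

lemma exists_XYs (h : OD G) {A : Subgroup G} (f : FA G A) (T : CTab G) : ∃ i0 X Y V c, XYs T A i0 X Y V c := by
  classical
  obtain ⟨i0, V, ev⟩ := exists_EV T f
  obtain ⟨X, Y, δ, ε, hX0, hY0, hXY, hδ, hε, c, cinj, hv⟩ := vec_core i0 V ev.v0 ev.norm ev.ip (by rw [ev.card]; norm_num)
  obtain ⟨m, hm, hmA⟩ := ev.deg X δ fun v hv' => (hv v hv').1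
  obtain ⟨m', hm', -⟩ := ev.deg Y ε fun v hv' => (hv v hv').2.1
  have hdG : ∀ i, T.d i ∣ ordL := fun i => by
    rw [← h.card]; exact T.deg_dvd i
  have rel : ∀ v ∈ V, (1 : ℤ) + δ * T.d X + ε * T.d Y + v (c v) * T.d (c v) = 0 := by
    intro v hv'
    obtain ⟨e1, e2, e3, e4, e5, e6, e7⟩ := hv v hv'
    have h1 := ev.vanish v hv' 1 (by intro x b hb hb1 hx; apply hb1; rw [← hx]; simp)
    rw [sum_four (fun i => (v i : KK) * T.ch i 1) (Ne.symm hX0) (Ne.symm hY0) (Ne.symm e3) hXY (Ne.symm e4) (Ne.symm e5) (by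
      intro x x1 x2 x3 x4
      rw [e7 x x1 x2 x3 x4]; simp)] at h1
    rw [ev.triv, ev.v0 v hv', e1, e2, T.ch_one, T.ch_one, T.ch_one] at h1
    have h2 : (((1 : ℤ) + δ * T.d X + ε * T.d Y + v (c v) * T.d (c v) : ℤ) : KK) = 0 := by
      push_cast; rw [← h1]; push_cast; ring
    exact_mod_cast h2
  have res : ∀ v ∈ V, _ := fun v hv' => deg_pairs (hdG X) (hdG Y) (hdG (c v)) hδ hε (hv v hv').2.2.2.2.2.1 hm hm' (rel v hv')
  obtain ⟨v0, hv0⟩ : V.Nonempty := Finset.card_pos.1 (by rw [ev.card]; norm_num)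
  have noX : ¬ (δ = 1 ∧ T.d X = 1) := by
    rintro ⟨h1, h2⟩
    exact hX0 (triv_unique T (no_linear h f T h2 (hmA h1 h2)) ev.triv)
  rcases (res v0 hv0).resolve_left noX with ⟨h1, h2, h3, h4, -⟩ | ⟨h1, h2, h3, h4, -⟩
  · refine ⟨i0, X, Y, V, c, ev, hX0, hY0, hXY, h3, h4, ?_, ?_, cinj, ?_, ?_, ?_, ?_, ?_, ?_⟩
    · intro v hv'; rw [(hv v hv').1, h1]
    · intro v hv'; rw [(hv v hv').2.1, h2]
    · intro v hv'; exact (hv v hv').2.2.1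
    · intro v hv'; exact (hv v hv').2.2.2.1
    · intro v hv'; exact (hv v hv').2.2.2.2.1
    · intro v hv'; exact (hv v hv').2.2.2.2.2.1
    · intro v hv'; exact (hv v hv').2.2.2.2.2.2
    · intro v hv'
      rcases (res v hv').resolve_left noX with g | g <;> omega
  · refine ⟨i0, Y, X, V, c, ev, hY0, hX0, hXY.symm, h3, h4, ?_, ?_, cinj, ?_, ?_, ?_, ?_, ?_, ?_⟩
    · intro v hv'; rw [(hv v hv').2.1, h2]
    · intro v hv'; rw [(hv v hv').1, h1]
    · intro v hv'; exact (hv v hv').2.2.1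
    · intro v hv'; exact (hv v hv').2.2.2.2.1
    · intro v hv'; exact (hv v hv').2.2.2.1
    · intro v hv'; exact (hv v hv').2.2.2.2.2.1
    · intro v hv' i i1 i2 i3; exact (hv v hv').2.2.2.2.2.2 i i1 i3 i2
    · intro v hv'
      rcases (res v hv').resolve_left noX with g | g <;> omega

end ExcChar4

section ExcChar5
variable {G : Type*} [Group G] [Fintype G]
variable {T : CTab G} {A : Subgroup G} {i0 X Y : Fin T.n} {V : Finset (Fin T.n → ℤ)} {c : (Fin T.n → ℤ) → Fin T.n}

lemma XYs.three (s : XYs T A i0 X Y V c) {j : Fin T.n} (hj : ∀ v ∈ V, v j ≠ 0) : j = i0 ∨ j = X ∨ j = Y := by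
  by_contra hcon
  push Not at hcon
  obtain ⟨v, hv, w, hw, hne⟩ := Finset.one_lt_card.1 (show 1 < V.card by rw [s.ev.card]; norm_num)
  have h1 : ∀ v ∈ V, j = c v := by
    intro v hv
    by_contra hjc
    exact hj v hv (s.vz v hv j hcon.1 hcon.2.1 hcon.2.2 hjc)
  exact hne (s.cinj hv hw (by rw [← h1 v hv, ← h1 w hw]))

lemma XYs.d0 (s : XYs T A i0 X Y V c) : T.d i0 = 1 := by
  have := T.ch_one i0
  rw [s.ev.triv] at this
  exact_mod_cast this.symm

lemma galois_deg (T : CTab G) {i j : Fin T.n} {σ : KK ≃+* KK} (h : ∀ g, T.ch j g = σ (T.ch i g)) : T.d j = T.d i := by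
  have := h 1
  rw [T.ch_one, T.ch_one, map_natCast] at this
  exact_mod_cast this

lemma XYs.ratX (s : XYs T A i0 X Y V c) (g : G) : ∃ z : ℤ, T.ch X g = z := by
  refine CTab.int_of_fixed (T.integral X g) fun σ => ?_
  obtain ⟨j, hj⟩ := T.galois σ X
  have h1 := s.ev.gal X (-1) σ j s.vX hj
  have h2 := galois_deg T hj
  rw [s.dX] at h2
  rcases s.three (fun v hv => by rw [h1 v hv]; norm_num) with rfl | rfl | rfl
  · rw [s.d0] at h2; omega
  · exact (hj g).symm
  · rw [s.dY] at h2; omega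

lemma XYs.ratY (s : XYs T A i0 X Y V c) (g : G) : ∃ z : ℤ, T.ch Y g = z := by
  refine CTab.int_of_fixed (T.integral Y g) fun σ => ?_
  obtain ⟨j, hj⟩ := T.galois σ Y
  have h1 := s.ev.gal Y 1 σ j s.vY hj
  have h2 := galois_deg T hj
  rw [s.dY] at h2
  rcases s.three (fun v hv => by rw [h1 v hv]; norm_num) with rfl | rfl | rfl
  · rw [s.d0] at h2; omega
  · rw [s.dX] at h2; omega
  · exact (hj g).symm

lemma bessel (T : CTab G) (u : G) {ι : Type*} (S : Finset ι) (j : ι → Fin T.n) (hj : Set.InjOn j S) (w : ι → ℤ)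
    (hw : ∀ i ∈ S, T.ch (j i) u = w i) : ∑ i ∈ S, w i ^ 2 ≤ card (centralizer {u}) := by
  classical
  haveI : Algebra.IsAlgebraic ℚ KK := by
    have h0 : (DivisionRing.toRatAlgebra : Algebra ℚ KK) = AlgebraicClosure.instAlgebra ℚ :=
      Subsingleton.elim _ _
    rw [h0]
    exact AlgebraicClosure.isAlgebraic ℚ
  let τ : KK →+* ℂ := (IsAlgClosed.lift (M := ℂ) (R := ℚ) (S := KK)).toRingHom
  have h1 := T.orth u u
  rw [conj_fiber_card (IsConj.refl u)] at h1
  have h2 := congrArg τ h1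
  rw [map_sum, map_natCast] at h2
  have h3 : ∑ i, ‖τ (T.ch i u)‖ ^ 2 = (card (centralizer {u}) : ℝ) := by
    have : ((∑ i, ‖τ (T.ch i u)‖ ^ 2 : ℝ) : ℂ) = ((card (centralizer {u}) : ℝ) : ℂ) := by
      push_cast
      rw [← h2]
      refine sum_congr rfl fun i _ => ?_
      rw [map_mul, T.star_ch]
      exact (Complex.mul_conj' _).symm
    exact_mod_cast this
  have h4 : ∑ i ∈ S, ((w i : ℝ)) ^ 2 ≤ ∑ i, ‖τ (T.ch i u)‖ ^ 2 := by
    calc ∑ i ∈ S, ((w i : ℝ)) ^ 2 = ∑ i ∈ S, ‖τ (T.ch (j i) u)‖ ^ 2 := by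
          refine sum_congr rfl fun i hi => ?_
          rw [hw i hi, map_intCast, Complex.norm_intCast, sq_abs]
      _ = ∑ k ∈ S.image j, ‖τ (T.ch k u)‖ ^ 2 := by rw [Finset.sum_image hj]
      _ ≤ _ := Finset.sum_le_sum_of_subset_of_nonneg (subset_univ _) (fun _ _ _ => by positivity)
  rw [h3] at h4
  exact_mod_cast h4

lemma XYs.elt (s : XYs T A i0 X Y V c) (f : FA G A) (h : OD G) {u : G} {e : ℕ} (hu : orderOf u = 79 ^ e) (hu1 : u ≠ 1) :
    ∃ x y : ℤ, T.ch X u = x ∧ T.ch Y u = y ∧ 79 ∣ x ∧ 79 ∣ y ∧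
      1 + x ^ 2 + y ^ 2 + 702 * (1 - x + y) ^ 2 ≤ card (centralizer {u}) ∧
      (card (centralizer {u}) : ℤ) * 6320 ∣ card G * x ∧
      (card (centralizer {u}) : ℤ) * 493039 ∣ card G * y ∧
      (card (centralizer {u}) : ℤ) * 486720 ∣ card G * (1 - x + y) := by
  classical
  obtain ⟨x, hx⟩ := s.ratX u
  obtain ⟨y, hy⟩ := s.ratY u
  have hp : Nat.Prime 79 := by norm_num
  have hvan : ∀ z, ∀ b ∈ A, b ≠ 1 → z * u⁻¹ * z⁻¹ ≠ b := by
    intro z b hb hb1 hz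
    have h1 := orderOf_dvd_of_mem hb
    rw [← hz, orderOf_conj', orderOf_inv, hu, f.cardA] at h1
    have h2 : e ≠ 0 := by
      rintro rfl
      exact hu1 (orderOf_eq_one_iff.1 (by rw [hu, pow_zero]))
    have := (dvd_pow_self 79 h2).trans h1
    revert this; norm_num
  have hc : ∀ v ∈ V, T.ch (c v) u = ((- v (c v) * (1 - x + y) : ℤ) : KK) := by
    intro v hv
    have h1 := s.ev.vanish v hv u hvan
    rw [sum_four (fun i => (v i : KK) * T.ch i u) (Ne.symm s.X0) (Ne.symm s.Y0) (Ne.symm (s.c0 v hv)) s.XY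
      (Ne.symm (s.cX v hv)) (Ne.symm (s.cY v hv)) (by
      intro i x1 x2 x3 x4
      rw [s.vz v hv i x1 x2 x3 x4]; simp), s.ev.triv, s.ev.v0 v hv, s.vX v hv, s.vY v hv, hx, hy] at h1
    push_cast at h1 ⊢
    rcases s.vc v hv with h2 | h2
    · rw [h2] at h1 ⊢; push_cast at h1 ⊢; linear_combination h1
    · rw [h2] at h1 ⊢; push_cast at h1 ⊢; linear_combination -h1
  refine ⟨x, y, hx, hy, ?_, ?_, ?_, ?_, ?_, ?_⟩
  · exact_mod_cast T.congr_p hp X hu hx (by rw [s.dX]; norm_num)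
  · exact_mod_cast T.congr_p hp Y hu hy (by rw [s.dY]; norm_num)
  · set j : Option (Option (Option V)) → Fin T.n := fun o => match o with
      | none => i0
      | some none => X
      | some (some none) => Y
      | some (some (some v)) => c v with hj
    set w : Option (Option (Option V)) → ℤ := fun o => match o with
      | none => 1
      | some none => x
      | some (some none) => y
      | some (some (some v)) => - v.1 (c v.1) * (1 - x + y) with hw
    have hb := bessel T u univ j (by
      have X0 := s.X0
      have Y0 := s.Y0
      have XY := s.XY
      have c0 := fun v : V => s.c0 v v.2
      have cX := fun v : V => s.cX v v.2
      have cY := fun v : V => s.cY v v.2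
      rintro (_ | _ | _ | v) - (_ | _ | _ | v') - hh <;> simp only [hj] at hh
      · rfl
      · exact absurd hh.symm X0
      · exact absurd hh.symm Y0
      · exact absurd hh.symm (c0 _)
      · exact absurd hh X0
      · rfl
      · exact absurd hh XY
      · exact absurd hh.symm (cX _)
      · exact absurd hh Y0
      · exact absurd hh.symm XY
      · rfl
      · exact absurd hh.symm (cY _)
      · exact absurd hh (c0 _)
      · exact absurd hh (cX _)
      · exact absurd hh (cY _)
      · rw [Subtype.ext (s.cinj v.2 v'.2 hh)]) w (by
      rintro (_ | _ | _ | v) - <;> simp only [hj, hw]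
      · rw [s.ev.triv]; simp
      · exact hx
      · exact hy
      · exact hc v v.2)
    rw [Fintype.sum_option, Fintype.sum_option, Fintype.sum_option] at hb
    simp only [hw] at hb
    rw [sum_congr rfl (g := fun _ => (1 - x + y) ^ 2), sum_const, card_univ, Fintype.card_coe,
      s.ev.card] at hb
    · refine le_trans (le_of_eq ?_) hb
      simp; ring
    · intro v _
      rcases s.vc v v.2 with h2 | h2 <;> rw [h2] <;> ring
  · have := T.omega X u x hx
    rw [s.dX] at this; exact_mod_cast this
  · have := T.omega Y u y hy
    rw [s.dY] at this; exact_mod_cast this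
  · obtain ⟨v, hv⟩ : V.Nonempty := Finset.card_pos.1 (by rw [s.ev.card]; norm_num)
    have := T.omega (c v) u _ (hc v hv)
    rw [s.dc v hv] at this
    push_cast at this
    rcases s.vc v hv with h2 | h2
    · rw [h2] at this
      rw [show (card G : ℤ) * (-1 * (1 - x + y)) = -(card G * (1 - x + y)) by ring, dvd_neg] at this
      exact this
    · rw [h2] at this
      rw [show (card G : ℤ) * (- -1 * (1 - x + y)) = (card G * (1 - x + y)) by ring] at this
      exact this

end ExcChar5

section Cent79
open Pointwise
variable {G : Type*} [Group G] [Finite G]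

lemma w_cases : ∀ s ∈ Finset.Icc (-8 : ℤ) 8, ∀ b : Fin 7, ∀ c : Fin 3,
    ((2 : ℤ) ^ b.val * 13 ^ c.val) ∣ 1 - 79 * s → ((2 : ℤ) ^ b.val * 13 ^ c.val) ∣ 4 * 9 * 49 * 169 * 43 * s →
    1 + 6241 * s ^ 2 + 702 * (1 - 79 * s) ^ 2 ≤ 493039 * ((2 : ℤ) ^ b.val * 13 ^ c.val) →
    (s = 0 ∧ (2 : ℤ) ^ b.val * 13 ^ c.val = 1) ∨ (s = 1 ∧ ((2 : ℤ) ^ b.val * 13 ^ c.val = 13 ∨ (2 : ℤ) ^ b.val * 13 ^ c.val = 26)) := by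
  decide +kernel

lemma cent_arith {d b c : ℕ} (hd : d = 2 ∨ d = 3) (hb : b ≤ 6) (hc : c ≤ 2) {x y n : ℤ} (hn : n = 79 ^ d * (2 ^ b * 13 ^ c))
    (hx : 79 ∣ x) (hy : 79 ∣ y) (h1 : 1 + x ^ 2 + y ^ 2 + 702 * (1 - x + y) ^ 2 ≤ n)
    (h2 : n * 6320 ∣ (ordL) * x)
    (h3 : n * 493039 ∣ (ordL) * y)
    (h4 : n * 486720 ∣ (ordL) * (1 - x + y)) :
    (x = 0 ∧ (n = 79 ^ 2 ∨ n = 79 ^ 3)) ∨ (x = 79 ∧ (n = 79 ^ 3 * 13 ∨ n = 79 ^ 3 * 26)) := by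
  obtain ⟨s, rfl⟩ := hx
  obtain ⟨w, hw⟩ : ∃ w : ℤ, w = 2 ^ b * 13 ^ c := ⟨_, rfl⟩
  obtain ⟨q, hq⟩ : ∃ q : ℤ, q = 79 ^ d := ⟨_, rfl⟩
  have hw0 : 0 < w := by rw [hw]; positivity
  have hq0 : 0 < q := by rw [hq]; positivity
  rw [← hw, ← hq] at hn
  have hqd : q = 6241 ∨ q = 493039 := by
    rcases hd with rfl | rfl <;> rw [hq] <;> norm_num
  have c1 : IsCoprime q ((2 : ℤ) ^ 6 * 3 ^ 2 * 5 * 7 ^ 2 * 13 ^ 2 * 43) := by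
    rw [hq]; refine IsCoprime.pow_left ?_
    rw [Int.isCoprime_iff_gcd_eq_one]; norm_num
  have c2 : IsCoprime w ((2107 * 79 ^ 3 : ℤ)) := by
    rw [hw]
    refine IsCoprime.mul_left (IsCoprime.pow_left ?_) (IsCoprime.pow_left ?_) <;>
      (rw [Int.isCoprime_iff_gcd_eq_one]; norm_num)
  have c3 : IsCoprime w ((79 ^ 3 : ℤ)) := by
    rw [hw]
    refine IsCoprime.mul_left (IsCoprime.pow_left ?_) (IsCoprime.pow_left ?_) <;>
      (rw [Int.isCoprime_iff_gcd_eq_one]; norm_num)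
  have qy : q ∣ y := by
    have : q ∣ (2 ^ 6 * 3 ^ 2 * 5 * 7 ^ 2 * 13 ^ 2 * 43) * y := by
      have h5 : (79 ^ 3 : ℤ) * n ∣ (79 ^ 3) * ((2 ^ 6 * 3 ^ 2 * 5 * 7 ^ 2 * 13 ^ 2 * 43) * y) := by
        convert h3 using 1 <;> ring
      have h6 := (mul_dvd_mul_iff_left (by norm_num)).1 h5
      exact (Dvd.intro _ hn.symm).trans h6
    exact c1.dvd_of_dvd_mul_left this
  have wz : w ∣ 1 - 79 * s + y := by
    have : w ∣ (2107 * 79 ^ 3) * (1 - 79 * s + y) := by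
      have h5 : (486720 : ℤ) * n ∣ 486720 * ((2107 * 79 ^ 3) * (1 - 79 * s + y)) := by
        convert h4 using 1 <;> ring
      have h6 := (mul_dvd_mul_iff_left (by norm_num)).1 h5
      exact (Dvd.intro_left _ hn.symm).trans h6
    exact c2.dvd_of_dvd_mul_left this
  have ws : w ∣ 4 * 9 * 49 * 169 * 43 * s := by
    have : w ∣ (79 ^ 3) * (4 * 9 * 49 * 169 * 43 * s) := by
      have h5 : (6320 : ℤ) * n ∣ 6320 * ((79 ^ 3) * (4 * 9 * 49 * 169 * 43 * s)) := by
        convert h2 using 1 <;> ring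
      have h6 := (mul_dvd_mul_iff_left (by norm_num)).1 h5
      exact (Dvd.intro_left _ hn.symm).trans h6
    exact c3.dvd_of_dvd_mul_left this
  have hz0 : 1 - 79 * s + y ≠ 0 := by omega
  have hwz : w ≤ |1 - 79 * s + y| := Int.le_of_dvd (abs_pos.2 hz0) ((dvd_abs _ _).2 wz)
  have hwz2 : w ^ 2 ≤ (1 - 79 * s + y) ^ 2 := by
    rw [← sq_abs (1 - 79 * s + y)]; exact pow_le_pow_left₀ hw0.le hwz 2
  have hqw : 702 * w < q := by
    have : 702 * w * w < q * w := by nlinarith [sq_nonneg y, sq_nonneg (79 * s)]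
    exact lt_of_mul_lt_mul_right this hw0.le
  have y0 : y = 0 := by
    by_contra hne
    have h5 : q ≤ |y| := Int.le_of_dvd (abs_pos.2 hne) ((dvd_abs _ _).2 qy)
    have h6 : q ^ 2 ≤ y ^ 2 := by rw [← sq_abs y]; exact pow_le_pow_left₀ hq0.le h5 2
    nlinarith [sq_nonneg (1 - 79 * s + y), sq_nonneg (79 * s)]
  rw [y0] at h1 wz
  have h1' : 1 + 6241 * s ^ 2 + 702 * (1 - 79 * s) ^ 2 ≤ q * w := by rw [← hn]; nlinarith
  have hs : (1 - 79 * s) ^ 2 ≤ 493039 := by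
    rcases hqd with h | h <;> rw [h] at h1' hqw <;> nlinarith [sq_nonneg s]
  have s1 : s ≤ 8 := by nlinarith
  have s2 : -8 ≤ s := by nlinarith
  have hle : q * w ≤ 493039 * w := mul_le_mul_of_nonneg_right (by omega) hw0.le
  have key := w_cases s (Finset.mem_Icc.2 ⟨s2, s1⟩) ⟨b, by omega⟩ ⟨c, by omega⟩
  simp only [] at key
  rw [← hw] at key
  rw [add_zero] at wz
  rcases key wz ws (h1'.trans hle) with ⟨k1, k2⟩ | ⟨k1, k2⟩
  · left
    refine ⟨by rw [k1]; norm_num, ?_⟩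
    rw [hn, k2]
    rcases hqd with h | h <;> rw [h] <;> norm_num
  · right
    refine ⟨by rw [k1]; norm_num, ?_⟩
    rcases hqd with h | h
    · exfalso; rw [k1, h] at h1'; rw [h] at hqw; omega
    · rw [hn, h]; rcases k2 with k2 | k2 <;> rw [k2] <;> norm_num

lemma cent_form (h : OD G) {u : G} {e : ℕ} (hu : orderOf u = 79 ^ e) (hu1 : u ≠ 1) :
    ∃ d b c, (d = 2 ∨ d = 3) ∧ b ≤ 6 ∧ c ≤ 2 ∧ card (centralizer {u}) = 79 ^ d * (2 ^ b * 13 ^ c) := by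
  have hp : Nat.Prime 79 := by norm_num
  have gr := h.gr
  have he : e ≠ 0 := by
    rintro rfl; exact hu1 (orderOf_eq_one_iff.1 (by rw [hu, pow_zero]))
  have hdu : 79 ∣ orderOf u := by rw [hu]; exact dvd_pow_self _ he
  have ht : orderOf (u ^ (orderOf u / 79)) = 79 := orderOf_pow_orderOf_div (orderOf_pos u).ne' hdu
  have hle : centralizer {u} ≤ centralizer {u ^ (orderOf u / 79)} := by
    intro c hc
    rw [mem_cent] at hc ⊢
    exact (Commute.pow_right (show Commute c u from hc) _)
  have hno : ∀ p, p.Prime → p ≠ 79 → ad G p 79 = 0 → ¬ p ∣ card (centralizer {u}) := by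
    intro p hpp hp79 had hdvd
    have := ad_of_dvd_centralizer hp hpp hp79.symm ht (hdvd.trans (card_dvd_of_le hle))
    rw [ad_comm, had] at this
    omega
  -- the 79-part
  have h79 : 79 ^ 2 ∣ card (centralizer {u}) := by
    obtain ⟨P, hP, huP⟩ : ∃ P : Subgroup G, card P = 79 ^ 3 ∧ u ∈ P := by
      obtain ⟨P, h1, h2, h3⟩ := sylow_exists_ge (G := G) (p := 79) (n := 3) (H := ⊤) (Q := zpowers u) hp le_top
        (IsPGroup.of_card (n := e) (by rw [card_zpowers, hu])) (by rw [card_top, h.card]; exact Dvd.intro_left _ rfl)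
        (by rw [card_top, h.card]; norm_num)
      exact ⟨P, h3, h2 (mem_zpowers u)⟩
    obtain ⟨z, hzP, hz, hzc⟩ := center_meets (K := P) hp hP le_rfl le_normalizer (by
      intro hb; rw [hb, card_bot] at hP; norm_num at hP)
    set H := P ⊓ centralizer {u} with hH
    have hHd : card H ∣ 79 ^ 3 := hP ▸ card_dvd_of_le inf_le_left
    obtain ⟨k, hk3, hk⟩ := (Nat.dvd_prime_pow hp).1 hHd
    have huH : u ∈ H := ⟨huP, mem_cent.2 rfl⟩
    have hzH : z ∈ H := ⟨hzP, mem_cent.2 (hzc u huP)⟩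
    have hk2 : 2 ≤ k := by
      by_contra hlt
      have hk1 : k = 1 := by
        have : k ≠ 0 := by
          rintro rfl
          have := orderOf_dvd_of_mem huH
          rw [hk, pow_zero, Nat.dvd_one] at this
          exact hu1 (orderOf_eq_one_iff.1 this)
        omega
      rw [hk1, pow_one] at hk
      have hzp : zpowers z = H := eq_of_le_of_card_ge (by rwa [zpowers_le])
        (by rw [hk, card_zpowers, hz])
      have huz : u ∈ zpowers z := hzp ▸ huH
      obtain ⟨j, hj⟩ := mem_zpowers_iff.1 huz
      have : P ≤ H := by
        intro g hg
        refine ⟨hg, mem_cent.2 ?_⟩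
        rw [← hj]
        exact Commute.zpow_right (show Commute g z from (hzc g hg).symm) _
      have := card_le_of_le this
      rw [hP, hk] at this
      norm_num at this
    have : 79 ^ 2 ∣ card H := by rw [hk]; exact pow_dvd_pow _ hk2
    exact this.trans (card_dvd_of_le inf_le_right)
  obtain ⟨v, hv, h2, h3, h5, h7, h13, h43, h79', hz, hpow⟩ := card_form' (h.dvd (centralizer {u}))
  have e3 := hz 3 (hno 3 (by norm_num) (by norm_num) gr.a379)
  have e5 := hz 5 (hno 5 (by norm_num) (by norm_num) gr.a579)
  have e7 := hz 7 (hno 7 (by norm_num) (by norm_num) gr.a779)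
  have e43 := hz 43 (hno 43 (by norm_num) (by norm_num) gr.a4379)
  have e79 := (hpow 79 2 hp).1 h79
  rw [e3, e5, e7, e43] at hv
  exact ⟨v 79, v 2, v 13, by omega, h2, h13, by rw [hv]; ring⟩

end Cent79

section Cent79b
variable {G : Type*} [Group G] [Fintype G]
variable {T : CTab G} {A : Subgroup G} {i0 X Y : Fin T.n} {V : Finset (Fin T.n → ℤ)} {c : (Fin T.n → ℤ) → Fin T.n}

lemma XYs.val (s : XYs T A i0 X Y V c) (f : FA G A) (h : OD G) {u : G} {e : ℕ} (hu : orderOf u = 79 ^ e) (hu1 : u ≠ 1) :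
    (T.ch X u = 0 ∧ (card (centralizer {u}) = 79 ^ 2 ∨ card (centralizer {u}) = 79 ^ 3)) ∨
    (T.ch X u = 79 ∧ (card (centralizer {u}) = 79 ^ 3 * 13 ∨ card (centralizer {u}) = 79 ^ 3 * 26)) := by
  obtain ⟨d, b, cc, hd, hb, hc, hn⟩ := cent_form h hu hu1
  obtain ⟨x, y, hx, hy, h1, h2, h3, h4, h5, h6⟩ := s.elt f h hu hu1
  rw [h.card] at h4 h5 h6
  have := cent_arith (n := (card (centralizer {u}) : ℤ)) hd hb hc (by rw [hn]; push_cast; ring) h1 h2 h3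
    (by exact_mod_cast h4) (by exact_mod_cast h5) (by exact_mod_cast h6)
  rw [hx]
  rcases this with ⟨k1, k2⟩ | ⟨k1, k2⟩
  · left; exact ⟨by rw [k1]; simp, by exact_mod_cast k2⟩
  · right; exact ⟨by rw [k1]; simp, by exact_mod_cast k2⟩

end Cent79b

/-- the 79-elements whose centralizer has order divisible by 13 -/
def DD (G : Type*) [Group G] : Set G :=
  {u | u ≠ 1 ∧ (∃ e : ℕ, orderOf u = 79 ^ e) ∧ 13 ∣ card (centralizer {u})}

/-- outcome of the character theoretic part -/
structure PH2 (G : Type*) [Group G] : Prop where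
  cent : ∀ u : G, u ≠ 1 → (∃ e : ℕ, orderOf u = 79 ^ e) →
    (u ∉ DD G ∧ (card (centralizer {u}) = 79 ^ 2 ∨ card (centralizer {u}) = 79 ^ 3)) ∨
    (u ∈ DD G ∧ (card (centralizer {u}) = 79 ^ 3 * 13 ∨ card (centralizer {u}) = 79 ^ 3 * 26))
  ex : ∃ u : G, orderOf u = 79 ∧ card (centralizer {u}) = 79 ^ 3 * 26
  cnt : ∀ P : Subgroup G, card P = 79 ^ 3 → (DD G ∩ P).ncard = 12402
  sq : ∀ B : Subgroup G, card B = 79 ^ 2 → (DD G ∩ B).ncard % 79 = 78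
  nonab : ∀ P : Subgroup G, card P = 79 ^ 3 → ¬ ∀ x ∈ P, ∀ y ∈ P, x * y = y * x

section Finish2
variable {G : Type*} [Group G]

lemma cent_pow_eq {u : G} {r s : ℕ} (h : u ^ (r * s) = u) : centralizer {u ^ r} = centralizer {u} := by
  ext g
  rw [mem_cent, mem_cent]
  constructor
  · intro hg
    have : Commute g ((u ^ r) ^ s) := Commute.pow_right hg s
    rw [← pow_mul, h] at this
    exact this
  · intro hg
    exact Commute.pow_right (show Commute g u from hg) r

lemma ord_of_mem [Finite G] {p n : ℕ} (hp : p.Prime) {P : Subgroup G} (hP : card P = p ^ n) {u : G} (hu : u ∈ P) :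
    ∃ e : ℕ, orderOf u = p ^ e := by
  obtain ⟨e, _, he⟩ := (Nat.dvd_prime_pow hp).1 (hP ▸ orderOf_dvd_of_mem hu)
  exact ⟨e, he⟩

lemma DD_pow_dvd [Finite G] {P : Subgroup G} (hP : card P = 79 ^ 3) {p r : ℕ} (hp : p.Prime)
    (h1 : r ^ p % 79 ^ 3 = 1) (h2 : Coprime (r - 1) (79 ^ 3)) (hr : 1 ≤ r) : p ∣ (DD G ∩ P).ncard := by
  classical
  haveI : Fact p.Prime := ⟨hp⟩
  have hu79 : ∀ u ∈ P, u ^ 79 ^ 3 = 1 := fun u hu =>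
    orderOf_dvd_iff_pow_eq_one.1 (hP ▸ orderOf_dvd_of_mem hu)
  have hrp : ∀ u ∈ P, u ^ r ^ p = u := by
    intro u hu
    conv_lhs => rw [← Nat.div_add_mod (r ^ p) (79 ^ 3), h1, pow_add, pow_mul, hu79 u hu, one_pow, one_mul, pow_one]
  haveI : Fintype (DD G ∩ P : Set G) := Fintype.ofFinite _
  have hmem : ∀ u : (DD G ∩ P : Set G), u.1 ^ r ∈ (DD G ∩ P : Set G) := by
    rintro ⟨u, ⟨hu1, ⟨e, he⟩, hu13⟩, huP⟩
    have hs : u ^ (r * r ^ (p - 1)) = u := by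
      rw [← pow_succ', Nat.sub_add_cancel hp.one_le]; exact hrp u huP
    refine ⟨⟨?_, ord_of_mem (by norm_num) hP (P.pow_mem huP r), ?_⟩, P.pow_mem huP r⟩
    · intro h; apply hu1; rw [← hs, pow_mul, h, one_pow]
    · simp only
      rw [cent_pow_eq hs]; exact hu13
  let f : Function.End (DD G ∩ P : Set G) := fun u => ⟨u.1 ^ r, hmem u⟩
  have hiter : ∀ (n : ℕ) (u : (DD G ∩ P : Set G)), ((f ^ n) u).1 = u.1 ^ r ^ n := by
    intro n
    induction n with
    | zero => intro u; rw [pow_zero, pow_zero, pow_one]; rfl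
    | succ n ih =>
      intro u
      rw [pow_succ]
      change ((f ^ n) (f u)).1 = _
      rw [ih]
      change (u.1 ^ r) ^ r ^ n = _
      rw [← pow_mul, pow_succ']
  have hf : f ^ p ^ 1 = 1 := by
    funext u
    apply Subtype.ext
    rw [hiter, pow_one]
    exact hrp _ u.2.2
  have key := Equiv.Perm.card_fixedPoints_modEq hf
  have h0 : Fintype.card (Function.fixedPoints f) = 0 := by
    rw [Fintype.card_eq_zero_iff]
    constructor
    rintro ⟨⟨u, hu, huP⟩, hfix⟩
    have h3 : u ^ r = u := congrArg Subtype.val hfix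
    have h4 : u ^ (r - 1) = 1 := by
      have : u ^ (r - 1) * u = 1 * u := by rw [← pow_succ, Nat.sub_add_cancel hr, h3, one_mul]
      exact mul_right_cancel this
    have h5 := Nat.dvd_gcd (orderOf_dvd_of_pow_eq_one h4) (orderOf_dvd_of_pow_eq_one (hu79 u huP))
    rw [h2.gcd_eq_one, Nat.dvd_one] at h5
    exact hu.1 (orderOf_eq_one_iff.1 h5)
  rw [h0] at key
  rw [← card_coe_set_eq, card_eq_fintype_card]
  exact (Nat.modEq_zero_iff_dvd).1 key

end Finish2

section Finish2b
variable {G : Type*} [Group G] [Fintype G]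
variable {T : CTab G} {A : Subgroup G} {i0 X Y : Fin T.n} {V : Finset (Fin T.n → ℤ)} {c : (Fin T.n → ℤ) → Fin T.n}

open Classical in
lemma XYs.valX (s : XYs T A i0 X Y V c) (f : FA G A) (h : OD G) {n : ℕ} {B : Subgroup G} (hB : card B = 79 ^ n) {u : G}
    (hu : u ∈ B) : T.ch X u = (if u = 1 then 6320 else 0) + 79 * (if u ∈ DD G then 1 else 0) := by
  obtain ⟨e, he⟩ := ord_of_mem (by norm_num) hB hu
  by_cases hu1 : u = 1
  · rw [if_pos hu1, if_neg (fun hh => hh.1 hu1), hu1, T.ch_one, s.dX]; simp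
  rw [if_neg hu1]
  rcases s.val f h he hu1 with ⟨k1, k2⟩ | ⟨k1, k2⟩
  · rw [if_neg, k1]; · simp
    rintro ⟨_, _, h3⟩
    rcases k2 with k2 | k2 <;> rw [k2] at h3 <;> norm_num at h3
  · rw [if_pos, k1]; · simp
    refine ⟨hu1, ⟨e, he⟩, ?_⟩
    rcases k2 with k2 | k2 <;> rw [k2] <;> norm_num

open Classical in
lemma sum_DD (B : Subgroup G) : ∑ b : B, (if (b : G) ∈ DD G then (1 : KK) else 0) = ((DD G ∩ B).ncard : KK) := by
  rw [Finset.sum_boole, Set.ncard_eq_toFinset_card']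
  congr 1
  refine Finset.card_bij (fun b _ => (b : G)) ?_ ?_ ?_
  · intro b hb; simpa using hb
  · intro a _ b _ hab; exact Subtype.ext hab
  · intro g hg; rw [Set.mem_toFinset] at hg
    exact ⟨⟨g, hg.2⟩, by simpa using hg.1, rfl⟩

open Classical in
lemma XYs.sumX (s : XYs T A i0 X Y V c) (f : FA G A) (h : OD G) {n : ℕ} {B : Subgroup G} (hB : card B = 79 ^ n) :
    79 ^ n ∣ 6320 + 79 * (DD G ∩ B).ncard := by
  obtain ⟨m, hm⟩ := T.sub_sum B X
  rw [sum_congr rfl (fun b _ => s.valX f h hB b.2), sum_add_distrib, ← mul_sum, sum_DD] at hm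
  have h1 : ∑ b : B, (if (b : G) = 1 then (6320 : KK) else 0) = 6320 := by
    rw [sum_eq_single 1]
    · simp
    · intro b _ hb; rw [if_neg]; exact fun h => hb (Subtype.ext h)
    · simp
  rw [h1, ← card_eq_fintype_card, hB] at hm
  exact ⟨m, by rw [mul_comm (79 ^ n) m]; exact_mod_cast hm⟩

open Classical in
lemma XYs.nonab (s : XYs T A i0 X Y V c) (f : FA G A) (h : OD G) {P : Subgroup G} (hP : card P = 79 ^ 3)
    (hc : (DD G ∩ P).ncard = 12402) : ¬ ∀ x ∈ P, ∀ y ∈ P, x * y = y * x := by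
  intro hcomm
  haveI : Fintype (P →* KKˣ) := Fintype.ofFinite _
  obtain ⟨m, hm1, hm2⟩ := T.abel P (fun x y => Subtype.ext (hcomm x x.2 y y.2)) X
  have hcardP : Fintype.card P = 79 ^ 3 := by rw [← card_eq_fintype_card, hP]
  have e1 : (∑ l, m l : ℕ) = 6320 := by
    have := hm1 1
    rw [OneMemClass.coe_one, T.ch_one, s.dX] at this
    simp only [map_one, Units.val_one, mul_one] at this
    exact_mod_cast this.symm
  have e2 : ∑ b : P, T.ch X (b : G) * T.ch X ((b⁻¹ : P) : G) = (∑ l, m l * m l : ℕ) * 79 ^ 3 := by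
    have h1 : ∀ b : P, T.ch X (b : G) * T.ch X ((b⁻¹ : P) : G) = ∑ l, (m l : KK) * (((l b⁻¹ : KKˣ) : KK) * T.ch X b) := by
      intro b
      rw [hm1 b⁻¹, mul_sum]
      exact sum_congr rfl (fun l _ => by ring)
    rw [sum_congr rfl (fun b _ => h1 b), sum_comm]
    push_cast
    rw [sum_mul]
    refine sum_congr rfl (fun l _ => ?_)
    rw [← mul_sum, ← hm2 l, hcardP]
    push_cast; ring
  have e3 : ∑ b : P, T.ch X (b : G) * T.ch X ((b⁻¹ : P) : G) = 6320 ^ 2 + 6241 * 12402 := by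
    have h1 : ∀ b : P, T.ch X (b : G) * T.ch X ((b⁻¹ : P) : G) =
        (if (b : G) = 1 then (6320 ^ 2 : KK) else 0) + 6241 * (if (b : G) ∈ DD G then 1 else 0) := by
      intro b
      have hi : (b : G)⁻¹ ∈ DD G ↔ (b : G) ∈ DD G := by
        have : centralizer {(b : G)⁻¹} = centralizer {(b : G)} := by
          ext g
          rw [mem_cent, mem_cent]
          exact Commute.inv_right_iff (a := g)
        simp only [DD, Set.mem_ofPred_eq, orderOf_inv, this, ne_eq, inv_eq_one]
      rw [s.valX f h hP b.2, s.valX f h hP (b⁻¹).2]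
      simp only [hi, Subgroup.coe_inv, inv_eq_one]
      by_cases hb : (b : G) = 1
      · have : (b : G) ∉ DD G := fun hh => hh.1 hb
        rw [if_pos hb, if_pos hb, if_neg this]; ring
      · rw [if_neg hb, if_neg hb]
        split_ifs <;> norm_num
    rw [sum_congr rfl (fun b _ => h1 b), sum_add_distrib, ← mul_sum, sum_DD, hc]
    rw [sum_eq_single 1]
    · simp
    · intro b _ hb; rw [if_neg]; exact fun h => hb (Subtype.ext h)
    · simp
  rw [e3] at e2
  have e4 : 6320 ^ 2 + 6241 * 12402 = (∑ l, m l * m l : ℕ) * 79 ^ 3 := by exact_mod_cast e2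
  have e5 : ∑ l, m l ≤ ∑ l, m l * m l := Finset.sum_le_sum (fun l _ => Nat.le_mul_self _)
  omega

end Finish2b

lemma dd_arith {k : ℕ} (h1 : 79 ^ 3 ∣ 6320 + 79 * k) (h2 : 2 ∣ k) (h3 : 3 ∣ k) (h13 : 13 ∣ k) (hk : k ≤ 79 ^ 3) :
    k = 12402 := by
  norm_num at h1 hk
  obtain ⟨j, rfl⟩ : 78 ∣ k := by omega
  omega

lemma OD.ph2 {G : Type*} [Group G] [Finite G] (h : OD G) : PH2 G := by
  haveI : Fintype G := Fintype.ofFinite G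
  obtain ⟨A, f⟩ := h.fa
  obtain ⟨T⟩ := exists_ctab G
  obtain ⟨i0, X, Y, V, c, s⟩ := exists_XYs h f T
  have hp : Nat.Prime 79 := by norm_num
  have cent : ∀ u : G, u ≠ 1 → (∃ e : ℕ, orderOf u = 79 ^ e) →
    (u ∉ DD G ∧ (Nat.card (centralizer {u}) = 79 ^ 2 ∨ Nat.card (centralizer {u}) = 79 ^ 3)) ∨
    (u ∈ DD G ∧ (Nat.card (centralizer {u}) = 79 ^ 3 * 13 ∨ Nat.card (centralizer {u}) = 79 ^ 3 * 26)) := by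
    rintro u hu1 ⟨e, he⟩
    rcases s.val f h he hu1 with ⟨k1, k2⟩ | ⟨k1, k2⟩
    · left; refine ⟨?_, k2⟩
      rintro ⟨_, _, h3⟩
      rcases k2 with k2 | k2 <;> rw [k2] at h3 <;> norm_num at h3
    · right; refine ⟨⟨hu1, ⟨e, he⟩, ?_⟩, k2⟩
      rcases k2 with k2 | k2 <;> rw [k2] <;> norm_num
  have cnt : ∀ P : Subgroup G, Nat.card P = 79 ^ 3 → (DD G ∩ P).ncard = 12402 := by
    intro P hP
    have h1 := s.sumX f h hP
    have d2 := DD_pow_dvd hP (p := 2) (r := 493038) (by norm_num) (by norm_num) (by norm_num) (by norm_num)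
    have d3 := DD_pow_dvd hP (p := 3) (r := 197997) (by norm_num) (by norm_num) (by norm_num) (by norm_num)
    have d13 := DD_pow_dvd hP (p := 13) (r := 414182) (by norm_num) (by norm_num) (by norm_num) (by norm_num)
    have hle : (DD G ∩ P).ncard ≤ 79 ^ 3 := by
      rw [← hP, ← SetLike.coe_sort_coe, card_coe_set_eq]
      exact Set.ncard_le_ncard Set.inter_subset_right (Set.toFinite _)
    exact dd_arith h1 d2 d3 d13 hle
  refine ⟨cent, ?_, cnt, ?_, ?_⟩
  · obtain ⟨x, y, hx, hy, hxy⟩ := exists_ad h.gr.a279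
    refine ⟨y, hy, ?_⟩
    have h2 : 2 ∣ Nat.card (centralizer {y}) := by
      rw [← hx]; exact orderOf_dvd_of_mem (mem_cent.2 hxy)
    rcases cent y (by rintro rfl; simp at hy) ⟨1, by rw [hy]; rfl⟩ with ⟨_, k | k⟩ | ⟨_, k | k⟩
    · rw [k] at h2; norm_num at h2
    · rw [k] at h2; norm_num at h2
    · rw [k] at h2; norm_num at h2
    · exact k
  · intro B hB
    have h1 := s.sumX f h hB
    omega
  · intro P hP
    exact s.nonab f h hP (cnt P hP)

section SylStruct
open Pointwise
variable {G : Type*} [Group G] [Finite G]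

lemma p79 : Nat.Prime 79 := by norm_num

lemma OD.n79 (h : OD G) : ¬ 79 ^ (3 + 1) ∣ Nat.card G := by rw [h.card]; norm_num

lemma prod_form {A B C : Subgroup G} (hA : A ≤ C) (hB : B ≤ C) (hc : card A * card B = card C)
    (hd : A ⊓ B = ⊥) {c : G} (hcC : c ∈ C) : ∃ a ∈ A, ∃ b ∈ B, c = a * b := by
  have h1 : (A.subgroupOf C).IsComplement' (B.subgroupOf C) := by
    apply isComplement'_of_card_mul_and_disjoint
    · rw [card_congr (subgroupOfEquivOfLe hA).toEquiv, card_congr (subgroupOfEquivOfLe hB).toEquiv, hc]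
    · rw [disjoint_iff, eq_bot_iff_forall]
      rintro x ⟨hx1, hx2⟩
      have : (x : G) ∈ A ⊓ B := ⟨hx1, hx2⟩
      rw [hd, mem_bot] at this
      exact Subtype.ext this
  obtain ⟨⟨a, b⟩, hab⟩ := h1.2 ⟨c, hcC⟩
  exact ⟨a.1.1, a.2, b.1.1, b.2, (congrArg Subtype.val hab).symm⟩

lemma inf_bot_of_prime {p : ℕ} (hp : p.Prime) {A B : Subgroup G} (hA : card A = p) (hAB : ¬ A ≤ B) : A ⊓ B = ⊥ := by
  rcases (Nat.dvd_prime hp).1 (hA ▸ card_dvd_of_le (inf_le_left : A ⊓ B ≤ A)) with h1 | h1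
  · exact card_eq_one.1 h1
  · exact absurd (inf_eq_left.1 (eq_of_le_of_card_ge inf_le_left (by rw [h1, hA]))) hAB

lemma mem_zpowers_of_card {p : ℕ} (hp : p.Prime) {Z : Subgroup G} (hZ : card Z = p) {c z : G} (hc : c ∈ Z) (hc1 : c ≠ 1)
    (hz : z ∈ Z) : z ∈ zpowers c := by
  have h1 : orderOf c = p := ((Nat.dvd_prime hp).1 (hZ ▸ orderOf_dvd_of_mem hc)).resolve_left
    (fun h => hc1 (orderOf_eq_one_iff.1 h))
  have : zpowers c = Z := eq_of_le_of_card_ge (by rwa [zpowers_le]) (by rw [hZ, card_zpowers, h1])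
  rwa [this]

lemma centralizer_le_of_mem_zpowers {u v : G} (h : v ∈ zpowers u) : centralizer {u} ≤ centralizer {v} := by
  obtain ⟨k, rfl⟩ := mem_zpowers_iff.1 h
  intro c hc
  rw [mem_cent] at hc ⊢
  exact Commute.zpow_right (show Commute c u from hc) k

lemma DD_zpowers {u v : G} (hu : u ∈ DD G) (ho : orderOf u = 79) (hv : v ∈ zpowers u) (hv1 : v ≠ 1) : v ∈ DD G := by
  refine ⟨hv1, ⟨1, ?_⟩, ?_⟩
  · rw [pow_one]
    refine ((Nat.dvd_prime p79).1 ?_).resolve_left (fun h => hv1 (orderOf_eq_one_iff.1 h))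
    rw [← ho, ← card_zpowers u]; exact orderOf_dvd_of_mem hv
  · exact hu.2.2.trans (card_dvd_of_le (centralizer_le_of_mem_zpowers hv))

lemma DD_conj {u : G} (g : G) : g * u * g⁻¹ ∈ DD G ↔ u ∈ DD G := by
  unfold DD
  simp only [Set.mem_ofPred_eq, orderOf_conj', ← conj_smul_centralizer, card_conj_smul, ne_eq, conj_eq_one_iff]

/-- the center of a Sylow 79-subgroup -/
def ZP (P : Subgroup G) : Subgroup G := P ⊓ centralizer (P : Set G)

lemma mem_ZP {P : Subgroup G} {z : G} : z ∈ ZP P ↔ z ∈ P ∧ ∀ q ∈ P, z * q = q * z := by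
  unfold ZP
  rw [mem_inf, mem_centralizer_iff]
  exact ⟨fun h => ⟨h.1, fun q hq => (h.2 q hq).symm⟩, fun h => ⟨h.1, fun q hq => (h.2 q hq).symm⟩⟩

lemma ZP_le {P : Subgroup G} : ZP P ≤ P := inf_le_left

lemma ZP_conj {P : Subgroup G} {z : G} (g : G) (hz : z ∈ ZP P) : g * z * g⁻¹ ∈ ZP (conj g • P) := by
  rw [mem_ZP] at hz ⊢
  refine ⟨conj_mem_conj_smul.2 hz.1, fun q hq => ?_⟩
  rw [mem_conj_smul] at hq
  have := hz.2 _ hq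
  calc g * z * g⁻¹ * q = g * (z * (g⁻¹ * q * g)) * g⁻¹ := by group
    _ = g * (g⁻¹ * q * g * z) * g⁻¹ := by rw [this]
    _ = q * (g * z * g⁻¹) := by group

lemma ZP_cards (h : OD G) {P : Subgroup G} (hP : card P = 79 ^ 3) :
    card (ZP P) = 79 ∧ ∀ w ∈ P, w ∉ ZP P → card (P ⊓ centralizer {w} : Subgroup G) = 79 ^ 2 := by
  have key : ∀ w ∈ P, w ∉ ZP P → card (ZP P) = 79 ∧ card (P ⊓ centralizer {w} : Subgroup G) = 79 ^ 2 := by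
    intro w hw hwZ
    obtain ⟨a, ha3, ha⟩ := (Nat.dvd_prime_pow p79).1 (hP ▸ card_dvd_of_le (ZP_le : ZP P ≤ P))
    obtain ⟨b, hb3, hb⟩ := (Nat.dvd_prime_pow p79).1 (hP ▸ card_dvd_of_le (inf_le_left : P ⊓ centralizer {w} ≤ P))
    have hZC : ZP P ≤ P ⊓ centralizer {w} := fun z hz =>
      ⟨(mem_ZP.1 hz).1, mem_cent.2 ((mem_ZP.1 hz).2 w hw)⟩
    have hwC : w ∈ P ⊓ centralizer {w} := ⟨hw, mem_cent.2 rfl⟩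
    have hab : a < b := by
      refine (Nat.pow_lt_pow_iff_right (by norm_num : 1 < 79)).1 ?_
      rw [← ha, ← hb]
      refine lt_of_not_ge (fun hge => hwZ ?_)
      rw [eq_of_le_of_card_ge hZC hge]; exact hwC
    have hb2 : b < 3 := by
      refine (Nat.pow_lt_pow_iff_right (by norm_num : 1 < 79)).1 ?_
      rw [← hP, ← hb]
      refine lt_of_not_ge (fun hge => hwZ ?_)
      rw [mem_ZP]
      refine ⟨hw, fun q hq => ?_⟩
      rw [← eq_of_le_of_card_ge inf_le_left hge] at hq
      exact (mem_cent.1 hq.2).symm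
    have ha0 : a ≠ 0 := by
      rintro rfl
      obtain ⟨z, hzP, hz, hzc⟩ := center_meets (K := P) p79 hP le_rfl le_normalizer (by
        intro hb; rw [hb, card_bot] at hP; norm_num at hP)
      have := orderOf_dvd_of_mem (mem_ZP.2 ⟨hzP, hzc⟩)
      rw [hz, ha] at this; norm_num at this
    obtain rfl : a = 1 := by omega
    obtain rfl : b = 2 := by omega
    exact ⟨ha, hb⟩
  refine ⟨?_, fun w hw hwZ => (key w hw hwZ).2⟩
  by_contra hne
  refine h.ph2.nonab P hP (fun x hx y hy => ?_)
  have : x ∈ ZP P := by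
    by_contra hx'
    exact hne (key x hx hx').1
  exact (mem_ZP.1 this).2 y hy

lemma comm_mem_ZP (h : OD G) {P : Subgroup G} (hP : card P = 79 ^ 3) {g w : G} (hg : g ∈ P) (hw : w ∈ P) :
    g * w * g⁻¹ * w⁻¹ ∈ ZP P := by
  have hZ := (ZP_cards h hP).1
  haveI hn : ((ZP P).subgroupOf P).Normal := by
    constructor
    intro n hn q
    rw [mem_subgroupOf] at hn ⊢
    have h1 : ((q * n * q⁻¹ : P) : G) = n := by
      push_cast
      rw [← (mem_ZP.1 hn).2 q q.2, mul_inv_cancel_right]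
    rwa [h1]
  have hq : card (P ⧸ (ZP P).subgroupOf P) = 79 ^ 2 := by
    have h1 := card_eq_card_quotient_mul_card_subgroup ((ZP P).subgroupOf P)
    rw [card_congr (subgroupOfEquivOfLe (ZP_le : ZP P ≤ P)).toEquiv, hZ, hP] at h1
    omega
  have h2 := comm_of_card_sq p79 (R := (⊤ : Subgroup (P ⧸ (ZP P).subgroupOf P))) (by rw [card_top, hq])
    (a := QuotientGroup.mk ⟨g, hg⟩) (b := QuotientGroup.mk ⟨w, hw⟩) trivial trivial
  have h3 : ((⟨g, hg⟩ * ⟨w, hw⟩ * ⟨g, hg⟩⁻¹ * ⟨w, hw⟩⁻¹ : P) : P ⧸ (ZP P).subgroupOf P) = 1 := by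
    rw [QuotientGroup.mk_mul, QuotientGroup.mk_mul, QuotientGroup.mk_mul, h2, QuotientGroup.mk_inv, QuotientGroup.mk_inv]
    group
  rw [QuotientGroup.eq_one_iff] at h3
  exact h3

lemma conj_coset (h : OD G) {P : Subgroup G} (hP : card P = 79 ^ 3) {w z : G} (hw : w ∈ P) (hwZ : w ∉ ZP P)
    (hz : z ∈ ZP P) : ∃ g ∈ P, g * w * g⁻¹ = w * z := by
  obtain ⟨g, hg, hgw⟩ : ∃ g ∈ P, g * w ≠ w * g := by
    by_contra hcon
    push Not at hcon
    exact hwZ (mem_ZP.2 ⟨hw, fun q hq => (hcon q hq).symm⟩)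
  have hc := comm_mem_ZP h hP hg hw
  obtain ⟨c, hcd⟩ : ∃ c, c = g * w * g⁻¹ * w⁻¹ := ⟨_, rfl⟩
  rw [← hcd] at hc
  have hc1 : c ≠ 1 := by
    intro h1; apply hgw
    rw [h1] at hcd
    have := mul_inv_eq_one.1 hcd.symm
    exact mul_inv_eq_iff_eq_mul.1 this
  obtain ⟨k, hk⟩ := mem_powers_iff_mem_zpowers.2 (mem_zpowers_of_card p79 (ZP_cards h hP).1 hc hc1 hz)
  have hgc : g * w * g⁻¹ = c * w := by rw [hcd]; group
  have hcc := (mem_ZP.1 hc).2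
  have hpow : ∀ k : ℕ, g ^ k * w * (g ^ k)⁻¹ = w * c ^ k := by
    intro k
    induction k with
    | zero => simp
    | succ k ih =>
      have h1 : g * c ^ k * g⁻¹ = c ^ k := by
        have : Commute g (c ^ k) := Commute.pow_right (hcc g hg).symm k
        rw [this.eq, mul_inv_cancel_right]
      calc g ^ (k + 1) * w * (g ^ (k + 1))⁻¹ = g * (g ^ k * w * (g ^ k)⁻¹) * g⁻¹ := by rw [pow_succ']; group
        _ = (g * w * g⁻¹) * (g * c ^ k * g⁻¹) := by rw [ih]; group
        _ = w * c ^ (k + 1) := by rw [h1, hgc, hcc w hw, pow_succ', mul_assoc]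
  exact ⟨g ^ k, P.pow_mem hg k, by rw [hpow]; exact congrArg (w * ·) hk⟩

/-- an element of `DD` generates the center of a Sylow 79-subgroup, which is normal in its centralizer -/
lemma DD_syl (h : OD G) {u : G} (hu : u ∈ DD G) : orderOf u = 79 ∧ ∃ P : Subgroup G, card P = 79 ^ 3 ∧
    ZP P = zpowers u ∧ P ≤ centralizer {u} ∧ centralizer {u} ≤ N[P] := by
  obtain ⟨e, he⟩ := hu.2.1
  obtain ⟨m, hm, hc⟩ : ∃ m, (m = 13 ∨ m = 26) ∧ card (centralizer {u}) = 79 ^ 3 * m := by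
    rcases h.ph2.cent u hu.1 hu.2.1 with ⟨k, _⟩ | ⟨_, k | k⟩
    · exact absurd hu k
    · exact ⟨13, Or.inl rfl, k⟩
    · exact ⟨26, Or.inr rfl, k⟩
  obtain ⟨P, hPC, hP⟩ := sylow_exists_in (G := G) (n := 3) p79 (Dvd.intro _ hc.symm)
  have hN : centralizer {u} ≤ N[P] := by
    refine normal_of_sylow p79 hPC hP hc (by rcases hm with rfl | rfl <;> norm_num) ?_
    intro k hk hk1
    have := le_of_dvd (by omega) hk
    omega
  have huP : u ∈ P := mem_sylow_of_normalizer p79 hP h.n79 he (hN (mem_cent.2 rfl))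
  have huZ : u ∈ ZP P := mem_ZP.2 ⟨huP, fun q hq => (mem_cent.1 (hPC hq)).symm⟩
  have hZ := (ZP_cards h hP).1
  have ho : orderOf u = 79 := ((Nat.dvd_prime p79).1 (hZ ▸ orderOf_dvd_of_mem huZ)).resolve_left
    (fun h => hu.1 (orderOf_eq_one_iff.1 h))
  refine ⟨ho, P, hP, ?_, hPC, hN⟩
  exact (eq_of_le_of_card_ge (by rwa [zpowers_le]) (by rw [hZ, card_zpowers, ho])).symm

lemma ZP_DD (h : OD G) {P : Subgroup G} (hP : card P = 79 ^ 3) {z : G} (hz : z ∈ ZP P) (hz1 : z ≠ 1) : z ∈ DD G := by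
  obtain ⟨u, hu, huc⟩ := h.ph2.ex
  have huD : u ∈ DD G := by
    refine ⟨by rintro rfl; simp at hu, ⟨1, by rw [hu, pow_one]⟩, by rw [huc]; norm_num⟩
  obtain ⟨_, Q, hQ, hQZ, _, _⟩ := DD_syl h huD
  obtain ⟨g, _, hg⟩ := sylow_conj_in p79 (le_top : Q ≤ ⊤) hQ (by rw [card_top]; exact h.n79) (le_top : P ≤ ⊤)
    (isPGroup_of_card hP)
  have hg' := conj_eq_of_le hg (by rw [hP, hQ])
  have h1 := ZP_conj g hz
  rw [hg', hQZ] at h1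
  rw [← DD_conj g]
  exact DD_zpowers huD hu h1 (by rwa [ne_eq, conj_eq_one_iff])

/-- special subgroups: order 79^2 with all nontrivial elements in `DD` -/
def Sp (S : Subgroup G) : Prop := card S = 79 ^ 2 ∧ ∀ x ∈ S, x ≠ 1 → x ∈ DD G

lemma Sp_cent (h : OD G) {P : Subgroup G} (hP : card P = 79 ^ 3) {w : G} (hw : w ∈ P) (hwD : w ∈ DD G) (hwZ : w ∉ ZP P) :
    Sp (P ⊓ centralizer {w}) := by
  have hC := (ZP_cards h hP).2 w hw hwZ
  have hZ := (ZP_cards h hP).1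
  have ho := (DD_syl h hwD).1
  refine ⟨hC, fun v hv hv1 => ?_⟩
  have hwC : w ∈ P ⊓ centralizer {w} := ⟨hw, mem_cent.2 rfl⟩
  have hZC : ZP P ≤ P ⊓ centralizer {w} := fun z hz =>
      ⟨(mem_ZP.1 hz).1, mem_cent.2 ((mem_ZP.1 hz).2 w hw)⟩
  have hd : zpowers w ⊓ ZP P = ⊥ := inf_bot_of_prime p79 (by rw [card_zpowers, ho]) (by rwa [zpowers_le])
  obtain ⟨a, ha, z, hz, rfl⟩ := prod_form (by rwa [zpowers_le]) hZC (by rw [hZ, hC, card_zpowers, ho]; norm_num) hd hv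
  by_cases ha1 : a = 1
  · rw [ha1, one_mul] at hv1 ⊢
    exact ZP_DD h hP hz hv1
  have haD := DD_zpowers hwD ho ha ha1
  have haP : a ∈ P := by
    have : zpowers w ≤ P := by rwa [zpowers_le]
    exact this ha
  have haZ : a ∉ ZP P := fun h2 => by
    have : a ∈ zpowers w ⊓ ZP P := ⟨ha, h2⟩
    rw [hd, mem_bot] at this
    exact ha1 this
  obtain ⟨g, _, hg⟩ := conj_coset h hP haP haZ hz
  rw [← hg, DD_conj]
  exact haD

/-- the two special subgroups of a Sylow subgroup -/
structure SY (P E F : Subgroup G) : Prop where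
  hP : card P = 79 ^ 3
  hE : Sp E
  hF : Sp F
  EP : E ≤ P
  FP : F ≤ P
  EF : E ⊓ F = ZP P
  all : ∀ u ∈ P, u ∈ DD G → u ∈ E ∨ u ∈ F

lemma exists_SY (h : OD G) {P : Subgroup G} (hP : card P = 79 ^ 3) : ∃ E F, SY P E F := by
  have hZ := (ZP_cards h hP).1
  have hcnt := h.ph2.cnt P hP
  have hcard : ∀ K : Subgroup G, (K : Set G).ncard = card K := fun K => rfl
  have hZle : ∀ w ∈ P, ZP P ≤ P ⊓ centralizer {w} := fun w hw z hz =>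
    ⟨(mem_ZP.1 hz).1, mem_cent.2 ((mem_ZP.1 hz).2 w hw)⟩
  have hout : ∀ K : Subgroup G, card K ≤ 79 ^ 2 → ∃ w ∈ P, w ∈ DD G ∧ w ∉ K := by
    intro K hK
    by_contra hcon
    push Not at hcon
    have : (DD G ∩ P).ncard ≤ (K : Set G).ncard := Set.ncard_le_ncard (fun w hw => hcon w hw.2 hw.1) (Set.toFinite _)
    rw [hcnt, hcard] at this
    omega
  obtain ⟨w, hw, hwD, hwZ⟩ := hout (ZP P) (by rw [hZ]; norm_num)
  have hE := Sp_cent h hP hw hwD hwZ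
  obtain ⟨v, hv, hvD, hvE⟩ := hout (P ⊓ centralizer {w}) hE.1.le
  have hvZ : v ∉ ZP P := fun hh => hvE (hZle w hw hh)
  have hF := Sp_cent h hP hv hvD hvZ
  have hvF : v ∈ P ⊓ centralizer {v} := ⟨hv, mem_cent.2 rfl⟩
  obtain ⟨E, hEd⟩ : ∃ E, E = P ⊓ centralizer {w} := ⟨_, rfl⟩
  obtain ⟨F, hFd⟩ : ∃ F, F = P ⊓ centralizer {v} := ⟨_, rfl⟩
  have hZE := hZle w hw
  have hZF := hZle v hv
  have hEP : P ⊓ centralizer {w} ≤ P := inf_le_left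
  have hFP : P ⊓ centralizer {v} ≤ P := inf_le_left
  rw [← hEd] at hE hvE hZE hEP
  rw [← hFd] at hF hvF hZF hFP
  have hEF : E ⊓ F = ZP P := by
    refine (eq_of_le_of_card_ge (le_inf hZE hZF) ?_).symm
    obtain ⟨a, ha2, ha⟩ := (Nat.dvd_prime_pow p79).1 (hF.1 ▸ card_dvd_of_le (inf_le_right : E ⊓ F ≤ F))
    have : a < 2 := by
      refine lt_of_le_of_ne ha2 ?_
      rintro rfl
      have h1 := eq_of_le_of_card_ge (inf_le_right : E ⊓ F ≤ F) (by rw [ha, hF.1])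
      rw [← h1] at hvF
      exact hvE hvF.1
    rw [ha, hZ]
    calc 79 ^ a ≤ 79 ^ 1 := Nat.pow_le_pow_right (by norm_num) (by omega)
      _ = 79 := pow_one _
  refine ⟨E, F, hP, hE, hF, hEP, hFP, hEF, ?_⟩
  have hsub : ((E : Set G) ∪ F) \ {1} ⊆ DD G ∩ P := by
    rintro x ⟨hx | hx, hx1⟩
    · exact ⟨hE.2 x hx hx1, hEP hx⟩
    · exact ⟨hF.2 x hx hx1, hFP hx⟩
  have hn : (((E : Set G) ∪ F) \ {1}).ncard = 12402 := by
    have h1 := Set.ncard_union_add_ncard_inter (E : Set G) F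
    have h2 := Set.ncard_sdiff_singleton_add_one (s := (E : Set G) ∪ F) (a := 1) (Or.inl E.one_mem)
    rw [← coe_inf, hEF, hcard, hcard, hcard, hE.1, hF.1, hZ] at h1
    omega
  have heq := Set.eq_of_subset_of_ncard_le hsub (by rw [hn, hcnt])
  intro u hu huD
  have : u ∈ ((E : Set G) ∪ F) \ {1} := by rw [heq]; exact ⟨huD, hu⟩
  exact this.1

lemma le_or_le_of_union {S E F : Subgroup G} (h : ∀ x ∈ S, x ∈ E ∨ x ∈ F) : S ≤ E ∨ S ≤ F := by
  by_contra hcon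
  push Not at hcon
  obtain ⟨⟨a, ha, haE⟩, ⟨b, hb, hbF⟩⟩ := SetLike.not_le_iff_exists.1 hcon.1, SetLike.not_le_iff_exists.1 hcon.2
  have haF := (h a ha).resolve_left haE
  have hbE := (h b hb).resolve_right hbF
  rcases h _ (S.mul_mem ha hb) with h1 | h1
  · exact haE ((E.mul_mem_cancel_right hbE).1 h1)
  · exact hbF ((F.mul_mem_cancel_left haF).1 h1)

lemma Sp.comm {S : Subgroup G} (hS : Sp S) {a b : G} (ha : a ∈ S) (hb : b ∈ S) : a * b = b * a :=
  comm_of_card_sq p79 hS.1 ha hb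

lemma Sp.ord (h : OD G) {S : Subgroup G} (hS : Sp S) {a : G} (ha : a ∈ S) (ha1 : a ≠ 1) : orderOf a = 79 :=
  (DD_syl h (hS.2 a ha ha1)).1

lemma Sp.conj {S : Subgroup G} (hS : Sp S) (g : G) : Sp (MulAut.conj g • S) := by
  refine ⟨by rw [card_conj_smul, hS.1], fun x hx hx1 => ?_⟩
  rw [mem_conj_smul] at hx
  have h1 : g⁻¹ * x * g ≠ 1 := by
    intro h2; apply hx1
    calc x = g * (g⁻¹ * x * g) * g⁻¹ := by group
      _ = 1 := by rw [h2]; group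
  have := (DD_conj g).2 (hS.2 _ hx h1)
  rwa [show g * (g⁻¹ * x * g) * g⁻¹ = x by group] at this

lemma Sp.gen (h : OD G) {S T : Subgroup G} (hS : Sp S) (hT : card T = 79 ^ 2) {a b : G} (ha : a ∈ S) (hb : b ∈ S) (ha1 : a ≠ 1)
    (hab : b ∉ zpowers a) (haT : a ∈ T) (hbT : b ∈ T) : S = T := by
  have hb1 : b ≠ 1 := fun h => hab (h ▸ one_mem _)
  refine eq_of_le_of_card_ge (fun c hc => ?_) (by rw [hT, hS.1])
  have hoa := hS.ord h ha ha1
  have hob := hS.ord h hb hb1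
  obtain ⟨x, hx, y, hy, rfl⟩ := prod_form (A := zpowers b) (B := zpowers a) (C := S) (by rwa [zpowers_le])
    (by rwa [zpowers_le]) (by rw [card_zpowers, card_zpowers, hoa, hob, hS.1]; norm_num)
    (inf_bot_of_prime p79 (by rw [card_zpowers, hob]) (by rwa [zpowers_le])) hc
  exact T.mul_mem ((zpowers_le.2 hbT) hx) ((zpowers_le.2 haT) hy)

lemma Sp.exists_notMem (h : OD G) {S : Subgroup G} (hS : Sp S) {a : G} (ha : a ∈ S) (ha1 : a ≠ 1) : ∃ b ∈ S, b ∉ zpowers a := by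
  by_contra hcon
  push Not at hcon
  have := card_le_of_le (show S ≤ zpowers a from hcon)
  rw [hS.1, card_zpowers, hS.ord h ha ha1] at this
  omega

lemma Sp.exists_ne {S : Subgroup G} (hS : Sp S) : ∃ a ∈ S, a ≠ 1 := by
  by_contra hcon
  push Not at hcon
  have := (eq_bot_iff_forall S).2 hcon
  have h1 := hS.1
  rw [this, card_bot] at h1
  norm_num at h1

lemma SY.sp {P E F S : Subgroup G} (s : SY P E F) (hS : Sp S) (hSP : S ≤ P) : S = E ∨ S = F := by
  have : ∀ x ∈ S, x ∈ E ∨ x ∈ F := by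
    intro x hx
    by_cases hx1 : x = 1
    · left; rw [hx1]; exact E.one_mem
    · exact s.all x (hSP hx) (hS.2 x hx hx1)
  rcases le_or_le_of_union this with h1 | h1
  · left; exact eq_of_le_of_card_ge h1 (by rw [s.hE.1, hS.1])
  · right; exact eq_of_le_of_card_ge h1 (by rw [s.hF.1, hS.1])

lemma SY.ne (h : OD G) {P E F : Subgroup G} (s : SY P E F) : E ≠ F := by
  intro h1
  have h2 := s.EF
  rw [← h1, inf_idem] at h2
  have := s.hE.1
  rw [h2, (ZP_cards h s.hP).1] at this
  norm_num at this

lemma SY.swap {P E F : Subgroup G} (s : SY P E F) : SY P F E :=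
  ⟨s.hP, s.hF, s.hE, s.FP, s.EP, inf_comm E F ▸ s.EF, fun u hu hD => (s.all u hu hD).symm⟩

lemma SY.norm (h : OD G) {P E F : Subgroup G} (s : SY P E F) : P ≤ N[E] := by
  intro g hg
  rw [mem_normalizer_conj]
  refine conj_eq_of_le (fun x hx => ?_) le_rfl
  rw [mem_conj_smul] at hx
  have h1 := comm_mem_ZP h s.hP hg (s.EP hx)
  have h2 : ZP P ≤ E := s.EF ▸ inf_le_left
  have h3 := E.mul_mem (h2 h1) hx
  rwa [show g * (g⁻¹ * x * g) * g⁻¹ * (g⁻¹ * x * g)⁻¹ * (g⁻¹ * x * g) = x by group] at h3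

/-- the data attached to an element of `DD` -/
lemma DD_two (h : OD G) {u : G} (hu : u ∈ DD G) : ∃ P E F : Subgroup G, SY P E F ∧ ZP P = zpowers u ∧
    centralizer {u} ≤ N[P] ∧ P ≤ centralizer {u} ∧ u ∈ E ∧ u ∈ F ∧ ∀ S, Sp S → u ∈ S → S = E ∨ S = F := by
  obtain ⟨_, P, hP, hZ, hPC, hN⟩ := DD_syl h hu
  obtain ⟨E, F, s⟩ := exists_SY h hP
  have huZ : u ∈ E ⊓ F := by rw [s.EF, hZ]; exact mem_zpowers u
  refine ⟨P, E, F, s, hZ, hN, hPC, huZ.1, huZ.2, fun S hS huS => s.sp hS ?_⟩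
  refine le_of_le_normalizer_sylow p79 hP h.n79 (isPGroup_of_card hS.1) (le_trans (fun x hx => ?_) hN)
  exact mem_cent.2 (hS.comm hx huS)

lemma Sp.two (h : OD G) {S : Subgroup G} (hS : Sp S) {u : G} (hu : u ∈ S) (hu1 : u ≠ 1) : ∃ P F : Subgroup G, SY P S F ∧
    ZP P = zpowers u ∧ centralizer {u} ≤ N[P] ∧ P ≤ centralizer {u} ∧ u ∈ F ∧
    ∀ T, Sp T → u ∈ T → T = S ∨ T = F := by
  obtain ⟨P, E, F, s, hZ, hN, hPC, huE, huF, hall⟩ := DD_two h (hS.2 u hu hu1)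
  rcases hall S hS hu with rfl | rfl
  · exact ⟨P, F, s, hZ, hN, hPC, huF, hall⟩
  · exact ⟨P, E, s.swap, hZ, hN, hPC, huE, fun T hT huT => (hall T hT huT).symm⟩

lemma Sp.move (h : OD G) {S : Subgroup G} (hS : Sp S) {u v : G} (hu : u ∈ S) (hu1 : u ≠ 1) (hv : v ∈ S) (hvu : v ∉ zpowers u) :
    ∃ g ∈ N[S], g * v * g⁻¹ = v * u := by
  obtain ⟨P, F, s, hZ, hN, hPC, huF, hall⟩ := hS.two h hu hu1
  obtain ⟨g, hg, hgv⟩ := conj_coset h s.hP (s.EP hv) (hZ ▸ hvu) (z := u) (hZ ▸ mem_zpowers u)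
  exact ⟨g, s.norm h hg, hgv⟩

lemma Sp.move' (h : OD G) {S : Subgroup G} (hS : Sp S) {a b : G} (ha : a ∈ S) (ha1 : a ≠ 1) (hb : b ∈ S) (hab : b ∉ zpowers a) :
    ∃ g ∈ N[S], g * a * g⁻¹ = b := by
  have hc : a⁻¹ * b ∈ S := S.mul_mem (S.inv_mem ha) hb
  have hc1 : a⁻¹ * b ≠ 1 := by
    intro h1; rw [inv_mul_eq_one] at h1; rw [← h1] at hab; exact hab (mem_zpowers a)
  have hac : a ∉ zpowers (a⁻¹ * b) := by
    intro h1
    have h2 : a⁻¹ * b ∈ zpowers a := mem_zpowers_of_card p79 (Z := zpowers (a⁻¹ * b))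
      (by rw [card_zpowers, hS.ord h hc hc1]) h1 ha1 (mem_zpowers _)
    exact hab (((zpowers a).mul_mem_cancel_left ((zpowers a).inv_mem (mem_zpowers a))).1 h2)
  obtain ⟨g, hg, hgv⟩ := hS.move h hc hc1 ha hac
  exact ⟨g, hg, by rw [hgv]; group⟩

lemma Sp.trans (h : OD G) {S : Subgroup G} (hS : Sp S) {a b : G} (ha : a ∈ S) (ha1 : a ≠ 1) (hb : b ∈ S) (hb1 : b ≠ 1) :
    ∃ g ∈ N[S], g * a * g⁻¹ = b := by
  by_cases hab : b ∈ zpowers a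
  · obtain ⟨c, hc, hca⟩ := hS.exists_notMem h ha ha1
    obtain ⟨g, hg, hgc⟩ := hS.move' h ha ha1 hc hca
    have hc1 : c ≠ 1 := fun h => hca (h ▸ one_mem _)
    have hbc : b ∉ zpowers c := by
      intro h1
      apply hca
      have h2 : c ∈ zpowers b := mem_zpowers_of_card p79 (Z := zpowers c)
        (by rw [card_zpowers, hS.ord h hc hc1]) h1 hb1 (mem_zpowers _)
      exact (zpowers_le.2 hab) h2
    obtain ⟨g', hg', hgc'⟩ := hS.move' h hc hc1 hb hbc
    refine ⟨g' * g, mul_mem hg' hg, ?_⟩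
    rw [← hgc', ← hgc]; group
  · exact hS.move' h ha ha1 hb hab

lemma Sp.cent (h : OD G) {S : Subgroup G} (hS : Sp S) {x : G} {e : ℕ} (hx : orderOf x = 79 ^ e) (hc : ∀ s ∈ S, x * s = s * x) :
    x ∈ S := by
  obtain ⟨u, hu, hu1⟩ := hS.exists_ne
  obtain ⟨v, hv, hvu⟩ := hS.exists_notMem h hu hu1
  obtain ⟨P, F, s, hZ, hN, hPC, huF, hall⟩ := hS.two h hu hu1
  have hxP : x ∈ P := mem_sylow_of_normalizer p79 s.hP h.n79 hx (hN (mem_cent.2 (hc u hu)))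
  have hle : S ≤ P ⊓ centralizer {v} := fun y hy => ⟨s.EP hy, mem_cent.2 (hS.comm hy hv)⟩
  rw [eq_of_le_of_card_ge hle (by rw [(ZP_cards h s.hP).2 v (s.EP hv) (hZ ▸ hvu), hS.1])]
  exact ⟨hxP, mem_cent.2 (hc v hv)⟩

lemma DD_class (h : OD G) {u v : G} (hu : u ∈ DD G) (hv : v ∈ DD G) : ∃ g, g * u * g⁻¹ = v := by
  obtain ⟨_, Q, hQ, hQZ, _, _⟩ := DD_syl h hu
  obtain ⟨P, E, F, s, hZ, _, _, hvE, _, _⟩ := DD_two h hv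
  obtain ⟨g, _, hg⟩ := sylow_conj_in p79 (le_top : P ≤ ⊤) s.hP (by rw [card_top]; exact h.n79) (le_top : Q ≤ ⊤)
    (isPGroup_of_card hQ)
  have hg' := conj_eq_of_le hg (by rw [s.hP, hQ])
  have h1 : g * u * g⁻¹ ∈ ZP P := by
    rw [← hg']; exact ZP_conj g (hQZ ▸ mem_zpowers u)
  have h2 : ZP P ≤ E := s.EF ▸ inf_le_left
  obtain ⟨k, _, hk⟩ := s.hE.trans h (h2 h1) (by rw [ne_eq, conj_eq_one_iff]; exact hu.1) hvE hv.1
  exact ⟨k * g, by rw [← hk]; group⟩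

lemma DD_card (h : OD G) {u : G} (hu : u ∈ DD G) : card (centralizer {u}) = 79 ^ 3 * 26 := by
  obtain ⟨v, hv, hvc⟩ := h.ph2.ex
  have hvD : v ∈ DD G := by
    refine ⟨by rintro rfl; simp at hv, ⟨1, by rw [hv, pow_one]⟩, by rw [hvc]; norm_num⟩
  obtain ⟨g, hg⟩ := DD_class h hvD hu
  rw [← hg, ← conj_smul_centralizer, card_conj_smul, hvc]

/-- the centralizer of `u` normalizes the special subgroups containing `u` -/
lemma Sp.norm (h : OD G) {S : Subgroup G} (hS : Sp S) {u : G} (hu : u ∈ S) (hu1 : u ≠ 1) :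
    centralizer {u} ≤ N[S] := by
  intro g hg
  obtain ⟨P, F, s, hZ, hN, hPC, huF, hall⟩ := hS.two h hu hu1
  have hor : ∀ x ∈ centralizer {u}, ∀ T, Sp T → u ∈ T → MulAut.conj x • T = S ∨ MulAut.conj x • T = F := by
    intro x hx T hT huT
    refine hall _ (hT.conj x) ?_
    rw [mem_conj_smul]
    rw [mem_cent] at hx
    rw [mul_assoc, ← hx, inv_mul_cancel_left]; exact huT
  have hinj : ∀ (x : G) (A B : Subgroup G), MulAut.conj x • A = MulAut.conj x • B → A = B :=
    fun x A B hAB => smul_left_cancel _ hAB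
  have hne := s.ne h
  by_contra hgS
  rw [mem_normalizer_conj] at hgS
  have g1 : MulAut.conj g • S = F := (hor g hg S hS hu).resolve_left hgS
  have g2 : MulAut.conj g • F = S := (hor g hg F s.hF huF).resolve_right (fun hh => hne (hinj g _ _ (g1.trans hh.symm)))
  -- an involution swapping the two subgroups
  obtain ⟨t, htd⟩ : ∃ t, t = g ^ (79 ^ 3 * 13) := ⟨_, rfl⟩
  have htC : t ∈ centralizer {u} := htd ▸ pow_mem hg _
  have ht2 : t * t = 1 := by
    have := orderOf_dvd_of_mem hg
    rw [DD_card h (hS.2 u hu hu1)] at this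
    rw [htd, ← pow_add]
    exact orderOf_dvd_iff_pow_eq_one.1 this
  have hev : ∀ k, MulAut.conj (g ^ (2 * k)) • S = S := by
    intro k
    induction k with
    | zero => simp
    | succ k ih =>
      rw [show 2 * (k + 1) = 2 * k + 1 + 1 by ring, pow_succ, pow_succ, map_mul, map_mul, mul_smul, mul_smul, g1, g2, ih]
  have ht : MulAut.conj t • S = F := by
    rw [htd, show 79 ^ 3 * 13 = 2 * 3204753 + 1 by norm_num, pow_succ', map_mul, mul_smul, hev, g1]
  obtain ⟨w, hw, hwu⟩ := hS.exists_notMem h hu hu1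
  have ht' : t⁻¹ = t := inv_eq_of_mul_eq_one_left ht2
  have hw' : t * w * t ∈ F := by
    have : t * w * t⁻¹ ∈ MulAut.conj t • S := conj_mem_conj_smul.2 hw
    rwa [ht, ht'] at this
  obtain ⟨v, hv⟩ : ∃ v, v = t * w * t := ⟨_, rfl⟩
  rw [← hv] at hw'
  have hvw : t * v * t = w := by
    rw [hv, show t * (t * w * t) * t = (t * t) * w * (t * t) by group, ht2, one_mul, mul_one]
  have hc := comm_mem_ZP h s.hP (s.FP hw') (s.EP hw)
  obtain ⟨k, hk⟩ := mem_zpowers_iff.1 (hZ ▸ hc)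
  have htu : t * u = u * t := mem_cent.1 htC
  have h3 : t * (v * w * v⁻¹ * w⁻¹) * t = v * w * v⁻¹ * w⁻¹ := by
    rw [← hk]
    have : Commute t (u ^ k) := Commute.zpow_right htu k
    rw [this.eq, mul_assoc, ht2, mul_one]
  have h4 : t * (v * w * v⁻¹ * w⁻¹) * t = w * v * w⁻¹ * v⁻¹ := by
    calc t * (v * w * v⁻¹ * w⁻¹) * t = (t * v * t⁻¹) * (t * w * t⁻¹) * (t * v * t⁻¹)⁻¹ * (t * w * t⁻¹)⁻¹ * (t * t) := by group
      _ = w * v * w⁻¹ * v⁻¹ := by rw [ht2, ht', hvw, ← hv, mul_one]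
  have h5 : (v * w * v⁻¹ * w⁻¹) * (v * w * v⁻¹ * w⁻¹) = 1 := by
    nth_rw 1 [← h3, h4]; group
  have h6 : v * w * v⁻¹ * w⁻¹ = 1 := by
    by_contra hne1
    have h7 : orderOf (v * w * v⁻¹ * w⁻¹) = 79 := (DD_syl h (ZP_DD h s.hP hc hne1)).1
    have h8 : orderOf (v * w * v⁻¹ * w⁻¹) ∣ 2 := orderOf_dvd_of_pow_eq_one (by rw [pow_two, h5])
    rw [h7] at h8; norm_num at h8
  -- so v centralizes S
  have hvS : v ∈ P ⊓ centralizer {w} := ⟨s.FP hw', mem_cent.2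
    (mul_inv_eq_iff_eq_mul.1 (mul_inv_eq_one.1 h6))⟩
  have hle : S ≤ P ⊓ centralizer {w} := fun y hy => ⟨s.EP hy, mem_cent.2 (hS.comm hy hw)⟩
  rw [← eq_of_le_of_card_ge hle (by rw [(ZP_cards h s.hP).2 w (s.EP hw) (hZ ▸ hwu), hS.1])] at hvS
  have h9 : v ∈ S ⊓ F := ⟨hvS, hw'⟩
  rw [s.EF, hZ] at h9
  apply hwu
  obtain ⟨j, hj⟩ := mem_zpowers_iff.1 h9
  have : Commute t (u ^ j) := Commute.zpow_right htu j
  rw [← hvw, ← hj, this.eq, mul_assoc, ht2, mul_one]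
  exact mem_zpowers_iff.2 ⟨j, rfl⟩

lemma Sp.not_conj (h : OD G) {S T : Subgroup G} (hS : Sp S) (hT : Sp T) {u : G} (hu : u ∈ S) (huT : u ∈ T) (hu1 : u ≠ 1)
    (hne : S ≠ T) (g : G) : MulAut.conj g • S ≠ T := by
  intro hg
  have h1 : g * u * g⁻¹ ∈ T := by rw [← hg]; exact conj_mem_conj_smul.2 hu
  obtain ⟨k, hk, hku⟩ := hT.trans h h1 (by rwa [ne_eq, conj_eq_one_iff]) huT hu1
  have h2 : k * g ∈ centralizer {u} := by
    rw [mem_cent]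
    rw [show k * (g * u * g⁻¹) * k⁻¹ = k * g * u * (k * g)⁻¹ by group] at hku
    exact mul_inv_eq_iff_eq_mul.1 hku
  have h3 := mem_normalizer_conj.1 (hS.norm h hu hu1 h2)
  rw [map_mul, mul_smul, hg, mem_normalizer_conj.1 hk] at h3
  exact hne h3.symm

lemma Sp.card_norm (h : OD G) {S : Subgroup G} (hS : Sp S) : card N[S] = 6240 * (79 ^ 3 * 26) := by
  obtain ⟨u, hu, hu1⟩ := hS.exists_ne
  have hC := hS.norm h hu hu1
  choose k hk hku using fun x : ((S : Set G) \ {1} : Set G) => hS.trans h hu hu1 x.2.1 x.2.2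
  have hx : card ((S : Set G) \ {1} : Set G) = 6240 := by
    have h2 := Set.ncard_sdiff_singleton_add_one (s := (S : Set G)) (a := 1) S.one_mem
    have h3 : (S : Set G).ncard = card S := rfl
    rw [h3, hS.1] at h2
    rw [card_coe_set_eq]; omega
  rw [← hx, ← DD_card h (hS.2 u hu hu1), ← Nat.card_prod]
  symm
  refine Nat.card_eq_of_bijective (fun p => ⟨k p.1 * p.2, mul_mem (hk p.1) (hC p.2.2)⟩) ⟨?_, ?_⟩
  · have hval : ∀ (x : ((S : Set G) \ {1} : Set G)) (c : centralizer {u}), (k x * c) * u * (k x * c)⁻¹ = x := by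
      intro x c
      have h2 := mem_cent.1 c.2
      rw [← hku x, mul_inv_rev, show k x * (c : G) * u * ((c : G)⁻¹ * (k x)⁻¹) = k x * ((c : G) * u * (c : G)⁻¹) * (k x)⁻¹ by group,
        h2, mul_inv_cancel_right]
    rintro ⟨x, c⟩ ⟨y, d⟩ hxy
    have h1 : k x * c = k y * d := congrArg Subtype.val hxy
    have h2 := hval x c
    rw [h1, hval] at h2
    have h3 : y = x := Subtype.ext h2
    rw [h3] at h1 ⊢
    rw [show c = d from Subtype.ext (mul_left_cancel h1)]
  · rintro ⟨g, hg⟩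
    have h1 : g * u * g⁻¹ ∈ (S : Set G) \ {1} := by
      refine ⟨((mem_normalizer_iff.1 hg) u).1 hu, ?_⟩
      rw [Set.mem_singleton_iff, conj_eq_one_iff]; exact hu1
    refine ⟨(⟨_, h1⟩, ⟨(k ⟨_, h1⟩)⁻¹ * g, ?_⟩), Subtype.ext (mul_inv_cancel_left _ _)⟩
    have h2 := hku ⟨_, h1⟩
    rw [mem_cent]
    generalize k ⟨_, h1⟩ = a at h2
    change a * u * a⁻¹ = g * u * g⁻¹ at h2
    calc a⁻¹ * g * u = a⁻¹ * (g * u * g⁻¹) * g := by group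
      _ = u * (a⁻¹ * g) := by rw [← h2]; group

lemma Sp.card_conj (h : OD G) {S : Subgroup G} (hS : Sp S) : card (conjSet (⊤ : Subgroup G) S) = 6321 := by
  have h1 := card_conjSet (⊤ : Subgroup G) S
  rw [top_inf_eq, hS.card_norm h, card_top, h.card] at h1
  omega

/-- Incidence: nontrivial intersection. -/
def Inc (p m : Subgroup G) : Prop := ∃ w, w ≠ 1 ∧ w ∈ p ∧ w ∈ m

lemma Inc.symm {p m : Subgroup G} : Inc p m → Inc m p := fun ⟨w, h, h1, h2⟩ => ⟨w, h, h2, h1⟩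

lemma Inc.conj {p m : Subgroup G} (g : G) : Inc p m → Inc (MulAut.conj g • p) (MulAut.conj g • m) := fun ⟨w, h, h1, h2⟩ =>
  ⟨g * w * g⁻¹, by rwa [ne_eq, conj_eq_one_iff], conj_mem_conj_smul.2 h1, conj_mem_conj_smul.2 h2⟩

lemma Inc.fix (h : OD G) {p l : Subgroup G} (hp : Sp p) (hl : Sp l) {u : G} (hu : u ∈ p) : Inc p l → MulAut.conj u • l = l :=
  fun ⟨w, h1, hwp, hwl⟩ => mem_normalizer_conj.1
    (hl.norm h hwl h1 (mem_cent.2 (hp.comm hu hwp)))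

/-- The two classes of special subgroups, as points and lines. -/
structure GEO (Pt Ln : Set (Subgroup G)) : Prop where
  sp : ∀ S, S ∈ Pt → Sp S
  sl : ∀ S, S ∈ Ln → Sp S
  conjP : ∀ S, S ∈ Pt → ∀ g : G, conj g • S ∈ Pt
  conjL : ∀ S, S ∈ Ln → ∀ g : G, conj g • S ∈ Ln
  exP : ∀ u ∈ DD G, ∃ p ∈ Pt, u ∈ p
  exL : ∀ u ∈ DD G, ∃ p ∈ Ln, u ∈ p
  uP : ∀ p ∈ Pt, ∀ q ∈ Pt, Inc p q → p = q
  uL : ∀ p ∈ Ln, ∀ q ∈ Ln, Inc p q → p = q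
  disj : ∀ p ∈ Pt, p ∉ Ln
  cov : ∀ S, Sp S → S ∈ Pt ∨ S ∈ Ln
  card : card Pt = 6321

lemma class_uniq (h : OD G) {E : Subgroup G} (hE : Sp E) : ∀ p ∈ conjSet ⊤ E, ∀ q ∈ conjSet ⊤ E, Inc p q → p = q := by
  rintro p ⟨a, _, rfl⟩ q ⟨b, _, rfl⟩ ⟨u, hu1, hup, huq⟩
  by_contra hne
  refine (hE.conj a).not_conj h (hE.conj b) hup huq hu1 hne (b * a⁻¹) ?_
  rw [map_mul, mul_smul, map_inv, inv_smul_smul]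

lemma class_conj {E : Subgroup G} : ∀ p ∈ conjSet ⊤ E, ∀ g : G, conj g • p ∈ conjSet ⊤ E := by
  rintro p ⟨a, _, rfl⟩ g
  exact ⟨g * a, mem_top _, by rw [map_mul, mul_smul]⟩

lemma exists_GEO (h : OD G) : ∃ Pt Ln : Set (Subgroup G), GEO Pt Ln := by
  obtain ⟨u, hu, huc⟩ := h.ph2.ex
  have huD : u ∈ DD G := ⟨by rintro rfl; simp at hu, ⟨1, by rw [hu, pow_one]⟩, by rw [huc]; norm_num⟩
  obtain ⟨P, E, F, s, -, -, -, huE, huF, hall⟩ := DD_two h huD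
  refine ⟨conjSet ⊤ E, conjSet ⊤ F, ?_, ?_, class_conj, class_conj, ?_, ?_, class_uniq h s.hE, class_uniq h s.hF, ?_, ?_,
    s.hE.card_conj h⟩
  · rintro S ⟨g, _, rfl⟩; exact s.hE.conj g
  · rintro S ⟨g, _, rfl⟩; exact s.hF.conj g
  · intro v hv
    obtain ⟨g, rfl⟩ := DD_class h huD hv
    exact ⟨_, ⟨g, mem_top _, rfl⟩, conj_mem_conj_smul.2 huE⟩
  · intro v hv
    obtain ⟨g, rfl⟩ := DD_class h huD hv
    exact ⟨_, ⟨g, mem_top _, rfl⟩, conj_mem_conj_smul.2 huF⟩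
  · rintro p ⟨a, _, rfl⟩ ⟨b, _, hb⟩
    refine s.hE.not_conj h s.hF huE huF huD.1 (s.ne h) (b⁻¹ * a) ?_
    rw [map_mul, mul_smul, hb, map_inv, inv_smul_smul]
  · intro S hS
    obtain ⟨v, hv, hv1⟩ := hS.exists_ne
    obtain ⟨g, hg⟩ := DD_class h huD (hS.2 v hv hv1)
    have h1 : u ∈ conj g⁻¹ • S := by
      rw [mem_conj_smul, inv_inv, hg]; exact hv
    have h2 : S = conj g • conj g⁻¹ • S := by rw [map_inv, smul_inv_smul]
    rcases hall _ (hS.conj g⁻¹) h1 with h3 | h3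
    · left; exact ⟨g, mem_top _, by rw [← h3, ← h2]⟩
    · right; exact ⟨g, mem_top _, by rw [← h3, ← h2]⟩

variable {Pt Ln : Set (Subgroup G)}

/-- An element of a line normalizing a point: they are incident. -/
lemma GEO.meet (o : GEO Pt Ln) (h : OD G) {p l : Subgroup G} (hp : p ∈ Pt) (hl : l ∈ Ln) {e : G} (he : e ∈ l) (he1 : e ≠ 1)
    (hep : conj e • p = p) : Inc p l := by
  haveI := Fact.mk p79
  have heD := (o.sl l hl).2 e he he1
  have hpp : IsPGroup 79 p := isPGroup_of_card (o.sp p hp).1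
  have hez : IsPGroup 79 (zpowers e) := isPGroup_of_card (n := 1) (by rw [card_zpowers, (o.sl l hl).ord h he he1, pow_one])
  have hsup := hez.to_sup_of_normal_right' hpp (by rw [zpowers_le]; exact mem_normalizer_conj.2 hep)
  obtain ⟨P, -, hQP, hP⟩ := sylow_exists_ge p79 (le_top : zpowers e ⊔ p ≤ ⊤) hsup (n := 3)
    (by rw [card_top, h.card]; norm_num) (by rw [card_top]; exact h.n79)
  have heP : e ∈ P := hQP ((le_sup_left : zpowers e ≤ _) (mem_zpowers e))
  obtain ⟨E, F, s⟩ := exists_SY h hP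
  have key : ∀ E F : Subgroup G, SY P E F → p = E → Inc p l := by
    rintro E F s rfl
    rcases s.all e heP heD with h1 | h1
    · exact ⟨e, he1, h1, he⟩
    have hz : Inc p F := by
      by_contra hcon
      have h2 : p ⊓ F = ⊥ := by
        rw [eq_bot_iff_forall]
        intro x hx
        by_contra hx1
        exact hcon ⟨x, hx1, hx.1, hx.2⟩
      have h3 := (ZP_cards h hP).1
      rw [← s.EF, h2, card_bot] at h3
      norm_num at h3
    rcases o.cov F s.hF with h2 | h2
    · exact absurd (o.uP _ hp _ h2 hz) (s.ne h)
    · rwa [← o.uL F h2 l hl ⟨e, he1, h1, he⟩]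
  rcases s.sp (o.sp p hp) (le_sup_right.trans hQP) with h1 | h1
  · exact key E F s h1
  · exact key F E s.swap h1

/-- The intersection of an incident pair is cyclic. -/
lemma GEO.cyc (o : GEO Pt Ln) (h : OD G) {p l : Subgroup G} (hp : p ∈ Pt) (hl : l ∈ Ln) {u w : G} (hu : u ∈ p) (hul : u ∈ l)
    (hu1 : u ≠ 1) (hw : w ∈ p) (hwl : w ∈ l) : w ∈ zpowers u := by
  by_contra hcon
  have := (o.sp p hp).gen h (o.sl l hl).1 hu hw hu1 hcon hul hwl
  exact o.disj p hp (this ▸ hl)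

/-- Two distinct points are on at most one line. -/
lemma GEO.two (o : GEO Pt Ln) (h : OD G) {p q l m : Subgroup G} (hp : p ∈ Pt) (hq : q ∈ Pt) (hl : l ∈ Ln) (hm : m ∈ Ln)
    (hpq : p ≠ q) (pl : Inc p l) (ql : Inc q l) (pm : Inc p m) (qm : Inc q m) : l = m := by
  obtain ⟨u, hu1, hup, hul⟩ := pl
  obtain ⟨w, hw1, hwq, hwm⟩ := qm
  have h1 := Inc.fix h (o.sp p hp) (o.sl m hm) hup pm
  have h2 := Inc.fix h (o.sl l hl) (o.sp q hq) hul ql.symm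
  have hou := (o.sl l hl).ord h hul hu1
  have h3 : u ∈ N[zpowers w] := by
    refine mem_normalizer_zpowers_of (o.cyc h hq hm hwq hwm hw1 ?_ ?_)
    · rw [← h2]; exact conj_mem_conj_smul.2 hwq
    · rw [← h1]; exact conj_mem_conj_smul.2 hwm
  obtain ⟨e, he, hN⟩ := card_normalizer_zpowers p79 ((o.sl m hm).ord h hwm hw1)
  have h4 : u ∈ centralizer {w} := by
    refine mem_centralizer_of_coprime (e := e) (by rw [hN, mul_comm]) h3 ?_
    rw [hou, Nat.Prime.coprime_iff_not_dvd p79]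
    intro h5
    have := le_of_dvd (by norm_num) (h5.trans he)
    omega
  obtain ⟨P, F, s, -, hNP, -, hwF, -⟩ := (o.sl m hm).two h hwm hw1
  have huP : u ∈ P := mem_sylow_of_normalizer p79 s.hP h.n79 (i := 1) (by rw [hou, pow_one]) (hNP h4)
  rcases s.all u huP ((o.sl l hl).2 u hul hu1) with h5 | h5
  · exact o.uL l hl m hm ⟨u, hu1, hul, h5⟩
  · exfalso
    rcases o.cov F s.hF with h6 | h6
    · have h7 := o.uP p hp F h6 ⟨u, hu1, hup, h5⟩
      exact hpq (o.uP p hp q hq ⟨w, hw1, h7 ▸ hwF, hwq⟩)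
    · exact s.ne h (o.uL m hm F h6 ⟨w, hw1, hwm, hwF⟩)

/-- Only the identity fixes all points. -/
lemma GEO.faithful (o : GEO Pt Ln) (h : OD G) (hex : ∀ l ∈ Ln, ∃ p ∈ Pt, ¬ Inc p l) {k : G}
    (hk : ∀ p ∈ Pt, conj k • p = p) : k = 1 := by
  let K : Subgroup G := ⨅ p ∈ Pt, N[p]
  have hK : ∀ x, x ∈ K ↔ ∀ p ∈ Pt, conj x • p = p := by
    intro x
    simp only [K, mem_iInf, mem_normalizer_conj]
  have hinv : ∀ g x, x ∈ K → g * x * g⁻¹ ∈ K := by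
    intro g x hx
    rw [hK] at hx ⊢
    intro p hp
    have := hx _ (o.conjP p hp g⁻¹)
    rw [map_mul, map_mul, mul_smul, mul_smul, this, map_inv, smul_inv_smul]
  have hcom : ∀ x ∈ K, ∀ p ∈ Pt, ∀ s ∈ p, x * s = s * x := by
    intro x hx p hp s hs
    have h1 : x * s * x⁻¹ * s⁻¹ ∈ p := by
      refine mul_mem ?_ (inv_mem hs)
      have := (hK x).1 hx p hp
      rw [← this]; exact conj_mem_conj_smul.2 hs
    have h2 : x * s * x⁻¹ * s⁻¹ ∈ K := by
      rw [show x * s * x⁻¹ * s⁻¹ = x * (s * x⁻¹ * s⁻¹) by group]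
      exact mul_mem hx (hinv s _ (inv_mem hx))
    by_contra hne
    have h3 : x * s * x⁻¹ * s⁻¹ ≠ 1 := fun h4 => hne (by rwa [mul_inv_eq_one, mul_inv_eq_iff_eq_mul] at h4)
    obtain ⟨l, hl, hel⟩ := o.exL _ ((o.sp p hp).2 _ h1 h3)
    obtain ⟨q, hq, hql⟩ := hex l hl
    exact hql (o.meet h hq hl hel h3 ((hK _).1 h2 q hq))
  obtain ⟨u, hu, huc⟩ := h.ph2.ex
  have huD : u ∈ DD G := ⟨by rintro rfl; simp at hu, ⟨1, by rw [hu, pow_one]⟩, by rw [huc]; norm_num⟩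
  obtain ⟨l, hl, hul⟩ := o.exL u huD
  obtain ⟨q, hq, hql⟩ := hex l hl
  obtain ⟨p, hp, hup⟩ := o.exP u huD
  have hKc : K ≤ centralizer {u} := fun x hx => mem_cent.2 (hcom x hx p hp u hup)
  have h79 : ¬ 79 ∣ Nat.card K := by
    intro hd
    obtain ⟨x, hx, hxo⟩ := exists_order_of_dvd p79 hd
    have hx1 : x ≠ 1 := by rintro rfl; simp at hxo
    have hmem : ∀ r ∈ Pt, x ∈ r := fun r hr => (o.sp r hr).cent h (e := 1) (by rw [hxo, pow_one]) (hcom x hx r hr)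
    have := o.uP p hp q hq ⟨x, hx1, hmem p hp, hmem q hq⟩
    exact hql ⟨u, huD.1, this ▸ hup, hul⟩
  have h26 : Nat.card K ∣ 26 := by
    have h1 := card_dvd_of_le hKc
    rw [huc] at h1
    exact Coprime.dvd_of_dvd_mul_left (Coprime.pow_right 3 ((Nat.Prime.coprime_iff_not_dvd p79).2 h79).symm) h1
  obtain ⟨w, hw⟩ := exists_order_of_dvd (p := 43) (by norm_num) (H := (⊤ : Subgroup G))
    (by rw [card_top, h.card]; norm_num)
  by_contra hk1
  have hc1 : ((K : Set G) \ {1}).ncard + 1 = Nat.card K := Set.ncard_sdiff_singleton_add_one K.one_mem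
  obtain ⟨a, ⟨haK, ha1⟩, hwa⟩ := conj_fixed_exists (p := 43) (n := 1) (by norm_num) (by rw [hw.2, pow_one]) ((K : Set G) \ {1})
    (fun a ha => ⟨hinv w a ha.1, by rw [Set.mem_singleton_iff, conj_eq_one_iff]; exact ha.2⟩) (by
      rw [card_coe_set_eq]
      intro hd
      have hpos : 0 < ((K : Set G) \ {1}).ncard := (Set.ncard_pos (Set.toFinite _)).2 ⟨k, (hK k).2 hk, hk1⟩
      have := le_of_dvd hpos hd
      have := le_of_dvd (by norm_num) h26
      omega)
  have hoa : orderOf a ∣ 26 := (orderOf_dvd_of_mem haK).trans h26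
  have hoa1 : orderOf a ≠ 1 := fun h1 => ha1 (orderOf_eq_one_iff.1 h1)
  have hor : 2 ∣ orderOf a ∨ 13 ∣ orderOf a := by
    have hle := le_of_dvd (by norm_num) hoa
    generalize orderOf a = n at *
    interval_cases n <;> omega
  rcases hor with h1 | h1
  · have := ad_of_commute_pow (by norm_num) (by norm_num) (by norm_num) h1 (dvd_of_eq hw.2.symm) hwa.symm
    rw [h.gr.a243] at this; omega
  · have := ad_of_commute_pow (by norm_num) (by norm_num) (by norm_num) h1 (dvd_of_eq hw.2.symm) hwa.symm
    rw [h.gr.a1343] at this; omega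

end SylStruct

section Coordinates
open Pointwise Matrix
variable {G : Type*} [Group G] [Finite G] {Pt Ln : Set (Subgroup G)}

instance fact79 : Fact (Nat.Prime 79) := ⟨p79⟩

/-- Coordinates on a line. -/
structure FR (l : Subgroup G) (ε : ZMod 79 → ZMod 79 → G) : Prop where
  mem : ∀ x y, ε x y ∈ l
  add : ∀ x y x' y', ε (x + x') (y + y') = ε x y * ε x' y'
  inj : ∀ x y, ε x y = 1 → x = 0 ∧ y = 0

lemma pow_val_add {a : G} (ha : orderOf a = 79) (x y : ZMod 79) : a ^ (x + y).val = a ^ x.val * a ^ y.val := by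
  have := pow_mod_orderOf a (x.val + y.val)
  rw [ha] at this
  rw [ZMod.val_add, this, pow_add]

lemma exists_FR (h : OD G) {l : Subgroup G} (hl : Sp l) : ∃ ε, FR l ε := by
  obtain ⟨a, ha, ha1⟩ := hl.exists_ne
  obtain ⟨b, hb, hab⟩ := hl.exists_notMem h ha ha1
  have hb1 : b ≠ 1 := fun h => hab (h ▸ one_mem _)
  have hoa := hl.ord h ha ha1
  have hob := hl.ord h hb hb1
  refine ⟨fun x y => a ^ x.val * b ^ y.val, fun x y => mul_mem (pow_mem ha _) (pow_mem hb _), fun x y x' y' => ?_, fun x y hxy => ?_⟩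
  · simp only [pow_val_add hoa, pow_val_add hob]
    have := hl.comm (pow_mem ha x'.val) (pow_mem hb y.val)
    rw [mul_assoc, ← mul_assoc (a ^ x'.val), this]; group
  · have h1 : b ^ y.val ∈ zpowers a := by
      rw [← inv_eq_of_mul_eq_one_right hxy]; exact inv_mem (npow_mem_zpowers a _)
    have h0 : ∀ (c : G) (t : ZMod 79), orderOf c = 79 → c ^ t.val = 1 → t = 0 := by
      intro c t hc ht
      rw [← ZMod.val_eq_zero]
      have h2 := orderOf_dvd_of_pow_eq_one ht
      rw [hc] at h2
      exact Nat.eq_zero_of_dvd_of_lt h2 t.val_lt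
    have hy : y = 0 := by
      refine h0 b y hob (by_contra fun h2 => hab ?_)
      exact zpowers_le.2 h1 (mem_zpowers_of_card p79 (by rw [card_zpowers, hob]) (npow_mem_zpowers b _) h2 (mem_zpowers b))
    refine ⟨h0 a x hoa ?_, hy⟩
    simpa [hy] using hxy

lemma FR.pow {l : Subgroup G} {ε : ZMod 79 → ZMod 79 → G} (f : FR l ε) (x y : ZMod 79) (n : ℕ) : ε (n * x) (n * y) = ε x y ^ n := by
  induction n with
  | zero =>
    have := f.add 0 0 0 0
    simpa using this
  | succ n ih => push_cast; rw [add_mul, add_mul, one_mul, one_mul, f.add, ih, pow_succ]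

lemma FR.smul {l : Subgroup G} {ε : ZMod 79 → ZMod 79 → G} (f : FR l ε) (x y t : ZMod 79) : ε (t * x) (t * y) = ε x y ^ t.val := by
  rw [← f.pow, ZMod.natCast_zmod_val]

lemma FR.eq {l : Subgroup G} {ε : ZMod 79 → ZMod 79 → G} (f : FR l ε) {x y x' y' : ZMod 79} (h : ε x y = ε x' y') : x = x' ∧ y = y' := by
  have h1 := f.add (x - x') (y - y') x' y'
  rw [sub_add_cancel, sub_add_cancel, h, right_eq_mul] at h1
  exact ⟨sub_eq_zero.1 (f.inj _ _ h1).1, sub_eq_zero.1 (f.inj _ _ h1).2⟩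

lemma GEO.exists_far (o : GEO Pt Ln) {l : Subgroup G} (hl : l ∈ Ln) : ∃ p ∈ Pt, ¬ Inc p l := by
  by_contra hcon
  push Not at hcon
  choose w hw1 hwp hwl using fun p : Pt => hcon p.1 p.2
  have h1 := Nat.card_le_card_of_injective (fun p : Pt => (⟨w p, hwl p⟩ : l)) (fun p q hpq => Subtype.ext
    (o.uP p.1 p.2 q.1 q.2 ⟨w p, hw1 p, hwp p, by rw [show w p = w q from congrArg Subtype.val hpq]; exact hwp q⟩))
  rw [o.card, (o.sl l hl).1] at h1
  omega

/-- Nonzero vectors. -/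
abbrev nz (x y z : ZMod 79) : Prop := x ≠ 0 ∨ y ≠ 0 ∨ z ≠ 0

/-- Homogeneous coordinates on the plane. -/
structure CO (Pt Ln : Set (Subgroup G)) (Q : ZMod 79 → ZMod 79 → ZMod 79 → Subgroup G) : Prop where
  pt : ∀ x y z, nz x y z → Q x y z ∈ Pt
  surj : ∀ p ∈ Pt, ∃ x y z, nz x y z ∧ Q x y z = p
  scale : ∀ c x y z, c ≠ 0 → nz x y z → Q (c * x) (c * y) (c * z) = Q x y z
  inj : ∀ x y z x' y' z', nz x y z → nz x' y' z' → Q x y z = Q x' y' z' → x * y' = x' * y ∧ x * z' = x' * z ∧ y * z' = y' * z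
  ln : ∀ p q r, nz p q r → ∃ m ∈ Ln, ∀ x y z, nz x y z → (Inc (Q x y z) m ↔ p * x + q * y + r * z = 0)
  li : ∀ m ∈ Ln, ∃ p q r, nz p q r ∧ ∀ x y z, nz x y z → (Inc (Q x y z) m ↔ p * x + q * y + r * z = 0)

lemma prop2 {p q x y : ZMod 79} (hpq : p ≠ 0 ∨ q ≠ 0) (h : p * x + q * y = 0) : ∃ t, x = t * q ∧ y = t * -p := by
  by_cases hq : q = 0
  · subst hq
    have hp : p ≠ 0 := by simpa using hpq
    have hx : x = 0 := by simpa [hp] using h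
    exact ⟨-y / p, by simp [hx], by field_simp⟩
  · refine ⟨x / q, by field_simp, ?_⟩
    field_simp
    linear_combination h

lemma prop3 {x y z x' y' z' : ZMod 79} (hv : nz x y z) (hv' : nz x' y' z') (h1 : x * y' = x' * y) (h2 : x * z' = x' * z)
    (h3 : y * z' = y' * z) : ∃ c, c ≠ 0 ∧ x' = c * x ∧ y' = c * y ∧ z' = c * z := by
  have key : ∃ c, x' = c * x ∧ y' = c * y ∧ z' = c * z := by
    rcases hv with h | h | h
    · exact ⟨x' / x, by field_simp, by field_simp; linear_combination h1, by field_simp; linear_combination h2⟩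
    · exact ⟨y' / y, by field_simp; linear_combination -h1, by field_simp, by field_simp; linear_combination h3⟩
    · exact ⟨z' / z, by field_simp; linear_combination -h2, by field_simp; linear_combination -h3, by field_simp⟩
  obtain ⟨c, rfl, rfl, rfl⟩ := key
  exact ⟨c, fun hc => by simp [nz, hc] at hv', rfl, rfl, rfl⟩

set_option maxHeartbeats 1000000 in
lemma GEO.exists_CO (o : GEO Pt Ln) (h : OD G) : ∃ Q, CO Pt Ln Q := by
  classical
  obtain ⟨u0, hu0, hu0c⟩ := h.ph2.ex
  obtain ⟨l, hl, -⟩ := o.exL u0 ⟨by rintro rfl; simp at hu0, ⟨1, by rw [hu0, pow_one]⟩, by rw [hu0c]; norm_num⟩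
  obtain ⟨ε, f⟩ := exists_FR h (o.sl l hl)
  obtain ⟨b, hb, hbl⟩ := o.exists_far hl
  choose! π hπ hπm using o.exP
  have hD : ∀ x y, ε x y ≠ 1 → ε x y ∈ DD G := fun x y => (o.sl l hl).2 _ (f.mem x y)
  have hne : ∀ x y, (x ≠ 0 ∨ y ≠ 0) → ε x y ≠ 1 := by
    intro x y hxy h1
    have := f.inj x y h1
    rcases hxy with h2 | h2
    · exact h2 this.1
    · exact h2 this.2
  have hP : ∀ x y, (x ≠ 0 ∨ y ≠ 0) → π (ε x y) ∈ Pt := fun x y hxy => hπ _ (hD x y (hne x y hxy))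
  have hPm : ∀ x y, (x ≠ 0 ∨ y ≠ 0) → ε x y ∈ π (ε x y) := fun x y hxy => hπm _ (hD x y (hne x y hxy))
  have hPl : ∀ x y, (x ≠ 0 ∨ y ≠ 0) → Inc (π (ε x y)) l := fun x y hxy => ⟨_, hne x y hxy, hPm x y hxy, f.mem x y⟩
  have hA : ∀ e : G, conj e • b ∈ Pt := fun e => o.conjP b hb e
  have hAl : ∀ e ∈ l, ¬ Inc (conj e • b) l := by
    intro e he h1
    apply hbl
    have h2 := h1.conj e⁻¹
    rwa [map_inv, inv_smul_smul, ← map_inv, conj_eq_of_le (G := G) (fun x hx => by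
      rw [mem_conj_smul, inv_inv] at hx
      exact (l.mul_mem_cancel_left he).1 ((l.mul_mem_cancel_right (inv_mem he)).1 hx)) le_rfl] at h2
  have hl0 : ∀ e ∈ l, ∀ x y, (x ≠ 0 ∨ y ≠ 0) → conj e • π (ε x y) = π (ε x y) := fun e he x y hxy =>
    Inc.fix h (o.sl l hl) (o.sp _ (hP x y hxy)) he (hPl x y hxy).symm
  let Q : ZMod 79 → ZMod 79 → ZMod 79 → Subgroup G := fun x y z => if z = 0 then π (ε x y) else conj (ε (x / z) (y / z)) • b
  have hQ0 : ∀ x y, Q x y 0 = π (ε x y) := fun x y => if_pos rfl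
  have hQ1 : ∀ x y z, z ≠ 0 → Q x y z = conj (ε (x / z) (y / z)) • b := fun x y z hz => if_neg hz
  have h00 : ∀ {x y : ZMod 79}, nz x y 0 → x ≠ 0 ∨ y ≠ 0 := fun hv => by simpa [nz] using hv
  have hQl : ∀ x y z, nz x y z → (Inc (Q x y z) l ↔ z = 0) := by
    intro x y z hv
    constructor
    · intro h1
      by_contra hz
      rw [hQ1 x y z hz] at h1
      exact hAl _ (f.mem _ _) h1
    · rintro rfl
      rw [hQ0]; exact hPl x y (h00 hv)
  have pt : ∀ x y z, nz x y z → Q x y z ∈ Pt := by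
    intro x y z hv
    by_cases hz : z = 0
    · subst hz; rw [hQ0]; exact hP x y (h00 hv)
    · rw [hQ1 x y z hz]; exact hA _
  have scale : ∀ c x y z, c ≠ 0 → nz x y z → Q (c * x) (c * y) (c * z) = Q x y z := by
    intro c x y z hc hv
    by_cases hz : z = 0
    · subst hz
      rw [mul_zero, hQ0, hQ0]
      have hv := h00 hv
      have hv' : c * x ≠ 0 ∨ c * y ≠ 0 := by simpa [hc] using hv
      refine o.uP _ (hP _ _ hv') _ (hP _ _ hv) ⟨_, hne _ _ hv', hPm _ _ hv', ?_⟩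
      rw [f.smul]; exact pow_mem (hPm _ _ hv) _
    · rw [hQ1 _ _ _ (mul_ne_zero hc hz), hQ1 _ _ _ hz, mul_div_mul_left _ _ hc, mul_div_mul_left _ _ hc]
  have inj : ∀ x y z x' y' z', nz x y z → nz x' y' z' → Q x y z = Q x' y' z' → x * y' = x' * y ∧ x * z' = x' * z ∧ y * z' = y' * z := by
    intro x y z x' y' z' hv hv' hE
    have hzz : z = 0 ↔ z' = 0 := by rw [← hQl x y z hv, hE, hQl x' y' z' hv']
    by_cases hz : z = 0
    · have hz' := hzz.1 hz
      subst hz; subst hz'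
      rw [hQ0, hQ0] at hE
      have hv := h00 hv
      have hv' := h00 hv'
      have h1 := o.cyc h (hP _ _ hv) hl (hPm _ _ hv) (f.mem _ _) (hne _ _ hv) (hE ▸ hPm _ _ hv') (f.mem x' y')
      rw [← mem_powers_iff_mem_zpowers] at h1
      obtain ⟨n, hn⟩ := h1
      change ε x y ^ n = ε x' y' at hn
      rw [← f.pow] at hn
      obtain ⟨rfl, rfl⟩ := f.eq hn
      refine ⟨by ring, by ring, by ring⟩
    · have hz' : z' ≠ 0 := fun h1 => hz (hzz.2 h1)
      rw [hQ1 _ _ _ hz, hQ1 _ _ _ hz'] at hE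
      have h1 : (ε (x' / z') (y' / z'))⁻¹ * ε (x / z) (y / z) = 1 := by
        by_contra hcon
        refine hbl (o.meet h hb hl (mul_mem (inv_mem (f.mem _ _)) (f.mem _ _)) hcon ?_)
        rw [map_mul, mul_smul, hE, map_inv, inv_smul_smul]
      obtain ⟨h2, h3⟩ := f.eq (inv_mul_eq_one.1 h1)
      field_simp at h2 h3
      refine ⟨?_, by linear_combination -h2, by linear_combination -h3⟩
      apply mul_left_cancel₀ hz
      apply mul_left_cancel₀ hz'
      linear_combination (-(y' * z)) * h2 + (x' * z) * h3
  have surj : ∀ p ∈ Pt, ∃ x y z, nz x y z ∧ Q x y z = p := by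
    have n1 : ∀ x y, nz x y 1 := fun x y => Or.inr (Or.inr one_ne_zero)
    have n2 : ∀ x, nz x 1 0 := fun x => Or.inr (Or.inl one_ne_zero)
    have n3 : nz 1 0 0 := Or.inl one_ne_zero
    let F : (ZMod 79 × ZMod 79) ⊕ (ZMod 79 ⊕ Unit) → Pt := fun t => match t with
      | Sum.inl (x, y) => ⟨Q x y 1, pt _ _ _ (n1 x y)⟩
      | Sum.inr (Sum.inl x) => ⟨Q x 1 0, pt _ _ _ (n2 x)⟩
      | Sum.inr (Sum.inr _) => ⟨Q 1 0 0, pt _ _ _ n3⟩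
    have hF : Function.Bijective F := by
      refine (Nat.bijective_iff_injective_and_card F).2 ⟨?_, by rw [o.card]; simp⟩
      rintro (⟨x, y⟩ | (x | _)) (⟨x', y'⟩ | (x' | _)) hE <;> replace hE := congrArg Subtype.val hE
      · have := inj _ _ _ _ _ _ (n1 _ _) (n1 _ _) hE
        simp only [mul_one] at this
        rw [this.2.1, this.2.2]
      · simpa using inj _ _ _ _ _ _ (n1 _ _) (n2 _) hE
      · simpa using inj _ _ _ _ _ _ (n1 _ _) n3 hE
      · simpa using inj _ _ _ _ _ _ (n2 _) (n1 _ _) hE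
      · simpa using inj _ _ _ _ _ _ (n2 _) (n2 _) hE
      · simpa using inj _ _ _ _ _ _ (n2 _) n3 hE
      · simpa using inj _ _ _ _ _ _ n3 (n1 _ _) hE
      · simpa using inj _ _ _ _ _ _ n3 (n2 _) hE
      · rfl
    intro p hp
    obtain ⟨t, ht⟩ := hF.2 ⟨p, hp⟩
    replace ht := congrArg Subtype.val ht
    rcases t with ⟨x, y⟩ | (x | _)
    · exact ⟨_, _, _, n1 x y, ht⟩
    · exact ⟨_, _, _, n2 x, ht⟩
    · exact ⟨_, _, _, n3, ht⟩
  have join : ∀ x y x' y', (x ≠ 0 ∨ y ≠ 0) → ∃ m ∈ Ln, m ≠ l ∧ Inc (Q x y 0) m ∧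
      ∀ t, Inc (Q (t * x + x') (t * y + y') 1) m := by
    intro x y x' y' hxy
    obtain ⟨w, hw, hwn⟩ := (o.sp _ (hP x y hxy)).exists_notMem h (hPm x y hxy) (hne x y hxy)
    have hw1 : w ≠ 1 := fun h => hwn (h ▸ one_mem _)
    obtain ⟨m, hm, hwm⟩ := o.exL w ((o.sp _ (hP x y hxy)).2 w hw hw1)
    have hml : m ≠ l := by
      rintro rfl
      exact hwn (o.cyc h (hP x y hxy) hl (hPm x y hxy) (f.mem _ _) (hne x y hxy) hw hwm)
    have hqm : Inc (π (ε x y)) m := ⟨w, hw1, hw, hwm⟩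
    obtain ⟨v, hv, hvn⟩ := (o.sl m hm).exists_notMem h hwm hw1
    have hv1 : v ≠ 1 := fun h => hvn (h ▸ one_mem _)
    obtain ⟨p, hp, hvp⟩ := o.exP v ((o.sl m hm).2 v hv hv1)
    have hpq : p ≠ π (ε x y) := by
      rintro rfl
      exact hvn (o.cyc h hp hm hw hwm hw1 hvp hv)
    have hpm : Inc p m := ⟨v, hv1, hvp, hv⟩
    obtain ⟨x1, y1, z1, hv1, rfl⟩ := surj p hp
    have hz1 : z1 ≠ 0 := by
      intro hz
      exact hml (o.two h hp (hP x y hxy) hl hm hpq ((hQl _ _ _ hv1).2 hz) (hPl x y hxy) hpm hqm).symm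
    rw [hQ1 _ _ _ hz1] at hpm
    set e := ε (x1 / z1) (y1 / z1)
    have hel : ε x' y' * e⁻¹ ∈ l := mul_mem (f.mem _ _) (inv_mem (f.mem _ _))
    have hfix : conj (ε x' y' * e⁻¹) • l = l := mem_normalizer_conj.1 (le_normalizer hel)
    refine ⟨conj (ε x' y' * e⁻¹) • m, o.conjL m hm _, ?_, ?_, ?_⟩
    · intro h1
      rw [← hfix] at h1
      exact hml (smul_left_cancel _ h1)
    · rw [hQ0, ← hl0 _ hel x y hxy]
      exact hqm.conj _
    · intro t
      have h1 : Inc (π (ε x y)) (conj (ε x' y' * e⁻¹) • m) := by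
        rw [← hl0 _ hel x y hxy]; exact hqm.conj _
      have h2 := Inc.fix h (o.sp _ (hP x y hxy)) (o.sl _ (o.conjL m hm _)) (pow_mem (hPm x y hxy) t.val) h1
      rw [hQ1 _ _ _ one_ne_zero, div_one, div_one, f.add, f.smul, ← h2, map_mul, mul_smul]
      refine Inc.conj _ ?_
      have := hpm.conj (ε x' y' * e⁻¹)
      rwa [← mul_smul, ← map_mul, inv_mul_cancel_right] at this
  have ln : ∀ p q r, nz p q r → ∃ m ∈ Ln, ∀ x y z, nz x y z → (Inc (Q x y z) m ↔ p * x + q * y + r * z = 0) := by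
    intro p q r hf
    by_cases hpq : p = 0 ∧ q = 0
    · obtain ⟨rfl, rfl⟩ := hpq
      have hr : r ≠ 0 := by simpa [nz] using hf
      refine ⟨l, hl, fun x y z hv => ?_⟩
      rw [hQl x y z hv]; simp [hr]
    have hpq : p ≠ 0 ∨ q ≠ 0 := not_and_or.1 hpq
    have hqp : q ≠ 0 ∨ -p ≠ 0 := by rw [neg_ne_zero]; exact hpq.symm
    obtain ⟨x0, y0, h0⟩ : ∃ x0 y0, p * x0 + q * y0 + r = 0 := by
      rcases hpq with h1 | h1
      · exact ⟨-r / p, 0, by field_simp; ring⟩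
      · exact ⟨0, -r / q, by field_simp; ring⟩
    obtain ⟨m, hm, hml, hqm, hall⟩ := join q (-p) x0 y0 hqp
    have nq : nz q (-p) 0 := by rcases hqp with h1 | h1 <;> simp [nz, h1]
    have norm : ∀ x y z, z ≠ 0 → Q x y z = Q (x / z) (y / z) 1 := by
      intro x y z hz
      rw [hQ1 _ _ _ hz, hQ1 _ _ _ one_ne_zero, div_one, div_one]
    have n1 : ∀ x y, nz x y 1 := fun x y => Or.inr (Or.inr one_ne_zero)
    refine ⟨m, hm, fun x y z hv => ?_⟩
    by_cases hz : z = 0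
    · subst hz
      rw [mul_zero, add_zero]
      constructor
      · intro h1
        by_contra hcon
        refine hml (o.two h (pt _ _ _ hv) (pt _ _ _ nq) hl hm ?_ ((hQl _ _ _ hv).2 rfl) ((hQl _ _ _ nq).2 rfl) h1 hqm).symm
        intro hE
        have := (inj _ _ _ _ _ _ hv nq hE).1
        exact hcon (by linear_combination -this)
      · intro h1
        obtain ⟨t, rfl, rfl⟩ := prop2 hpq h1
        have ht : t ≠ 0 := by rintro rfl; simp [nz] at hv
        have := scale t q (-p) 0 ht nq
        rw [mul_zero] at this
        rwa [this]
    · have e1 : p * x + q * y + r * z = 0 ↔ p * (x / z - x0) + q * (y / z - y0) = 0 := by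
        have : p * x + q * y + r * z = z * (p * (x / z - x0) + q * (y / z - y0)) := by
          field_simp; linear_combination z * h0
        rw [this]; simp [hz]
      rw [e1, norm x y z hz]
      constructor
      · intro h1
        by_contra hcon
        have h2 : x / z - x0 ≠ 0 ∨ y / z - y0 ≠ 0 := by
          by_contra h3
          push Not at h3
          exact hcon (by rw [h3.1, h3.2]; ring)
        obtain ⟨m', hm', hml', hqm', hall'⟩ := join _ _ x0 y0 h2
        have hb0 := hall 0
        have hb0' := hall' 0
        have hb1' := hall' 1
        simp only [zero_mul, zero_add, one_mul, sub_add_cancel] at hb0 hb0' hb1'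
        have hmm : m = m' := by
          refine o.two h (pt _ _ _ (n1 _ _)) (pt _ _ _ (n1 _ _)) hm hm' ?_ hb0 h1 hb0' hb1'
          intro hE
          have := inj _ _ _ _ _ _ (n1 _ _) (n1 _ _) hE
          simp only [mul_one] at this
          rw [← this.2.1, ← this.2.2] at h2
          simp at h2
        have nq' : nz (x / z - x0) (y / z - y0) 0 := by rcases h2 with h1 | h1 <;> simp [nz, h1]
        rw [← hmm] at hqm'
        refine hml (o.two h (pt _ _ _ nq') (pt _ _ _ nq) hl hm ?_ ((hQl _ _ _ nq').2 rfl) ((hQl _ _ _ nq).2 rfl) hqm' hqm).symm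
        intro hE
        have := (inj _ _ _ _ _ _ nq' nq hE).1
        exact hcon (by linear_combination -this)
      · intro h1
        obtain ⟨t, h2, h3⟩ := prop2 hpq h1
        have := hall t
        rwa [← h2, ← h3, sub_add_cancel, sub_add_cancel] at this
  refine ⟨Q, pt, surj, scale, inj, ln, ?_⟩
  intro m hm
  obtain ⟨w, hw, hw1⟩ := (o.sl m hm).exists_ne
  obtain ⟨v, hv, hvn⟩ := (o.sl m hm).exists_notMem h hw hw1
  have hv1 : v ≠ 1 := fun h => hvn (h ▸ one_mem _)
  obtain ⟨p, hp, hwp⟩ := o.exP w ((o.sl m hm).2 w hw hw1)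
  obtain ⟨q, hq, hvq⟩ := o.exP v ((o.sl m hm).2 v hv hv1)
  have hpq : p ≠ q := by
    rintro rfl
    exact hvn (o.cyc h hp hm hwp hw hw1 hvq hv)
  obtain ⟨x, y, z, n, rfl⟩ := surj p hp
  obtain ⟨x', y', z', n', rfl⟩ := surj q hq
  have hcr : nz (y * z' - y' * z) (x' * z - x * z') (x * y' - x' * y) := by
    by_contra hcon
    simp only [nz, not_or, not_not] at hcon
    obtain ⟨c, hc, rfl, rfl, rfl⟩ := prop3 n n' (by linear_combination hcon.2.2) (by linear_combination -hcon.2.1)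
      (by linear_combination hcon.1)
    exact hpq (scale c x y z hc n).symm
  obtain ⟨m', hm', hiff⟩ := ln _ _ _ hcr
  have : m = m' := o.two h hp hq hm hm' hpq ⟨w, hw1, hwp, hw⟩ ⟨v, hv1, hvq, hv⟩ ((hiff _ _ _ n).2 (by ring))
    ((hiff _ _ _ n').2 (by ring))
  exact ⟨_, _, _, hcr, this ▸ hiff⟩

variable {Q : ZMod 79 → ZMod 79 → ZMod 79 → Subgroup G}

lemma CO.swap (c : CO Pt Ln Q) : CO Pt Ln (fun x y z => Q y x z) := by
  have n : ∀ {x y z}, nz x y z → nz y x z := fun h => or_left_comm.1 h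
  refine ⟨fun x y z h => c.pt _ _ _ (n h), ?_, fun r x y z hr h => c.scale r _ _ _ hr (n h), ?_, ?_, ?_⟩
  · intro p hp
    obtain ⟨x, y, z, h, h1⟩ := c.surj p hp
    exact ⟨y, x, z, n h, h1⟩
  · intro x y z x' y' z' h h' hE
    obtain ⟨h1, h2, h3⟩ := c.inj _ _ _ _ _ _ (n h) (n h') hE
    exact ⟨by linear_combination -h1, h3, h2⟩
  · intro p q r h
    obtain ⟨m, hm, h1⟩ := c.ln q p r (n h)
    exact ⟨m, hm, fun x y z hv => by rw [h1 _ _ _ (n hv), add_comm (q * y)]⟩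
  · intro m hm
    obtain ⟨p, q, r, h, h1⟩ := c.li m hm
    exact ⟨q, p, r, n h, fun x y z hv => by rw [h1 _ _ _ (n hv), add_comm (q * x)]⟩

lemma CO.rot (c : CO Pt Ln Q) : CO Pt Ln (fun x y z => Q y z x) := by
  have n : ∀ {x y z}, nz x y z → nz y z x := fun h => or_assoc.1 (or_comm.1 h)
  have n' : ∀ {x y z}, nz x y z → nz z x y := fun h => n (n h)
  refine ⟨fun x y z h => c.pt _ _ _ (n h), ?_, fun r x y z hr h => c.scale r _ _ _ hr (n h), ?_, ?_, ?_⟩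
  · intro p hp
    obtain ⟨x, y, z, h, h1⟩ := c.surj p hp
    exact ⟨z, x, y, n' h, h1⟩
  · intro x y z x' y' z' h h' hE
    obtain ⟨h1, h2, h3⟩ := c.inj _ _ _ _ _ _ (n h) (n h') hE
    exact ⟨by linear_combination -h2, by linear_combination -h3, h1⟩
  · intro p q r h
    obtain ⟨m, hm, h1⟩ := c.ln q r p (n h)
    exact ⟨m, hm, fun x y z hv => by rw [h1 _ _ _ (n hv), add_comm (q * y + r * z), add_assoc]⟩
  · intro m hm
    obtain ⟨p, q, r, h, h1⟩ := c.li m hm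
    exact ⟨r, p, q, n' h, fun x y z hv => by rw [h1 _ _ _ (n hv), add_comm (p * y + q * z), add_assoc]⟩

/-- One elation with centre `(0,0,1)` and axis `x = 0`. -/
lemma CO.elation (o : GEO Pt Ln) (h : OD G) (c : CO Pt Ln Q) : ∃ g : G, ∃ t : ZMod 79, t ≠ 0 ∧
    ∀ x y z, nz x y z → Q x y (z + t * x) = conj g • Q x y z := by
  have n1 : ∀ y z, nz 1 y z := fun y z => Or.inl one_ne_zero
  obtain ⟨m, hm, hmi⟩ := c.ln 1 0 0 (n1 _ _)
  simp only [one_mul, zero_mul, add_zero] at hmi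
  have n3 : nz 0 0 1 := Or.inr (Or.inr one_ne_zero)
  obtain ⟨g, hg1, hgo, hgm⟩ := (hmi 0 0 1 n3).2 rfl
  have fixP : ∀ y z, nz 0 y z → conj g • Q 0 y z = Q 0 y z := fun y z hv =>
    Inc.fix h (o.sl m hm) (o.sp _ (c.pt _ _ _ hv)) hgm ((hmi 0 y z hv).2 rfl).symm
  have ex : ∀ y z, ∃ w, conj g • Q 1 y z = Q 1 y w := by
    intro y z
    obtain ⟨k, hk, hki⟩ := c.ln y (-1) 0 (Or.inr (Or.inl (by simp)))
    have h1 := Inc.fix h (o.sp _ (c.pt _ _ _ n3)) (o.sl k hk) hgo ((hki 0 0 1 n3).2 (by ring))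
    obtain ⟨x', y', z', hv, hE⟩ := c.surj _ (o.conjP _ (c.pt _ _ _ (n1 y z)) g)
    have h2 : Inc (Q x' y' z') k := by
      rw [hE, ← h1]; exact ((hki 1 y z (n1 y z)).2 (by ring)).conj g
    have h3 := (hki _ _ _ hv).1 h2
    have hy : y' = x' * y := by linear_combination -h3
    subst hy
    have hx : x' ≠ 0 := by
      rintro rfl
      rw [← fixP _ _ hv] at hE
      have := c.inj _ _ _ _ _ _ hv (n1 y z) (smul_left_cancel _ hE)
      simp only [zero_mul, one_mul, zero_eq_mul] at this hv
      simp [nz, ← this.2.1] at hv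
    refine ⟨z' / x', ?_⟩
    rw [← hE, ← c.scale x' 1 y (z' / x') hx (n1 _ _), mul_one, mul_div_cancel₀ _ hx]
  choose φ hφ using ex
  have img : ∀ p q r, nz p q r → ∃ p' q' r', nz p' q' r' ∧ ∀ x y z x' y' z', nz x y z → nz x' y' z' →
      conj g • Q x y z = Q x' y' z' → p * x + q * y + r * z = 0 → p' * x' + q' * y' + r' * z' = 0 := by
    intro p q r hv
    obtain ⟨k, hk, hki⟩ := c.ln p q r hv
    obtain ⟨p', q', r', hv', hki'⟩ := c.li _ (o.conjL k hk g)
    refine ⟨p', q', r', hv', fun x y z x' y' z' nv nv' hE h1 => ?_⟩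
    rw [← hki' _ _ _ nv', ← hE]
    exact ((hki _ _ _ nv).2 h1).conj g
  have key1 : ∀ y z, y ≠ 0 → φ y z = z + φ 0 0 := by
    intro y z hy
    have nn : nz 0 y z := Or.inr (Or.inl hy)
    obtain ⟨p, q, r, hv, hi⟩ := img 0 z (-y) (Or.inr (Or.inr (neg_ne_zero.2 hy)))
    have e1 := hi _ _ _ _ _ _ (n1 _ _) (n1 _ _) (hφ y z) (by ring)
    have e2 := hi _ _ _ _ _ _ (n1 _ _) (n1 _ _) (hφ 0 0) (by ring)
    have e3 := hi _ _ _ _ _ _ nn nn (fixP y z nn) (by ring)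
    have e4 : r * (φ y z - (z + φ 0 0)) = 0 := by linear_combination e1 - e2 - e3
    rcases mul_eq_zero.1 e4 with h1 | h1
    · exfalso
      subst h1
      have hq : q = 0 := by simpa [hy] using e3
      subst hq
      have hp : p = 0 := by simpa using e2
      simp [nz, hp] at hv
    · linear_combination h1
  have key : ∀ y z, φ y z = z + φ 0 0 := by
    intro y z
    by_cases hy : y = 0
    · subst hy
      have nn : nz 0 1 (-z) := Or.inr (Or.inl one_ne_zero)
      obtain ⟨p, q, r, hv, hi⟩ := img (-z) z 1 (Or.inr (Or.inr one_ne_zero))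
      have e1 := hi _ _ _ _ _ _ (n1 _ _) (n1 _ _) (hφ 0 z) (by ring)
      have e2 := hi _ _ _ _ _ _ (n1 _ _) (n1 _ _) (hφ 1 0) (by ring)
      have e3 := hi _ _ _ _ _ _ nn nn (fixP 1 (-z) nn) (by ring)
      rw [key1 1 0 one_ne_zero] at e2
      have e4 : r * (φ 0 z - (z + φ 0 0)) = 0 := by linear_combination e1 - e2 + e3
      rcases mul_eq_zero.1 e4 with h1 | h1
      · exfalso
        subst h1
        have hq : q = 0 := by simpa using e3
        subst hq
        have hp : p = 0 := by simpa using e2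
        simp [nz, hp] at hv
      · linear_combination h1
    · exact key1 y z hy
  refine ⟨g, φ 0 0, ?_, ?_⟩
  · intro h0
    have h1 := hφ 0 0
    rw [h0] at h1
    have h2 := o.meet h (c.pt _ _ _ (n1 0 0)) hm hgm hg1 h1
    rw [hmi _ _ _ (n1 0 0)] at h2
    exact one_ne_zero h2
  · intro x y z hv
    by_cases hx : x = 0
    · subst hx
      rw [mul_zero, add_zero, fixP y z hv]
    · have h1 := hφ (y / x) (z / x)
      rw [key] at h1
      rw [← c.scale x _ _ _ hx (n1 _ _), ← c.scale x _ _ _ hx (n1 _ _)] at h1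
      rw [mul_one, mul_div_cancel₀ _ hx, mul_add, mul_div_cancel₀ _ hx] at h1
      rw [h1, mul_comm]

lemma CO.elations (o : GEO Pt Ln) (h : OD G) (c : CO Pt Ln Q) (s : ZMod 79) : ∃ g : G,
    ∀ x y z, nz x y z → Q x y (z + s * x) = conj g • Q x y z := by
  obtain ⟨g, t, ht, hg⟩ := c.elation o h
  have hpow : ∀ n : ℕ, ∀ x y z, nz x y z → Q x y (z + (n * t) * x) = conj (g ^ n) • Q x y z := by
    intro n
    induction n with
    | zero => intro x y z hv; simp
    | succ n ih =>
      intro x y z hv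
      have hv' : nz x y (z + (n * t) * x) := by
        by_cases hx : x = 0
        · subst hx; simpa using hv
        · exact Or.inl hx
      rw [pow_succ', map_mul, mul_smul, ← ih x y z hv, ← hg _ _ _ hv']
      congr 1; push_cast; ring
  refine ⟨g ^ (s / t).val, ?_⟩
  have := hpow (s / t).val
  rwa [ZMod.natCast_zmod_val, div_mul_cancel₀ _ ht] at this


lemma nz_iff (v : Fin 3 → ZMod 79) : v ≠ 0 ↔ nz (v 0) (v 1) (v 2) := by
  rw [← not_iff_not]
  simp [nz, funext_iff, Fin.forall_fin_succ]

/-- The action of a matrix of determinant one on column vectors. -/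
abbrev app (A : SL(3, ZMod 79)) (v : Fin 3 → ZMod 79) : Fin 3 → ZMod 79 := (A : Matrix (Fin 3) (Fin 3) (ZMod 79)) *ᵥ v

lemma app_mul (A B : SL(3, ZMod 79)) (v : Fin 3 → ZMod 79) : app (A * B) v = app A (app B v) := by
  simp [app, mulVec_mulVec]

/-- The matrix `A` acts on the coordinatised points as conjugation by `g`. -/
def Acts (Q : ZMod 79 → ZMod 79 → ZMod 79 → Subgroup G) (A : SL(3, ZMod 79)) (g : G) : Prop :=
  ∀ v : Fin 3 → ZMod 79, v ≠ 0 → Q (app A v 0) (app A v 1) (app A v 2) = conj g • Q (v 0) (v 1) (v 2)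

lemma app_ne (A : SL(3, ZMod 79)) {v : Fin 3 → ZMod 79} (hv : v ≠ 0) : app A v ≠ 0 := by
  intro h
  apply hv
  have h1 := app_mul A⁻¹ A v
  rw [h, inv_mul_cancel] at h1
  simpa [app] using h1

lemma Acts.mul {A B : SL(3, ZMod 79)} {a b : G} (hA : Acts Q A a) (hB : Acts Q B b) : Acts Q (A * B) (a * b) := by
  intro v hv
  rw [app_mul, hA _ (app_ne B hv), hB v hv, map_mul, mul_smul]

lemma app_transvection {i j : Fin 3} (hij : i ≠ j) (s : ZMod 79) (v : Fin 3 → ZMod 79) :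
    app (Matrix.SpecialLinearGroup.transvection hij s) v = fun k => v k + if k = i then s * v j else 0 := by
  ext k
  rw [app, Matrix.SpecialLinearGroup.transvection_coe, add_mulVec, one_mulVec, Pi.add_apply]
  congr 1
  simp [mulVec, dotProduct, single_apply, ite_and, eq_comm]

lemma CO.acts_transvection (o : GEO Pt Ln) (h : OD G) (c : CO Pt Ln Q) (i j : Fin 3) (hij : i ≠ j) (s : ZMod 79) :
    ∃ g, Acts Q (Matrix.SpecialLinearGroup.transvection hij s) g := by
  have e1 := CO.elations o h c s
  have e2 := CO.elations o h c.swap s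
  have e3 := CO.elations o h c.rot s
  have e4 := CO.elations o h c.rot.rot s
  have e5 := CO.elations o h c.swap.rot s
  have e6 := CO.elations o h c.rot.swap s
  simp only [Acts, app_transvection, nz_iff]
  have n1 : ∀ {x y z}, nz x y z → nz y x z := fun h => or_left_comm.1 h
  have n2 : ∀ {x y z}, nz x y z → nz y z x := fun h => or_assoc.1 (or_comm.1 h)
  fin_cases i <;> fin_cases j <;> simp at hij ⊢
  · obtain ⟨g, hg⟩ := e4
    exact ⟨g, fun v hv => hg _ _ _ (n2 hv)⟩
  · obtain ⟨g, hg⟩ := e5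
    exact ⟨g, fun v hv => hg _ _ _ (n1 (n2 hv))⟩
  · obtain ⟨g, hg⟩ := e6
    exact ⟨g, fun v hv => hg _ _ _ (n1 (n2 (n2 hv)))⟩
  · obtain ⟨g, hg⟩ := e3
    exact ⟨g, fun v hv => hg _ _ _ (n2 (n2 hv))⟩
  · obtain ⟨g, hg⟩ := e1
    exact ⟨g, fun v hv => hg _ _ _ hv⟩
  · obtain ⟨g, hg⟩ := e2
    exact ⟨g, fun v hv => hg _ _ _ (n1 hv)⟩

lemma diag2n_eq {i j : Fin 3} (hij : i ≠ j) {a : ZMod 79} (ha : a ≠ 0) :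
    Matrix.SpecialLinearGroup.diag2n hij a ha =
      Matrix.SpecialLinearGroup.transvection hij a * (Matrix.SpecialLinearGroup.transvection hij.symm (-a⁻¹) *
      (Matrix.SpecialLinearGroup.transvection hij a * (Matrix.SpecialLinearGroup.transvection hij (-1) *
      (Matrix.SpecialLinearGroup.transvection hij.symm 1 * Matrix.SpecialLinearGroup.transvection hij (-1))))) := by
  apply Subtype.ext
  apply mulVec_injective
  ext v k
  change app _ v k = app _ v k
  simp only [app_mul, app_transvection]
  rw [app]
  erw [Matrix.SpecialLinearGroup.diag2n_coe]
  rw [mulVec_diagonal]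
  have h1 := mul_inv_cancel₀ ha
  by_cases hki : k = i
  · subst hki
    simp [hij, hij.symm]
    linear_combination (a * v k - v j) * h1
  · by_cases hkj : k = j
    · subst hkj
      simp [hij, hij.symm]
      linear_combination v i * h1
    · simp [hki, hkj]

lemma CO.acts (o : GEO Pt Ln) (h : OD G) (c : CO Pt Ln Q) (A : SL(3, ZMod 79)) : ∃ g, Acts Q A g := by
  have hm : ∀ A B, (∃ g, Acts Q A g) → (∃ g, Acts Q B g) → ∃ g, Acts Q (A * B) g :=
    fun A B ⟨a, ha⟩ ⟨b, hb⟩ => ⟨a * b, ha.mul hb⟩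
  have ht := CO.acts_transvection o h c
  refine Matrix.SpecialLinearGroup.diagonal_transvection_induction' (fun A => ∃ g, Acts Q A g) A ?_ ht hm
  intro i j hij a ha
  rw [diag2n_eq]
  exact hm _ _ (ht ..) (hm _ _ (ht ..) (hm _ _ (ht ..) (hm _ _ (ht ..) (hm _ _ (ht ..) (ht ..)))))

lemma CO.acts_unique (o : GEO Pt Ln) (h : OD G) (c : CO Pt Ln Q) {A : SL(3, ZMod 79)} {a b : G} (ha : Acts Q A a)
    (hb : Acts Q A b) : a = b := by
  rw [← inv_mul_eq_one]
  refine o.faithful h (fun l hl => o.exists_far hl) fun p hp => ?_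
  obtain ⟨x, y, z, hv, rfl⟩ := c.surj p hp
  have h1 := ha ![x, y, z] ((nz_iff _).2 (by simpa using hv))
  have h2 := hb ![x, y, z] ((nz_iff _).2 (by simpa using hv))
  rw [h1] at h2
  rw [map_mul, mul_smul, map_inv, inv_smul_eq_iff]
  exact h2.symm

lemma CO.acts_one_iff (c : CO Pt Ln Q) {A : SL(3, ZMod 79)} : Acts Q A 1 ↔ A ∈ center SL(3, ZMod 79) := by
  rw [Matrix.SpecialLinearGroup.mem_center_iff]
  constructor
  · intro hA
    have key : ∀ v : Fin 3 → ZMod 79, v ≠ 0 → app A v 0 * v 1 = v 0 * app A v 1 ∧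
        app A v 0 * v 2 = v 0 * app A v 2 ∧ app A v 1 * v 2 = v 1 * app A v 2 := by
      intro v hv
      refine c.inj _ _ _ _ _ _ ((nz_iff _).1 (app_ne A hv)) ((nz_iff _).1 hv) ?_
      have := hA v hv
      rwa [map_one, one_smul] at this
    have k0 := key ![1, 0, 0] (by simp)
    have k1 := key ![0, 1, 0] (by simp)
    have k2 := key ![0, 0, 1] (by simp)
    have k3 := key ![1, 1, 1] (by simp)
    simp [app, mulVec, dotProduct, Fin.sum_univ_three] at k0 k1 k2 k3
    have hs : scalar (Fin 3) (A.1 0 0) = A.1 := by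
      ext i j
      fin_cases i <;> fin_cases j <;> simp <;> grind
    refine ⟨A.1 0 0, ?_, hs⟩
    have := A.2
    rw [← hs] at this
    simpa using this
  · rintro ⟨r, hr, hA⟩ v hv
    have hr0 : r ≠ 0 := by rintro rfl; simp at hr
    have : app A v = r • v := by rw [app, ← hA]; ext k; simp [scalar_apply, mulVec_diagonal]
    rw [this, map_one, one_smul]
    exact c.scale _ _ _ _ hr0 ((nz_iff _).1 hv)

lemma card_sl : card SL(3, ZMod 79) = 3 * (ordL) := by
  have e : SL(3, ZMod 79) ≃ (GeneralLinearGroup.det : GL (Fin 3) (ZMod 79) →* (ZMod 79)ˣ).ker := by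
    refine Equiv.ofBijective (fun A => ⟨A.toGL, by rw [MonoidHom.mem_ker]; exact Matrix.SpecialLinearGroup.coeToGL_det A⟩) ⟨?_, ?_⟩
    · intro A B hAB
      exact Matrix.SpecialLinearGroup.toGL_injective (congrArg Subtype.val hAB)
    · rintro ⟨B, hB⟩
      rw [MonoidHom.mem_ker] at hB
      refine ⟨⟨B.1, by simpa using congrArg Units.val hB⟩, ?_⟩
      apply Subtype.ext
      apply Units.ext
      rfl
  have h1 := (GeneralLinearGroup.det : GL (Fin 3) (ZMod 79) →* (ZMod 79)ˣ).ker.card_mul_index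
  rw [index_ker, MonoidHom.range_eq_top.2 GeneralLinearGroup.det_surjective, card_top,
    Matrix.card_GL_field, card_eq_fintype_card (α := (ZMod 79)ˣ), ZMod.card_units, ZMod.card, Fin.prod_univ_three] at h1
  rw [card_congr e]
  norm_num at h1 ⊢
  omega

theorem OD.iso (h : OD G) (hcard : Nat.card G = ordL) :
    Nonempty (G ≃* PSL(3, ZMod 79)) := by
  obtain ⟨Pt, Ln, o⟩ := exists_GEO h
  obtain ⟨Q, c⟩ := o.exists_CO h
  choose f hf using CO.acts o h c
  let ρ : SL(3, ZMod 79) →* G := MonoidHom.mk' f fun A B => CO.acts_unique o h c (hf _) ((hf A).mul (hf B))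
  have hker : ρ.ker = center SL(3, ZMod 79) := by
    ext A
    rw [MonoidHom.mem_ker, ← c.acts_one_iff]
    refine ⟨fun hA => ?_, fun hA => CO.acts_unique o h c (hf A) hA⟩
    have := hf A
    rwa [show f A = 1 from hA] at this
  have hc : Nat.card (center SL(3, ZMod 79)) ≤ 3 := by
    rw [card_congr (Matrix.SpecialLinearGroup.center_equiv_rootsOfUnity' (0 : Fin 3)).toEquiv]
    exact card_rootsOfUnity (ZMod 79) 3
  have hsurj : Function.Surjective ρ := by
    have h1 := ρ.ker.card_mul_index
    rw [index_ker, hker, card_sl, ← hcard] at h1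
    rw [← MonoidHom.range_eq_top]
    apply eq_top_of_le_card
    nlinarith
  exact ⟨((QuotientGroup.quotientMulEquivOfEq hker.symm).trans (QuotientGroup.quotientKerEquivOfSurjective ρ hsurj)).symm⟩

end Coordinates

theorem L3_79_OD_characterizable (G : Type*) [Group G] [Finite G]
    (hcard : Nat.card G = 2 ^ 6 * 3 ^ 2 * 5 * 7 ^ 2 * 13 ^ 2 * 43 * 79 ^ 3)
    (hdeg2 : primeGraphDeg G 2 = 4)
    (hdeg3 : primeGraphDeg G 3 = 2)
    (hdeg5 : primeGraphDeg G 5 = 2)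
    (hdeg7 : primeGraphDeg G 7 = 1)
    (hdeg13 : primeGraphDeg G 13 = 4)
    (hdeg43 : primeGraphDeg G 43 = 1)
    (hdeg79 : primeGraphDeg G 79 = 2) :
    Nonempty (G ≃* PSL(3, ZMod 79)) := by
  exact (OD.mk' hcard hdeg2 hdeg3 hdeg5 hdeg7 hdeg13 hdeg43 hdeg79).iso hcard
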